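/- Let d ≥ 1, let P(ξ) = ⟨ξ⟩ = √(1+|ξ|²), fix 0 < δ < 1/2 and 0 < ε < 1, and let χ ∈ C_c^∞(ℝ^d) be real-valued, radial, and equal to 1 near 0. Define A(t) = Op(a^{KG}(t)) and A_±(t) = Op(a^{KG}_±(t)), where a^{KG}(t,x,ξ) = 1_{|x| > |t|·|ξ|/⟨ξ⟩} · χ(ξ/|t|^ε) and a^{KG}_±(t,x,ξ) = χ((x ± t ξ/⟨ξ⟩)/|t|^{1/2+δ}) · 1_{|x| > |t|·|ξ|/⟨ξ⟩} · χ(ξ/|t|^ε). Then for all v₀, v_{0,1} ∈ L²(ℝ^d) and for each choice of sign ±: (i) lim_{t→+∞} ‖A_±(t) e^{± i t P(D_x)} v₀‖²_{L²} = (1/4) ‖v₀‖²_{L²}; (ii) lim_{t→+∞} ⟨A_±(t) e^{± i t P(D_x)} v₀, A_∓(t) e^{∓ i t P(D_x)} v_{0,1}⟩_{L²} = 0; (iii) lim_{t→+∞} ‖(A(t) − A_±(t)) e^{± i t P(D_x)} v₀‖²_{L²} = 0. -/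

import Mathlib

open MeasureTheory Filter Topology
open scoped RealInnerProductSpace ENNReal

noncomputable section

abbrev Euc (d : ℕ) := EuclideanSpace ℝ (Fin d)

/-- Fourier transform `f̂(ξ) = ∫ e^{-i x·ξ} f(x) dx`. -/
def FT {d : ℕ} (f : Euc d → ℂ) (ξ : Euc d) : ℂ :=
  ∫ x : Euc d, Complex.exp (-(Complex.I * ((⟪x, ξ⟫ : ℝ) : ℂ))) * f x

/-- `v` is the (distributional) Fourier transform of `u`: tested against Schwartz functions,
`∫ v·g = ∫ u·ĝ`. For `u ∈ L²` this characterizes `v` almost everywhere. -/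
def IsFourierTransformOf {d : ℕ} (u v : Euc d → ℂ) : Prop :=
  ∀ g : SchwartzMap (Euc d) ℂ, ∫ ξ : Euc d, v ξ * g ξ = ∫ x : Euc d, u x * FT (⇑g) x

/-- A function on `ℝ^d` is radial if it only depends on the norm. -/
def IsRadial {d : ℕ} {α : Type*} (f : Euc d → α) : Prop :=
  ∀ x y : Euc d, ‖x‖ = ‖y‖ → f x = f y

/-- A function equals `1` in a neighbourhood of `0`. -/
def EqOneNearZero {d : ℕ} (f : Euc d → ℝ) : Prop :=
  ∃ r : ℝ, 0 < r ∧ ∀ x : Euc d, ‖x‖ < r → f x = 1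

/-- The japanese bracket `⟨ξ⟩ = √(1+|ξ|²)`. -/
def jap {d : ℕ} (ξ : Euc d) : ℝ := Real.sqrt (1 + ‖ξ‖ ^ 2)

/-- The Klein–Gordon truncation symbol
`a^{KG}_ε(t,x,ξ) = 1_{|x| > |t||ξ|/⟨ξ⟩} · χ(ξ/|t|^ε)`. -/
def aKG {d : ℕ} (χ : Euc d → ℝ) (ε t : ℝ) (x ξ : Euc d) : ℂ :=
  (if |t| * (‖ξ‖ / jap ξ) < ‖x‖ then (1:ℂ) else 0) * ((χ ((|t| ^ ε)⁻¹ • ξ) : ℝ) : ℂ)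

/-- `Op(a)` applied to the `L²` function with Fourier transform `g`:
`(2π)^{-d} ∫ e^{i x·ξ} a(x,ξ) g(ξ) dξ` (absolutely convergent when `a` is compactly
supported in `ξ` and `g ∈ L²`). -/
def OpF {d : ℕ} (a : Euc d → Euc d → ℂ) (g : Euc d → ℂ) (x : Euc d) : ℂ :=
  (((2 * Real.pi) ^ d : ℝ) : ℂ)⁻¹ *
    ∫ ξ : Euc d, Complex.exp (Complex.I * ((⟪x, ξ⟫ : ℝ) : ℂ)) * a x ξ * g ξ


/-- The signed Klein–Gordon truncation symbol
`a^{KG}_±(t,x,ξ) = χ((x ± tξ/⟨ξ⟩)/|t|^{1/2+δ}) · 1_{|x| > |t||ξ|/⟨ξ⟩} · χ(ξ/|t|^ε)`,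
with `s = ±1`. -/
def aKGpm {d : ℕ} (χ : Euc d → ℝ) (δ ε s t : ℝ) (x ξ : Euc d) : ℂ :=
  ((χ ((|t| ^ ((1:ℝ)/2 + δ))⁻¹ • (x + (s * t / jap ξ) • ξ)) : ℝ) : ℂ) *
    (if |t| * (‖ξ‖ / jap ξ) < ‖x‖ then (1:ℂ) else 0) *
    ((χ ((|t| ^ ε)⁻¹ • ξ) : ℝ) : ℂ)

/-- Fourier transform of `e^{s·itP(D)}v₀` (`s = ±1`), where `P(ξ) = ⟨ξ⟩`:
`ξ ↦ e^{s it⟨ξ⟩} v̂₀(ξ)`. -/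
def propagate {d : ℕ} (s t : ℝ) (g : Euc d → ℂ) (ξ : Euc d) : ℂ :=
  Complex.exp (Complex.I * ((s * t * jap ξ : ℝ) : ℂ)) * g ξ

set_option linter.all false

structure Nice (g : ℝ → ℝ) (a b M : ℝ) : Prop where
  meas : Measurable g
  bdd : ∀ r, |g r| ≤ M
  pos : 0 < a
  supp : ∀ r, ¬ (a ≤ r ∧ r ≤ b) → g r = 0

def Hop (h g : ℝ → ℝ) (x : ℝ) : ℝ := ∫ r, h (x * r) * g r

structure Sec (B B0 : ℝ) where
  h : ℝ → ℝ
  h' : ℝ → ℝ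
  p : ℝ
  B' : ℝ
  hp : 0 ≤ p
  hd : ∀ s, 0 < s → HasDerivAt h (h' s) s
  hd' : ∀ s, 0 < s → HasDerivAt h' (-(1 - p * (p - 1) / s ^ 2) * h s) s
  bd : ∀ s, 0 < s → s ≤ 16 → |h s| ≤ B
  n0 : ∀ s, 0 < s → s ≤ 1 → |h s| ≤ B' * s ^ p
  n1 : ∀ s, 0 < s → s ≤ 1 → |s * h' s - p * h s| ≤ B' * s ^ (p + 2)
  isoI : ∀ g a b M, Nice g a b M → IntegrableOn (fun x => Hop h g x ^ 2) (Set.Ioi 0)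
  iso : ∀ g a b M, Nice g a b M → ∫ x in Set.Ioi 0, Hop h g x ^ 2 = B0 * ∫ r, g r ^ 2

namespace Sec
variable {B B0 : ℝ} (S : Sec B B0)

def mu : ℝ := S.p * (S.p - 1)
def w (s : ℝ) : ℝ := √(s ^ 2 - S.mu)
def E (s : ℝ) : ℝ := S.w s / s * S.h s ^ 2 + s / S.w s * S.h' s ^ 2
def G (s : ℝ) : ℝ := S.E s + S.mu / S.w s ^ 3 * (S.h s * S.h' s)
/-- the oscillatory region -/
def Reg (s : ℝ) : Prop := 0 < s ∧ S.mu < s ^ 2 ∧ |S.mu| ≤ S.w s ^ 3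

lemma w_sq {s : ℝ} (h : S.mu ≤ s ^ 2) : S.w s ^ 2 = s ^ 2 - S.mu := by
  rw [w, Real.sq_sqrt (by linarith)]
lemma w_pos {s : ℝ} (h : S.mu < s ^ 2) : 0 < S.w s := Real.sqrt_pos.2 (by linarith)

lemma Reg.mono {S : Sec B B0} {s x : ℝ} (hs : S.Reg s) (hx : s ≤ x) : S.Reg x := by
  obtain ⟨h1, h2, h3⟩ := hs
  have : s ^ 2 ≤ x ^ 2 := by gcongr
  refine ⟨by linarith, by linarith, h3.trans ?_⟩
  have : S.w s ≤ S.w x := Real.sqrt_le_sqrt (by linarith)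
  have := (S.w_pos h2).le
  gcongr

lemma hasDeriv_w {s : ℝ} (h : S.mu < s ^ 2) : HasDerivAt S.w (s / S.w s) s := by
  have h1 : HasDerivAt (fun s : ℝ => s ^ 2 - S.mu) (2 * s) s := by
    simpa using (hasDerivAt_pow 2 s).sub_const S.mu
  have h2 := h1.sqrt (by linarith)
  have := S.w_pos h
  refine HasDerivAt.congr_deriv (f := S.w) h2 ?_
  change 2 * s / (2 * S.w s) = _
  field_simp

lemma hasDeriv_G {s : ℝ} (hs : 0 < s) (h : S.mu < s ^ 2) :
    HasDerivAt S.G (-(3 * S.mu * s / S.w s ^ 5) * (S.h s * S.h' s)) s := by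
  have hw := S.hasDeriv_w h
  have hwp := S.w_pos h
  have hw2 := S.w_sq h.le
  have d1 := ((hw.div (hasDerivAt_id s) hs.ne').mul ((S.hd s hs).pow 2))
  have d2 := (((hasDerivAt_id s).div hw hwp.ne').mul ((S.hd' s hs).pow 2))
  have d3 := (((hw.pow 3).inv (pow_pos hwp 3).ne').const_mul S.mu).mul ((S.hd s hs).mul (S.hd' s hs))
  have d := (d1.add d2).add d3
  have e : HasDerivAt S.G _ s := d.congr_of_eventuallyEq (Eventually.of_forall fun x => by
    simp [G, E, div_eq_mul_inv])
  refine e.congr_deriv ?_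
  have hm : S.p * (S.p - 1) = s ^ 2 - S.w s ^ 2 := by rw [hw2]; simp [mu]
  have hm' : S.mu = s ^ 2 - S.w s ^ 2 := by rw [hw2]; ring
  simp only [hm, hm', id, Pi.pow_apply, Pi.inv_apply, Pi.mul_apply, Pi.div_apply]
  field_simp
  ring

lemma hh_le {s : ℝ} (hs : 0 < s) (h : S.mu < s ^ 2) : |S.h s * S.h' s| ≤ S.E s / 2 := by
  have hwp := S.w_pos h
  have key : ∀ a b : ℝ, a * b ≤ (S.w s / s * a ^ 2 + s / S.w s * b ^ 2) / 2 := by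
    intro a b
    have : (S.w s / s * a ^ 2 + s / S.w s * b ^ 2) / 2 - a * b
        = (S.w s * a - s * b) ^ 2 / (2 * s * S.w s) := by field_simp; ring
    have h2 : 0 ≤ (S.w s * a - s * b) ^ 2 / (2 * s * S.w s) := by positivity
    linarith
  rw [abs_le, E]
  have k1 := key (S.h s) (S.h' s)
  have k2 := key (-S.h s) (S.h' s)
  constructor <;> nlinarith

lemma E_nonneg {s : ℝ} (hs : 0 < s) : 0 ≤ S.E s := by
  have : 0 ≤ S.w s := Real.sqrt_nonneg _
  unfold E; positivity

lemma G_near {s : ℝ} (hs : S.Reg s) : |S.G s - S.E s| ≤ S.E s / 2 := by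
  obtain ⟨h1, h2, h3⟩ := hs
  have hwp := pow_pos (S.w_pos h2) 3
  have := S.hh_le h1 h2
  have e : S.G s - S.E s = S.mu / S.w s ^ 3 * (S.h s * S.h' s) := by simp [G]
  rw [e, abs_mul, abs_div, abs_of_pos hwp]
  have h4 : |S.mu| / S.w s ^ 3 ≤ 1 := (div_le_one hwp).2 h3
  calc _ ≤ 1 * (S.E s / 2) := by gcongr
    _ = _ := one_mul _

lemma G_le {s x : ℝ} (hs : S.Reg s) (hx : s ≤ x) :
    S.G x ≤ 3 * S.G s ∧ S.G s ≤ 3 * S.G x := by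
  set φ : ℝ → ℝ := fun x => |S.mu| / S.w x ^ 3 with hφ
  have hφ01 : ∀ y, S.Reg y → 0 ≤ φ y ∧ φ y ≤ 1 := fun y hy =>
    ⟨by have := S.w_pos hy.2.1; positivity, (div_le_one (pow_pos (S.w_pos hy.2.1) 3)).2 hy.2.2⟩
  have hGn : ∀ y, S.Reg y → 0 ≤ S.G y ∧ S.E y ≤ 2 * S.G y := fun y hy => by
    have := abs_le.1 (S.G_near hy)
    have := S.E_nonneg hy.1
    constructor <;> linarith
  have hφd : ∀ y, S.Reg y → HasDerivAt φ (-(3 * |S.mu| * y / S.w y ^ 5)) y := fun y hy => by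
    have hw := S.w_pos hy.2.1
    have := (((S.hasDeriv_w hy.2.1).pow 3).inv (pow_pos hw 3).ne').const_mul |S.mu|
    refine (this.congr_of_eventuallyEq (Eventually.of_forall fun x => by
      simp [hφ, div_eq_mul_inv])).congr_deriv ?_
    simp only [Pi.pow_apply]
    field_simp
    norm_num
    ring
  have hGd : ∀ y, S.Reg y → |-(3 * S.mu * y / S.w y ^ 5) * (S.h y * S.h' y)| ≤
      (3 * |S.mu| * y / S.w y ^ 5) * S.G y := fun y hy => by
    have hw := S.w_pos hy.2.1
    have h0 := hy.1
    have h1 := (S.hh_le hy.1 hy.2.1).trans (by linarith [(hGn y hy).2] : S.E y / 2 ≤ S.G y)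
    rw [abs_mul, abs_neg, abs_div, abs_of_pos (pow_pos hw 5), abs_mul, abs_mul, abs_of_pos h0]
    simp only [Nat.abs_ofNat]
    gcongr
  have hexp : Real.exp 1 ≤ 3 := Real.exp_one_lt_three.le
  have m1 : MonotoneOn (fun y => S.G y * Real.exp (-φ y)) (Set.Ici s) := by
    refine monotoneOn_of_hasDerivWithinAt_nonneg (f' := fun y =>
      (-(3 * S.mu * y / S.w y ^ 5) * (S.h y * S.h' y)) * Real.exp (-φ y)
       + S.G y * (Real.exp (-φ y) * (3 * |S.mu| * y / S.w y ^ 5))) (convex_Ici s) ?_ ?_ ?_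
    · intro y hy
      have hr := hs.mono hy
      exact ((S.hasDeriv_G hr.1 hr.2.1).continuousAt.mul
        (hφd y hr).continuousAt.neg.rexp).continuousWithinAt
    · intro y hy
      rw [interior_Ici] at hy
      have hr := hs.mono (le_of_lt hy)
      have := (S.hasDeriv_G hr.1 hr.2.1).mul (hφd y hr).neg.exp
      refine (this.congr_deriv ?_).hasDerivWithinAt
      simp only [Pi.neg_apply]
      ring
    · intro y hy
      rw [interior_Ici] at hy
      have hr := hs.mono (le_of_lt hy)
      have := (abs_le.1 (hGd y hr)).1
      have e := Real.exp_pos (-φ y)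
      nlinarith
  have m2 : AntitoneOn (fun y => S.G y * Real.exp (φ y)) (Set.Ici s) := by
    refine antitoneOn_of_hasDerivWithinAt_nonpos (f' := fun y =>
      (-(3 * S.mu * y / S.w y ^ 5) * (S.h y * S.h' y)) * Real.exp (φ y)
       + S.G y * (Real.exp (φ y) * (-(3 * |S.mu| * y / S.w y ^ 5)))) (convex_Ici s) ?_ ?_ ?_
    · intro y hy
      have hr := hs.mono hy
      exact ((S.hasDeriv_G hr.1 hr.2.1).continuousAt.mul
        (hφd y hr).continuousAt.rexp).continuousWithinAt
    · intro y hy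
      rw [interior_Ici] at hy
      have hr := hs.mono (le_of_lt hy)
      exact ((S.hasDeriv_G hr.1 hr.2.1).mul (hφd y hr).exp).hasDerivWithinAt
    · intro y hy
      rw [interior_Ici] at hy
      have hr := hs.mono (le_of_lt hy)
      have := (abs_le.1 (hGd y hr)).2
      have e := Real.exp_pos (φ y)
      nlinarith
  have k1 := m1 (Set.mem_Ici.2 le_rfl) hx hx
  have k2 := m2 (Set.mem_Ici.2 le_rfl) hx hx
  simp only at k1 k2
  have hb := hs.mono hx
  have a1 := hφ01 s hs
  have a2 := hφ01 x hb
  have g1 := (hGn s hs).1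
  have g2 := (hGn x hb).1
  constructor
  · calc S.G x ≤ S.G x * Real.exp (φ x) :=
        le_mul_of_one_le_right g2 (Real.one_le_exp a2.1)
      _ ≤ S.G s * Real.exp (φ s) := k2
      _ ≤ S.G s * 3 := by
        gcongr; exact (Real.exp_le_exp.2 a1.2).trans hexp
      _ = _ := mul_comm _ _
  · have e1 : 1 ≤ 3 * Real.exp (-φ s) := by
      have : Real.exp (-φ s) * Real.exp (φ s) = 1 := by rw [← Real.exp_add]; simp
      have h3 : Real.exp (φ s) ≤ 3 := (Real.exp_le_exp.2 a1.2).trans hexp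
      nlinarith [Real.exp_pos (-φ s)]
    have e2 : Real.exp (-φ x) ≤ 1 := Real.exp_le_one_iff.2 (by linarith)
    nlinarith [Real.exp_pos (-φ s)]

lemma E_comp {s x : ℝ} (hs : S.Reg s) (hx : s ≤ x) : S.E x ≤ 9 * S.E s ∧ S.E s ≤ 9 * S.E x := by
  have h1 := S.G_le hs hx
  have h2 := abs_le.1 (S.G_near hs)
  have h3 := abs_le.1 (S.G_near (hs.mono hx))
  constructor <;> linarith
end Sec

namespace Sec
variable {B B0 : ℝ} (S : Sec B B0)

lemma cont_h : ContinuousOn S.h (Set.Ioi 0) := fun s hs => (S.hd s hs).continuousAt.continuousWithinAt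
lemma cont_h' : ContinuousOn S.h' (Set.Ioi 0) := fun s hs => (S.hd' s hs).continuousAt.continuousWithinAt

lemma nice_ind {f : ℝ → ℝ} {a b : ℝ} (ha : 0 < a) (hab : a ≤ b) (hf : ContinuousOn f (Set.Icc a b)) :
    ∃ M, Nice ((Set.Icc a b).indicator f) a b M := by
  obtain ⟨M, hM⟩ := (isCompact_Icc (a := a) (b := b)).exists_bound_of_continuousOn hf
  refine ⟨M, ?_, ?_, ha, ?_⟩
  · classical
    have := hf.measurable_piecewise (g := fun _ => (0:ℝ)) continuousOn_const measurableSet_Icc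
    convert this using 1
    ext r; simp [Set.indicator, Set.piecewise]
  · intro r
    have h0 : 0 ≤ M := (norm_nonneg _).trans (hM a ⟨le_rfl, hab⟩)
    by_cases hr : r ∈ Set.Icc a b
    · simpa [hr] using hM r hr
    · simpa [hr] using h0
  · intro r hr
    exact Set.indicator_of_notMem (s := Set.Icc a b) hr f

lemma B0_nonneg (S : Sec B B0) : 0 ≤ B0 := by
  obtain ⟨M, hM⟩ := nice_ind (f := fun _ => 1) one_pos one_le_two continuousOn_const
  have h := S.iso _ _ _ _ hM
  have h1 : ∫ r, (Set.Icc (1:ℝ) 2).indicator (fun _ => (1:ℝ)) r ^ 2 = 1 := by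
    have : ∀ r, (Set.Icc (1:ℝ) 2).indicator (fun _ => (1:ℝ)) r ^ 2
        = (Set.Icc (1:ℝ) 2).indicator (fun _ => (1:ℝ)) r := by
      intro r; by_cases hr : r ∈ Set.Icc (1:ℝ) 2 <;> simp [hr]
    simp_rw [this]
    rw [integral_indicator measurableSet_Icc]; norm_num
  rw [h1, mul_one] at h
  rw [← h]
  positivity

lemma E_bd {s : ℝ} (hs : S.Reg s) : S.E s ≤ 10 ^ 10 * B0 := by
  set e := S.E s with he
  have he0 : 0 ≤ e := S.E_nonneg hs.1
  have hB := S.B0_nonneg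
  obtain ⟨X, hX1, hX2, hX3⟩ : ∃ X : ℝ, s ≤ X ∧ 2 * |S.mu| ≤ X ∧ 10000 ≤ X :=
    ⟨max s (max (2 * |S.mu|) 10000), le_max_left _ _, (le_max_left _ _).trans (le_max_right _ _),
      (le_max_right _ _).trans (le_max_right _ _)⟩
  have hXp : 0 < X := by linarith
  -- pointwise bounds
  have hmu : ∀ y, X ≤ y → |S.mu| ≤ y ^ 2 / 2 := fun y hy => by nlinarith [abs_nonneg S.mu]
  have pb : ∀ y, X ≤ y → S.h y ^ 2 + S.h' y ^ 2 ≤ 18 * e ∧ e ≤ 18 * (S.h y ^ 2 + S.h' y ^ 2) := by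
    intro y hy
    have hr := hs.mono (hX1.trans hy)
    have hE := S.E_comp hs (hX1.trans hy)
    have hw := S.w_pos hr.2.1
    have hw2 := S.w_sq hr.2.1.le
    have hy0 := hr.1
    have hm := abs_le.1 (hmu y hy)
    have a1 : S.w y ≤ 2 * y := by nlinarith
    have a2 : y ≤ 2 * S.w y := by nlinarith
    have b1 : S.w y / y ≤ 2 := (div_le_iff₀ hy0).2 a1
    have b2 : y / S.w y ≤ 2 := (div_le_iff₀ hw).2 a2
    have b3 : 1 / 2 ≤ S.w y / y := by rw [le_div_iff₀ hy0]; linarith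
    have b4 : 1 / 2 ≤ y / S.w y := by rw [le_div_iff₀ hw]; linarith
    have q1 := sq_nonneg (S.h y)
    have q2 := sq_nonneg (S.h' y)
    have : S.E y = S.w y / y * S.h y ^ 2 + y / S.w y * S.h' y ^ 2 := rfl
    constructor <;> nlinarith
  set f : ℝ → ℝ := fun r => S.h (X * r) with hf
  have hmaps : Set.MapsTo (fun r => X * r) (Set.Icc (1:ℝ) 2) (Set.Ioi 0) :=
    fun r hr => mul_pos hXp (by linarith [hr.1])
  have cX : ContinuousOn (fun r : ℝ => X * r) (Set.Icc (1:ℝ) 2) := by fun_prop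
  have cf : ContinuousOn f (Set.Icc 1 2) := S.cont_h.comp cX hmaps
  have cf' : ContinuousOn (fun r => S.h' (X * r)) (Set.Icc 1 2) := S.cont_h'.comp cX hmaps
  have i1 : IntervalIntegrable (fun r => f r ^ 2) volume 1 2 := by
    apply ContinuousOn.intervalIntegrable; rw [Set.uIcc_of_le one_le_two]; exact cf.pow 2
  have i2 : IntervalIntegrable (fun r => S.h' (X * r) ^ 2) volume 1 2 := by
    apply ContinuousOn.intervalIntegrable; rw [Set.uIcc_of_le one_le_two]; exact cf'.pow 2
  have hxr : ∀ r ∈ Set.Icc (1:ℝ) 2, X ≤ X * r := fun r hr => by nlinarith [hr.1]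
  -- lower bound
  have J : e / 100 ≤ ∫ r in (1:ℝ)..2, f r ^ 2 := by
    set q : ℝ → ℝ := fun r => 1 - S.mu / (X * r) ^ 2 with hq
    have cq : ContinuousOn q (Set.Icc 1 2) := by
      apply continuousOn_const.sub
      apply continuousOn_const.div (cX.pow 2)
      intro r hr
      exact (pow_pos (hmaps hr) 2).ne'
    have i3 : IntervalIntegrable (fun r => q r * f r ^ 2) volume 1 2 := by
      apply ContinuousOn.intervalIntegrable; rw [Set.uIcc_of_le one_le_two]; exact cq.mul (cf.pow 2)
    have dV : ∀ r ∈ Set.uIcc (1:ℝ) 2, HasDerivAt (fun r => f r * S.h' (X * r))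
        (X * (S.h' (X * r) ^ 2 - q r * f r ^ 2)) r := by
      intro r hr
      rw [Set.uIcc_of_le one_le_two] at hr
      have d0 : HasDerivAt (fun r : ℝ => X * r) X r := by simpa using (hasDerivAt_id r).const_mul X
      have d1 : HasDerivAt f _ r := (S.hd _ (hmaps hr)).comp r d0
      have d2 : HasDerivAt (fun r => S.h' (X * r)) _ r := (S.hd' _ (hmaps hr)).comp r d0
      refine (d1.mul d2).congr_deriv ?_
      simp only [hq, hf, mu]
      ring
    have I := intervalIntegral.integral_eq_sub_of_hasDerivAt dV ((i2.sub i3).const_mul X)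
    rw [intervalIntegral.integral_const_mul, intervalIntegral.integral_sub i2 i3] at I
    have v1 := (pb (X * 1) (hxr 1 (by simp))).1
    have v2 := (pb (X * 2) (hxr 2 (by simp))).1
    have k1 : f 2 * S.h' (X * 2) - f 1 * S.h' (X * 1) ≤ 18 * e := by
      simp only [hf]
      nlinarith [sq_nonneg (S.h (X * 2) - S.h' (X * 2)), sq_nonneg (S.h (X * 1) + S.h' (X * 1))]
    have k2 : ∫ r in (1:ℝ)..2, q r * f r ^ 2 ≤ ∫ r in (1:ℝ)..2, 2 * f r ^ 2 := by
      apply intervalIntegral.integral_mono_on one_le_two i3 (i1.const_mul 2)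
      intro r hr
      have hm := (abs_le.1 (hmu _ (hxr r hr))).1
      have hp : 0 < (X * r) ^ 2 := pow_pos (Set.mem_Ioi.1 (hmaps hr)) 2
      have : q r ≤ 2 := by
        have : -1 ≤ S.mu / (X * r) ^ 2 := by
          rw [le_div_iff₀ hp]; linarith
        simp only [hq]; linarith
      exact mul_le_mul_of_nonneg_right this (sq_nonneg _)
    have k3 : ∫ r in (1:ℝ)..2, e / 18 ≤ ∫ r in (1:ℝ)..2, (f r ^ 2 + S.h' (X * r) ^ 2) := by
      apply intervalIntegral.integral_mono_on one_le_two (by simp) (i1.add i2)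
      intro r hr
      have := (pb _ (hxr r hr)).2
      simp only [hf]; linarith
    rw [intervalIntegral.integral_add i1 i2] at k3
    rw [intervalIntegral.integral_const_mul] at k2
    simp only [intervalIntegral.integral_const, smul_eq_mul] at k3
    set A := ∫ r in (1:ℝ)..2, f r ^ 2
    set A' := ∫ r in (1:ℝ)..2, S.h' (X * r) ^ 2
    set Q := ∫ r in (1:ℝ)..2, q r * f r ^ 2
    have k4 : A' - Q ≤ e / 500 := by
      by_contra hc
      push Not at hc
      have : X * (e / 500) < X * (A' - Q) := by gcongr
      nlinarith
    linarith
  obtain ⟨M, hN⟩ := nice_ind one_pos one_le_two cf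
  have hiso := S.iso _ _ _ _ hN
  have hg2 : ∫ r, (Set.Icc (1:ℝ) 2).indicator f r ^ 2 ≤ 18 * e := by
    have : ∀ r, (Set.Icc (1:ℝ) 2).indicator f r ^ 2 = (Set.Icc (1:ℝ) 2).indicator (fun r => f r ^ 2) r := by
      intro r; by_cases hr : r ∈ Set.Icc (1:ℝ) 2 <;> simp [hr]
    simp_rw [this]
    rw [integral_indicator measurableSet_Icc, integral_Icc_eq_integral_Ioc,
      ← intervalIntegral.integral_of_le one_le_two]
    calc _ ≤ ∫ r in (1:ℝ)..2, 18 * e := by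
          apply intervalIntegral.integral_mono_on one_le_two i1 (by simp)
          intro r hr
          have := (pb _ (hxr r hr)).1
          simp only [hf]; nlinarith [sq_nonneg (S.h' (X * r))]
      _ = 18 * e := by simp; norm_num
  have hlow : ∀ x ∈ Set.Ioc X (X + 1 / 7200), (e / 200) ^ 2 ≤ Hop S.h ((Set.Icc (1:ℝ) 2).indicator f) x ^ 2 := by
    intro x hx
    have hx0 : 0 < x := hXp.trans hx.1
    have cx : ContinuousOn (fun r => S.h (x * r)) (Set.Icc 1 2) :=
      S.cont_h.comp (by fun_prop) (fun r hr => mul_pos hx0 (by linarith [hr.1]))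
    have eH : Hop S.h ((Set.Icc (1:ℝ) 2).indicator f) x = ∫ r in (1:ℝ)..2, S.h (x * r) * f r := by
      have : ∀ r, S.h (x * r) * (Set.Icc (1:ℝ) 2).indicator f r
          = (Set.Icc (1:ℝ) 2).indicator (fun r => S.h (x * r) * f r) r := by
        intro r; by_cases hr : r ∈ Set.Icc (1:ℝ) 2 <;> simp [hr]
      unfold Hop
      simp_rw [this]
      rw [integral_indicator measurableSet_Icc, integral_Icc_eq_integral_Ioc,
        ← intervalIntegral.integral_of_le one_le_two]
    have : e / 200 ≤ Hop S.h ((Set.Icc (1:ℝ) 2).indicator f) x := by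
      rw [eH]
      have : ∫ r in (1:ℝ)..2, (f r ^ 2 - e / 200) ≤ ∫ r in (1:ℝ)..2, S.h (x * r) * f r := by
        apply intervalIntegral.integral_mono_on one_le_two (i1.sub (by simp))
        · apply ContinuousOn.intervalIntegrable; rw [Set.uIcc_of_le one_le_two]; exact cx.mul cf
        · intro r hr
          have hle : X * r ≤ x * r := by nlinarith [hr.1, hx.1]
          have lip : ‖S.h (x * r) - S.h (X * r)‖ ≤ √(18 * e) * ‖x * r - X * r‖ := by
            apply (convex_Ici X).norm_image_sub_le_of_norm_hasDerivWithin_le (f' := S.h')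
              (fun y hy => (S.hd y (hXp.trans_le hy)).hasDerivWithinAt)
            · intro y hy
              rw [Real.norm_eq_abs]
              apply Real.abs_le_sqrt
              have := (pb y hy).1
              nlinarith [sq_nonneg (S.h y)]
            · exact hxr r hr
            · exact (hxr r hr).trans hle
          have hd : ‖x * r - X * r‖ ≤ 1 / 3600 := by
            rw [Real.norm_eq_abs, abs_of_nonneg (by linarith)]
            have := hx.2
            nlinarith [hr.1, hr.2, hx.1]
          have hfb : |f r| ≤ √(18 * e) := by
            apply Real.abs_le_sqrt
            have := (pb _ (hxr r hr)).1
            simp only [hf]; nlinarith [sq_nonneg (S.h' (X * r))]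
          have hs18 := Real.mul_self_sqrt (show 0 ≤ 18 * e by linarith)
          have : |(S.h (x * r) - S.h (X * r)) * f r| ≤ (√(18 * e) * (1 / 3600)) * √(18 * e) := by
            rw [abs_mul]
            have := Real.sqrt_nonneg (18 * e)
            gcongr
            exact lip.trans (by gcongr)
          have := (abs_le.1 this).1
          simp only [hf] at this ⊢
          nlinarith
      rw [intervalIntegral.integral_sub i1 (by simp)] at this
      simp only [intervalIntegral.integral_const, smul_eq_mul] at this
      linarith
    gcongr
  have hfin : ∫ x in Set.Ioc X (X + 1 / 7200), (e / 200) ^ 2 ≤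
      ∫ x in Set.Ioi 0, Hop S.h ((Set.Icc (1:ℝ) 2).indicator f) x ^ 2 := by
    have hsub : Set.Ioc X (X + 1 / 7200) ⊆ Set.Ioi 0 := fun x hx => hXp.trans hx.1
    have hI := S.isoI _ _ _ _ hN
    calc _ ≤ ∫ x in Set.Ioc X (X + 1 / 7200), Hop S.h ((Set.Icc (1:ℝ) 2).indicator f) x ^ 2 := by
          apply setIntegral_mono_on (by simp) (hI.mono_set hsub) measurableSet_Ioc hlow
      _ ≤ _ := setIntegral_mono_set hI (Eventually.of_forall fun x => sq_nonneg _)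
          hsub.eventuallyLE
  rw [hiso] at hfin
  have e1 : ∫ x in Set.Ioc X (X + 1 / 7200), (e / 200) ^ 2 = 1 / 7200 * (e / 200) ^ 2 := by
    simp
  rw [e1] at hfin
  have : 1 / 7200 * (e / 200) ^ 2 ≤ B0 * (18 * e) := hfin.trans (by gcongr)
  rcases he0.eq_or_lt with h | h
  · rw [← h]; positivity
  · have : e * (e / (7200 * 40000)) ≤ e * (18 * B0) := by nlinarith
    have := le_of_mul_le_mul_left this h
    linarith
end Sec


lemma integral_cs {α : Type*} [MeasurableSpace α] {m : Measure α} {f g : α → ℝ}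
    (hf : Integrable (fun x => f x ^ 2) m) (hg : Integrable (fun x => g x ^ 2) m)
    (hfg : Integrable (fun x => f x * g x) m) :
    (∫ x, f x * g x ∂m) ^ 2 ≤ (∫ x, f x ^ 2 ∂m) * ∫ x, g x ^ 2 ∂m := by
  have key : ∀ c : ℝ, 0 ≤ (∫ x, f x ^ 2 ∂m) * (c * c) + (2 * ∫ x, f x * g x ∂m) * c
      + ∫ x, g x ^ 2 ∂m := by
    intro c
    have : ∫ x, (c * f x + g x) ^ 2 ∂m = (∫ x, f x ^ 2 ∂m) * (c * c)
        + (2 * ∫ x, f x * g x ∂m) * c + ∫ x, g x ^ 2 ∂m := by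
      have e : ∀ x, (c * f x + g x) ^ 2 = (c * c) * f x ^ 2 + (2 * c) * (f x * g x) + g x ^ 2 :=
        fun x => by ring
      simp_rw [e]
      rw [integral_add (f := fun x => c * c * f x ^ 2 + 2 * c * (f x * g x))
          ((hf.const_mul _).add (hfg.const_mul _)) hg,
        integral_add (hf.const_mul _) (hfg.const_mul _), integral_const_mul, integral_const_mul]
      ring
    rw [← this]
    positivity
  have := discrim_le_zero key
  unfold discrim at this
  linarith

namespace Sec
variable {B B0 : ℝ} (S : Sec B B0)

lemma mu_p (hm : 1 ≤ S.mu) : 1 < S.p := by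
  have := S.hp
  unfold mu at hm
  nlinarith

lemma tend0 (hm : 1 ≤ S.mu) : Tendsto (fun s => S.h s * S.h' s) (𝓝[>] 0) (𝓝 0) ∧
    Tendsto (fun s => s * S.h' s ^ 2) (𝓝[>] 0) (𝓝 0) ∧
    Tendsto (fun s => S.h s ^ 2 / s) (𝓝[>] 0) (𝓝 0) := by
  have hp := S.mu_p hm
  set C := |S.B'| * (1 + S.p) with hC
  have hC0 : 0 ≤ C := by positivity
  have hB : |S.B'| ≤ C := by nlinarith [abs_nonneg S.B']
  have lim : Tendsto (fun s : ℝ => C ^ 2 * s) (𝓝[>] 0) (𝓝 0) := by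
    have : Tendsto (fun s : ℝ => C ^ 2 * s) (𝓝 0) (𝓝 (C ^ 2 * 0)) := tendsto_id.const_mul _
    rw [mul_zero] at this
    exact this.mono_left nhdsWithin_le_nhds
  have ev : ∀ᶠ s : ℝ in 𝓝[>] 0, 0 < s ∧ s ≤ 1 := by
    filter_upwards [Ioc_mem_nhdsGT (zero_lt_one (α := ℝ))] with s hs using hs
  have b : ∀ s : ℝ, 0 < s → s ≤ 1 → |S.h s| ≤ C * s ∧ |S.h' s| ≤ C := by
    intro s h0 h1
    have a0 := S.n0 s h0 h1
    have a1 := S.n1 s h0 h1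
    have r1 : s ^ S.p ≤ s := by
      simpa using Real.rpow_le_rpow_of_exponent_ge h0 h1 hp.le
    have r2 : s ^ (S.p + 2) ≤ s := by
      simpa using Real.rpow_le_rpow_of_exponent_ge h0 h1 (by linarith : (1:ℝ) ≤ S.p + 2)
    have c0 : |S.h s| ≤ |S.B'| * s := a0.trans (by
      have := le_abs_self S.B'
      have := abs_nonneg S.B'
      gcongr)
    have c1 : |s * S.h' s - S.p * S.h s| ≤ |S.B'| * s := a1.trans (by
      have := le_abs_self S.B'
      have := abs_nonneg S.B'
      gcongr)
    refine ⟨c0.trans (by gcongr), ?_⟩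
    have : s * |S.h' s| ≤ s * C := by
      calc s * |S.h' s| = |s * S.h' s| := by rw [abs_mul, abs_of_pos h0]
        _ = |(s * S.h' s - S.p * S.h s) + S.p * S.h s| := by ring_nf
        _ ≤ |s * S.h' s - S.p * S.h s| + |S.p * S.h s| := abs_add_le _ _
        _ ≤ |S.B'| * s + S.p * (|S.B'| * s) := by
          rw [abs_mul S.p, abs_of_pos (by linarith : 0 < S.p)]
          have := S.hp
          gcongr
        _ = s * C := by rw [hC]; ring
    exact le_of_mul_le_mul_left this h0
  have sq : ∀ s : ℝ, 0 < s → s ≤ 1 → S.h s ^ 2 ≤ (C * s) ^ 2 ∧ S.h' s ^ 2 ≤ C ^ 2 := fun s h0 h1 =>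
    ⟨sq_le_sq' (abs_le.1 (b s h0 h1).1).1 (abs_le.1 (b s h0 h1).1).2,
     sq_le_sq' (abs_le.1 (b s h0 h1).2).1 (abs_le.1 (b s h0 h1).2).2⟩
  refine ⟨?_, ?_, ?_⟩
  · refine squeeze_zero_norm' ?_ lim
    filter_upwards [ev] with s hs
    rw [norm_mul]
    have := b s hs.1 hs.2
    calc ‖S.h s‖ * ‖S.h' s‖ ≤ (C * s) * C := by
          apply mul_le_mul this.1 this.2 (abs_nonneg _); have := hs.1; positivity
      _ = _ := by ring
  · refine squeeze_zero' ?_ ?_ lim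
    · filter_upwards [ev] with s hs; have := hs.1; positivity
    · filter_upwards [ev] with s hs; have := (sq s hs.1 hs.2).2; nlinarith [hs.1]
  · refine squeeze_zero' ?_ ?_ lim
    · filter_upwards [ev] with s hs; have := hs.1; positivity
    · filter_upwards [ev] with s hs
      have := (sq s hs.1 hs.2).1
      rw [div_le_iff₀ hs.1]; nlinarith

/-- primitive of `h^2` -/
def Phi (y : ℝ) : ℝ := (y * S.h' y ^ 2 - S.h y * S.h' y + (y - S.mu / y) * S.h y ^ 2) / 2

lemma hasDeriv_Phi {y : ℝ} (hy : 0 < y) : HasDerivAt S.Phi (S.h y ^ 2) y := by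
  have d1 := S.hd y hy
  have d2 := S.hd' y hy
  have d := ((((hasDerivAt_id y).mul (d2.pow 2)).sub (d1.mul d2)).add
    (((hasDerivAt_id y).sub ((hasDerivAt_inv hy.ne').const_mul S.mu)).mul (d1.pow 2))).div_const 2
  refine HasDerivAt.congr_deriv (f := S.Phi) (d.congr_of_eventuallyEq
    (Eventually.of_forall fun x => by simp [Phi, div_eq_mul_inv])) ?_
  simp only [mu, id, Pi.sub_apply, Pi.pow_apply]
  field_simp
  ring

lemma mono_of_tend {f f' : ℝ → ℝ} {N : ℝ} (hf : ∀ s, 0 < s → s ≤ N → HasDerivAt f (f' s) s)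
    (h0 : ∀ s, 0 < s → s ≤ N → 0 ≤ f' s) (ht : Tendsto f (𝓝[>] 0) (𝓝 0)) :
    MonotoneOn f (Set.Ioc 0 N) ∧ ∀ s ∈ Set.Ioc 0 N, 0 ≤ f s := by
  have hm : MonotoneOn f (Set.Ioc 0 N) := by
    refine monotoneOn_of_hasDerivWithinAt_nonneg (f' := f') (convex_Ioc 0 N) ?_ ?_ ?_
    · exact fun y hy => (hf y hy.1 hy.2).continuousAt.continuousWithinAt
    · intro y hy
      rw [interior_Ioc] at hy
      exact (hf y hy.1 hy.2.le).hasDerivWithinAt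
    · intro y hy
      rw [interior_Ioc] at hy
      exact h0 y hy.1 hy.2.le
  refine ⟨hm, fun s hs => ?_⟩
  refine le_of_tendsto ht ?_
  filter_upwards [Ioc_mem_nhdsGT hs.1] with y hy
  exact hm ⟨hy.1, hy.2.trans hs.2⟩ hs hy.2

lemma Phi_mono (hm : 1 ≤ S.mu) (N : ℝ) :
    MonotoneOn S.Phi (Set.Ioc 0 N) ∧ ∀ s ∈ Set.Ioc 0 N, 0 ≤ S.Phi s := by
  refine mono_of_tend (f' := fun s => S.h s ^ 2) (fun s hs _ => S.hasDeriv_Phi hs)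
    (fun s _ _ => sq_nonneg _) ?_
  obtain ⟨t1, t2, t3⟩ := S.tend0 hm
  have t4 : Tendsto (fun s => s ^ 2 * (S.h s ^ 2 / s)) (𝓝[>] 0) (𝓝 (0 ^ 2 * 0)) :=
    ((tendsto_id.pow 2).mono_left nhdsWithin_le_nhds).mul t3
  have := ((((t2.sub t1).add t4).sub (t3.const_mul S.mu)).div_const 2)
  simp only [mul_zero, sub_zero, add_zero, zero_div] at this
  refine this.congr' ?_
  filter_upwards [self_mem_nhdsWithin] with s hs
  have : (s:ℝ) ≠ 0 := ne_of_gt hs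
  unfold Phi
  field_simp
  ring

lemma hh_mono (hm : 1 ≤ S.mu) {s : ℝ} (h0 : 0 < s) (h1 : s ^ 2 ≤ S.mu) : 0 ≤ S.h s * S.h' s := by
  refine (mono_of_tend (f := fun s => S.h s * S.h' s) (N := s)
    (f' := fun s => S.h' s ^ 2 + (S.mu / s ^ 2 - 1) * S.h s ^ 2) ?_ ?_ (S.tend0 hm).1).2 s ⟨h0, le_rfl⟩
  · intro y hy _
    refine ((S.hd y hy).mul (S.hd' y hy)).congr_deriv ?_
    simp only [mu]; ring
  · intro y hy hys
    have : 1 ≤ S.mu / y ^ 2 := by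
      rw [le_div_iff₀ (by positivity)]; nlinarith
    have : 0 ≤ S.mu / y ^ 2 - 1 := by linarith
    positivity

lemma Phi_le_hh (hm : 1 ≤ S.mu) {y : ℝ} (h0 : 0 < y) (h1 : y ^ 2 ≤ S.mu) :
    S.Phi y / y ≤ (S.h' y ^ 2 + (S.mu / y ^ 2 - 1) * S.h y ^ 2) / 2 := by
  have h2 := S.hh_mono hm h0 h1
  have e : S.Phi y / y = (S.h' y ^ 2 - (S.mu / y ^ 2 - 1) * S.h y ^ 2) / 2
      - S.h y * S.h' y / (2 * y) := by
    unfold Phi; field_simp; ring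
  have : 1 ≤ S.mu / y ^ 2 := by rw [le_div_iff₀ (by positivity)]; linarith
  have h3 : 0 ≤ (S.mu / y ^ 2 - 1) * S.h y ^ 2 := mul_nonneg (by linarith) (sq_nonneg _)
  have h4 : 0 ≤ S.h y * S.h' y / (2 * y) := by positivity
  rw [e]; linarith

lemma Phi_le_w (hm : 1 ≤ S.mu) {y : ℝ} (hr : S.Reg y) : S.Phi y ≤ 2 * S.w y * (10 ^ 10 * B0) := by
  have hE := S.E_bd hr
  have hE0 := S.E_nonneg hr.1
  have h1 := S.hh_le hr.1 hr.2.1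
  have hw := S.w_pos hr.2.1
  have hw2 := S.w_sq hr.2.1.le
  have hy := hr.1
  have hw1 : 1 ≤ S.w y := by
    by_contra hc; push Not at hc
    have : S.w y ^ 3 < 1 := pow_lt_one₀ hw.le hc (by norm_num)
    have := hr.2.2
    rw [abs_of_pos (by linarith)] at this
    linarith
  have e : S.Phi y = (S.w y * S.E y - S.h y * S.h' y) / 2 := by
    have : S.mu = y ^ 2 - S.w y ^ 2 := by linarith
    unfold Phi E; rw [this]; field_simp; ring
  rw [e]
  have := (abs_le.1 h1).1
  nlinarith

/-- the edge of the oscillatory region -/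
lemma exists_star (hm : 1 ≤ S.mu) : ∃ y, S.Reg y ∧ S.w y ^ 3 = S.mu := by
  set c := S.mu ^ ((1:ℝ)/3) with hc
  have hc3 : c ^ 3 = S.mu := by
    rw [hc, ← Real.rpow_natCast, ← Real.rpow_mul (by linarith)]; norm_num
  have hc0 : 0 < c := Real.rpow_pos_of_pos (by linarith) _
  have hy : √(S.mu + c ^ 2) ^ 2 = S.mu + c ^ 2 := Real.sq_sqrt (by positivity)
  have hw : S.w (√(S.mu + c ^ 2)) = c := by
    unfold w; rw [hy, add_sub_cancel_left, Real.sqrt_sq hc0.le]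
  have hlt : S.mu < √(S.mu + c ^ 2) ^ 2 := by rw [hy]; nlinarith
  refine ⟨√(S.mu + c ^ 2), ⟨Real.sqrt_pos.2 (by positivity), hlt, ?_⟩, ?_⟩
  · rw [hw, hc3, abs_of_pos (by linarith)]
  · rw [hw, hc3]

lemma hh_nu (hm : 1 ≤ S.mu) {v : ℝ} (hv : 0 < v) (hv2 : v ^ 2 = S.mu) :
    S.h v * S.h' v ≤ 2 * (10 ^ 10 * B0) := by
  obtain ⟨y, hy, hy3⟩ := S.exists_star hm
  have hE := S.E_bd hy
  have hw := S.w_pos hy.2.1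
  have hw2 := S.w_sq hy.2.1.le
  have hy0 := hy.1
  set K := 10 ^ 10 * B0
  have hvy : v < y := by nlinarith [hy.2.1]
  have hm0 : 0 < S.mu := by linarith
  have dE : ∀ s, 0 < s → HasDerivAt (fun s => (1 - S.mu * (s ^ 2)⁻¹) * S.h s ^ 2 + S.h' s ^ 2)
      (2 * S.mu / s ^ 3 * S.h s ^ 2) s := by
    intro s hs
    have d1 := S.hd s hs
    have d2 := S.hd' s hs
    have := (((((hasDerivAt_pow 2 s).inv (by positivity)).const_mul S.mu).const_sub 1).mul
      (d1.pow 2)).add (d2.pow 2)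
    refine this.congr_deriv ?_
    simp only [mu, Pi.pow_apply, Pi.inv_apply]
    field_simp
    ring
  have E2 : (1 - S.mu * (y ^ 2)⁻¹) * S.h y ^ 2 + S.h' y ^ 2 ≤ S.w y / y * K := by
    have : (1 - S.mu * (y ^ 2)⁻¹) * S.h y ^ 2 + S.h' y ^ 2 = S.w y / y * S.E y := by
      have : S.mu = y ^ 2 - S.w y ^ 2 := by linarith
      unfold E; rw [this]; field_simp; ring
    rw [this]; gcongr
  have mono : MonotoneOn (fun s => (1 - S.mu * (s ^ 2)⁻¹) * S.h s ^ 2 + S.h' s ^ 2) (Set.Icc v y) := by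
    refine monotoneOn_of_hasDerivWithinAt_nonneg (f' := fun s => 2 * S.mu / s ^ 3 * S.h s ^ 2)
      (convex_Icc v y) ?_ ?_ ?_
    · exact fun s hs => (dE s (hv.trans_le hs.1)).continuousAt.continuousWithinAt
    · intro s hs
      rw [interior_Icc] at hs
      exact (dE s (hv.trans hs.1)).hasDerivWithinAt
    · intro s hs
      rw [interior_Icc] at hs
      have := hv.trans hs.1
      positivity
  have hd : ∀ s ∈ Set.Icc v y, |S.h' s| ≤ √(S.w y / y * K) := by
    intro s hs
    apply Real.abs_le_sqrt
    have := mono hs (Set.right_mem_Icc.2 hvy.le) hs.2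
    simp only at this
    have hq : 0 ≤ 1 - S.mu * (s ^ 2)⁻¹ := by
      have hs0 := hv.trans_le hs.1
      rw [sub_nonneg, ← div_eq_mul_inv, div_le_one (by positivity), ← hv2]
      have := hs.1
      gcongr
    have : 0 ≤ (1 - S.mu * (s ^ 2)⁻¹) * S.h s ^ 2 := by positivity
    linarith
  have lip : ‖S.h v - S.h y‖ ≤ √(S.w y / y * K) * ‖v - y‖ := by
    apply (convex_Icc v y).norm_image_sub_le_of_norm_hasDerivWithin_le (f' := S.h')
      (fun s hs => (S.hd s (hv.trans_le hs.1)).hasDerivWithinAt) hd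
      (Set.right_mem_Icc.2 hvy.le) (Set.left_mem_Icc.2 hvy.le)
  have hK : 0 ≤ K := by have := S.B0_nonneg; positivity
  have hhy : |S.h y| ≤ √(y / S.w y * K) := by
    apply Real.abs_le_sqrt
    have h1 : S.w y / y * S.h y ^ 2 ≤ K := by
      have : 0 ≤ y / S.w y * S.h' y ^ 2 := by positivity
      unfold E at hE; linarith
    rw [div_mul_eq_mul_div, div_le_iff₀ hy0] at h1
    rw [div_mul_eq_mul_div, le_div_iff₀ hw]; linarith
  set α := √(S.w y / y * K)
  set β := √(y / S.w y * K)
  have hα : α * α = S.w y / y * K := Real.mul_self_sqrt (by positivity)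
  have hαβ : α * β = K := by
    rw [← Real.sqrt_mul (by positivity)]
    have : S.w y / y * K * (y / S.w y * K) = K ^ 2 := by field_simp
    rw [this, Real.sqrt_sq hK]
  have hα0 : 0 ≤ α := Real.sqrt_nonneg _
  rw [Real.norm_eq_abs, Real.norm_eq_abs, abs_sub_comm v y, abs_of_pos (by linarith : 0 < y - v)] at lip
  have h1 : |S.h v| ≤ β + α * (y - v) := by
    have := abs_sub_abs_le_abs_sub (S.h v) (S.h y); linarith
  have h2 := hd v (Set.left_mem_Icc.2 hvy.le)
  have h3 : y - v ≤ S.w y ^ 2 / y := by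
    rw [le_div_iff₀ hy0, hw2, ← hv2]; nlinarith
  calc S.h v * S.h' v ≤ |S.h v| * |S.h' v| := by rw [← abs_mul]; exact le_abs_self _
    _ ≤ (β + α * (S.w y ^ 2 / y)) * α := by
      apply mul_le_mul _ h2 (abs_nonneg _) (by positivity)
      exact h1.trans (by gcongr)
    _ = α * β + S.w y ^ 2 / y * (α * α) := by ring
    _ = K + S.w y ^ 3 / y ^ 2 * K := by rw [hα, hαβ]; field_simp
    _ ≤ K + 1 * K := by
      gcongr
      rw [div_le_one (by positivity), hy3]; exact hy.2.1.le
    _ = 2 * K := by ring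
end Sec


def nn (t r : ℝ) : ℝ := t * r / √(1 + r ^ 2)
def mm (t x : ℝ) : ℝ := x / √(t ^ 2 - x ^ 2)
def Top' (h : ℝ → ℝ) (t : ℝ) (g : ℝ → ℝ) (x : ℝ) : ℝ :=
  ∫ r, if nn t r < x then h (x * r) * g r else 0

lemma nn_lt_iff {t x r : ℝ} (hx : 0 < x) (hxt : x < t) (hr : 0 < r) : nn t r < x ↔ r < mm t x := by
  have h1 : 0 < √(1 + r ^ 2) := Real.sqrt_pos.2 (by positivity)
  have hp : 0 < t ^ 2 - x ^ 2 := by nlinarith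
  have h2 : 0 < √(t ^ 2 - x ^ 2) := Real.sqrt_pos.2 hp
  have s1 := Real.sq_sqrt (show 0 ≤ 1 + r ^ 2 by positivity)
  have s2 := Real.sq_sqrt hp.le
  rw [nn, mm, div_lt_iff₀ h1, lt_div_iff₀ h2,
    ← pow_lt_pow_iff_left₀ (by nlinarith) (by positivity) two_ne_zero,
    ← pow_lt_pow_iff_left₀ (a := r * _) (by positivity) (by positivity) two_ne_zero,
    mul_pow, mul_pow, mul_pow, s1, s2]
  constructor <;> intro <;> nlinarith

lemma nn_continuous (t : ℝ) : Continuous (nn t) := by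
  unfold nn
  refine Continuous.div (by fun_prop) (by fun_prop) fun r => ?_
  exact (Real.sqrt_pos.2 (by positivity)).ne'

namespace Nice
variable {g : ℝ → ℝ} {a b M : ℝ} (hN : Nice g a b M)
include hN
lemma zero {r : ℝ} (hr : r ≤ 0) : g r = 0 := hN.supp r fun h => by linarith [hN.pos, h.1]
lemma integrable : Integrable g := by
  have : IntegrableOn g (Set.Icc a b) := by
    refine Integrable.mono' (g := fun _ => M) (by simp) hN.meas.aestronglyMeasurable ?_
    exact Eventually.of_forall hN.bdd
  refine this.integrable_of_forall_notMem_eq_zero fun r hr => hN.supp r hr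
lemma mul {f : ℝ → ℝ} {A : ℝ} (hf : Measurable f) (hA : ∀ r, a ≤ r → r ≤ b → |f r| ≤ A) :
    Nice (fun r => f r * g r) a b (|A| * |M|) where
  meas := hf.mul hN.meas
  bdd r := by
    by_cases h : a ≤ r ∧ r ≤ b
    · rw [abs_mul]
      exact mul_le_mul ((hA r h.1 h.2).trans (le_abs_self _)) ((hN.bdd r).trans (le_abs_self _))
        (abs_nonneg _) (abs_nonneg _)
    · simp only [hN.supp r h, mul_zero, abs_zero]; positivity
  pos := hN.pos
  supp r h := by simp [hN.supp r h]
lemma sq : Integrable (fun r => g r ^ 2) := by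
  have := (hN.mul hN.meas (fun r _ _ => hN.bdd r)).integrable
  simpa [pow_two] using this
lemma ind {D : Set ℝ} (hD : MeasurableSet D) : Nice (D.indicator g) a b M where
  meas := hN.meas.indicator hD
  bdd r := by
    by_cases h : r ∈ D
    · simpa [h] using hN.bdd r
    · simpa [h] using (abs_nonneg _).trans (hN.bdd r)
  pos := hN.pos
  supp r h := by
    by_cases h' : r ∈ D
    · simpa [h'] using hN.supp r h
    · simp [h']
lemma ind_sq {D : Set ℝ} (hD : MeasurableSet D) : ∫ r, D.indicator g r ^ 2 ≤ ∫ r, g r ^ 2 := by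
  apply integral_mono (hN.ind hD).sq hN.sq
  intro r
  by_cases h : r ∈ D
  · simp [h]
  · simpa [h] using sq_nonneg _
end Nice

namespace Sec
variable {B B0 : ℝ} (S : Sec B B0)

lemma meas_ind : Measurable ((Set.Ioi 0).indicator S.h) := by
  classical
  have := S.cont_h.measurable_piecewise (g := fun _ => (0:ℝ)) continuousOn_const measurableSet_Ioi
  convert this using 1
  ext r; simp [Set.indicator, Set.piecewise]

lemma meas_K {g : ℝ → ℝ} {a b M : ℝ} (hN : Nice g a b M) {f : ℝ × ℝ → ℝ} (hf : Measurable f) :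
    AEStronglyMeasurable (fun x => ∫ r, f (x, r) * (S.h (x * r) * g r)) (volume.restrict (Set.Ioi 0)) := by
  have : StronglyMeasurable (fun x : ℝ => ∫ r, f (x, r) * ((Set.Ioi 0).indicator S.h (x * r) * g r)) := by
    apply StronglyMeasurable.integral_prod_right' (f := fun p : ℝ × ℝ =>
      f p * ((Set.Ioi 0).indicator S.h (p.1 * p.2) * g p.2))
    have h1 := S.meas_ind.comp (measurable_fst.mul measurable_snd (M := ℝ) (α := ℝ × ℝ))
    exact (hf.mul (h1.mul (hN.meas.comp measurable_snd))).stronglyMeasurable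
  refine this.aestronglyMeasurable.congr ?_
  filter_upwards [ae_restrict_mem measurableSet_Ioi] with x hx
  apply integral_congr_ae
  refine Eventually.of_forall fun r => ?_
  by_cases hr : 0 < r
  · simp [Set.indicator, mul_pos (Set.mem_Ioi.1 hx) hr]
  · simp [hN.zero (not_lt.1 hr)]

lemma meas_Hop {g : ℝ → ℝ} {a b M : ℝ} (hN : Nice g a b M) :
    AEStronglyMeasurable (Hop S.h g) (volume.restrict (Set.Ioi 0)) := by
  have := S.meas_K hN (f := fun _ => 1) measurable_const
  simp only [one_mul] at this
  exact this

lemma meas_Top {g : ℝ → ℝ} {a b M : ℝ} (hN : Nice g a b M) (t : ℝ) :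
    AEStronglyMeasurable (Top' S.h t g) (volume.restrict (Set.Ioi 0)) := by
  have hf : Measurable (fun p : ℝ × ℝ => if nn t p.2 < p.1 then (1:ℝ) else 0) :=
    Measurable.ite (measurableSet_lt ((nn_continuous t).measurable.comp measurable_snd) measurable_fst)
      measurable_const measurable_const
  refine (S.meas_K hN hf).congr (Eventually.of_forall fun x => ?_)
  simp [Top', ite_mul]

lemma cont_x {x a m : ℝ} (hx : 0 < x) (ha : 0 < a) :
    ContinuousOn (fun r => S.h (x * r)) (Set.Icc a m) :=
  S.cont_h.comp (by fun_prop) (fun r hr => mul_pos hx (ha.trans_le hr.1))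

/-- kernel Cauchy-Schwarz: `D` a section contained in `[l,m]`. -/
lemma K_cs {g : ℝ → ℝ} {a b M x l m : ℝ} (hN : Nice g a b M) (hx : 0 < x) (hl : 0 < l)
    {c : ℝ → ℝ} (hc : Measurable c) (hc1 : ∀ r, |c r| ≤ 1)
    (hD : ∀ r, a ≤ r → r ≤ b → c r ≠ 0 → l ≤ r ∧ r ≤ m) :
    (∫ r, c r * (S.h (x * r) * g r)) ^ 2 ≤ (∫ r in Set.Icc l m, S.h (x * r) ^ 2) * ∫ r, g r ^ 2 := by
  rcases lt_or_ge m l with hml | hml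
  · have : ∀ r, c r * (S.h (x * r) * g r) = 0 := by
      intro r
      by_cases hr : a ≤ r ∧ r ≤ b
      · by_cases h : c r = 0
        · simp [h]
        · have := hD r hr.1 hr.2 h; linarith
      · simp [hN.supp r hr]
    simp [this, hml]
  obtain ⟨M', hM'⟩ := nice_ind hl hml (S.cont_x hx hl)
  set f := (Set.Icc l m).indicator fun r => S.h (x * r)
  have hg' : Nice (fun r => c r * g r) a b (|1| * |M|) := hN.mul hc (fun r _ _ => hc1 r)
  have e : ∀ r, c r * (S.h (x * r) * g r) = f r * (c r * g r) := by
    intro r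
    by_cases hr : a ≤ r ∧ r ≤ b
    · by_cases h : c r = 0
      · simp [h]
      · have hm : r ∈ Set.Icc l m := hD r hr.1 hr.2 h
        simp only [f, Set.indicator_of_mem hm]; ring
    · simp [hN.supp r hr]
  simp_rw [e]
  have hfg := hg'.mul hM'.meas (fun r _ _ => hM'.bdd r)
  refine (integral_cs hM'.sq hg'.sq hfg.integrable).trans ?_
  have e2 : ∫ r, f r ^ 2 = ∫ r in Set.Icc l m, S.h (x * r) ^ 2 := by
    rw [← integral_indicator measurableSet_Icc]
    congr 1; ext r
    by_cases hr : r ∈ Set.Icc l m <;> simp [f, hr]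
  rw [e2]
  refine mul_le_mul_of_nonneg_left (integral_mono hg'.sq hN.sq fun r => ?_)
    (integral_nonneg fun _ => sq_nonneg _)
  have := hc1 r
  simp only
  rw [mul_pow]
  have : c r ^ 2 ≤ 1 := by
    rw [← sq_abs]; exact pow_le_one₀ (abs_nonneg _) this
  nlinarith [sq_nonneg (g r)]

lemma Top_cs {g : ℝ → ℝ} {a b M x t : ℝ} (hN : Nice g a b M) (hx : 0 < x) (hxt : x < t) :
    (Top' S.h t g x) ^ 2 ≤ (∫ r in Set.Icc a (mm t x), S.h (x * r) ^ 2) * ∫ r, g r ^ 2 := by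
  have := S.K_cs (c := fun r => if nn t r < x then 1 else 0) (m := mm t x) hN hx hN.pos
    (Measurable.ite (measurableSet_lt (nn_continuous t).measurable measurable_const)
      measurable_const measurable_const) (fun r => by split_ifs <;> simp) (fun r h1 _ h => by
        have h' : nn t r < x := by by_contra hc; simp [hc] at h
        exact ⟨h1, ((nn_lt_iff hx hxt (hN.pos.trans_le h1)).1 h').le⟩)
  simpa [Top', ite_mul] using this

lemma setint_le {F D : ℝ → ℝ} {u v C : ℝ} (hu : 0 ≤ u)
    (hF : AEStronglyMeasurable F (volume.restrict (Set.Ioi 0)))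
    (hD : IntegrableOn D (Set.Ioc u v)) (h : ∀ x ∈ Set.Ioc u v, F x ^ 2 ≤ D x)
    (hC : ∫ x in Set.Ioc u v, D x ≤ C) :
    IntegrableOn (fun x => F x ^ 2) (Set.Ioc u v) ∧ ∫ x in Set.Ioc u v, F x ^ 2 ≤ C := by
  have hsub : Set.Ioc u v ⊆ Set.Ioi 0 := fun x hx => hu.trans_lt hx.1
  have hm : AEStronglyMeasurable F (volume.restrict (Set.Ioc u v)) :=
    hF.mono_measure (Measure.restrict_mono hsub le_rfl)
  have hI : IntegrableOn (fun x => F x ^ 2) (Set.Ioc u v) := by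
    refine Integrable.mono' hD (hm.pow 2) ?_
    filter_upwards [ae_restrict_mem measurableSet_Ioc] with x hx
    rw [Real.norm_of_nonneg (sq_nonneg _)]
    exact h x hx
  exact ⟨hI, (setIntegral_mono_on hI hD measurableSet_Ioc h).trans hC⟩

lemma mm_mono {t x y : ℝ} (hx : 0 ≤ x) (hxy : x ≤ y) (hy : y < t) : mm t x ≤ mm t y := by
  unfold mm
  have hp : 0 < t ^ 2 - y ^ 2 := by nlinarith
  have : √(t ^ 2 - y ^ 2) ≤ √(t ^ 2 - x ^ 2) := Real.sqrt_le_sqrt (by nlinarith)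
  have := Real.sqrt_pos.2 hp
  have : 0 ≤ y := hx.trans hxy
  gcongr

lemma corner_small {g : ℝ → ℝ} {a b M X t : ℝ} (hN : Nice g a b M) (hX : 0 < X) (hXt : X < t)
    (h16 : X * mm t X ≤ 16) :
    IntegrableOn (fun x => Top' S.h t g x ^ 2) (Set.Ioc 0 X) ∧
      ∫ x in Set.Ioc 0 X, Top' S.h t g x ^ 2 ≤ 16 * B ^ 2 * ∫ r, g r ^ 2 := by
  have hG : 0 ≤ ∫ r, g r ^ 2 := integral_nonneg fun _ => sq_nonneg _
  have hm0 : 0 ≤ mm t X := div_nonneg hX.le (Real.sqrt_nonneg _)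
  refine setint_le (D := fun _ => B ^ 2 * mm t X * ∫ r, g r ^ 2) le_rfl (S.meas_Top hN t) continuous_const.integrableOn_Ioc ?_ ?_
  · intro x hx
    refine (S.Top_cs hN hx.1 (hx.2.trans_lt hXt)).trans ?_
    gcongr
    have hmx := mm_mono hx.1.le hx.2 hXt
    rcases lt_or_ge (mm t x) a with h | h
    · rw [Set.Icc_eq_empty (not_le.2 h), setIntegral_empty]
      positivity
    calc ∫ r in Set.Icc a (mm t x), S.h (x * r) ^ 2 ≤ ∫ r in Set.Icc a (mm t x), B ^ 2 := by
          apply setIntegral_mono_on _ (by simp) measurableSet_Icc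
          · intro r hr
            have hr0 := hN.pos.trans_le hr.1
            have : x * r ≤ 16 := by
              refine le_trans ?_ h16
              have := hr.2.trans hmx
              have := hx.2
              gcongr
            have := S.bd _ (mul_pos hx.1 hr0) this
            exact sq_le_sq' (abs_le.1 this).1 (abs_le.1 this).2
          · exact ((S.cont_x hx.1 hN.pos).pow 2).integrableOn_Icc
      _ ≤ _ := by
        simp only [integral_const, smul_eq_mul, MeasurableSet.univ, measureReal_restrict_apply,
          Set.univ_inter, Real.volume_real_Icc_of_le h]
        nlinarith [hN.pos, sq_nonneg B]
  · simp only [integral_const, smul_eq_mul, MeasurableSet.univ, measureReal_restrict_apply,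
          Set.univ_inter, Real.volume_real_Ioc_of_le hX.le]
    nlinarith [mul_nonneg (sq_nonneg B) hG]

lemma int_le_Phi (hm : 1 ≤ S.mu) {x a m : ℝ} (hx : 0 < x) (ha : 0 < a) (hm0 : 0 < m) :
    ∫ r in Set.Icc a m, S.h (x * r) ^ 2 ≤ S.Phi (x * m) / x := by
  have hP : ∀ y, 0 < y → 0 ≤ S.Phi y := fun y hy => (S.Phi_mono hm y).2 y ⟨hy, le_rfl⟩
  rcases lt_or_ge m a with h | h
  · rw [Set.Icc_eq_empty (not_le.2 h), setIntegral_empty]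
    have := hP _ (mul_pos hx hm0)
    positivity
  rw [integral_Icc_eq_integral_Ioc, ← intervalIntegral.integral_of_le h]
  have : ∫ r in a..m, S.h (x * r) ^ 2 = S.Phi (x * m) / x - S.Phi (x * a) / x := by
    apply intervalIntegral.integral_eq_sub_of_hasDerivAt (f := fun r => S.Phi (x * r) / x)
    · intro r hr
      rw [Set.uIcc_of_le h] at hr
      have d0 : HasDerivAt (fun r : ℝ => x * r) x r := by simpa using (hasDerivAt_id r).const_mul x
      have := ((S.hasDeriv_Phi (mul_pos hx (ha.trans_le hr.1))).comp r d0).div_const x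
      refine this.congr_deriv ?_
      field_simp
    · apply ContinuousOn.intervalIntegrable
      rw [Set.uIcc_of_le h]
      exact (S.cont_x hx ha).pow 2
  rw [this]
  have := hP _ (mul_pos hx ha)
  have : 0 ≤ S.Phi (x * a) / x := by positivity
  linarith
end Sec


def PI (F : ℝ → ℝ) (u v C : ℝ) : Prop :=
  IntegrableOn (fun x => F x ^ 2) (Set.Ioc u v) ∧ ∫ x in Set.Ioc u v, F x ^ 2 ≤ C

lemma PI.join {F : ℝ → ℝ} {u v z C D : ℝ} (h1 : PI F u v C) (h2 : PI F v z D) (huv : u ≤ v) (hvz : v ≤ z) :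
    PI F u z (C + D) := by
  have hU : Set.Ioc u z = Set.Ioc u v ∪ Set.Ioc v z := (Set.Ioc_union_Ioc_eq_Ioc huv hvz).symm
  refine ⟨by rw [hU]; exact h1.1.union h2.1, ?_⟩
  rw [hU, setIntegral_union (Set.Ioc_disjoint_Ioc_of_le le_rfl) measurableSet_Ioc h1.1 h2.1]
  linarith [h1.2, h2.2]

lemma mm_pos {t x : ℝ} (hx : 0 < x) (hxt : x < t) : 0 < mm t x :=
  div_pos hx (Real.sqrt_pos.2 (by nlinarith))

lemma hasDeriv_f {t x : ℝ} (hx : 0 < x) (hxt : x < t) :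
    HasDerivAt (fun x => x * mm t x) (mm t x * (2 + mm t x ^ 2)) x := by
  have hp : 0 < t ^ 2 - x ^ 2 := by nlinarith
  have h2 : 0 < √(t ^ 2 - x ^ 2) := Real.sqrt_pos.2 hp
  have s2 := Real.sq_sqrt hp.le
  have d1 : HasDerivAt (fun x : ℝ => t ^ 2 - x ^ 2) (-(2 * x)) x := by
    simpa using (hasDerivAt_pow 2 x).const_sub (t ^ 2)
  have d := (hasDerivAt_id x).mul ((hasDerivAt_id x).div (d1.sqrt hp.ne') h2.ne')
  refine HasDerivAt.congr_deriv (f := fun x => x * mm t x) d ?_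
  simp only [id, mm, Pi.div_apply]
  set q := √(t ^ 2 - x ^ 2)
  field_simp
  nlinarith

lemma f_mono {t x y : ℝ} (hx : 0 ≤ x) (hxy : x ≤ y) (hy : y < t) : x * mm t x ≤ y * mm t y := by
  have := Sec.mm_mono hx hxy hy
  have : 0 ≤ mm t x := div_nonneg hx (Real.sqrt_nonneg _)
  gcongr
  linarith

namespace Sec
variable {B B0 : ℝ} (S : Sec B B0)

lemma Top_zero {g : ℝ → ℝ} {a b M x t : ℝ} (hN : Nice g a b M) (ht : 0 < t) (hx : x ≤ nn t a) :
    Top' S.h t g x = 0 := by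
  unfold Top'
  refine integral_eq_zero_of_ae (Eventually.of_forall fun r => ?_)
  by_cases hr : a ≤ r
  · have : nn t a ≤ nn t r := by
      have h1 : 0 < √(1 + r ^ 2) := Real.sqrt_pos.2 (by positivity)
      have h2 : 0 < √(1 + a ^ 2) := Real.sqrt_pos.2 (by positivity)
      have s1 := Real.sq_sqrt (show 0 ≤ 1 + r ^ 2 by positivity)
      have s2 := Real.sq_sqrt (show 0 ≤ 1 + a ^ 2 by positivity)
      have ha := hN.pos
      unfold nn
      rw [div_le_div_iff₀ h2 h1, mul_assoc, mul_assoc]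
      refine mul_le_mul_of_nonneg_left ?_ ht.le
      have : 0 < r := by linarith
      rw [← pow_le_pow_iff_left₀ (by positivity) (by positivity) two_ne_zero, mul_pow, mul_pow, s1, s2]
      nlinarith
    simp only [Pi.zero_apply]
    rw [if_neg (by linarith)]
  · simp [hN.supp r (fun h => hr h.1)]

lemma corner_piece (hm : 1 ≤ S.mu) {g : ℝ → ℝ} {a b M x1 x2 t : ℝ} (hN : Nice g a b M) (h1 : 0 < x1)
    (h12 : x1 ≤ x2) (h2t : x2 < t) {F F' : ℝ → ℝ} (hF : ∀ x ∈ Set.Icc x1 x2, HasDerivAt F (F' x) x)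
    (hF' : ∀ x ∈ Set.Icc x1 x2, S.Phi (x * mm t x) / x ≤ F' x) :
    PI (Top' S.h t g) x1 x2 ((F x2 - F x1) * ∫ r, g r ^ 2) := by
  have hG : 0 ≤ ∫ r, g r ^ 2 := integral_nonneg fun _ => sq_nonneg _
  have hc : ContinuousOn (fun x => S.Phi (x * mm t x) / x) (Set.Icc x1 x2) := by
    intro x hx
    have hx0 : 0 < x := h1.trans_le hx.1
    have hxt : x < t := hx.2.trans_lt h2t
    have := (S.hasDeriv_Phi (mul_pos hx0 (mm_pos hx0 hxt))).comp x (hasDeriv_f hx0 hxt)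
    exact (this.continuousAt.div continuousAt_id hx0.ne').continuousWithinAt
  have hi : IntegrableOn (fun x => S.Phi (x * mm t x) / x) (Set.Icc x1 x2) := hc.integrableOn_Icc
  have hle := intervalIntegral.integral_le_sub_of_hasDeriv_right_of_le h12
    (fun x hx => (hF x hx).continuousAt.continuousWithinAt)
    (fun x hx => (hF x (Set.Ioo_subset_Icc_self hx)).hasDerivWithinAt) hi
    (fun x hx => hF' x (Set.Ioo_subset_Icc_self hx))
  rw [intervalIntegral.integral_of_le h12] at hle
  have hi2 : IntegrableOn (fun x => S.Phi (x * mm t x) / x * ∫ r, g r ^ 2) (Set.Ioc x1 x2) :=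
    Integrable.mul_const (hi.mono_set Set.Ioc_subset_Icc_self) _
  refine setint_le h1.le (S.meas_Top hN t) hi2 ?_ ?_
  · intro x hx
    have hx0 : 0 < x := h1.trans hx.1
    have hxt : x < t := hx.2.trans_lt h2t
    refine (S.Top_cs hN hx0 hxt).trans ?_
    exact mul_le_mul_of_nonneg_right (S.int_le_Phi hm hx0 hN.pos (mm_pos hx0 hxt)) hG
  · rw [integral_mul_const]
    exact mul_le_mul_of_nonneg_right hle hG

lemma corner_zero {g : ℝ → ℝ} {a b M x t C : ℝ} (hN : Nice g a b M) (ht : 0 < t) (hx : x ≤ nn t a)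
    (hC : 0 ≤ C) : PI (Top' S.h t g) 0 x C := by
  have e : Set.EqOn (fun x => Top' S.h t g x ^ 2) (fun _ => 0) (Set.Ioc 0 x) := fun y hy => by
    simp [S.Top_zero hN ht (hy.2.trans hx)]
  refine ⟨(integrableOn_congr_fun e measurableSet_Ioc).2 integrableOn_zero, ?_⟩
  rw [setIntegral_congr_fun measurableSet_Ioc e]; simpa using hC

lemma nn_pos {t a : ℝ} (ht : 0 < t) (ha : 0 < a) : 0 < nn t a :=
  div_pos (mul_pos ht ha) (Real.sqrt_pos.2 (by positivity))

lemma corner_B1 (hm : 1 ≤ S.mu) {g : ℝ → ℝ} {a b M X t : ℝ} (hN : Nice g a b M) (hX : 0 < X)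
    (hXt : X < t) (hv : (X * mm t X) ^ 2 ≤ S.mu) :
    PI (Top' S.h t g) 0 X (10 ^ 10 * B0 * ∫ r, g r ^ 2) := by
  have hG : 0 ≤ ∫ r, g r ^ 2 := integral_nonneg fun _ => sq_nonneg _
  have hB := S.B0_nonneg
  have ht : 0 < t := hX.trans hXt
  have hxa := nn_pos ht hN.pos
  rcases le_total X (nn t a) with hc | hc
  · exact S.corner_zero hN ht hc (by positivity)
  have hv0 : 0 < √S.mu := Real.sqrt_pos.2 (by linarith)
  have hv2 : √S.mu ^ 2 = S.mu := Real.sq_sqrt (by linarith)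
  have hf0 : ∀ x, 0 < x → x ≤ X → (x * mm t x) ^ 2 ≤ S.mu := fun x hx hxX => by
    refine le_trans ?_ hv
    have := f_mono hx.le hxX hXt
    have := mul_pos hx (mm_pos hx (hxX.trans_lt hXt))
    gcongr
  have hmono : MonotoneOn (fun s => S.h s * S.h' s) (Set.Ioc 0 (√S.mu)) := by
    refine (mono_of_tend (f := fun s => S.h s * S.h' s)
      (f' := fun s => S.h' s ^ 2 + (S.mu / s ^ 2 - 1) * S.h s ^ 2) ?_ ?_ (S.tend0 hm).1).1
    · intro y hy _
      refine ((S.hd y hy).mul (S.hd' y hy)).congr_deriv ?_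
      simp only [mu]; ring
    · intro y hy hyv
      have : 1 ≤ S.mu / y ^ 2 := by
        rw [le_div_iff₀ (by positivity), one_mul, ← hv2]; gcongr
      have : 0 ≤ S.mu / y ^ 2 - 1 := by linarith
      positivity
  have key := S.corner_piece hm hN hxa hc hXt
    (F := fun x => (S.h (x * mm t x) * S.h' (x * mm t x)) / 2)
    (F' := fun x => ((S.h' (x * mm t x) ^ 2 + (S.mu / (x * mm t x) ^ 2 - 1) * S.h (x * mm t x) ^ 2)
      * (mm t x * (2 + mm t x ^ 2))) / 2) ?_ ?_
  · have j := (S.corner_zero hN ht le_rfl le_rfl).join key hxa.le hc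
    refine ⟨j.1, j.2.trans ?_⟩
    rw [zero_add]
    refine mul_le_mul_of_nonneg_right ?_ hG
    have a1 := S.hh_mono hm (mul_pos hxa (mm_pos hxa (hc.trans_lt hXt))) (hf0 _ hxa hc)
    have hfX := mul_pos hX (mm_pos hX hXt)
    have hfv : X * mm t X ≤ √S.mu := Real.le_sqrt_of_sq_le hv
    have a2 : S.h (X * mm t X) * S.h' (X * mm t X) ≤ S.h (√S.mu) * S.h' (√S.mu) :=
      hmono ⟨hfX, hfv⟩ ⟨hv0, le_rfl⟩ hfv
    have a3 := S.hh_nu hm hv0 hv2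
    linarith
  · intro x hx
    have hx0 : 0 < x := hxa.trans_le hx.1
    have hxt : x < t := hx.2.trans_lt hXt
    have hf := hasDeriv_f hx0 hxt
    have hfp := mul_pos hx0 (mm_pos hx0 hxt)
    have d : HasDerivAt (fun s => S.h s * S.h' s)
        (S.h' (x * mm t x) ^ 2 + (S.mu / (x * mm t x) ^ 2 - 1) * S.h (x * mm t x) ^ 2) (x * mm t x) := by
      refine ((S.hd _ hfp).mul (S.hd' _ hfp)).congr_deriv ?_
      simp only [mu]; ring
    exact (HasDerivAt.comp x d hf).div_const 2
  · intro x hx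
    have hx0 : 0 < x := hxa.trans_le hx.1
    have hxt : x < t := hx.2.trans_lt hXt
    have hmp := mm_pos hx0 hxt
    have hfp := mul_pos hx0 hmp
    have h1 := S.Phi_le_hh hm hfp (hf0 x hx0 hx.2)
    have hP : 0 ≤ S.Phi (x * mm t x) := (S.Phi_mono hm _).2 _ ⟨hfp, le_rfl⟩
    set y := x * mm t x
    have e : S.Phi y / x = S.Phi y / y * mm t x := by simp only [y]; field_simp
    rw [e]
    have h0 : 0 ≤ S.Phi y / y := by positivity
    set V := S.h' y ^ 2 + (S.mu / y ^ 2 - 1) * S.h y ^ 2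
    nlinarith [mul_le_mul_of_nonneg_right h1 hmp.le, mul_nonneg (mul_nonneg (h0.trans h1) hmp.le)
      (sq_nonneg (mm t x)), mul_nonneg (h0.trans h1) hmp.le]

lemma corner_B (hm : 1 ≤ S.mu) {g : ℝ → ℝ} {a b M X t : ℝ} (hN : Nice g a b M) (hX : 0 < X)
    (hXt : X < t) (h2 : (X * mm t X) ^ 2 ≤ 4 * S.mu)
    (hw : S.mu ≤ (X * mm t X) ^ 2 → S.w (X * mm t X) ^ 3 ≤ (X * mm t X) ^ 2 * (1 + mm t X ^ 2)) :
    PI (Top' S.h t g) 0 X (20 * 10 ^ 10 * B0 * ∫ r, g r ^ 2) := by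
  have hG : 0 ≤ ∫ r, g r ^ 2 := integral_nonneg fun _ => sq_nonneg _
  have hB := S.B0_nonneg
  have ht : 0 < t := hX.trans hXt
  have hv0 : 0 < √S.mu := Real.sqrt_pos.2 (by linarith)
  have hv2 : √S.mu ^ 2 = S.mu := Real.sq_sqrt (by linarith)
  set v := √S.mu
  set y0 := X * mm t X with hy0
  set m0 := mm t X with hm0
  have hm0p : 0 < m0 := mm_pos hX hXt
  have hy0p : 0 < y0 := mul_pos hX hm0p
  rcases le_or_gt (y0 ^ 2) S.mu with hc | hc
  · have := S.corner_B1 hm hN hX hXt hc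
    exact ⟨this.1, this.2.trans (by nlinarith [mul_nonneg hB hG])⟩
  have hvy : v < y0 := by
    rw [← pow_lt_pow_iff_left₀ hv0.le hy0p.le two_ne_zero, hv2]; exact hc
  obtain ⟨Xv, hXv, hfv⟩ : ∃ x ∈ Set.Icc 0 X, x * mm t x = v := by
    have hcont : ContinuousOn (fun x => x * mm t x) (Set.Icc 0 X) := by
      unfold mm
      refine continuousOn_id.mul (ContinuousOn.div continuousOn_id (by fun_prop) fun x hx => ?_)
      exact (Real.sqrt_pos.2 (by nlinarith [hx.1, hx.2])).ne'
    have := intermediate_value_Icc hX.le hcont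
    exact this ⟨by simpa using hv0.le, hvy.le⟩
  have hXv0 : 0 < Xv := by
    rcases hXv.1.eq_or_lt with h | h
    · rw [← h] at hfv; simp at hfv; linarith
    · exact h
  have hXvt := hXv.2.trans_lt hXt
  set mv := mm t Xv with hmv
  have hmvp : 0 < mv := mm_pos hXv0 hXvt
  have p1 := S.corner_B1 hm hN hXv0 hXvt (by rw [hfv, hv2])
  obtain ⟨ys, hys, hys3⟩ := S.exists_star hm
  set y1 := max y0 ys with hy1
  have hr1 : S.Reg y1 := hys.mono (le_max_right _ _)
  have hw1 := S.w_pos hr1.2.1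
  have hP1 := S.Phi_le_w hm hr1
  have hy1p : 0 < y1 := hy0p.trans_le (le_max_left _ _)
  have hPn : 0 ≤ S.Phi y1 := (S.Phi_mono hm _).2 _ ⟨hy1p, le_rfl⟩
  have p2 := S.corner_piece hm hN hXv0 hXv.2 hXt
    (F := fun x => S.Phi y1 / (2 + mv ^ 2) * Real.log (x * mm t x))
    (F' := fun x => S.Phi y1 / (2 + mv ^ 2) * (mm t x * (2 + mm t x ^ 2) / (x * mm t x))) ?_ ?_
  · have j := p1.join p2 hXv.1 hXv.2
    refine ⟨j.1, j.2.trans ?_⟩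
    rw [← add_mul]
    refine mul_le_mul_of_nonneg_right ?_ hG
    rw [← hm0, ← hy0, ← hmv, hfv]
    rw [← mul_sub, ← Real.log_div hy0p.ne' hv0.ne']
    have l1 : Real.log (y0 / v) ≤ (y0 ^ 2 - S.mu) / (2 * S.mu) := by
      have := Real.log_le_sub_one_of_pos (show 0 < (y0 / v) ^ 2 by positivity)
      rw [Real.log_pow, div_pow, hv2] at this
      push_cast at this
      rw [le_div_iff₀ (by linarith)]
      have e : (y0 ^ 2 / S.mu - 1) * S.mu = y0 ^ 2 - S.mu := by
        rw [sub_mul, div_mul_cancel₀ _ (by linarith)]; ring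
      nlinarith
    have w1 : y0 ^ 2 - S.mu ≤ S.w y1 ^ 2 := by
      rw [S.w_sq hr1.2.1.le]
      have : y0 ≤ y1 := le_max_left _ _
      have : y0 ^ 2 ≤ y1 ^ 2 := by gcongr
      linarith
    have hmm : m0 ≤ 2 * mv := by
      have : y0 ≤ 2 * v := by
        rw [← pow_le_pow_iff_left₀ hy0p.le (by positivity) two_ne_zero, mul_pow 2 v, hv2]; linarith
      have h3 : X * m0 ≤ X * (2 * mv) := by
        calc X * m0 ≤ 2 * (Xv * mv) := by rw [hfv]; exact this
          _ ≤ 2 * (X * mv) := by have := hXv.2; gcongr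
          _ = _ := by ring
      exact le_of_mul_le_mul_left h3 hX
    have w3 : S.w y1 ^ 3 ≤ 16 * S.mu * (2 + mv ^ 2) := by
      have c1 : y0 ^ 2 * (1 + m0 ^ 2) ≤ 16 * S.mu * (2 + mv ^ 2) := by
        have : m0 ^ 2 ≤ 4 * mv ^ 2 := by nlinarith
        calc y0 ^ 2 * (1 + m0 ^ 2) ≤ (4 * S.mu) * (1 + 4 * mv ^ 2) := by gcongr
          _ ≤ _ := by nlinarith
      rcases le_total ys y0 with h | h
      · rw [hy1, max_eq_left h]; exact (hw hc.le).trans c1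
      · rw [hy1, max_eq_right h, hys3]; nlinarith [sq_nonneg mv]
    calc 10 ^ 10 * B0 + S.Phi y1 / (2 + mv ^ 2) * Real.log (y0 / v)
        ≤ 10 ^ 10 * B0 + (2 * S.w y1 * (10 ^ 10 * B0)) / (2 + mv ^ 2) * (S.w y1 ^ 2 / (2 * S.mu)) := by
          have : Real.log (y0 / v) ≤ S.w y1 ^ 2 / (2 * S.mu) := l1.trans (by gcongr)
          have hl0 : 0 ≤ Real.log (y0 / v) := Real.log_nonneg (by rw [le_div_iff₀ hv0]; linarith)
          gcongr
      _ = 10 ^ 10 * B0 + 10 ^ 10 * B0 * (S.w y1 ^ 3 / (S.mu * (2 + mv ^ 2))) := by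
          have : S.mu ≠ 0 := by linarith
          field_simp
      _ ≤ 10 ^ 10 * B0 + 10 ^ 10 * B0 * 16 := by
          gcongr
          rw [div_le_iff₀ (by have : 0 < S.mu := by linarith
                              positivity)]
          linarith
      _ ≤ _ := by linarith
  · intro x hx
    have hx0 : 0 < x := hXv0.trans_le hx.1
    have hxt : x < t := hx.2.trans_lt hXt
    exact ((hasDeriv_f hx0 hxt).log (mul_pos hx0 (mm_pos hx0 hxt)).ne').const_mul _
  · intro x hx
    have hx0 : 0 < x := hXv0.trans_le hx.1
    have hxt : x < t := hx.2.trans_lt hXt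
    have hmp := mm_pos hx0 hxt
    have h1 : S.Phi (x * mm t x) ≤ S.Phi y1 := by
      have : x * mm t x ≤ y1 := (f_mono hx0.le hx.2 hXt).trans (le_max_left _ _)
      exact (S.Phi_mono hm y1).1 ⟨mul_pos hx0 hmp, this⟩ ⟨hy1p, le_rfl⟩ this
    have h2 : mv ≤ mm t x := mm_mono hXv.1 hx.1 hxt
    have e : mm t x * (2 + mm t x ^ 2) / (x * mm t x) = (2 + mm t x ^ 2) / x := by field_simp
    rw [e, ← mul_div_assoc]
    gcongr
    refine h1.trans ?_
    rw [div_mul_eq_mul_div, le_div_iff₀ (by positivity)]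
    gcongr
end Sec


lemma eta_bound : ∃ M : ℝ, 0 < M ∧ ∀ x, |deriv Real.smoothTransition x| ≤ M ∧
    |deriv (deriv Real.smoothTransition) x| ≤ M := by
  have hC : ContDiff ℝ 2 Real.smoothTransition := Real.smoothTransition.contDiff
  have hC1 : ContDiff ℝ 1 (deriv Real.smoothTransition) := (contDiff_succ_iff_deriv.1 hC).2.2
  have c1 : Continuous (deriv Real.smoothTransition) := hC1.continuous
  have c2 : Continuous (deriv (deriv Real.smoothTransition)) := hC1.continuous_deriv le_rfl
  obtain ⟨M1, h1⟩ := (isCompact_Icc (a := (0:ℝ)) (b := 1)).exists_bound_of_continuousOn c1.continuousOn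
  obtain ⟨M2, h2⟩ := (isCompact_Icc (a := (0:ℝ)) (b := 1)).exists_bound_of_continuousOn c2.continuousOn
  have z : ∀ x, x ∉ Set.Icc (0:ℝ) 1 → deriv Real.smoothTransition x = 0 ∧
      deriv (deriv Real.smoothTransition) x = 0 := by
    intro x hx
    have : ∀ᶠ y in 𝓝 x, deriv Real.smoothTransition y = 0 := by
      filter_upwards [isClosed_Icc.isOpen_compl.mem_nhds hx] with y hy
      rcases lt_or_ge y 0 with h | h
      · refine IsLocalMin.deriv_eq_zero (Eventually.of_forall fun z => ?_)
        rw [Real.smoothTransition.zero_of_nonpos h.le]; exact Real.smoothTransition.nonneg z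
      · refine IsLocalMax.deriv_eq_zero (Eventually.of_forall fun z => ?_)
        have hy1 : 1 ≤ y := by by_contra hc; exact hy ⟨h, by linarith⟩
        rw [Real.smoothTransition.one_of_one_le (x := y) hy1]
        exact Real.smoothTransition.le_one z
    refine ⟨this.self_of_nhds, ?_⟩
    have e : deriv Real.smoothTransition =ᶠ[𝓝 x] fun _ => 0 := this
    rw [e.deriv_eq]; simp
  refine ⟨|M1| + |M2| + 1, by positivity, fun x => ?_⟩
  by_cases hx : x ∈ Set.Icc (0:ℝ) 1
  · have := h1 x hx
    have := h2 x hx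
    rw [Real.norm_eq_abs] at *
    constructor <;> linarith [le_abs_self M1, le_abs_self M2, abs_nonneg M1, abs_nonneg M2]
  · rw [(z x hx).1, (z x hx).2, abs_zero]
    constructor <;> positivity

/-- cutoff data -/
structure Cut (Ψ Ψ' Ψ'' : ℝ → ℝ) (x1 X M J : ℝ) : Prop where
  h0 : 0 < x1
  h1 : x1 < X
  d : ∀ x, HasDerivAt Ψ (Ψ' x) x
  d' : ∀ x, HasDerivAt Ψ' (Ψ'' x) x
  c'' : Continuous Ψ''
  b : ∀ x, |Ψ x| ≤ 1
  b' : ∀ x, |Ψ' x| ≤ M * J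
  b'' : ∀ x, |Ψ'' x| ≤ M * J ^ 2
  one : ∀ x, x ≤ x1 → Ψ x = 1
  zero : ∀ x, X ≤ x → Ψ x = 0
  z' : ∀ x, x ≤ x1 → Ψ' x = 0
  zX : ∀ x, X ≤ x → Ψ' x = 0

lemma int_mul {m : Measure ℝ} {f g : ℝ → ℝ} (mf : AEStronglyMeasurable f m) (mg : AEStronglyMeasurable g m)
    (hf : Integrable (fun x => f x ^ 2) m) (hg : Integrable (fun x => g x ^ 2) m) :
    Integrable (fun x => f x * g x) m := by
  refine Integrable.mono' (hf.add hg) (mf.mul mg) (Eventually.of_forall fun x => ?_)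
  simp only [Pi.add_apply, Real.norm_eq_abs, abs_mul]
  rw [← sq_abs (f x), ← sq_abs (g x)]
  nlinarith [sq_nonneg (|f x| - |g x|), abs_nonneg (f x), abs_nonneg (g x), sq_nonneg (|f x|), sq_nonneg (|g x|)]

namespace Sec

lemma hasDeriv_gen {φ φ' : ℝ → ℝ} (hd : ∀ s, 0 < s → HasDerivAt φ (φ' s) s) (hc : ContinuousOn φ' (Set.Ioi 0))
    (hmφ : Measurable ((Set.Ioi 0).indicator φ)) (hmφ' : Measurable ((Set.Ioi 0).indicator φ'))
    {g : ℝ → ℝ} {a b M x : ℝ} (hN : Nice g a b M) (hx : 0 < x) :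
    HasDerivAt (Hop φ g) (Hop φ' (fun r => r * g r) x) x := by
  have hcφ : ContinuousOn φ (Set.Ioi 0) := fun s hs => (hd s hs).continuousAt.continuousWithinAt
  have ha := hN.pos
  have hK : ∀ {ψ : ℝ → ℝ}, ContinuousOn ψ (Set.Ioi 0) → ∃ C, ∀ s ∈ Set.Icc (x / 2 * a) (2 * x * b), ‖ψ s‖ ≤ C :=
    fun h => isCompact_Icc.exists_bound_of_continuousOn (h.mono fun s hs =>
      lt_of_lt_of_le (by positivity) hs.1)
  have hmeas : ∀ {ψ : ℝ → ℝ} {g : ℝ → ℝ}, Measurable ((Set.Ioi 0).indicator ψ) → Measurable g →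
      (∀ r ≤ 0, g r = 0) → ∀ y : ℝ, 0 < y → AEStronglyMeasurable (fun r => ψ (y * r) * g r) volume := by
    intro ψ g hψ hg hz y hy
    have : (fun r => ψ (y * r) * g r) = fun r => (Set.Ioi 0).indicator ψ (y * r) * g r := by
      ext r
      rcases le_or_gt r 0 with h | h
      · simp [hz r h]
      · simp [mul_pos hy h]
    rw [this]
    exact ((hψ.comp (measurable_const.mul measurable_id)).mul hg).aestronglyMeasurable
  obtain ⟨C, hC⟩ := hK hc
  obtain ⟨C0, hC0⟩ := hK hcφ
  have hbd : ∀ y ∈ Metric.ball x (x / 2), ∀ r, a ≤ r → r ≤ b → 0 < y ∧ y * r ∈ Set.Icc (x / 2 * a) (2 * x * b) := by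
    intro y hy r h1 h2
    rw [Metric.mem_ball, Real.dist_eq, abs_lt] at hy
    have : x / 2 ≤ y := by linarith
    have : y ≤ 2 * x := by linarith
    exact ⟨by linarith, by gcongr; linarith, mul_le_mul (by linarith) h2 (by linarith) (by linarith)⟩
  have hN' : Nice (fun r => r * g r) a b (|b| * |M|) :=
    hN.mul measurable_id fun r h1 h2 => by
      change |r| ≤ b; rw [abs_of_nonneg (by linarith)]; exact h2
  have key := hasDerivAt_integral_of_dominated_loc_of_deriv_le (μ := volume)
    (F := fun y r => φ (y * r) * g r) (F' := fun y r => φ' (y * r) * (r * g r)) (x₀ := x)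
    (s := Metric.ball x (x / 2)) (bound := fun r => C * |r * g r|)
    (Metric.ball_mem_nhds x (by positivity)) ?_ ?_ ?_ ?_ ?_ ?_
  · exact key.2
  · filter_upwards [lt_mem_nhds hx] with y hy
    exact hmeas hmφ hN.meas (fun r h => hN.zero h) y hy
  · refine Integrable.mono' (g := fun r => C0 * |g r|) (hN.integrable.abs.const_mul C0)
      (hmeas hmφ hN.meas (fun r h => hN.zero h) x hx) (Eventually.of_forall fun r => ?_)
    by_cases h : a ≤ r ∧ r ≤ b
    · rw [norm_mul, Real.norm_eq_abs (g r)]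
      gcongr
      exact hC0 _ (hbd x (Metric.mem_ball_self (by positivity)) r h.1 h.2).2
    · simp [hN.supp r h]
  · exact hmeas hmφ' hN'.meas (fun r h => hN'.zero h) x hx
  · refine Eventually.of_forall fun r y hy => ?_
    by_cases h : a ≤ r ∧ r ≤ b
    · rw [norm_mul, Real.norm_eq_abs (r * g r)]
      gcongr
      exact hC _ (hbd y hy r h.1 h.2).2
    · simp [hN.supp r h]
  · exact hN'.integrable.abs.const_mul C
  · refine Eventually.of_forall fun r y hy => ?_
    by_cases h : a ≤ r ∧ r ≤ b
    · have h0 := hbd y hy r h.1 h.2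
      have dd : HasDerivAt (fun y : ℝ => y * r) r y := by simpa using (hasDerivAt_id y).mul_const r
      have := ((hd (y * r) (mul_pos h0.1 (by linarith))).comp y dd).mul_const (g r)
      refine this.congr_deriv ?_
      ring
    · simpa [hN.supp r h] using hasDerivAt_const y (0:ℝ)

variable {B B0 : ℝ} (S : Sec B B0)

lemma meas_of_cont {f : ℝ → ℝ} (hf : ContinuousOn f (Set.Ioi 0)) : Measurable ((Set.Ioi 0).indicator f) := by
  classical
  have := hf.measurable_piecewise (g := fun _ => (0:ℝ)) continuousOn_const measurableSet_Ioi
  convert this using 1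
  ext r; simp [Set.indicator, Set.piecewise]

/-- derivative of `Hop` -/
def HD (g : ℝ → ℝ) (x : ℝ) : ℝ := Hop S.h' (fun r => r * g r) x

lemma hasDeriv_Hop {g : ℝ → ℝ} {a b M x : ℝ} (hN : Nice g a b M) (hx : 0 < x) :
    HasDerivAt (Hop S.h g) (S.HD g x) x :=
  hasDeriv_gen S.hd S.cont_h' S.meas_ind (meas_of_cont S.cont_h') hN hx

lemma nice_r {g : ℝ → ℝ} {a b M : ℝ} (hN : Nice g a b M) : Nice (fun r => r * g r) a b (|b| * |M|) :=
  hN.mul measurable_id fun r h1 h2 => by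
    change |r| ≤ b; rw [abs_of_nonneg (by linarith [hN.pos])]; exact h2

lemma nice_q {g : ℝ → ℝ} {a b M : ℝ} (hN : Nice g a b M) (e : ℝ) :
    Nice (fun r => (r ^ 2 - e) * g r) a b (|b ^ 2 + abs e| * |M|) :=
  hN.mul (by fun_prop) fun r h1 h2 => by
    have : |r ^ 2| ≤ b ^ 2 := by
      rw [abs_of_nonneg (sq_nonneg r)]; have := hN.pos; gcongr; linarith
    linarith [abs_sub (r ^ 2) e]

lemma int_Hop {g : ℝ → ℝ} {a b M x : ℝ} (hN : Nice g a b M) (hx : 0 < x) :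
    Integrable fun r => S.h (x * r) * g r := by
  rcases lt_or_ge b a with hba | hba
  · have : ∀ r, g r = 0 := fun r => hN.supp r fun h => by linarith [h.1, h.2]
    simp [this]
  obtain ⟨M', hM'⟩ := nice_ind hN.pos hba (S.cont_x hx hN.pos (m := b))
  refine (hN.mul hM'.meas (fun r _ _ => hM'.bdd r)).integrable.congr (Eventually.of_forall fun r => ?_)
  by_cases hr : r ∈ Set.Icc a b
  · simp [hr]
  · simp [hN.supp r hr]

lemma Hop_sub {g1 g2 : ℝ → ℝ} {a b M a2 b2 M2 x : ℝ} (h1 : Nice g1 a b M) (h2 : Nice g2 a2 b2 M2) (hx : 0 < x)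
    (c : ℝ) : Hop S.h (fun r => g1 r + c * g2 r) x = Hop S.h g1 x + c * Hop S.h g2 x := by
  unfold Hop
  rw [← integral_const_mul, ← integral_add (S.int_Hop h1 hx) ((S.int_Hop h2 hx).const_mul c)]
  congr 1; ext r; ring

lemma hasDeriv_HD {g : ℝ → ℝ} {a b M x : ℝ} (hN : Nice g a b M) (hx : 0 < x) (e : ℝ) :
    HasDerivAt (S.HD g) (-(e - S.mu / x ^ 2) * Hop S.h g x - Hop S.h (fun r => (r ^ 2 - e) * g r) x) x := by
  have hc : ContinuousOn (fun s => -(1 - S.p * (S.p - 1) / s ^ 2) * S.h s) (Set.Ioi 0) := by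
    refine ContinuousOn.mul (ContinuousOn.neg (ContinuousOn.sub continuousOn_const
      (ContinuousOn.div continuousOn_const (by fun_prop) fun s hs => ?_))) S.cont_h
    exact (pow_pos hs 2).ne'
  have := hasDeriv_gen S.hd' hc (meas_of_cont S.cont_h') (meas_of_cont hc) (nice_r hN) hx
  refine this.congr_deriv ?_
  have h2 := nice_q hN e
  unfold Hop
  rw [← integral_const_mul, ← integral_sub ((S.int_Hop hN hx).const_mul _) (S.int_Hop h2 hx)]
  congr 1; ext r
  by_cases hr : a ≤ r ∧ r ≤ b
  · have : 0 < r := hN.pos.trans_le hr.1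
    simp only [mu]
    field_simp
    ring
  · simp [hN.supp r hr]

lemma near0 {g : ℝ → ℝ} {a b M : ℝ} (hN : Nice g a b M) : ∃ C, 0 ≤ C ∧ ∀ x, 0 < x → x * b ≤ 1 → x ≤ 1 →
    |Hop S.h g x| ≤ C * x ^ S.p ∧ |x * S.HD g x - S.p * Hop S.h g x| ≤ C * x ^ (S.p + 2) := by
  set Q := (|b| + 1) ^ (S.p + 2) with hQ
  have hQ0 : 0 ≤ Q := by positivity
  have hI : 0 ≤ ∫ r, |g r| := integral_nonneg fun r => abs_nonneg _
  refine ⟨|S.B'| * Q * ∫ r, |g r|, by positivity, fun x hx hxb hx1 => ?_⟩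
  have hp := S.hp
  have hrQ : ∀ r, a ≤ r → r ≤ b → r ^ S.p ≤ Q ∧ r ^ (S.p + 2) ≤ Q := by
    intro r h1 h2
    have hr0 : 0 < r := hN.pos.trans_le h1
    have : r ≤ |b| + 1 := by linarith [le_abs_self b]
    constructor
    · refine (Real.rpow_le_rpow hr0.le this hp).trans ?_
      exact Real.rpow_le_rpow_of_exponent_le (by linarith [abs_nonneg b]) (by linarith)
    · exact Real.rpow_le_rpow hr0.le this (by linarith)
  constructor
  · unfold Hop
    rw [← Real.norm_eq_abs]
    refine (norm_integral_le_of_norm_le (g := fun r => |S.B'| * Q * x ^ S.p * |g r|)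
      (hN.integrable.abs.const_mul _) (Eventually.of_forall fun r => ?_)).trans ?_
    · by_cases h : a ≤ r ∧ r ≤ b
      · have hr0 : 0 < r := hN.pos.trans_le h.1
        rw [norm_mul, Real.norm_eq_abs, Real.norm_eq_abs]
        gcongr
        refine (S.n0 _ (mul_pos hx hr0) (by nlinarith [h.2])).trans ?_
        rw [Real.mul_rpow hx.le hr0.le]
        calc _ ≤ |S.B'| * (x ^ S.p * Q) := by
              gcongr
              · exact le_abs_self _
              · exact (hrQ r h.1 h.2).1
          _ = _ := by ring
      · simp [hN.supp r h]
    · rw [integral_const_mul]; apply le_of_eq; ring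
  · have i1 : Integrable fun r => S.h' (x * r) * (r * g r) := by
      rcases lt_or_ge b a with hba | hba
      · have : ∀ r, g r = 0 := fun r => hN.supp r fun h => by linarith [h.1, h.2]
        simp [this]
      have hcx : ContinuousOn (fun r => S.h' (x * r)) (Set.Icc a b) :=
        S.cont_h'.comp (by fun_prop) (fun r hr => mul_pos hx (hN.pos.trans_le hr.1))
      obtain ⟨M', hM'⟩ := nice_ind hN.pos hba hcx
      refine ((nice_r hN).mul hM'.meas (fun r _ _ => hM'.bdd r)).integrable.congr (Eventually.of_forall fun r => ?_)
      by_cases hr : r ∈ Set.Icc a b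
      · simp [hr]
      · simp [hN.supp r hr]
    have e : x * S.HD g x - S.p * Hop S.h g x = ∫ r, (x * r * S.h' (x * r) - S.p * S.h (x * r)) * g r := by
      unfold HD Hop
      rw [← integral_const_mul, ← integral_const_mul,
        ← integral_sub (i1.const_mul x) ((S.int_Hop hN hx).const_mul S.p)]
      congr 1; ext r; ring
    rw [e, ← Real.norm_eq_abs]
    refine (norm_integral_le_of_norm_le (g := fun r => |S.B'| * Q * x ^ (S.p + 2) * |g r|)
      (hN.integrable.abs.const_mul _) (Eventually.of_forall fun r => ?_)).trans ?_
    · by_cases h : a ≤ r ∧ r ≤ b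
      · have hr0 : 0 < r := hN.pos.trans_le h.1
        rw [norm_mul, Real.norm_eq_abs, Real.norm_eq_abs]
        gcongr
        refine (S.n1 _ (mul_pos hx hr0) (by nlinarith [h.2])).trans ?_
        rw [Real.mul_rpow hx.le hr0.le]
        calc _ ≤ |S.B'| * (x ^ (S.p + 2) * Q) := by
              gcongr
              · exact le_abs_self _
              · exact (hrQ r h.1 h.2).2
          _ = _ := by ring
      · simp [hN.supp r h]
    · rw [integral_const_mul]; apply le_of_eq; ring

/-- the Wronskian vanishes at `0` -/
lemma wronsk {g1 g2 : ℝ → ℝ} {a b M a2 b2 M2 : ℝ} (h1 : Nice g1 a b M) (h2 : Nice g2 a2 b2 M2) :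
    Tendsto (fun x => Hop S.h g1 x * S.HD g2 x - S.HD g1 x * Hop S.h g2 x) (𝓝[>] 0) (𝓝 0) := by
  obtain ⟨C, hC0, hC⟩ := S.near0 h1
  obtain ⟨D, hD0, hD⟩ := S.near0 h2
  have hp := S.hp
  have ht : Tendsto (fun x : ℝ => 2 * C * D * x) (𝓝[>] 0) (𝓝 0) := by
    have : Tendsto (fun x : ℝ => 2 * C * D * x) (𝓝 0) (𝓝 (2 * C * D * 0)) := by
      exact (continuous_const.mul continuous_id).tendsto 0
    rw [mul_zero] at this
    exact this.mono_left nhdsWithin_le_nhds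
  refine squeeze_zero_norm' ?_ ht
  have hpos : 0 < 1 / (1 + |b| + |b2|) := by positivity
  filter_upwards [Ioo_mem_nhdsGT hpos] with x hx
  have hx0 : 0 < x := hx.1
  have hx1 : x * (1 + |b| + |b2|) < 1 := (lt_div_iff₀ (by positivity)).1 hx.2
  have k1 := le_abs_self b
  have k2 := le_abs_self b2
  have k3 := abs_nonneg b
  have k4 := abs_nonneg b2
  obtain ⟨u1, u2⟩ := hC x hx0 (by nlinarith) (by nlinarith)
  obtain ⟨v1, v2⟩ := hD x hx0 (by nlinarith) (by nlinarith)
  set u := Hop S.h g1 x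
  set v := Hop S.h g2 x
  set u' := S.HD g1 x
  set v' := S.HD g2 x
  have hx1' : x ≤ 1 := by nlinarith
  have e : x * (u * v' - u' * v) = u * (x * v' - S.p * v) - (x * u' - S.p * u) * v := by ring
  have a1 : |u * (x * v' - S.p * v)| ≤ C * (D * x ^ 2) := by
    rw [abs_mul]
    calc _ ≤ (C * x ^ S.p) * (D * x ^ (S.p + 2)) := by gcongr
      _ ≤ (C * 1) * (D * x ^ 2) := by
        have : x ^ S.p ≤ 1 := Real.rpow_le_one hx0.le hx1' hp
        have : x ^ (S.p + 2) ≤ x ^ 2 := by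
          rw [← Real.rpow_two]; exact Real.rpow_le_rpow_of_exponent_ge hx0 hx1' (by linarith)
        gcongr
      _ = _ := by ring
  have a2 : |(x * u' - S.p * u) * v| ≤ C * (D * x ^ 2) := by
    rw [abs_mul]
    calc _ ≤ (C * x ^ (S.p + 2)) * (D * x ^ S.p) := by gcongr
      _ ≤ (C * x ^ 2) * (D * 1) := by
        have : x ^ S.p ≤ 1 := Real.rpow_le_one hx0.le hx1' hp
        have : x ^ (S.p + 2) ≤ x ^ 2 := by
          rw [← Real.rpow_two]; exact Real.rpow_le_rpow_of_exponent_ge hx0 hx1' (by linarith)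
        gcongr
      _ = _ := by ring
  have h3 : x * |u * v' - u' * v| ≤ x * (2 * C * D * x) := by
    have : x * |u * v' - u' * v| = |x * (u * v' - u' * v)| := by rw [abs_mul, abs_of_pos hx0]
    rw [this, e]
    refine (abs_sub _ _).trans ?_
    linarith
  exact le_of_mul_le_mul_left h3 hx0
end Sec


namespace Cut
variable {Ψ Ψ' Ψ'' : ℝ → ℝ} {x1 X M J : ℝ} (c : Cut Ψ Ψ' Ψ'' x1 X M J)
include c
lemma cΨ : Continuous Ψ := continuous_iff_continuousAt.2 fun x => (c.d x).continuousAt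
lemma cΨ' : Continuous Ψ' := continuous_iff_continuousAt.2 fun x => (c.d' x).continuousAt
lemma zz : ∀ x, x < x1 ∨ X < x → Ψ'' x = 0 := by
  intro x hx
  have e : Ψ' =ᶠ[𝓝 x] fun _ => 0 := by
    rcases hx with hx | hx
    · filter_upwards [gt_mem_nhds hx] with y hy using c.z' y hy.le
    · filter_upwards [lt_mem_nhds hx] with y hy using c.zX y hy.le
  have := (c.d' x).deriv
  rw [e.deriv_eq] at this
  simpa using this.symm
end Cut

namespace Sec
variable {B B0 : ℝ} (S : Sec B B0)

lemma cont_Hop {g : ℝ → ℝ} {a b M : ℝ} (hN : Nice g a b M) : ContinuousOn (Hop S.h g) (Set.Ioi 0) :=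
  fun x hx => (S.hasDeriv_Hop hN hx).continuousAt.continuousWithinAt
lemma cont_HD {g : ℝ → ℝ} {a b M : ℝ} (hN : Nice g a b M) : ContinuousOn (S.HD g) (Set.Ioi 0) :=
  fun x hx => (S.hasDeriv_HD hN hx 0).continuousAt.continuousWithinAt

/-- a function continuous on `(0,∞)`, vanishing below `x1` is integrable on `(0,X]` -/
lemma int_window {f : ℝ → ℝ} {x1 X : ℝ} (h0 : 0 < x1) (hf : ContinuousOn f (Set.Ioi 0))
    (hz : ∀ x, x < x1 → f x = 0) : IntegrableOn f (Set.Ioc 0 X) := by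
  have : IntegrableOn f (Set.Icc x1 X) :=
    (hf.mono fun x hx => h0.trans_le hx.1).integrableOn_compact isCompact_Icc
  have h2 : IntegrableOn f (Set.Ioo 0 x1) := by
    refine (integrableOn_zero (s := Set.Ioo 0 x1)).congr_fun (fun x hx => (hz x hx.2).symm) measurableSet_Ioo
  refine (this.union h2).mono_set fun x hx => ?_
  rcases lt_or_ge x x1 with h | h
  · exact Or.inr ⟨hx.1, h⟩
  · exact Or.inl ⟨h, hx.2⟩

variable {Ψ Ψ' Ψ'' : ℝ → ℝ} {x1 X M J : ℝ} {g v : ℝ → ℝ} {a b N a2 b2 N2 : ℝ}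

lemma iso_mono (hN : Nice g a b N) {f : ℝ → ℝ} {A : ℝ} (hf : AEStronglyMeasurable f (volume.restrict (Set.Ioi 0)))
    (hA : ∀ x, 0 < x → |f x| ≤ A * |Hop S.h g x|) :
    IntegrableOn (fun x => f x ^ 2) (Set.Ioi 0) ∧ ∫ x in Set.Ioi 0, f x ^ 2 ≤ A ^ 2 * (B0 * ∫ r, g r ^ 2) := by
  have hp : ∀ x, 0 < x → f x ^ 2 ≤ A ^ 2 * Hop S.h g x ^ 2 := fun x hx => by
    rw [← sq_abs (f x), ← sq_abs (Hop S.h g x), ← mul_pow]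
    exact pow_le_pow_left₀ (abs_nonneg _) (hA x hx) 2
  have hI := (S.isoI _ _ _ _ hN).const_mul (A ^ 2)
  have h1 : IntegrableOn (fun x => f x ^ 2) (Set.Ioi 0) := by
    refine Integrable.mono' hI (hf.pow 2) ?_
    refine (ae_restrict_iff' measurableSet_Ioi).2 (Eventually.of_forall fun x hx => ?_)
    rw [Real.norm_eq_abs, abs_of_nonneg (sq_nonneg _)]
    exact hp x hx
  refine ⟨h1, ?_⟩
  rw [← S.iso _ _ _ _ hN, ← integral_const_mul]
  exact setIntegral_mono_on h1 hI measurableSet_Ioi hp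

lemma green_id (c : Cut Ψ Ψ' Ψ'' x1 X M J) (hg : Nice g a b N) (hv : Nice v a2 b2 N2) (e : ℝ) :
    ∫ x in Set.Ioc 0 X, Ψ x * Hop S.h g x * Hop S.h (fun r => (r ^ 2 - e) * v r) x =
    (∫ x in Set.Ioc 0 X, Ψ x * Hop S.h (fun r => (r ^ 2 - e) * g r) x * Hop S.h v x) -
    ∫ x in Set.Ioc 0 X, (2 * Ψ' x * S.HD g x + Ψ'' x * Hop S.h g x) * Hop S.h v x := by
  have hg2 := nice_q hg e
  have hv2 := nice_q hv e
  have hX : 0 < X := c.h0.trans c.h1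
  set u := Hop S.h g
  set w := Hop S.h v
  set u2 := Hop S.h (fun r => (r ^ 2 - e) * g r)
  set w2 := Hop S.h (fun r => (r ^ 2 - e) * v r)
  have hL : ∀ {g1 g2 : ℝ → ℝ} {a b M a2 b2 M2 : ℝ}, Nice g1 a b M → Nice g2 a2 b2 M2 →
      IntegrableOn (fun x => Ψ x * Hop S.h g1 x * Hop S.h g2 x) (Set.Ioc 0 X) := by
    intro g1 g2 a b M a2 b2 M2 h1 h2
    have i1 := (S.iso_mono h1 (f := fun x => Ψ x * Hop S.h g1 x) (A := 1)
      (c.cΨ.aestronglyMeasurable.mul (S.meas_Hop h1)) (fun x _ => by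
        rw [abs_mul]; exact mul_le_mul_of_nonneg_right (c.b x) (abs_nonneg _))).1
    have : IntegrableOn (fun x => Ψ x * Hop S.h g1 x * Hop S.h g2 x) (Set.Ioi 0) :=
      int_mul (c.cΨ.aestronglyMeasurable.mul (S.meas_Hop h1)) (S.meas_Hop h2) i1 (S.isoI _ _ _ _ h2)
    exact this.mono_set fun x hx => hx.1
  have i1 := hL hg hv2
  have i2 := hL hg2 hv
  have i3 : IntegrableOn (fun x => (2 * Ψ' x * S.HD g x + Ψ'' x * u x) * w x) (Set.Ioc 0 X) := by
    refine int_window c.h0 ?_ ?_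
    · exact ((((continuous_const.mul c.cΨ').continuousOn).mul (S.cont_HD hg)).add
        (c.c''.continuousOn.mul (S.cont_Hop hg))).mul (S.cont_Hop hv)
    · intro x hx
      rw [c.z' x hx.le, c.zz x (Or.inl hx)]; simp
  have key := intervalIntegral.integral_eq_sub_of_hasDerivAt_of_tendsto (a := 0) (b := X) hX
    (f := fun x => Ψ x * (u x * S.HD v x - S.HD g x * w x) - Ψ' x * (u x * w x))
    (f' := fun x => -(Ψ x * u x * w2 x) + Ψ x * u2 x * w x - (2 * Ψ' x * S.HD g x + Ψ'' x * u x) * w x)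
    (fa := 0) (fb := 0) ?_ ?_ ?_ ?_
  · rw [intervalIntegral.integral_of_le hX.le, integral_sub (by exact i1.neg.add i2) i3,
      integral_add (by exact i1.neg) i2, integral_neg] at key
    linarith
  · intro x hx
    have hx0 := hx.1
    have d1 := S.hasDeriv_Hop hg hx0
    have d2 := S.hasDeriv_HD hg hx0 e
    have d3 := S.hasDeriv_Hop hv hx0
    have d4 := S.hasDeriv_HD hv hx0 e
    have := ((c.d x).mul ((d1.mul d4).sub (d2.mul d3))).sub ((c.d' x).mul (d1.mul d3))
    refine this.congr_deriv ?_
    simp only [Pi.mul_apply, Pi.sub_apply]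
    ring
  · rw [intervalIntegrable_iff_integrableOn_Ioc_of_le hX.le]
    exact (i1.neg.add i2).sub i3
  · have hw := S.wronsk hg hv
    refine hw.congr' ?_
    filter_upwards [Ioo_mem_nhdsGT c.h0] with x hx
    rw [c.one x hx.2.le, c.z' x hx.2.le]; ring
  · have hc : ContinuousAt (fun x => Ψ x * (u x * S.HD v x - S.HD g x * w x) - Ψ' x * (u x * w x)) X := by
      have n := Ioi_mem_nhds hX
      exact (c.cΨ.continuousAt.mul ((((S.cont_Hop hg).continuousAt n).mul ((S.cont_HD hv).continuousAt n)).sub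
        (((S.cont_HD hg).continuousAt n).mul ((S.cont_Hop hv).continuousAt n)))).sub
        (c.cΨ'.continuousAt.mul (((S.cont_Hop hg).continuousAt n).mul ((S.cont_Hop hv).continuousAt n)))
    have := hc.tendsto
    simp only [c.zero X le_rfl, c.zX X le_rfl, zero_mul, sub_zero] at this
    exact this.mono_left nhdsWithin_le_nhds

lemma energy (c : Cut Ψ Ψ' Ψ'' x1 X M J) (hg : Nice g a b N) {e Q D : ℝ} (hD : 0 < D) (hQ : 0 ≤ Q)
    (hDg : ∀ r, a ≤ r → r ≤ b → |r ^ 2 - e| ≤ D) (hq : ∀ x, x1 ≤ x → x ≤ X → e - S.mu / x ^ 2 ≤ Q) :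
    ∫ x in Set.Ioc 0 X, (Ψ' x * S.HD g x) ^ 2 ≤
      M ^ 2 * (4 * J ^ 4 + 2 * J ^ 2 * (Q + D)) * (B0 * ∫ r, g r ^ 2) := by
  have hg2 := nice_q hg e
  have hX : 0 < X := c.h0.trans c.h1
  set u := Hop S.h g with hu
  set u2 := Hop S.h (fun r => (r ^ 2 - e) * g r) with hu2
  set A := ∫ r, g r ^ 2 with hA
  have hB0 := S.B0_nonneg
  have hDA : ∫ r, ((r ^ 2 - e) * g r) ^ 2 ≤ D ^ 2 * A := by
    rw [hA, ← integral_const_mul]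
    refine integral_mono hg2.sq (hg.sq.const_mul _) fun r => ?_
    by_cases h : a ≤ r ∧ r ≤ b
    · simp only [mul_pow]
      rw [← sq_abs (r ^ 2 - e)]
      have := hDg r h.1 h.2
      gcongr
    · simp [hg.supp r h]
  have cu := S.cont_Hop hg
  have cu2 := S.cont_Hop hg2
  have cd := S.cont_HD hg
  -- F2
  have hF : ∀ x, 0 < x → HasDerivAt (fun x => Ψ' x ^ 2 * (u x * S.HD g x))
      (2 * Ψ' x * Ψ'' x * (u x * S.HD g x) + Ψ' x ^ 2 * S.HD g x ^ 2
        + Ψ' x ^ 2 * (u x * (-(e - S.mu / x ^ 2) * u x - u2 x))) x := by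
    intro x hx
    have := ((c.d' x).pow 2).mul ((S.hasDeriv_Hop hg hx).mul (S.hasDeriv_HD hg hx e))
    refine this.congr_deriv ?_
    simp only [Pi.mul_apply, Pi.pow_apply]
    ring
  have cF : ContinuousOn (fun x => 2 * Ψ' x * Ψ'' x * (u x * S.HD g x) + Ψ' x ^ 2 * S.HD g x ^ 2
        + Ψ' x ^ 2 * (u x * (-(e - S.mu / x ^ 2) * u x - u2 x))) (Set.Ioi 0) := by
    have c1 := c.cΨ'.continuousOn (s := Set.Ioi (0:ℝ))
    have c2 := c.c''.continuousOn (s := Set.Ioi (0:ℝ))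
    have c3 : ContinuousOn (fun x : ℝ => S.mu / x ^ 2) (Set.Ioi 0) :=
      continuousOn_const.div (by fun_prop) fun x hx => (pow_pos hx 2).ne'
    exact ((((continuousOn_const.mul c1).mul c2).mul (cu.mul cd)).add ((c1.pow 2).mul (cd.pow 2))).add
      ((c1.pow 2).mul (cu.mul (((continuousOn_const.sub c3).neg.mul cu).sub cu2)))
  have iF : IntegrableOn (fun x => 2 * Ψ' x * Ψ'' x * (u x * S.HD g x) + Ψ' x ^ 2 * S.HD g x ^ 2
        + Ψ' x ^ 2 * (u x * (-(e - S.mu / x ^ 2) * u x - u2 x))) (Set.Ioc 0 X) :=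
    int_window c.h0 cF fun x hx => by rw [c.z' x hx.le]; ring
  have key := intervalIntegral.integral_eq_sub_of_hasDerivAt_of_tendsto (a := 0) (b := X) hX
    (f := fun x => Ψ' x ^ 2 * (u x * S.HD g x)) (fa := 0) (fb := 0) (fun x hx => hF x hx.1)
    (by rw [intervalIntegrable_iff_integrableOn_Ioc_of_le hX.le]; exact iF)
    (by
      refine tendsto_const_nhds.congr' ?_
      filter_upwards [Ioo_mem_nhdsGT c.h0] with x hx
      rw [c.z' x hx.2.le]; ring)
    (by
      have := (hF X hX).continuousAt.tendsto
      rw [c.zX X le_rfl] at this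
      simp only [ne_eq, OfNat.ofNat_ne_zero, not_false_eq_true, zero_pow, zero_mul] at this
      exact this.mono_left nhdsWithin_le_nhds)
  rw [intervalIntegral.integral_of_le hX.le, sub_zero] at key
  have sub : ∀ {f : ℝ → ℝ}, IntegrableOn f (Set.Ioi 0) → IntegrableOn f (Set.Ioc 0 X) :=
    fun h => h.mono_set fun x hx => hx.1
  have iu := sub (S.isoI _ _ _ _ hg)
  have iu2 := sub (S.isoI _ _ _ _ hg2)
  have iY : IntegrableOn (fun x => (Ψ' x * S.HD g x) ^ 2) (Set.Ioc 0 X) :=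
    int_window c.h0 ((c.cΨ'.continuousOn.mul cd).pow 2) fun x hx => by rw [c.z' x hx.le]; ring
  have hI1 : ∫ x in Set.Ioc 0 X, u x ^ 2 ≤ B0 * A := by
    rw [hA, ← S.iso _ _ _ _ hg]
    exact setIntegral_mono_set (S.isoI _ _ _ _ hg) (Eventually.of_forall fun x => sq_nonneg _)
      (LE.le.eventuallyLE fun x hx => hx.1)
  have hI2 : ∫ x in Set.Ioc 0 X, u2 x ^ 2 ≤ B0 * (D ^ 2 * A) := by
    refine le_trans ?_ (mul_le_mul_of_nonneg_left hDA hB0)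
    rw [← S.iso _ _ _ _ hg2]
    exact setIntegral_mono_set (S.isoI _ _ _ _ hg2) (Eventually.of_forall fun x => sq_nonneg _)
      (LE.le.eventuallyLE fun x hx => hx.1)
  have pt : ∀ x ∈ Set.Ioc 0 X, (1/2) * (Ψ' x * S.HD g x) ^ 2 ≤
      (2 * Ψ' x * Ψ'' x * (u x * S.HD g x) + Ψ' x ^ 2 * S.HD g x ^ 2
        + Ψ' x ^ 2 * (u x * (-(e - S.mu / x ^ 2) * u x - u2 x))) +
      ((2 * M ^ 2 * J ^ 4 + M ^ 2 * J ^ 2 * (Q + D / 2)) * u x ^ 2 + M ^ 2 * J ^ 2 / (2 * D) * u2 x ^ 2) := by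
    intro x hx
    have b1 : Ψ' x ^ 2 ≤ M ^ 2 * J ^ 2 := by
      rw [← sq_abs, ← mul_pow]; exact pow_le_pow_left₀ (abs_nonneg _) (c.b' x) 2
    have b2 : Ψ'' x ^ 2 ≤ M ^ 2 * J ^ 4 := by
      rw [← sq_abs, show M ^ 2 * J ^ 4 = (M * J ^ 2) ^ 2 by ring]
      exact pow_le_pow_left₀ (abs_nonneg _) (c.b'' x) 2
    have h1 : Ψ' x ^ 2 * ((e - S.mu / x ^ 2) * u x ^ 2) ≤ M ^ 2 * J ^ 2 * (Q * u x ^ 2) := by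
      rcases lt_or_ge x x1 with hh | hh
      · rw [c.z' x hh.le]; simp; positivity
      · have := hq x hh hx.2
        calc _ ≤ Ψ' x ^ 2 * (Q * u x ^ 2) := by gcongr
          _ ≤ _ := by gcongr
    have h2 : Ψ' x ^ 2 * (u x * u2 x) ≤ M ^ 2 * J ^ 2 * (D / 2 * u x ^ 2 + u2 x ^ 2 / (2 * D)) := by
      have h3 : u x * u2 x ≤ D / 2 * u x ^ 2 + u2 x ^ 2 / (2 * D) := by
        have : D / 2 * u x ^ 2 + u2 x ^ 2 / (2 * D) - u x * u2 x = (D * u x - u2 x) ^ 2 / (2 * D) := by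
          field_simp; ring
        have : 0 ≤ (D * u x - u2 x) ^ 2 / (2 * D) := by positivity
        linarith
      calc _ ≤ Ψ' x ^ 2 * (D / 2 * u x ^ 2 + u2 x ^ 2 / (2 * D)) := by gcongr
        _ ≤ _ := by gcongr
    have h4 : Ψ'' x ^ 2 * u x ^ 2 ≤ M ^ 2 * J ^ 4 * u x ^ 2 := by gcongr
    have h5 : M ^ 2 * J ^ 2 * (D / 2 * u x ^ 2 + u2 x ^ 2 / (2 * D)) =
      M ^ 2 * J ^ 2 * (D / 2) * u x ^ 2 + M ^ 2 * J ^ 2 / (2 * D) * u2 x ^ 2 := by field_simp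
    nlinarith [sq_nonneg (Ψ' x * S.HD g x + 2 * Ψ'' x * u x)]
  have fin := setIntegral_mono_on (iY.const_mul (1/2)) (iF.add ((iu.const_mul
    (2 * M ^ 2 * J ^ 4 + M ^ 2 * J ^ 2 * (Q + D / 2))).add (iu2.const_mul (M ^ 2 * J ^ 2 / (2 * D)))))
    measurableSet_Ioc pt
  rw [integral_const_mul] at fin
  simp only [Pi.add_apply] at fin
  rw [integral_add (f := fun x => 2 * Ψ' x * Ψ'' x * (u x * S.HD g x) + Ψ' x ^ 2 * S.HD g x ^ 2
        + Ψ' x ^ 2 * (u x * (-(e - S.mu / x ^ 2) * u x - u2 x)))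
      (g := fun x => (2 * M ^ 2 * J ^ 4 + M ^ 2 * J ^ 2 * (Q + D / 2)) * u x ^ 2
        + M ^ 2 * J ^ 2 / (2 * D) * u2 x ^ 2) iF ((iu.const_mul
    (2 * M ^ 2 * J ^ 4 + M ^ 2 * J ^ 2 * (Q + D / 2))).add (iu2.const_mul (M ^ 2 * J ^ 2 / (2 * D)))), key, zero_add,
    integral_add (iu.const_mul _) (iu2.const_mul _), integral_const_mul, integral_const_mul] at fin
  have f1 : (2 * M ^ 2 * J ^ 4 + M ^ 2 * J ^ 2 * (Q + D / 2)) * ∫ x in Set.Ioc 0 X, u x ^ 2 ≤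
      (2 * M ^ 2 * J ^ 4 + M ^ 2 * J ^ 2 * (Q + D / 2)) * (B0 * A) := by gcongr
  have f2 : M ^ 2 * J ^ 2 / (2 * D) * ∫ x in Set.Ioc 0 X, u2 x ^ 2 ≤
      M ^ 2 * J ^ 2 / (2 * D) * (B0 * (D ^ 2 * A)) := by gcongr
  have f3 : M ^ 2 * J ^ 2 / (2 * D) * (B0 * (D ^ 2 * A)) = M ^ 2 * J ^ 2 * (D / 2) * (B0 * A) := by
    field_simp
  nlinarith

/-- Green bound -/
lemma green (c : Cut Ψ Ψ' Ψ'' x1 X M J) (hg : Nice g a b N) (hv : Nice v a2 b2 N2) {e Q D : ℝ} (hD : 0 < D)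
    (hQ : 0 ≤ Q) (hDg : ∀ r, a ≤ r → r ≤ b → |r ^ 2 - e| ≤ D)
    (hq : ∀ x, x1 ≤ x → x ≤ X → e - S.mu / x ^ 2 ≤ Q) :
    (∫ x in Set.Ioc 0 X, Ψ x * Hop S.h g x * Hop S.h (fun r => (r ^ 2 - e) * v r) x) ^ 2 ≤
      68 * (1 + M ^ 2) * (D ^ 2 + J ^ 4 + J ^ 2 * (Q + D)) * (B0 * ∫ r, g r ^ 2) * (B0 * ∫ r, v r ^ 2) := by
  have hE := S.energy c hg hD hQ hDg hq
  rw [S.green_id c hg hv e]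
  have hg2 := nice_q hg e
  have hX : 0 < X := c.h0.trans c.h1
  set u := Hop S.h g with hu
  set w := Hop S.h v with hw
  set u2 := Hop S.h (fun r => (r ^ 2 - e) * g r) with hu2
  set A := ∫ r, g r ^ 2 with hA
  set V := ∫ r, v r ^ 2 with hV
  have hB0 := S.B0_nonneg
  have hA0 : 0 ≤ A := integral_nonneg fun _ => sq_nonneg _
  have hV0 : 0 ≤ V := integral_nonneg fun _ => sq_nonneg _
  have hDA : ∫ r, ((r ^ 2 - e) * g r) ^ 2 ≤ D ^ 2 * A := by
    rw [hA, ← integral_const_mul]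
    refine integral_mono hg2.sq (hg.sq.const_mul _) fun r => ?_
    by_cases h : a ≤ r ∧ r ≤ b
    · simp only [mul_pow]
      rw [← sq_abs (r ^ 2 - e)]
      have := hDg r h.1 h.2
      gcongr
    · simp [hg.supp r h]
  have hsub : Set.Ioc 0 X ⊆ Set.Ioi 0 := fun x hx => hx.1
  have msub : ∀ {f : ℝ → ℝ}, AEStronglyMeasurable f (volume.restrict (Set.Ioi 0)) →
      AEStronglyMeasurable f (volume.restrict (Set.Ioc 0 X)) := fun h => h.mono_measure (Measure.restrict_mono hsub le_rfl)
  have iw := (S.isoI _ _ _ _ hv).mono_set hsub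
  have Iw : ∫ x in Set.Ioc 0 X, w x ^ 2 ≤ B0 * V := by
    rw [hV, ← S.iso _ _ _ _ hv]
    exact setIntegral_mono_set (S.isoI _ _ _ _ hv) (Eventually.of_forall fun x => sq_nonneg _)
      (LE.le.eventuallyLE hsub)
  have m1 : AEStronglyMeasurable (fun x => Ψ x * u2 x) (volume.restrict (Set.Ioi 0)) :=
    c.cΨ.aestronglyMeasurable.mul (S.meas_Hop hg2)
  obtain ⟨j1, J1⟩ := S.iso_mono hg2 (A := 1) m1 (fun x _ => by
        rw [abs_mul]; exact mul_le_mul_of_nonneg_right (c.b x) (abs_nonneg _))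
  have J1' : ∫ x in Set.Ioc 0 X, (Ψ x * u2 x) ^ 2 ≤ D ^ 2 * (B0 * A) := by
    refine (setIntegral_mono_set j1 (Eventually.of_forall fun x => sq_nonneg _)
      (LE.le.eventuallyLE hsub)).trans (J1.trans ?_)
    have := mul_le_mul_of_nonneg_left hDA hB0
    linarith
  have b1 : (∫ x in Set.Ioc 0 X, Ψ x * u2 x * w x) ^ 2 ≤ D ^ 2 * (B0 * A) * (B0 * V) := by
    refine (integral_cs (j1.mono_set hsub) iw (int_mul (msub m1) (msub (S.meas_Hop hv)) (j1.mono_set hsub) iw)).trans ?_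
    exact mul_le_mul J1' Iw (integral_nonneg fun _ => sq_nonneg _) (by positivity)
  -- second
  have cz : ContinuousOn (fun x => 2 * Ψ' x * S.HD g x + Ψ'' x * u x) (Set.Ioi 0) :=
    (((continuous_const.mul c.cΨ').continuousOn).mul (S.cont_HD hg)).add
        (c.c''.continuousOn.mul (S.cont_Hop hg))
  have iz : IntegrableOn (fun x => (2 * Ψ' x * S.HD g x + Ψ'' x * u x) ^ 2) (Set.Ioc 0 X) :=
    int_window c.h0 (cz.pow 2) fun x hx => by rw [c.z' x hx.le, c.zz x (Or.inl hx)]; simp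
  have mz : AEStronglyMeasurable (fun x => 2 * Ψ' x * S.HD g x + Ψ'' x * u x) (volume.restrict (Set.Ioc 0 X)) :=
    msub (cz.aestronglyMeasurable measurableSet_Ioi)
  have iY : IntegrableOn (fun x => (Ψ' x * S.HD g x) ^ 2) (Set.Ioc 0 X) :=
    int_window c.h0 ((c.cΨ'.continuousOn.mul (S.cont_HD hg)).pow 2) fun x hx => by rw [c.z' x hx.le]; ring
  have iu := (S.isoI _ _ _ _ hg).mono_set hsub
  have hI1 : ∫ x in Set.Ioc 0 X, u x ^ 2 ≤ B0 * A := by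
    rw [hA, ← S.iso _ _ _ _ hg]
    exact setIntegral_mono_set (S.isoI _ _ _ _ hg) (Eventually.of_forall fun x => sq_nonneg _)
      (LE.le.eventuallyLE hsub)
  have Iz : ∫ x in Set.Ioc 0 X, (2 * Ψ' x * S.HD g x + Ψ'' x * u x) ^ 2 ≤
      8 * (M ^ 2 * (4 * J ^ 4 + 2 * J ^ 2 * (Q + D)) * (B0 * A)) + 2 * (M ^ 2 * J ^ 4) * (B0 * A) := by
    have := setIntegral_mono_on iz ((iY.const_mul 8).add (iu.const_mul (2 * (M ^ 2 * J ^ 4)))) measurableSet_Ioc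
      (fun x hx => by
        have b2 : Ψ'' x ^ 2 ≤ M ^ 2 * J ^ 4 := by
          rw [← sq_abs, show M ^ 2 * J ^ 4 = (M * J ^ 2) ^ 2 by ring]
          exact pow_le_pow_left₀ (abs_nonneg _) (c.b'' x) 2
        have h4 : Ψ'' x ^ 2 * u x ^ 2 ≤ M ^ 2 * J ^ 4 * u x ^ 2 := by gcongr
        simp only [Pi.add_apply]
        nlinarith [sq_nonneg (2 * Ψ' x * S.HD g x - Ψ'' x * u x)])
    refine this.trans ?_
    simp only [Pi.add_apply]
    rw [integral_add (iY.const_mul _) (iu.const_mul _), integral_const_mul, integral_const_mul]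
    gcongr
  have b2 : (∫ x in Set.Ioc 0 X, (2 * Ψ' x * S.HD g x + Ψ'' x * u x) * w x) ^ 2 ≤
      (8 * (M ^ 2 * (4 * J ^ 4 + 2 * J ^ 2 * (Q + D)) * (B0 * A)) + 2 * (M ^ 2 * J ^ 4) * (B0 * A)) * (B0 * V) := by
    refine (integral_cs iz iw (int_mul mz (msub (S.meas_Hop hv)) iz iw)).trans ?_
    exact mul_le_mul Iz Iw (integral_nonneg fun _ => sq_nonneg _) (by positivity)
  set p := ∫ x in Set.Ioc 0 X, Ψ x * u2 x * w x
  set q := ∫ x in Set.Ioc 0 X, (2 * Ψ' x * S.HD g x + Ψ'' x * u x) * w x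
  have b3 : (p - q) ^ 2 ≤ 2 * p ^ 2 + 2 * q ^ 2 := by nlinarith [sq_nonneg (p + q)]
  refine b3.trans ?_
  have hW : 0 ≤ (B0 * A) * (B0 * V) := by positivity
  calc 2 * p ^ 2 + 2 * q ^ 2 ≤ (2 * D ^ 2 + (68 * M ^ 2 * J ^ 4 + 32 * M ^ 2 * (J ^ 2 * (Q + D)))) * ((B0 * A) * (B0 * V)) := by
        nlinarith
    _ ≤ (68 * (1 + M ^ 2) * (D ^ 2 + J ^ 4 + J ^ 2 * (Q + D))) * ((B0 * A) * (B0 * V)) := by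
        apply mul_le_mul_of_nonneg_right _ hW
        have : 0 ≤ J ^ 2 * (Q + D) := by positivity
        have : 0 ≤ M ^ 2 * (J ^ 2 * (Q + D)) := by positivity
        have : 0 ≤ M ^ 2 * D ^ 2 := by positivity
        have : 0 ≤ M ^ 2 * J ^ 4 := by positivity
        have : 0 ≤ J ^ 4 := by positivity
        nlinarith [sq_nonneg D]
    _ = _ := by ring
end Sec


lemma nn_strict {t r r' : ℝ} (ht : 0 < t) (h0 : 0 ≤ r) (h : r < r') : nn t r < nn t r' := by
  unfold nn
  have h1 : 0 < √(1 + r ^ 2) := Real.sqrt_pos.2 (by positivity)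
  have h2 : 0 < √(1 + r' ^ 2) := Real.sqrt_pos.2 (by positivity)
  have h3 : 0 < r' := by linarith
  have hs : r ^ 2 < r' ^ 2 := by gcongr
  rw [div_lt_div_iff₀ h1 h2, mul_assoc, mul_assoc]
  apply mul_lt_mul_of_pos_left _ ht
  apply lt_of_pow_lt_pow_left₀ 2 (by positivity)
  rw [mul_pow, mul_pow, Real.sq_sqrt (by positivity), Real.sq_sqrt (by positivity)]
  nlinarith

lemma nn_mono' {t r r' : ℝ} (ht : 0 < t) (h0 : 0 ≤ r) (h : r ≤ r') : nn t r ≤ nn t r' := by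
  rcases h.eq_or_lt with h | h
  · rw [h]
  · exact (nn_strict ht h0 h).le

/-- standard cutoff -/
lemma cut_std {M : ℝ} (hM : ∀ x, |deriv Real.smoothTransition x| ≤ M ∧
    |deriv (deriv Real.smoothTransition) x| ≤ M) {x1 X : ℝ} (h0 : 0 < x1) (h1 : x1 < X) :
    Cut (fun x => 1 - Real.smoothTransition ((x - x1) / (X - x1)))
      (fun x => -(deriv Real.smoothTransition ((x - x1) / (X - x1)) * (X - x1)⁻¹))
      (fun x => -(deriv (deriv Real.smoothTransition) ((x - x1) / (X - x1)) * (X - x1)⁻¹ * (X - x1)⁻¹))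
      x1 X M (X - x1)⁻¹ := by
  have hI : 0 < X - x1 := by linarith
  have hC : ContDiff ℝ 2 Real.smoothTransition := Real.smoothTransition.contDiff
  have hC1 : ContDiff ℝ 1 (deriv Real.smoothTransition) := (contDiff_succ_iff_deriv.1 hC).2.2
  have c2 : Continuous (deriv (deriv Real.smoothTransition)) := hC1.continuous_deriv le_rfl
  have dl : ∀ x : ℝ, HasDerivAt (fun x => (x - x1) / (X - x1)) ((X - x1)⁻¹) x := by
    intro x
    have := ((hasDerivAt_id x).sub_const x1).div_const (X - x1)
    simpa using this
  have hz : ∀ x, x ≤ x1 → (x - x1) / (X - x1) ≤ 0 := fun x hx => div_nonpos_of_nonpos_of_nonneg (by linarith) hI.le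
  have ho : ∀ x, X ≤ x → 1 ≤ (x - x1) / (X - x1) := fun x hx => by rw [le_div_iff₀ hI]; linarith
  constructor
  · exact h0
  · exact h1
  · intro x
    have := ((hC.differentiable (by norm_num) _).hasDerivAt.comp x (dl x)).const_sub 1
    exact this
  · intro x
    have := (((hC1.differentiable (by norm_num) _).hasDerivAt.comp x (dl x)).mul_const (X - x1)⁻¹).neg
    exact this
  · fun_prop
  · intro x
    have a1 := Real.smoothTransition.nonneg ((x - x1) / (X - x1))
    have a2 := Real.smoothTransition.le_one ((x - x1) / (X - x1))
    rw [abs_le]; constructor <;> linarith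
  · intro x
    rw [abs_neg, abs_mul, abs_of_pos (inv_pos.2 hI)]
    have := (hM ((x - x1) / (X - x1))).1
    have := inv_pos.2 hI
    gcongr
  · intro x
    rw [abs_neg, abs_mul, abs_mul, abs_of_pos (inv_pos.2 hI), mul_assoc, ← pow_two]
    have := (hM ((x - x1) / (X - x1))).2
    have := inv_pos.2 hI
    gcongr
  · intro x hx
    rw [Real.smoothTransition.zero_of_nonpos (hz x hx), sub_zero]
  · intro x hx
    rw [Real.smoothTransition.one_of_one_le (ho x hx), sub_self]
  · intro x hx
    have : IsLocalMin Real.smoothTransition ((x - x1) / (X - x1)) := Eventually.of_forall fun z => by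
      rw [Real.smoothTransition.zero_of_nonpos (hz x hx)]; exact Real.smoothTransition.nonneg z
    rw [this.deriv_eq_zero]; simp
  · intro x hx
    have : IsLocalMax Real.smoothTransition ((x - x1) / (X - x1)) := Eventually.of_forall fun z => by
      rw [Real.smoothTransition.one_of_one_le (x := (x - x1) / (X - x1)) (ho x hx)]
      exact Real.smoothTransition.le_one z
    rw [this.deriv_eq_zero]; simp

namespace Sec
variable {B B0 : ℝ} (S : Sec B B0) {g : ℝ → ℝ} {a b N : ℝ}

lemma Hop_union (hg : Nice g a b N) {D E : Set ℝ} (hD : MeasurableSet D) (hE : MeasurableSet E)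
    (hdis : Disjoint D E) {x : ℝ} (hx : 0 < x) :
    Hop S.h ((D ∪ E).indicator g) x = Hop S.h (D.indicator g) x + Hop S.h (E.indicator g) x := by
  unfold Hop
  rw [← integral_add (S.int_Hop (hg.ind hD) hx) (S.int_Hop (hg.ind hE) hx)]
  congr 1; ext r
  rw [Set.indicator_union_of_disjoint hdis, mul_add]

lemma int_pair {f : ℝ → ℝ} {a2 b2 N2 : ℝ} (hg : Nice g a b N) (hf : Nice f a2 b2 N2) :
    IntegrableOn (fun x => Hop S.h g x * Hop S.h f x) (Set.Ioi 0) :=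
  int_mul (S.meas_Hop hg) (S.meas_Hop hf) (S.isoI _ _ _ _ hg) (S.isoI _ _ _ _ hf)

lemma ortho (hg : Nice g a b N) {D E : Set ℝ} (hD : MeasurableSet D) (hE : MeasurableSet E)
    (hdis : Disjoint D E) :
    ∫ x in Set.Ioi 0, Hop S.h (D.indicator g) x * Hop S.h (E.indicator g) x = 0 := by
  have h1 := S.iso _ _ _ _ (hg.ind hD)
  have h2 := S.iso _ _ _ _ (hg.ind hE)
  have h3 := S.iso _ _ _ _ (hg.ind (hD.union hE))
  have i1 := S.isoI _ _ _ _ (hg.ind hD)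
  have i2 := S.isoI _ _ _ _ (hg.ind hE)
  have i12 := S.int_pair (hg.ind hD) (hg.ind hE)
  have e1 : ∫ x in Set.Ioi 0, Hop S.h ((D ∪ E).indicator g) x ^ 2 =
      ∫ x in Set.Ioi 0, ((Hop S.h (D.indicator g) x ^ 2 + Hop S.h (E.indicator g) x ^ 2) +
        2 * (Hop S.h (D.indicator g) x * Hop S.h (E.indicator g) x)) := by
    refine setIntegral_congr_fun measurableSet_Ioi fun x hx => ?_
    rw [S.Hop_union hg hD hE hdis hx]; ring
  have e2 : ∫ r, (D ∪ E).indicator g r ^ 2 = (∫ r, D.indicator g r ^ 2) + ∫ r, E.indicator g r ^ 2 := by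
    rw [← integral_add (hg.ind hD).sq (hg.ind hE).sq]
    congr 1; ext r
    by_cases hr : r ∈ D
    · have : r ∉ E := fun h => hdis.le_bot ⟨hr, h⟩
      simp [hr, this]
    · by_cases hE : r ∈ E <;> simp [hr, hE]
  rw [e1, integral_add (by exact i1.add i2) (i12.const_mul 2), integral_add i1 i2, integral_const_mul, e2, h1, h2] at h3
  linarith
end Sec

lemma amgm_aux {p q y : ℝ} (hp : 0 ≤ p) (hq : 0 ≤ q) (h : y ^ 2 ≤ p * q) : 2 * (-y) ≤ p + q := by
  nlinarith [sq_nonneg (p - q), sq_nonneg (p + q + 2 * y)]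

/-- cell data -/
structure Cells {B B0 : ℝ} (S : Sec B B0) (t K : ℝ) (n : ℕ) (ρ H Q : ℕ → ℝ) : Prop where
  ht : 0 < t
  pos : 0 < ρ 0
  mono : ∀ k, ρ k < ρ (k + 1)
  hH : ∀ k < n, ∀ x r, nn t (ρ k) ≤ x → x ≤ nn t (ρ (k + 1)) → ρ k ≤ r → r ≤ ρ (k + 1) → S.h (x * r) ^ 2 ≤ H k
  hA : ∀ k < n, H k * (nn t (ρ (k + 1)) - nn t (ρ k)) * (ρ (k + 1) - ρ k) ≤ K
  hQ0 : ∀ k < n, 0 ≤ Q k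
  hQ : ∀ k < n, ∀ x, nn t (ρ k) ≤ x → x ≤ nn t (ρ (k + 1)) → ρ k ^ 2 - S.mu / x ^ 2 ≤ Q k
  hB : ∀ k < n, (ρ (k + 1) ^ 2 - ρ k ^ 2) ^ 2 + (nn t (ρ (k + 1)) - nn t (ρ k))⁻¹ ^ 4 +
      (nn t (ρ (k + 1)) - nn t (ρ k))⁻¹ ^ 2 * (Q k + (ρ (k + 1) ^ 2 - ρ k ^ 2)) ≤
      K * ((ρ (k + 1) - ρ k) ^ 2 * ρ k ^ 2)
  hF : ∀ r, ∑ k ∈ Finset.range n, (if ρ 0 ≤ r ∧ r < ρ (k - 1) then (ρ (k + 1) - ρ k) ^ 2 / (ρ k - r) ^ 2 else 0) ≤ K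

namespace Cells
variable {B B0 : ℝ} {S : Sec B B0} {t K : ℝ} {n : ℕ} {ρ H Q : ℕ → ℝ} (c : Cells S t K n ρ H Q)
  {g : ℝ → ℝ} {a b N : ℝ}
include c

lemma smono : StrictMono ρ := strictMono_nat_of_lt_succ c.mono
lemma rpos (k : ℕ) : 0 < ρ k := c.pos.trans_le (c.smono.monotone (Nat.zero_le k))
lemma Xlt {k l : ℕ} (h : k < l) : nn t (ρ k) < nn t (ρ l) := nn_strict c.ht (c.rpos k).le (c.smono h)
lemma Xpos (k : ℕ) : 0 < nn t (ρ k) := by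
  have := nn_strict c.ht le_rfl (c.rpos k)
  simpa [nn] using this

set_option maxHeartbeats 1000000 in
lemma cross {M : ℝ} (hM : ∀ x, |deriv Real.smoothTransition x| ≤ M ∧
    |deriv (deriv Real.smoothTransition) x| ≤ M) (hg : Nice g a b N) {k : ℕ} (hk : k < n) :
    2 * ∫ x in Set.Ioi 0, Real.smoothTransition ((x - nn t (ρ k)) / (nn t (ρ (k + 1)) - nn t (ρ k))) *
      (Hop S.h ((Set.Ico (ρ k) (ρ (k + 1))).indicator g) x * Hop S.h ((Set.Ico (ρ 0) (ρ (k - 1))).indicator g) x) ≤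
    B0 * ((∫ r, (Set.Ico (ρ k) (ρ (k + 1))).indicator g r ^ 2) +
      68 * (1 + M ^ 2) * K * ∫ r, (if ρ 0 ≤ r ∧ r < ρ (k - 1) then (ρ (k + 1) - ρ k) ^ 2 / (ρ k - r) ^ 2 else 0) * g r ^ 2) := by
  have hX := c.Xpos k
  have hXX := c.Xlt (Nat.lt_succ_self k)
  have ct := cut_std hM hX hXX
  set X1 := nn t (ρ k) with hX1
  set X2 := nn t (ρ (k + 1)) with hX2
  set D := Set.Ico (ρ 0) (ρ (k - 1)) with hD
  set E := Set.Ico (ρ k) (ρ (k + 1)) with hE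
  have mD : MeasurableSet D := measurableSet_Ico
  have mE : MeasurableSet E := measurableSet_Ico
  have hk1 : ρ (k - 1) ≤ ρ k := c.smono.monotone (Nat.sub_le k 1)
  have hdis : Disjoint E D := by
    rw [Set.disjoint_left]; intro r h1 h2
    linarith [h1.1, h2.2]
  have hDk : ∀ r ∈ D, ρ (k - 1) < ρ k := by
    intro r hr
    have : k ≠ 0 := by
      rintro rfl; exact absurd (hr.1.trans_lt hr.2) (lt_irrefl _)
    exact c.smono (by omega)
  have rk := c.rpos k
  have r0 := c.rpos 0
  have rm := c.mono k
  -- v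
  set f : ℝ → ℝ := D.indicator fun r => (r ^ 2 - ρ k ^ 2)⁻¹ with hf
  have hfm : Measurable f := by
    refine Measurable.indicator ?_ mD; fun_prop
  have hpt : ∀ r ∈ D, 0 < ρ k ^ 2 - ρ (k - 1) ^ 2 ∧ ρ k ^ 2 - ρ (k - 1) ^ 2 ≤ ρ k ^ 2 - r ^ 2 := by
    intro r hr
    have h1 := hDk r hr
    have h2 := hr.2
    have h3 := hr.1
    have h4 : r ^ 2 ≤ ρ (k - 1) ^ 2 := by have : 0 ≤ r := by linarith
                                          gcongr
    have h5 : ρ (k - 1) ^ 2 < ρ k ^ 2 := by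
      have := c.rpos (k - 1)
      gcongr
    constructor <;> linarith
  have hv := hg.mul (A := (ρ k ^ 2 - ρ (k - 1) ^ 2)⁻¹) hfm (fun r _ _ => by
    by_cases hr : r ∈ D
    · have := hpt r hr
      simp only [hf, Set.indicator_of_mem hr]
      rw [abs_inv, abs_sub_comm, abs_of_pos (by linarith)]
      exact inv_anti₀ this.1 this.2
    · simp only [hf, Set.indicator_of_notMem hr, abs_zero]
      rw [inv_nonneg]
      have := c.rpos (k - 1)
      have : ρ (k - 1) ^ 2 ≤ ρ k ^ 2 := by gcongr
      linarith)
  have hvD : (fun r => (r ^ 2 - ρ k ^ 2) * (f r * g r)) = D.indicator g := by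
    ext r
    by_cases hr : r ∈ D
    · have := hpt r hr
      simp only [hf, Set.indicator_of_mem hr]
      rw [← mul_assoc, mul_inv_cancel₀ (by linarith), one_mul]
    · simp [hf, hr]
  have gE := hg.ind mE
  have gD := hg.ind mD
  have hgr : Nice (E.indicator g) (ρ k) (ρ (k + 1)) N := by
    refine ⟨gE.meas, gE.bdd, rk, fun r hr => ?_⟩
    rw [Set.indicator_of_notMem]
    exact fun h => hr ⟨h.1, h.2.le⟩
  have hDpos : 0 < ρ (k + 1) ^ 2 - ρ k ^ 2 := by nlinarith
  have green := S.green ct hgr hv (e := ρ k ^ 2) (D := ρ (k + 1) ^ 2 - ρ k ^ 2) (Q := Q k) hDpos (c.hQ0 k hk)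
    (fun r h1 h2 => by
      have : ρ k ^ 2 ≤ r ^ 2 := by gcongr
      rw [abs_of_nonneg (by linarith)]
      have : r ^ 2 ≤ ρ (k + 1) ^ 2 := by have : 0 ≤ r := by linarith
                                         gcongr
      linarith) (c.hQ k hk)
  rw [hvD] at green
  set y := ∫ x in Set.Ioc 0 X2, (1 - Real.smoothTransition ((x - X1) / (X2 - X1))) * Hop S.h (E.indicator g) x *
    Hop S.h (D.indicator g) x with hy
  set A := ∫ r, E.indicator g r ^ 2 with hA
  set V := ∫ r, (f r * g r) ^ 2 with hV
  have hA0 : 0 ≤ A := integral_nonneg fun _ => sq_nonneg _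
  have hV0 : 0 ≤ V := integral_nonneg fun _ => sq_nonneg _
  have hB0 := S.B0_nonneg
  set L := 68 * (1 + M ^ 2) with hL
  have hL0 : 0 < L := by positivity
  have hy2 : y ^ 2 ≤ (B0 * A) * (B0 * (L * K * ((ρ (k + 1) - ρ k) ^ 2 * ρ k ^ 2 * V))) := by
    refine green.trans ?_
    calc _ ≤ L * (K * ((ρ (k + 1) - ρ k) ^ 2 * ρ k ^ 2)) * (B0 * A) * (B0 * V) := by
          gcongr
          exact c.hB k hk
      _ = _ := by ring
  -- the integral equals -y
  have i0 := S.int_pair gE gD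
  have hη : ∀ x, |Real.smoothTransition ((x - X1) / (X2 - X1))| ≤ 1 := fun x => by
    rw [abs_of_nonneg (Real.smoothTransition.nonneg _)]; exact Real.smoothTransition.le_one _
  have hηc : Continuous fun x => Real.smoothTransition ((x - X1) / (X2 - X1)) :=
    Real.smoothTransition.continuous.comp (by fun_prop)
  have i1 : IntegrableOn (fun x => (1 - Real.smoothTransition ((x - X1) / (X2 - X1))) *
      (Hop S.h (E.indicator g) x * Hop S.h (D.indicator g) x)) (Set.Ioi 0) :=
    i0.bdd_mul (c := 1) (by fun_prop) (Eventually.of_forall fun x => ct.b x)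
  have hI : ∫ x in Set.Ioi 0, Real.smoothTransition ((x - X1) / (X2 - X1)) *
      (Hop S.h (E.indicator g) x * Hop S.h (D.indicator g) x) = -y := by
    have e1 : ∫ x in Set.Ioi 0, Real.smoothTransition ((x - X1) / (X2 - X1)) *
      (Hop S.h (E.indicator g) x * Hop S.h (D.indicator g) x) = ∫ x in Set.Ioi 0,
        ((Hop S.h (E.indicator g) x * Hop S.h (D.indicator g) x) - (1 - Real.smoothTransition ((x - X1) / (X2 - X1))) *
      (Hop S.h (E.indicator g) x * Hop S.h (D.indicator g) x)) := by
      congr 1; ext x; ring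
    rw [e1, integral_sub i0 i1, S.ortho hg mE mD hdis, zero_sub, hy]
    congr 1
    rw [← setIntegral_eq_of_subset_of_forall_diff_eq_zero measurableSet_Ioi (s := Set.Ioc 0 X2) (fun x hx => hx.1)]
    · congr 1; ext x; ring
    · intro x hx
      have : X2 ≤ x := by
        by_contra h; exact hx.2 ⟨hx.1, by linarith⟩
      rw [ct.zero x this]; simp
  rw [hI]
  have hVW : (ρ (k + 1) - ρ k) ^ 2 * ρ k ^ 2 * V ≤ ∫ r, (if ρ 0 ≤ r ∧ r < ρ (k - 1) then
      (ρ (k + 1) - ρ k) ^ 2 / (ρ k - r) ^ 2 else 0) * g r ^ 2 := by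
    rw [hV, ← integral_const_mul]
    refine integral_mono (hv.sq.const_mul _) ?_ fun r => ?_
    · have : Measurable fun r : ℝ => (if ρ 0 ≤ r ∧ r < ρ (k - 1) then
        (ρ (k + 1) - ρ k) ^ 2 / (ρ k - r) ^ 2 else 0) :=
        Measurable.ite mD (by fun_prop) measurable_const
      refine hg.sq.bdd_mul (c := (ρ (k + 1) - ρ k) ^ 2 / (ρ k - ρ (k - 1)) ^ 2) this.aestronglyMeasurable
        (Eventually.of_forall fun r => ?_)
      split_ifs with hr
      · have := hDk r hr
        have : 0 < ρ k - ρ (k - 1) := by linarith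
        have : ρ k - ρ (k - 1) ≤ ρ k - r := by linarith [hr.2]
        rw [Real.norm_eq_abs, abs_of_nonneg (by positivity)]
        gcongr
      · rw [norm_zero]; positivity
    · by_cases hr : r ∈ D
      · have h1 := hDk r hr
        have h2 := hr.2
        have h3 := hr.1
        simp only [hf, Set.indicator_of_mem hr]
        rw [if_pos (by exact hr), mul_pow, ← mul_assoc]
        refine mul_le_mul_of_nonneg_right ?_ (sq_nonneg _)
        rw [inv_pow, ← div_eq_mul_inv]
        have h4 : 0 < ρ k - r := by linarith
        have h5 : 0 < r := by linarith
        have h6 : (r ^ 2 - ρ k ^ 2) ^ 2 = (ρ k - r) ^ 2 * (ρ k + r) ^ 2 := by ring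
        rw [h6, div_le_div_iff₀ (by positivity) (by positivity)]
        have : ρ k ^ 2 ≤ (ρ k + r) ^ 2 := by gcongr; linarith
        have h7 : 0 ≤ (ρ (k + 1) - ρ k) ^ 2 * (ρ k - r) ^ 2 := by positivity
        nlinarith
      · simp only [hf, Set.indicator_of_notMem hr]
        rw [if_neg (by exact hr)]; simp
  have hK0 : 0 ≤ K := (Finset.sum_nonneg fun i _ => by split_ifs <;> positivity).trans (c.hF 0)
  set Y := (ρ (k + 1) - ρ k) ^ 2 * ρ k ^ 2 * V with hY
  have hY0 : 0 ≤ Y := by positivity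
  have h8 : 2 * (-y) ≤ B0 * A + B0 * (L * K * Y) := by
    have p1 : 0 ≤ B0 * A := by positivity
    have p2 : 0 ≤ B0 * (L * K * Y) := by positivity
    exact amgm_aux p1 p2 hy2
  calc _ ≤ _ := h8
    _ = B0 * (A + L * K * Y) := by ring
    _ ≤ _ := by gcongr
end Cells


namespace Cells
variable {B B0 : ℝ} (S : Sec B B0) (t : ℝ) (ρ : ℕ → ℝ) (g : ℝ → ℝ)

def psi (k : ℕ) (x : ℝ) : ℝ := Real.smoothTransition ((x - nn t (ρ k)) / (nn t (ρ (k + 1)) - nn t (ρ k)))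
def Ss (m : ℕ) (x : ℝ) : ℝ := ∑ k ∈ Finset.range m, psi t ρ k x * Hop S.h ((Set.Ico (ρ k) (ρ (k + 1))).indicator g) x
def rr (k : ℕ) (x : ℝ) : ℝ := Top' S.h t ((Set.Ico (ρ k) (ρ (k + 1))).indicator g) x -
  psi t ρ k x * Hop S.h ((Set.Ico (ρ k) (ρ (k + 1))).indicator g) x

variable {S t ρ g} {a b N : ℝ}

lemma hopL2 (hg : Nice g a b N) : MemLp (Hop S.h g) 2 (volume.restrict (Set.Ioi 0)) :=
  (memLp_two_iff_integrable_sq (S.meas_Hop hg)).2 (S.isoI _ _ _ _ hg)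

lemma psi_cont (k : ℕ) : Continuous (psi t ρ k) := Real.smoothTransition.continuous.comp (by fun_prop)
lemma psi_bd (k : ℕ) (x : ℝ) : |psi t ρ k x| ≤ 1 := by
  unfold psi; rw [abs_of_nonneg (Real.smoothTransition.nonneg _)]; exact Real.smoothTransition.le_one _

lemma psiL2 {f : ℝ → ℝ} (k : ℕ) (hf : MemLp f 2 (volume.restrict (Set.Ioi 0))) :
    MemLp (fun x => psi t ρ k x * f x) 2 (volume.restrict (Set.Ioi 0)) := by
  refine hf.of_le ((psi_cont k).aestronglyMeasurable.mul hf.1) (Eventually.of_forall fun x => ?_)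
  rw [norm_mul]
  have := psi_bd (t := t) (ρ := ρ) k x
  nlinarith [norm_nonneg (f x), Real.norm_eq_abs (psi t ρ k x)]

lemma Ss_L2 (hg : Nice g a b N) (m : ℕ) : MemLp (Ss S t ρ g m) 2 (volume.restrict (Set.Ioi 0)) :=
  memLp_finsetSum _ fun k _ => psiL2 k (hopL2 (hg.ind measurableSet_Ico))

variable {K : ℝ} {n : ℕ} {H Q : ℕ → ℝ} (c : Cells S t K n ρ H Q)

lemma psi_zero {k : ℕ} {x : ℝ} (h : nn t (ρ k) < nn t (ρ (k + 1))) (hx : x ≤ nn t (ρ k)) : psi t ρ k x = 0 :=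
  Real.smoothTransition.zero_of_nonpos (div_nonpos_of_nonpos_of_nonneg (by linarith) (by linarith))
lemma psi_one {k : ℕ} {x : ℝ} (h : nn t (ρ k) < nn t (ρ (k + 1))) (hx : nn t (ρ (k + 1)) ≤ x) : psi t ρ k x = 1 :=
  Real.smoothTransition.one_of_one_le (by rw [le_div_iff₀ (by linarith)]; linarith)

include c

lemma Ico_succ (m : ℕ) : Set.Ico (ρ 0) (ρ (m + 1)) = Set.Ico (ρ 0) (ρ m) ∪ Set.Ico (ρ m) (ρ (m + 1)) :=
  (Set.Ico_union_Ico_eq_Ico (c.smono.monotone (Nat.zero_le m)) (c.mono m).le).symm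
lemma Ico_dis (m : ℕ) : Disjoint (Set.Ico (ρ 0) (ρ m)) (Set.Ico (ρ m) (ρ (m + 1))) := by
  rw [Set.disjoint_left]; intro r h1 h2; linarith [h1.2, h2.1]

lemma Ss_eq (hg : Nice g a b N) (m : ℕ) {x : ℝ} (hx : nn t (ρ m) ≤ x) :
    Ss S t ρ g m x = Hop S.h ((Set.Ico (ρ 0) (ρ m)).indicator g) x := by
  induction m with
  | zero => simp [Ss, Hop]
  | succ m ih =>
    have h1 := c.Xlt (Nat.lt_succ_self m)
    rw [c.Ico_succ m, S.Hop_union hg measurableSet_Ico measurableSet_Ico (c.Ico_dis m) ((c.Xpos _).trans_le hx),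
      ← ih (h1.le.trans hx)]
    unfold Ss
    rw [Finset.sum_range_succ, psi_one h1 hx, one_mul]

lemma sumA (hg : Nice g a b N) (m : ℕ) : ∑ k ∈ Finset.range m, ∫ r, (Set.Ico (ρ k) (ρ (k + 1))).indicator g r ^ 2 =
    ∫ r, (Set.Ico (ρ 0) (ρ m)).indicator g r ^ 2 := by
  induction m with
  | zero => simp
  | succ m ih =>
    rw [Finset.sum_range_succ, ih, c.Ico_succ m,
      ← integral_add (hg.ind measurableSet_Ico).sq (hg.ind measurableSet_Ico).sq]
    congr 1; ext r
    rw [Set.indicator_union_of_disjoint (c.Ico_dis m)]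
    by_cases hr : r ∈ Set.Ico (ρ 0) (ρ m)
    · have : r ∉ Set.Ico (ρ m) (ρ (m + 1)) := fun h => (c.Ico_dis m).le_bot ⟨hr, h⟩
      simp [hr, this]
    · simp [Set.indicator_of_notMem hr]

lemma Ss_step {M : ℝ} (hM : ∀ x, |deriv Real.smoothTransition x| ≤ M ∧
    |deriv (deriv Real.smoothTransition) x| ≤ M) (hg : Nice g a b N) {m : ℕ} (hm : m < n) :
    ∫ x in Set.Ioi 0, Ss S t ρ g (m + 1) x ^ 2 ≤ (∫ x in Set.Ioi 0, Ss S t ρ g m x ^ 2) +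
      B0 * (3 * (∫ r, (Set.Ico (ρ m) (ρ (m + 1))).indicator g r ^ 2) +
        (∫ r, (Set.Ico (ρ (m - 1)) (ρ m)).indicator g r ^ 2) + 68 * (1 + M ^ 2) * K * ∫ r,
        (if ρ 0 ≤ r ∧ r < ρ (m - 1) then (ρ (m + 1) - ρ m) ^ 2 / (ρ m - r) ^ 2 else 0) * g r ^ 2) := by
  have hc := c.cross hM hg hm
  have gE : Nice ((Set.Ico (ρ m) (ρ (m + 1))).indicator g) a b N := hg.ind measurableSet_Ico
  have gP : Nice ((Set.Ico (ρ (m - 1)) (ρ m)).indicator g) a b N := hg.ind measurableSet_Ico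
  have gD : Nice ((Set.Ico (ρ 0) (ρ (m - 1))).indicator g) a b N := hg.ind measurableSet_Ico
  have iE := S.iso _ _ _ _ gE
  have iP := S.iso _ _ _ _ gP
  have qE := (hopL2 (S := S) gE).integrable_sq
  have qP := (hopL2 (S := S) gP).integrable_sq
  have qS := (Ss_L2 (S := S) (t := t) (ρ := ρ) hg m).integrable_sq
  have qS1 := (Ss_L2 (S := S) (t := t) (ρ := ρ) hg (m + 1)).integrable_sq
  have qc := (psiL2 (t := t) (ρ := ρ) m (hopL2 (S := S) gE)).integrable_mul (hopL2 (S := S) gD)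
  have hX := c.Xlt (Nat.lt_succ_self m)
  have key : ∀ x ∈ Set.Ioi (0:ℝ), Ss S t ρ g (m + 1) x ^ 2 ≤ (Ss S t ρ g m x ^ 2 +
      (2 * Hop S.h ((Set.Ico (ρ m) (ρ (m + 1))).indicator g) x ^ 2 +
        Hop S.h ((Set.Ico (ρ (m - 1)) (ρ m)).indicator g) x ^ 2)) + 2 *
        (psi t ρ m x * Hop S.h ((Set.Ico (ρ m) (ρ (m + 1))).indicator g) x *
        Hop S.h ((Set.Ico (ρ 0) (ρ (m - 1))).indicator g) x) := by
    intro x hx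
    have e : Ss S t ρ g (m + 1) x = Ss S t ρ g m x + psi t ρ m x * Hop S.h ((Set.Ico (ρ m) (ρ (m + 1))).indicator g) x := by
      unfold Ss; rw [Finset.sum_range_succ]
    rw [e]
    rcases le_or_gt x (nn t (ρ m)) with h | h
    · rw [psi_zero hX h]
      nlinarith [sq_nonneg (Hop S.h ((Set.Ico (ρ m) (ρ (m + 1))).indicator g) x),
        sq_nonneg (Hop S.h ((Set.Ico (ρ (m - 1)) (ρ m)).indicator g) x)]
    · have hU : Set.Ico (ρ 0) (ρ m) = Set.Ico (ρ 0) (ρ (m - 1)) ∪ Set.Ico (ρ (m - 1)) (ρ m) :=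
        (Set.Ico_union_Ico_eq_Ico (c.smono.monotone (Nat.zero_le _)) (c.smono.monotone (Nat.sub_le m 1))).symm
      have hd : Disjoint (Set.Ico (ρ 0) (ρ (m - 1))) (Set.Ico (ρ (m - 1)) (ρ m)) := by
        rw [Set.disjoint_left]; intro r h1 h2; linarith [h1.2, h2.1]
      rw [c.Ss_eq hg m h.le, hU, S.Hop_union hg measurableSet_Ico measurableSet_Ico hd hx]
      generalize Hop S.h ((Set.Ico (ρ 0) (ρ (m - 1))).indicator g) x = D
      generalize Hop S.h ((Set.Ico (ρ (m - 1)) (ρ m)).indicator g) x = P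
      generalize Hop S.h ((Set.Ico (ρ m) (ρ (m + 1))).indicator g) x = E
      have hb := psi_bd (t := t) (ρ := ρ) m x
      generalize psi t ρ m x = y at *
      have h2 : y ^ 2 ≤ 1 := by rw [← sq_abs]; exact pow_le_one₀ (abs_nonneg _) hb
      nlinarith [sq_nonneg (y * E - P), mul_nonneg (sub_nonneg.2 h2) (sq_nonneg E)]
  refine (setIntegral_mono_on qS1 ((qS.add ((qE.const_mul 2).add qP)).add (qc.const_mul 2)) measurableSet_Ioi key).trans ?_
  simp only [Pi.add_apply, Pi.mul_apply]
  rw [integral_add (by exact (qS.add ((qE.const_mul 2).add qP))) (by exact (qc.const_mul 2)),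
    integral_add qS (by exact ((qE.const_mul 2).add qP)), integral_add (qE.const_mul 2) qP, integral_const_mul,
    integral_const_mul, iE, iP]
  have e2 : ∀ x, psi t ρ m x * Hop S.h ((Set.Ico (ρ m) (ρ (m + 1))).indicator g) x *
        Hop S.h ((Set.Ico (ρ 0) (ρ (m - 1))).indicator g) x = psi t ρ m x * (Hop S.h ((Set.Ico (ρ m) (ρ (m + 1))).indicator g) x *
        Hop S.h ((Set.Ico (ρ 0) (ρ (m - 1))).indicator g) x) := fun x => mul_assoc _ _ _
  simp only [e2]
  unfold psi
  linarith

lemma K0 : 0 ≤ K := (Finset.sum_nonneg fun i _ => by split_ifs <;> positivity).trans (c.hF 0)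

lemma Ss_bound {M : ℝ} (hM : ∀ x, |deriv Real.smoothTransition x| ≤ M ∧
    |deriv (deriv Real.smoothTransition) x| ≤ M) (hg : Nice g a b N) :
    ∫ x in Set.Ioi 0, Ss S t ρ g n x ^ 2 ≤ B0 * (4 + 68 * (1 + M ^ 2) * K * K) * ∫ r, g r ^ 2 := by
  set F : ℕ → ℝ → ℝ := fun m r => if ρ 0 ≤ r ∧ r < ρ (m - 1) then (ρ (m + 1) - ρ m) ^ 2 / (ρ m - r) ^ 2 else 0 with hF
  have hF0 : ∀ m r, 0 ≤ F m r := fun m r => by simp only [hF]; split_ifs <;> positivity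
  have h1 : ∀ m ≤ n, ∫ x in Set.Ioi 0, Ss S t ρ g m x ^ 2 ≤ B0 * (3 * (∑ k ∈ Finset.range m, ∫ r, (Set.Ico (ρ k) (ρ (k + 1))).indicator g r ^ 2) +
      (∑ k ∈ Finset.range m, ∫ r, (Set.Ico (ρ (k - 1)) (ρ k)).indicator g r ^ 2) +
      68 * (1 + M ^ 2) * K * ∑ k ∈ Finset.range m, ∫ r, F k r * g r ^ 2) := by
    intro m
    induction m with
    | zero => simp [Ss]
    | succ m ih =>
      intro hm
      have := c.Ss_step hM hg (m := m) (by omega)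
      have := ih (by omega)
      simp only [Finset.sum_range_succ]
      simp only [hF] at *
      linarith
  refine (h1 n le_rfl).trans ?_
  rw [mul_assoc B0]
  refine mul_le_mul_of_nonneg_left ?_ S.B0_nonneg
  have hG := integral_nonneg (μ := volume) (f := fun r => g r ^ 2) fun _ => sq_nonneg _
  have s1 : ∑ k ∈ Finset.range n, ∫ r, (Set.Ico (ρ k) (ρ (k + 1))).indicator g r ^ 2 ≤ ∫ r, g r ^ 2 := by
    rw [c.sumA hg n]; exact hg.ind_sq measurableSet_Ico
  have s2 : ∑ k ∈ Finset.range n, ∫ r, (Set.Ico (ρ (k - 1)) (ρ k)).indicator g r ^ 2 ≤ ∫ r, g r ^ 2 := by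
    rcases Nat.eq_zero_or_pos n with h | h
    · rw [h]; simpa using hG
    · obtain ⟨j, rfl⟩ := Nat.exists_eq_succ_of_ne_zero h.ne'
      rw [Finset.sum_range_succ']
      simp only [Nat.add_sub_cancel, Nat.zero_sub, Set.Ico_self]
      rw [c.sumA hg j]
      simpa using hg.ind_sq (D := Set.Ico (ρ 0) (ρ j)) measurableSet_Ico
  have s3 : ∑ k ∈ Finset.range n, ∫ r, F k r * g r ^ 2 ≤ K * ∫ r, g r ^ 2 := by
    have iF : ∀ k ∈ Finset.range n, Integrable fun r => F k r * g r ^ 2 := by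
      intro k hk
      have : Measurable (F k) := Measurable.ite measurableSet_Ico (by fun_prop) measurable_const
      refine hg.sq.bdd_mul (c := K) this.aestronglyMeasurable (Eventually.of_forall fun r => ?_)
      rw [Real.norm_eq_abs, abs_of_nonneg (hF0 k r)]
      exact (Finset.single_le_sum (f := fun k => F k r) (fun i _ => hF0 i r) hk).trans (c.hF r)
    rw [← integral_finset_sum _ iF, ← integral_const_mul]
    refine integral_mono (integrable_finset_sum _ iF) (hg.sq.const_mul K) fun r => ?_
    simp only
    rw [← Finset.sum_mul]
    exact mul_le_mul_of_nonneg_right (c.hF r) (sq_nonneg _)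
  have hK := c.K0
  have : 68 * (1 + M ^ 2) * K * ∑ k ∈ Finset.range n, ∫ r, F k r * g r ^ 2 ≤ 68 * (1 + M ^ 2) * K * (K * ∫ r, g r ^ 2) := by
    gcongr
  linarith

lemma rr_zero (hg : Nice g a b N) (k : ℕ) {x : ℝ} (hx : 0 < x) (h : x ≤ nn t (ρ k) ∨ nn t (ρ (k + 1)) ≤ x) :
    rr S t ρ g k x = 0 := by
  have h1 := c.Xlt (Nat.lt_succ_self k)
  unfold rr Top' Hop
  rcases h with h | h
  · rw [psi_zero h1 h, zero_mul, sub_zero]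
    refine integral_eq_zero_of_ae (Eventually.of_forall fun r => ?_)
    by_cases hr : r ∈ Set.Ico (ρ k) (ρ (k + 1))
    · have := nn_mono' c.ht (c.rpos k).le hr.1
      simp only; rw [if_neg (by linarith)]; rfl
    · simp [hr]
  · rw [psi_one h1 h, one_mul, sub_eq_zero]
    congr 1; ext r
    by_cases hr : r ∈ Set.Ico (ρ k) (ρ (k + 1))
    · have := nn_strict c.ht ((c.rpos k).le.trans hr.1) hr.2
      rw [if_pos (by linarith)]
    · simp [hr]

lemma rr_bound (hg : Nice g a b N) {k : ℕ} (hk : k < n) :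
    IntegrableOn (fun x => rr S t ρ g k x ^ 2) (Set.Ioi 0) ∧
    ∫ x in Set.Ioi 0, rr S t ρ g k x ^ 2 ≤ K * ∫ r, (Set.Ico (ρ k) (ρ (k + 1))).indicator g r ^ 2 := by
  have gE : Nice ((Set.Ico (ρ k) (ρ (k + 1))).indicator g) a b N := hg.ind measurableSet_Ico
  have h1 := c.Xlt (Nat.lt_succ_self k)
  have hX := c.Xpos k
  have hr := c.mono k
  have hm : AEStronglyMeasurable (rr S t ρ g k) (volume.restrict (Set.Ioi 0)) :=
    (S.meas_Top gE t).sub ((psi_cont k).aestronglyMeasurable.mul (S.meas_Hop gE))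
  set A := ∫ r, (Set.Ico (ρ k) (ρ (k + 1))).indicator g r ^ 2 with hA
  have hA0 : 0 ≤ A := integral_nonneg fun _ => sq_nonneg _
  have hsub : Set.Ioc (nn t (ρ k)) (nn t (ρ (k + 1))) ⊆ Set.Ioi 0 := fun x hx => hX.trans hx.1
  have key := Sec.setint_le (F := rr S t ρ g k) (D := fun _ => H k * (ρ (k + 1) - ρ k) * A) (C := K * A) hX.le hm
    (u := nn t (ρ k)) (v := nn t (ρ (k + 1))) continuous_const.integrableOn_Ioc (fun x hx => by
      have hx0 := hsub hx
      have e : rr S t ρ g k x = ∫ r, ((Set.Ico (ρ k) (ρ (k + 1))).indicator (fun r => (if nn t r < x then 1 else 0) - psi t ρ k x) r) *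
          (S.h (x * r) * (Set.Ico (ρ k) (ρ (k + 1))).indicator g r) := by
        unfold rr Top' Hop
        rw [← integral_const_mul, ← integral_sub]
        · congr 1; ext r
          by_cases hr : r ∈ Set.Ico (ρ k) (ρ (k + 1))
          · simp only [Set.indicator_of_mem hr]; split_ifs <;> ring
          · simp [hr]
        · have := (S.int_Hop gE hx0).indicator (measurableSet_lt (nn_continuous t).measurable (measurable_const (a := x)))
          refine this.congr (Eventually.of_forall fun r => ?_)
          simp [Set.indicator]
        · exact (S.int_Hop gE hx0).const_mul _
      rw [e]
      refine (S.K_cs (l := ρ k) (m := ρ (k + 1)) gE hx0 (c.rpos k) ?_ ?_ ?_).trans ?_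
      · refine Measurable.indicator (Measurable.sub (Measurable.ite (measurableSet_lt (nn_continuous t).measurable measurable_const)
          measurable_const measurable_const) measurable_const) measurableSet_Ico
      · intro r
        have p1 : 0 ≤ psi t ρ k x := Real.smoothTransition.nonneg _
        have p2 : psi t ρ k x ≤ 1 := Real.smoothTransition.le_one _
        by_cases hr : r ∈ Set.Ico (ρ k) (ρ (k + 1))
        · simp only [Set.indicator_of_mem hr]
          rw [abs_le]; split_ifs <;> constructor <;> linarith
        · simp [hr]
      · intro r _ _ h
        have := Set.mem_of_indicator_ne_zero h
        exact ⟨this.1, this.2.le⟩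
      · refine mul_le_mul_of_nonneg_right ?_ hA0
        have ci : IntegrableOn (fun r => S.h (x * r) ^ 2) (Set.Icc (ρ k) (ρ (k + 1))) :=
          ((S.cont_x hx0 (c.rpos k)).pow 2).integrableOn_Icc
        refine (setIntegral_mono_on ci (g := fun _ => H k) (by simp) measurableSet_Icc fun r hr =>
          c.hH k hk x r hx.1.le hx.2 hr.1 hr.2).trans (le_of_eq ?_)
        rw [setIntegral_const, Real.volume_real_Icc_of_le hr.le, smul_eq_mul, mul_comm])
    (by
      rw [setIntegral_const, Real.volume_real_Ioc_of_le h1.le, smul_eq_mul]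
      have := mul_le_mul_of_nonneg_right (c.hA k hk) hA0
      linarith)
  have hz : ∀ x ∈ Set.Ioi (0:ℝ) \ Set.Ioc (nn t (ρ k)) (nn t (ρ (k + 1))), rr S t ρ g k x ^ 2 = 0 := by
    intro x hx
    rw [c.rr_zero hg k hx.1, zero_pow two_ne_zero]
    by_contra h; push Not at h
    exact hx.2 ⟨h.1, h.2.le⟩
  refine ⟨key.1.of_forall_diff_eq_zero measurableSet_Ioi hz, ?_⟩
  rw [setIntegral_eq_of_subset_of_forall_diff_eq_zero measurableSet_Ioi hsub hz]
  exact key.2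

lemma Rr_bound (hg : Nice g a b N) : ∀ m ≤ n,
    IntegrableOn (fun x => (∑ k ∈ Finset.range m, rr S t ρ g k x) ^ 2) (Set.Ioi 0) ∧
    ∫ x in Set.Ioi 0, (∑ k ∈ Finset.range m, rr S t ρ g k x) ^ 2 ≤
      K * ∑ k ∈ Finset.range m, ∫ r, (Set.Ico (ρ k) (ρ (k + 1))).indicator g r ^ 2 := by
  intro m
  induction m with
  | zero => simp
  | succ m ih =>
    intro hm
    obtain ⟨i1, b1⟩ := ih (by omega)
    obtain ⟨i2, b2⟩ := c.rr_bound hg (k := m) (by omega)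
    have e : ∀ x ∈ Set.Ioi (0:ℝ), (∑ k ∈ Finset.range m, rr S t ρ g k x) ^ 2 + rr S t ρ g m x ^ 2 =
      (∑ k ∈ Finset.range (m + 1), rr S t ρ g k x) ^ 2 := by
      intro x hx
      rw [Finset.sum_range_succ]
      rcases le_or_gt x (nn t (ρ m)) with h | h
      · rw [c.rr_zero hg m hx (Or.inl h)]; ring
      · have : ∑ k ∈ Finset.range m, rr S t ρ g k x = 0 := Finset.sum_eq_zero fun k hk => by
          have hk := Finset.mem_range.1 hk
          exact c.rr_zero hg k hx (Or.inr ((nn_mono' c.ht (c.rpos _).le (c.smono.monotone hk)).trans h.le))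
        rw [this]; ring
    refine ⟨(integrableOn_congr_fun e measurableSet_Ioi).1 (i1.add i2), ?_⟩
    rw [← setIntegral_congr_fun measurableSet_Ioi e, integral_add i1 i2, Finset.sum_range_succ, mul_add]
    linarith

lemma Top_eq (hg : Nice g a b N) {x : ℝ} (hx : 0 < x) (m : ℕ) :
    Top' S.h t ((Set.Ico (ρ 0) (ρ m)).indicator g) x = Ss S t ρ g m x + ∑ k ∈ Finset.range m, rr S t ρ g k x := by
  have ti : ∀ D : Set ℝ, MeasurableSet D → Integrable fun r => if nn t r < x then S.h (x * r) * D.indicator g r else 0 := by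
    intro D hD
    have := (S.int_Hop (hg.ind hD) hx).indicator (measurableSet_lt (nn_continuous t).measurable (measurable_const (a := x)))
    refine this.congr (Eventually.of_forall fun r => ?_)
    simp [Set.indicator]
  induction m with
  | zero => simp [Ss, Top']
  | succ m ih =>
    have : Top' S.h t ((Set.Ico (ρ 0) (ρ (m + 1))).indicator g) x = Top' S.h t ((Set.Ico (ρ 0) (ρ m)).indicator g) x +
        Top' S.h t ((Set.Ico (ρ m) (ρ (m + 1))).indicator g) x := by
      unfold Top'
      rw [← integral_add (ti _ measurableSet_Ico) (ti _ measurableSet_Ico)]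
      congr 1; ext r
      rw [c.Ico_succ m, Set.indicator_union_of_disjoint (c.Ico_dis m)]
      split_ifs <;> ring
    rw [this, ih]
    simp only [Ss, rr, Finset.sum_range_succ]
    ring

lemma block {M : ℝ} (hM : ∀ x, |deriv Real.smoothTransition x| ≤ M ∧
    |deriv (deriv Real.smoothTransition) x| ≤ M) (hg : Nice g a b N) :
    IntegrableOn (fun x => Top' S.h t ((Set.Ico (ρ 0) (ρ n)).indicator g) x ^ 2) (Set.Ioi 0) ∧
    ∫ x in Set.Ioi 0, Top' S.h t ((Set.Ico (ρ 0) (ρ n)).indicator g) x ^ 2 ≤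
      2 * (B0 * (4 + 68 * (1 + M ^ 2) * K * K) + K) * ∫ r, g r ^ 2 := by
  have qS := (Ss_L2 (S := S) (t := t) (ρ := ρ) hg n).integrable_sq
  have bS := c.Ss_bound hM hg
  obtain ⟨qR, bR⟩ := c.Rr_bound hg n le_rfl
  have key : ∀ x ∈ Set.Ioi (0:ℝ), Top' S.h t ((Set.Ico (ρ 0) (ρ n)).indicator g) x ^ 2 ≤
      2 * Ss S t ρ g n x ^ 2 + 2 * (∑ k ∈ Finset.range n, rr S t ρ g k x) ^ 2 := by
    intro x hx
    rw [c.Top_eq hg hx n]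
    nlinarith [sq_nonneg (Ss S t ρ g n x - ∑ k ∈ Finset.range n, rr S t ρ g k x)]
  have iT : IntegrableOn (fun x => Top' S.h t ((Set.Ico (ρ 0) (ρ n)).indicator g) x ^ 2) (Set.Ioi 0) := by
    refine Integrable.mono' ((qS.const_mul 2).add (qR.const_mul 2)) ((S.meas_Top (hg.ind measurableSet_Ico) t).pow 2) ?_
    filter_upwards [ae_restrict_mem measurableSet_Ioi] with x hx
    rw [Real.norm_eq_abs, abs_of_nonneg (sq_nonneg _)]
    exact key x hx
  refine ⟨iT, (setIntegral_mono_on iT ((qS.const_mul 2).add (qR.const_mul 2)) measurableSet_Ioi key).trans ?_⟩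
  simp only [Pi.add_apply]
  rw [integral_add (qS.const_mul 2) (qR.const_mul 2), integral_const_mul, integral_const_mul]
  have s1 : ∑ k ∈ Finset.range n, ∫ r, (Set.Ico (ρ k) (ρ (k + 1))).indicator g r ^ 2 ≤ ∫ r, g r ^ 2 := by
    rw [c.sumA hg n]; exact hg.ind_sq measurableSet_Ico
  have := mul_le_mul_of_nonneg_left s1 c.K0
  linarith
end Cells


lemma nn_diff {t r r' : ℝ} (ht : 0 < t) (hr : 0 < r) (h : r < r') (h2 : r' ≤ 2 * r) :
    t * (r' - r) / (4 * √(1 + r ^ 2) ^ 3) ≤ nn t r' - nn t r ∧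
    nn t r' - nn t r ≤ t * (r' - r) / √(1 + r ^ 2) ^ 3 := by
  unfold nn
  have hJ2 := Real.sq_sqrt (show 0 ≤ 1 + r ^ 2 by positivity)
  have hJ2' := Real.sq_sqrt (show 0 ≤ 1 + r' ^ 2 by positivity)
  have hJ : 0 < √(1 + r ^ 2) := Real.sqrt_pos.2 (by positivity)
  have hJJ : √(1 + r ^ 2) ≤ √(1 + r' ^ 2) := Real.sqrt_le_sqrt (by gcongr)
  have hJJ2 : √(1 + r' ^ 2) ≤ 2 * √(1 + r ^ 2) := by
    rw [Real.sqrt_le_left (by positivity), mul_pow, hJ2]; nlinarith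
  set J := √(1 + r ^ 2)
  set J' := √(1 + r' ^ 2)
  have hJ' : 0 < J' := by linarith
  have hr' : 0 < r' := by linarith
  have e : t * r' / J' - t * r / J = t * (r' - r) * ((r' + r) / (J * J' * (r' * J + r * J'))) := by
    field_simp
    have : (r' * J - J' * r) * (r' * J + r * J') = (r' - r) * (r' + r) := by
      have : (r' * J - J' * r) * (r' * J + r * J') = r' ^ 2 * J ^ 2 - J' ^ 2 * r ^ 2 := by ring
      rw [this, hJ2, hJ2']; ring
    linarith
  have hp : 0 ≤ t * (r' - r) := mul_nonneg ht.le (by linarith)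
  have l1 : (1:ℝ) / (4 * J ^ 3) ≤ (r' + r) / (J * J' * (r' * J + r * J')) := by
    rw [div_le_div_iff₀ (by positivity) (by positivity)]
    have a1 : J * J' ≤ 2 * J ^ 2 := by nlinarith
    have a2 : r' * J + r * J' ≤ 2 * ((r' + r) * J) := by nlinarith
    have := mul_le_mul a1 a2 (by positivity) (by positivity)
    nlinarith
  have l2 : (r' + r) / (J * J' * (r' * J + r * J')) ≤ 1 / J ^ 3 := by
    rw [div_le_div_iff₀ (by positivity) (by positivity)]
    have a1 : J ^ 2 ≤ J * J' := by nlinarith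
    have a2 : (r' + r) * J ≤ r' * J + r * J' := by nlinarith
    have := mul_le_mul a1 a2 (by positivity) (by positivity)
    nlinarith
  rw [e]
  constructor
  · have := mul_le_mul_of_nonneg_left l1 hp
    rwa [mul_one_div] at this
  · have := mul_le_mul_of_nonneg_left l2 hp
    rwa [mul_one_div] at this

/-- the summation step -/
lemma tele_step {q δ κ t : ℝ} (hq : 0 < q) (hqδ : q ≤ δ) (hκ : 0 < κ) (ht : 0 < t)
    (h : κ ^ 2 ≤ 40 * (q * δ + δ ^ 3 / t)) (hδt : 8 * δ ≤ t) :
    κ ^ 2 / δ ^ 2 ≤ (-(84 * √q / √(δ + κ)) + 28 * √(δ + κ) / √t) - (-(84 * √q / √δ) + 28 * √δ / √t) := by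
  have hδ : 0 < δ := by linarith
  have e1 := Real.sq_sqrt hδ.le
  have e2 := Real.sq_sqrt (show 0 ≤ δ + κ by linarith)
  have e3 := Real.sq_sqrt hq.le
  have e4 := Real.sq_sqrt ht.le
  have p1 := Real.sqrt_pos.2 hδ
  have p2 := Real.sqrt_pos.2 (show 0 < δ + κ by linarith)
  have p3 := Real.sqrt_pos.2 hq
  have p4 := Real.sqrt_pos.2 ht
  have hyz : √δ < √(δ + κ) := Real.sqrt_lt_sqrt hδ.le (by linarith)
  set y := √δ
  set z := √(δ + κ)
  set p := √q
  set T := √t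
  have k7 : κ ≤ 7 * δ := by
    have : δ ^ 3 / t ≤ δ ^ 2 / 8 := by
      rw [div_le_div_iff₀ ht (by norm_num)]
      nlinarith [sq_nonneg δ]
    have : κ ^ 2 ≤ (7 * δ) ^ 2 := by nlinarith
    exact le_of_sq_le_sq this (by positivity)
  have hz3 : z ≤ 3 * y := by
    apply le_of_sq_le_sq _ (by positivity); rw [mul_pow, e2, e1]; linarith
  have hk : κ ≤ 7 * (p * y + y ^ 3 / T) := by
    apply le_of_sq_le_sq _ (by positivity)
    have : δ ^ 3 / t = (y ^ 3 / T) ^ 2 := by rw [div_pow, e4, ← e1]; ring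
    rw [this, ← e3, ← e1] at h
    have : 0 ≤ p * y * (y ^ 3 / T) := by positivity
    nlinarith [sq_nonneg (p * y), sq_nonneg (y ^ 3 / T)]
  have hκe : κ = (z - y) * (z + y) := by nlinarith
  have h1 : κ ^ 2 / δ ^ 2 ≤ κ * (7 * (p * y + y ^ 3 / T)) / δ ^ 2 := by
    rw [pow_two]; gcongr
  refine h1.trans ?_
  have h2 : κ * (7 * (p * y + y ^ 3 / T)) / δ ^ 2 = 7 * p * (z - y) * ((z + y) / y ^ 3) + 7 * (z - y) * ((z + y) / y) / T := by
    rw [hκe, ← e1]; field_simp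
  have h3 : (z + y) / y ^ 3 ≤ 12 / (y * z) := by
    rw [div_le_div_iff₀ (by positivity) (by positivity)]
    have : (z + y) * z ≤ 4 * y * (3 * y) := by gcongr; linarith
    nlinarith
  have h4 : (z + y) / y ≤ 4 := by rw [div_le_iff₀ p1]; linarith
  have hzy : 0 ≤ z - y := by linarith
  have h5 : 7 * p * (z - y) * ((z + y) / y ^ 3) ≤ 7 * p * (z - y) * (12 / (y * z)) := by gcongr
  have h6 : 7 * (z - y) * ((z + y) / y) / T ≤ 7 * (z - y) * 4 / T := by gcongr
  have h7 : 7 * p * (z - y) * (12 / (y * z)) = 84 * p / y - 84 * p / z := by field_simp; ring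
  have h8 : 7 * (z - y) * 4 / T = 28 * z / T - 28 * y / T := by ring
  linarith

namespace Sec
variable {B B0 : ℝ} (S : Sec B B0)

def cc (t r : ℝ) : ℝ := √(1 - max S.mu 0 / (nn t r * r) ^ 2)
def kk (t r : ℝ) : ℝ := √(S.cc t r * √(1 + r ^ 2) ^ 3 / t)
def Star (t r : ℝ) : Prop := 1 + r ^ 2 ≤ nn t r * r * S.cc t r ^ 3

lemma mu_ge : -(1/4) ≤ S.mu := by unfold mu; nlinarith [sq_nonneg (S.p - 1/2)]

structure Facts (t r : ℝ) : Prop where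
  c0 : 0 < S.cc t r
  c1 : S.cc t r ≤ 1
  c2 : S.cc t r ^ 2 * (nn t r * r) ^ 2 = (nn t r * r) ^ 2 - max S.mu 0
  k0 : 0 < S.kk t r
  k2 : S.kk t r ^ 2 * t = S.cc t r * √(1 + r ^ 2) ^ 3
  kr : S.kk t r ≤ r * S.cc t r ^ 2
  kx : 1 ≤ S.kk t r * nn t r * S.cc t r
  s1 : 1 ≤ nn t r * r

lemma facts {t r : ℝ} (ht : 0 < t) (hr : 0 < r) (h : S.Star t r) : S.Facts t r := by
  have hX : 0 < nn t r := by simpa [nn] using nn_strict ht le_rfl hr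
  have hJ2 := Real.sq_sqrt (show 0 ≤ 1 + r ^ 2 by positivity)
  have hJ : 0 < √(1 + r ^ 2) := Real.sqrt_pos.2 (by positivity)
  have hXJ : nn t r * √(1 + r ^ 2) = t * r := by unfold nn; field_simp
  have hc : 0 ≤ S.cc t r := Real.sqrt_nonneg _
  have hk : S.kk t r ^ 2 = S.cc t r * √(1 + r ^ 2) ^ 3 / t := Real.sq_sqrt (by positivity)
  unfold Star at h
  have c0 : 0 < S.cc t r := by
    rcases hc.eq_or_lt with h0 | h0
    · rw [← h0] at h; norm_num at h; nlinarith
    · exact h0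
  have c1 : S.cc t r ≤ 1 := by
    unfold cc; rw [Real.sqrt_le_left zero_le_one, one_pow]
    have : 0 ≤ max S.mu 0 / (nn t r * r) ^ 2 := by positivity
    linarith
  have c2 : S.cc t r ^ 2 * (nn t r * r) ^ 2 = (nn t r * r) ^ 2 - max S.mu 0 := by
    have : 0 < 1 - max S.mu 0 / (nn t r * r) ^ 2 := Real.sqrt_pos.1 c0
    unfold cc
    rw [Real.sq_sqrt this.le]; field_simp
  have k0 : 0 < S.kk t r := Real.sqrt_pos.2 (by positivity)
  have k2 : S.kk t r ^ 2 * t = S.cc t r * √(1 + r ^ 2) ^ 3 := by rw [hk]; field_simp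
  have s1 : 1 ≤ nn t r * r := by
    have : S.cc t r ^ 3 ≤ 1 := pow_le_one₀ hc c1
    have : 0 < nn t r * r := by positivity
    nlinarith [sq_nonneg r]
  suffices hh : S.kk t r ≤ r * S.cc t r ^ 2 ∧ 1 ≤ S.kk t r * nn t r * S.cc t r from ⟨c0, c1, c2, k0, k2, hh.1, hh.2, s1⟩
  generalize S.cc t r = c at *
  generalize S.kk t r = k at *
  generalize nn t r = X at *
  generalize √(1 + r ^ 2) = J at *
  rw [← hJ2] at h
  have kr : k ≤ r * c ^ 2 := by
    apply le_of_sq_le_sq _ (by positivity)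
    have h1 : k ^ 2 * t ≤ (r * c ^ 2) ^ 2 * t := by
      rw [k2]
      have h2 := mul_le_mul_of_nonneg_left h (show 0 ≤ c * J by positivity)
      have h3 : c * J * (X * r * c ^ 3) = (X * J) * (r * c ^ 4) := by ring
      rw [h3, hXJ] at h2
      nlinarith
    exact le_of_mul_le_mul_right h1 ht
  refine ⟨kr, ?_⟩
  apply le_of_sq_le_sq _ (by positivity)
  have hJ1 : 1 ≤ J ^ 2 := by rw [hJ2]; nlinarith [sq_nonneg r]
  have h1 : (k * X * c) ^ 2 * (t * J) = (X * r * c ^ 3) * J ^ 2 * (t * J) := by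
    have : (k * X * c) ^ 2 * (t * J) = (k ^ 2 * t) * (X * J) * X * c ^ 2 := by ring
    rw [this, k2, hXJ]; ring
  have h2 := mul_right_cancel₀ (by positivity) h1
  rw [h2, one_pow]; nlinarith

lemma Facts.hb {S : Sec B B0} {t r : ℝ} (f : S.Facts t r) {y : ℝ} (h : S.Star t r) (hy : nn t r * r ≤ y) :
    S.h y ^ 2 ≤ 10 ^ 10 * B0 / S.cc t r := by
  have s1 := f.s1
  have c0 := f.c0
  have c2 := f.c2
  unfold Star at h
  set s := nn t r * r
  set c := S.cc t r
  have hmm : S.mu ≤ max S.mu 0 := le_max_left _ _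
  have hm0 : 0 ≤ max S.mu 0 := le_max_right _ _
  have hms : max S.mu 0 < s ^ 2 := by have : 0 < c ^ 2 * s ^ 2 := by positivity
                                      linarith
  have hg := S.mu_ge
  have hR : S.Reg s := by
    refine ⟨by linarith, by linarith, ?_⟩
    have h1 : s * c ≤ S.w s := by
      refine le_of_sq_le_sq (b := S.w s) ?_ (Real.sqrt_nonneg _)
      rw [S.w_sq (by linarith)]; nlinarith
    have h2 : (s * c) ^ 3 ≤ S.w s ^ 3 := by gcongr
    have h3 : |S.mu| ≤ s ^ 2 := by
      rw [abs_le]; constructor <;> nlinarith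
    have h4 : s ^ 2 ≤ (s * c) ^ 3 := by
      have : (s * c) ^ 3 = s ^ 2 * (s * c ^ 3) := by ring
      rw [this]; nlinarith [sq_nonneg r, sq_nonneg s]
    linarith
  have hRy := hR.mono hy
  have hE := S.E_bd hRy
  have hy0 := hRy.1
  have hw : c ≤ S.w y / y := by
    rw [le_div_iff₀ hy0]
    refine le_of_sq_le_sq (b := S.w y) ?_ (Real.sqrt_nonneg _)
    rw [S.w_sq hRy.2.1.le]
    have : c ^ 2 ≤ 1 := pow_le_one₀ c0.le f.c1
    have : s ^ 2 ≤ y ^ 2 := by gcongr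
    nlinarith
  rw [le_div_iff₀ c0]
  unfold E at hE
  have h5 : 0 ≤ y / S.w y * S.h' y ^ 2 := mul_nonneg (div_nonneg hy0.le (Real.sqrt_nonneg _)) (sq_nonneg _)
  nlinarith [sq_nonneg (S.h y)]

lemma Facts.hq {S : Sec B B0} {t r : ℝ} (f : S.Facts t r) (hr : 0 < r) {I x : ℝ} (hI : 0 ≤ I) (hIk : I * S.kk t r ≤ S.cc t r)
    (hx : nn t r ≤ x) (hx' : x ≤ nn t r + I) : r ^ 2 - S.mu / x ^ 2 ≤ 3 * (r ^ 2 * S.cc t r ^ 2) := by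
  obtain ⟨c0, c1, c2, k0, -, -, kx, s1⟩ := f
  have hg := S.mu_ge
  set X := nn t r
  set c := S.cc t r
  set k := S.kk t r
  have hX : 0 < X := by by_contra hh; push Not at hh; nlinarith
  have hx0 : 0 < x := by linarith
  have hIX : I ≤ c ^ 2 * X := by
    have h1 : I * 1 ≤ I * (k * X * c) := by gcongr
    have h2 : (I * k) * (X * c) ≤ c * (X * c) := by gcongr
    nlinarith
  rw [sub_le_iff_le_add, ← sub_le_iff_le_add', le_div_iff₀ (by positivity)]
  rcases le_total S.mu 0 with h0 | h0
  · rw [max_eq_right h0] at c2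
    have : c ^ 2 = 1 := by
      have h3 : c ^ 2 * (X * r) ^ 2 = 1 * (X * r) ^ 2 := by linarith
      exact mul_right_cancel₀ (by positivity) h3
    rw [this]
    have h4 : 1 ≤ (x * r) ^ 2 := one_le_pow₀ (s1.trans (by gcongr))
    nlinarith
  · rw [max_eq_left h0] at c2
    have e : S.mu = X ^ 2 * r ^ 2 * (1 - c ^ 2) := by nlinarith
    rw [e]
    have hc2 : 0 < c ^ 2 := by positivity
    have hc3 : c ^ 2 ≤ 1 := pow_le_one₀ c0.le c1
    have h6 : x ≤ X * (1 + c ^ 2) := by nlinarith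
    have h7 : x ^ 2 ≤ (X * (1 + c ^ 2)) ^ 2 := by gcongr
    rcases le_total (1 - 3 * c ^ 2) 0 with h8 | h8
    · have : (r ^ 2 - 3 * (r ^ 2 * c ^ 2)) * x ^ 2 ≤ 0 := by
        have : (r ^ 2 - 3 * (r ^ 2 * c ^ 2)) * x ^ 2 = (1 - 3 * c ^ 2) * (r ^ 2 * x ^ 2) := by ring
        rw [this]; exact mul_nonpos_of_nonpos_of_nonneg h8 (by positivity)
      have : 0 ≤ X ^ 2 * r ^ 2 * (1 - c ^ 2) := mul_nonneg (by positivity) (by linarith)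
      linarith
    · have h9 := mul_le_mul_of_nonneg_left h7 (show 0 ≤ (1 - 3 * c ^ 2) * r ^ 2 by positivity)
      have h10 : (1 - 3 * c ^ 2) * (1 + c ^ 2) ^ 2 ≤ 1 - c ^ 2 := by
        generalize c ^ 2 = u at *
        nlinarith [sq_nonneg u, mul_nonneg hc2.le (sq_nonneg u)]
      have h11 := mul_le_mul_of_nonneg_left h10 (show 0 ≤ X ^ 2 * r ^ 2 by positivity)
      nlinarith
end Sec


namespace Sec
variable {B B0 : ℝ} (S : Sec B B0)

lemma s_mono {t r r' : ℝ} (ht : 0 < t) (hr : 0 < r) (h : r ≤ r') : nn t r * r ≤ nn t r' * r' := by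
  have h1 := nn_mono' ht hr.le h
  have h2 : 0 < nn t r := by simpa [nn] using nn_strict ht le_rfl hr
  have : 0 < r' := by linarith
  gcongr
  exact h2.le.trans h1

lemma cc_mono {t r r' : ℝ} (ht : 0 < t) (hr : 0 < r) (h : r ≤ r') : S.cc t r ≤ S.cc t r' := by
  have h1 := s_mono ht hr h
  have h2 : 0 < nn t r := by simpa [nn] using nn_strict ht le_rfl hr
  unfold cc
  apply Real.sqrt_le_sqrt
  have : 0 ≤ max S.mu 0 := le_max_right _ _
  gcongr

lemma kk_mono {t r r' : ℝ} (ht : 0 < t) (hr : 0 < r) (h : r ≤ r') : S.kk t r ≤ S.kk t r' := by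
  have h1 := S.cc_mono ht hr h
  have h2 : 0 ≤ S.cc t r := Real.sqrt_nonneg _
  unfold kk
  apply Real.sqrt_le_sqrt
  gcongr
  exact h2.trans h1

lemma cc_grow {t r r' : ℝ} (ht : 0 < t) (hr : 0 < r) (h : r ≤ r') (f : S.Facts t r) :
    S.cc t r' ≤ S.cc t r + 4 * (r' - r) / (r * S.cc t r) := by
  have hc := S.cc_mono ht hr h
  have c0 := f.c0
  have hs := s_mono ht hr h
  have c2 := f.c2
  have s1 := f.s1
  have hm0 : 0 ≤ max S.mu 0 := le_max_right _ _
  have hr' : 0 < r' := by linarith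
  have hs4 : nn t r' * r' * r ^ 2 ≤ nn t r * r * r' ^ 2 := by
    unfold nn
    have hJ : 0 < √(1 + r ^ 2) := Real.sqrt_pos.2 (by positivity)
    have hJ' : √(1 + r ^ 2) ≤ √(1 + r' ^ 2) := Real.sqrt_le_sqrt (by gcongr)
    have e1 : t * r' / √(1 + r' ^ 2) * r' * r ^ 2 = t * r ^ 2 * r' ^ 2 / √(1 + r' ^ 2) := by ring
    have e2 : t * r / √(1 + r ^ 2) * r * r' ^ 2 = t * r ^ 2 * r' ^ 2 / √(1 + r ^ 2) := by ring
    rw [e1, e2]; gcongr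
  have c2' : S.cc t r' ^ 2 * (nn t r' * r') ^ 2 = (nn t r' * r') ^ 2 - max S.mu 0 := by
    have h1 : 0 < 1 - max S.mu 0 / (nn t r' * r') ^ 2 := Real.sqrt_pos.1 (c0.trans_le hc)
    have : nn t r' * r' ≠ 0 := by linarith
    have h3 := Real.sq_sqrt h1.le
    change S.cc t r' ^ 2 = _ at h3
    rw [h3, sub_mul, one_mul, div_mul_cancel₀ _ (pow_ne_zero 2 this)]
  set s := nn t r * r
  set s' := nn t r' * r'
  set c := S.cc t r
  set c' := S.cc t r'
  set m := max S.mu 0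
  have hms : m ≤ s ^ 2 := by nlinarith [mul_nonneg (sq_nonneg c) (sq_nonneg s)]
  have hd : 0 ≤ r' - r := by linarith
  have key : c' ^ 2 - c ^ 2 ≤ 4 * (r' - r) / r := by
    have e : c' ^ 2 - c ^ 2 = (m / s ^ 2) * (1 - (s / s') ^ 2) := by
      have : 0 < s := by linarith
      have : 0 < s' := by linarith
      field_simp
      nlinarith
    have e1 : m / s ^ 2 ≤ 1 := div_le_one_of_le₀ hms (by positivity)
    have e2 : (r / r') ^ 2 ≤ s / s' := by
      rw [div_pow, div_le_div_iff₀ (by positivity) (by linarith)]; linarith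
    have e3 : s / s' ≤ 1 := div_le_one_of_le₀ hs (by linarith)
    have e4 : 0 ≤ s / s' := div_nonneg (by linarith) (by linarith)
    have e5 : 1 - (s / s') ^ 2 ≤ 2 * (1 - s / s') := by nlinarith [sq_nonneg (1 - s / s')]
    have e6 : 1 - (r / r') ^ 2 ≤ 2 * (1 - r / r') := by nlinarith [sq_nonneg (1 - r / r')]
    have e7 : 1 - r / r' ≤ (r' - r) / r := by
      rw [show 1 - r / r' = (r' - r) / r' by field_simp]
      gcongr
    have e8 : 0 ≤ 1 - (s / s') ^ 2 := by nlinarith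
    rw [e]
    calc _ ≤ 1 * (1 - (s / s') ^ 2) := by gcongr
      _ ≤ 4 * ((r' - r) / r) := by linarith
      _ = _ := by ring
  have h2 : (c' - c) * c ≤ 4 * (r' - r) / r := by nlinarith
  have h3 : c' - c ≤ 4 * (r' - r) / r / c := by rwa [le_div_iff₀ c0]
  rw [div_div] at h3
  linarith

lemma kk_grow {t r r' : ℝ} (ht : 0 < t) (hr : 0 < r) (f : S.Facts t r) (hd : S.kk t r ≤ r' - r) :
    S.kk t r' ^ 2 ≤ 40 * (S.kk t r * (r' - r) + (r' - r) ^ 3 / t) := by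
  have k0 := f.k0
  have h : r ≤ r' := by linarith
  have hc := S.cc_grow ht hr h f
  have c0 := f.c0
  have k2 := f.k2
  have kr := f.kr
  have hc0' : 0 ≤ S.cc t r' := Real.sqrt_nonneg _
  have hc1' : S.cc t r' ≤ 1 := by
    unfold cc; rw [Real.sqrt_le_left zero_le_one, one_pow]
    have : 0 ≤ max S.mu 0 / (nn t r' * r') ^ 2 := by positivity
    linarith
  have e : S.kk t r' ^ 2 = S.cc t r' * √(1 + r' ^ 2) ^ 3 / t := Real.sq_sqrt (by positivity)
  rw [e]
  have hJ2 := Real.sq_sqrt (show 0 ≤ 1 + r ^ 2 by positivity)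
  have hJ : 0 < √(1 + r ^ 2) := Real.sqrt_pos.2 (by positivity)
  have hJr : r ≤ √(1 + r ^ 2) := Real.le_sqrt_of_sq_le (by linarith)
  have hJJ : √(1 + r' ^ 2) ≤ √(1 + r ^ 2) + (r' - r) := by
    rw [Real.sqrt_le_left (by linarith)]
    nlinarith
  have hJ' := Real.sqrt_nonneg (1 + r' ^ 2)
  set J := √(1 + r ^ 2)
  set J' := √(1 + r' ^ 2)
  set c := S.cc t r
  set c' := S.cc t r'
  set k := S.kk t r
  set δ := r' - r
  have hδ : 0 < δ := by linarith
  rw [div_le_iff₀ ht]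
  have e9 : 40 * (k * δ + δ ^ 3 / t) * t = 40 * (k * δ * t) + 40 * δ ^ 3 := by field_simp
  rw [e9]
  have q1 : 0 ≤ k * δ * t := by positivity
  rcases le_total δ J with hh | hh
  · have h1 : J' ^ 3 ≤ (2 * J) ^ 3 := by gcongr; linarith
    have h2 : c' * J' ^ 3 ≤ (c + 4 * δ / (r * c)) * (2 * J) ^ 3 := by gcongr
    have h3 : (c + 4 * δ / (r * c)) * (2 * J) ^ 3 = 8 * (c * J ^ 3) + 32 * δ * (c * J ^ 3) / (r * c ^ 2) := by
      field_simp; ring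
    rw [h3, ← k2] at h2
    have h4 : 32 * δ * (k ^ 2 * t) / (r * c ^ 2) ≤ 32 * (k * δ * t) := by
      rw [div_le_iff₀ (by positivity)]
      have := mul_le_mul_of_nonneg_left kr (show 0 ≤ 32 * (k * δ * t) by positivity)
      linarith
    have h5 : k ^ 2 * t ≤ k * δ * t := by rw [pow_two]; gcongr
    have : 0 < δ ^ 3 := by positivity
    linarith
  · have h1 : J' ^ 3 ≤ (2 * δ) ^ 3 := by gcongr; linarith
    have h2 : c' * J' ^ 3 ≤ 1 * (2 * δ) ^ 3 := by gcongr
    have : 0 < δ ^ 3 := by positivity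
    nlinarith

def rho (t r0 : ℝ) : ℕ → ℝ
  | 0 => r0
  | k + 1 => rho t r0 k + S.kk t (rho t r0 k)

lemma mkCells {t r0 R : ℝ} (ht : 0 < t) (hR : 8 * R ≤ t) (hr0 : 0 < r0) (hr0R : r0 ≤ R)
    (hst : ∀ r, r0 ≤ r → r ≤ R → S.Star t r) :
    ∃ n H Q, Cells S t (5000 + 10 ^ 10 * B0) n (S.rho t r0) H Q ∧ R < S.rho t r0 n := by
  have hB := S.B0_nonneg
  set ρ := S.rho t r0 with hρ
  have ρ0 : ρ 0 = r0 := rfl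
  have ρs : ∀ k, ρ (k + 1) = ρ k + S.kk t (ρ k) := fun k => rfl
  have k00 := (S.facts ht hr0 (hst r0 le_rfl hr0R)).k0
  have ge : ∀ k, r0 ≤ ρ k := by
    intro k
    induction k with
    | zero => exact le_rfl
    | succ k ih => rw [ρs]; linarith [k00.trans_le (S.kk_mono ht hr0 ih)]
  have kpos : ∀ k, S.kk t r0 ≤ S.kk t (ρ k) := fun k => S.kk_mono ht hr0 (ge k)
  have mono : ∀ k, ρ k < ρ (k + 1) := fun k => by rw [ρs]; linarith [kpos k]
  have sm : StrictMono ρ := strictMono_nat_of_lt_succ mono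
  have ge2 : ∀ k : ℕ, r0 + k * S.kk t r0 ≤ ρ k := by
    intro k
    induction k with
    | zero => simp [ρ0]
    | succ k ih => rw [ρs]; push_cast; linarith [kpos k]
  have unb : ∀ x, ∃ n, x < ρ n := by
    intro x
    obtain ⟨n, hn⟩ := exists_nat_gt (x / S.kk t r0)
    rw [div_lt_iff₀ k00] at hn
    exact ⟨n, by linarith [ge2 n]⟩
  classical
  set n := Nat.find (unb R) with hn
  have hnR : R < ρ n := Nat.find_spec (unb R)
  have hlt : ∀ k < n, ρ k ≤ R := fun k hk => not_lt.1 (Nat.find_min (unb R) hk)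
  have F : ∀ k < n, S.Facts t (ρ k) := fun k hk => S.facts ht (by linarith [ge k]) (hst _ (ge k) (hlt k hk))
  have pos : ∀ k, 0 < ρ k := fun k => by linarith [ge k]
  have hk2 : ∀ k < n, ρ (k + 1) ≤ 2 * ρ k := fun k hk => by
    have := (F k hk).kr
    have h1 : S.cc t (ρ k) ^ 2 ≤ 1 := pow_le_one₀ (F k hk).c0.le (F k hk).c1
    have := pos k
    rw [ρs]; nlinarith
  have hI : ∀ k < n, S.cc t (ρ k) ≤ 4 * ((nn t (ρ (k + 1)) - nn t (ρ k)) * S.kk t (ρ k)) ∧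
      (nn t (ρ (k + 1)) - nn t (ρ k)) * S.kk t (ρ k) ≤ S.cc t (ρ k) := by
    intro k hk
    obtain ⟨h1, h2⟩ := nn_diff ht (pos k) (mono k) (hk2 k hk)
    have k0 := (F k hk).k0
    have k2 := (F k hk).k2
    have hJ : 0 < √(1 + ρ k ^ 2) := Real.sqrt_pos.2 (by positivity)
    have e : ρ (k + 1) - ρ k = S.kk t (ρ k) := by rw [ρs]; ring
    rw [e] at h1 h2
    have e2 : t * S.kk t (ρ k) / √(1 + ρ k ^ 2) ^ 3 * S.kk t (ρ k) = S.cc t (ρ k) := by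
      field_simp; linarith
    have e3 : 4 * (t * S.kk t (ρ k) / (4 * √(1 + ρ k ^ 2) ^ 3) * S.kk t (ρ k)) = S.cc t (ρ k) := by
      rw [← e2]; field_simp
    constructor
    · rw [← e3]; gcongr
    · rw [← e2]; gcongr
  refine ⟨n, fun k => 10 ^ 10 * B0 / S.cc t (ρ k), fun k => 3 * (ρ k ^ 2 * S.cc t (ρ k) ^ 2), ?_, hnR⟩
  refine ⟨ht, hr0, mono, ?_, ?_, fun k hk => by positivity, ?_, ?_, ?_⟩
  · intro k hk x r h1 _ h3 _
    refine (F k hk).hb (hst _ (ge k) (hlt k hk)) ?_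
    have : 0 < nn t (ρ k) := by simpa [nn] using nn_strict ht le_rfl (pos k)
    have := pos k
    gcongr
    linarith
  · intro k hk
    have e : ρ (k + 1) - ρ k = S.kk t (ρ k) := by rw [ρs]; ring
    have c0 := (F k hk).c0
    rw [e, mul_assoc, div_mul_eq_mul_div, div_le_iff₀ c0]
    have := (hI k hk).2
    nlinarith [mul_le_mul_of_nonneg_left this (show 0 ≤ 10 ^ 10 * B0 by positivity)]
  · intro k hk x h1 h2
    refine (F k hk).hq (pos k) (I := nn t (ρ (k + 1)) - nn t (ρ k)) ?_ (hI k hk).2 h1 (by linarith)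
    linarith [nn_strict ht (pos k).le (mono k)]
  · intro k hk
    have hX := nn_strict ht (pos k).le (mono k)
    have hi := (hI k hk).1
    have e : ρ (k + 1) - ρ k = S.kk t (ρ k) := by rw [ρs]; ring
    have kr := (F k hk).kr
    have k0 := (F k hk).k0
    have c0 := (F k hk).c0
    have c1 := (F k hk).c1
    have r0 := pos k
    rw [e]
    have hD : ρ (k + 1) ^ 2 - ρ k ^ 2 = S.kk t (ρ k) * (2 * ρ k + S.kk t (ρ k)) := by rw [ρs]; ring
    rw [hD]
    set I := nn t (ρ (k + 1)) - nn t (ρ k)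
    have hIp : 0 < I := by linarith
    generalize S.kk t (ρ k) = q at *
    generalize S.cc t (ρ k) = c at *
    generalize ρ k = r at *
    have c2 : c ^ 2 ≤ 1 := pow_le_one₀ c0.le c1
    have hJ : I⁻¹ ≤ 4 * q / c := by
      rw [inv_le_comm₀ hIp (by positivity), inv_div, div_le_iff₀ (by positivity)]; linarith
    have hJ0 : 0 < I⁻¹ := inv_pos.2 hIp
    have qr : q ≤ r := by nlinarith
    have qc : q / c ^ 2 ≤ r := by rw [div_le_iff₀ (by positivity)]; exact kr
    have t1 : (q * (2 * r + q)) ^ 2 ≤ 9 * (q ^ 2 * r ^ 2) := by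
      have : q * (2 * r + q) ≤ 3 * (q * r) := by nlinarith
      calc _ ≤ (3 * (q * r)) ^ 2 := by gcongr
        _ = _ := by ring
    have t2 : I⁻¹ ^ 4 ≤ 256 * (q ^ 2 * r ^ 2) := by
      calc I⁻¹ ^ 4 ≤ (4 * q / c) ^ 4 := by gcongr
        _ = 256 * (q ^ 2 * (q / c ^ 2) ^ 2) := by field_simp; ring
        _ ≤ _ := by gcongr
    have t3 : I⁻¹ ^ 2 * (3 * (r ^ 2 * c ^ 2) + q * (2 * r + q)) ≤ 96 * (q ^ 2 * r ^ 2) := by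
      calc _ ≤ (4 * q / c) ^ 2 * (3 * (r ^ 2 * c ^ 2) + q * (2 * r + r)) := by gcongr
        _ = 48 * (q ^ 2 * r ^ 2) + 48 * (q ^ 2 * (q / c ^ 2 * r)) := by field_simp; ring
        _ ≤ 48 * (q ^ 2 * r ^ 2) + 48 * (q ^ 2 * (r * r)) := by gcongr
        _ = _ := by ring
    have : 0 ≤ B0 * (q ^ 2 * r ^ 2) := by positivity
    have : 0 ≤ q ^ 2 * r ^ 2 := by positivity
    nlinarith
  · intro r
    rcases lt_or_ge r (ρ 0) with h0 | h0
    · rw [Finset.sum_eq_zero]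
      · positivity
      · intro k _; rw [if_neg]; intro hh; linarith [hh.1]
    set i := Nat.find (unb r) with hi
    have hir : r < ρ i := Nat.find_spec (unb r)
    have himin : ∀ j, r < ρ j → i ≤ j := fun j hj => Nat.find_min' (unb r) hj
    have i1 : 1 ≤ i := by
      by_contra hh
      have : i = 0 := by omega
      rw [this] at hir; linarith
    set Φ : ℕ → ℝ := fun k => -(84 * √(S.kk t (ρ i)) / √(ρ k - ρ i)) + 28 * √(ρ k - ρ i) / √t with hΦ
    have hle : ∀ m ≤ n, ∑ k ∈ Finset.range m, (if ρ 0 ≤ r ∧ r < ρ (k - 1) then (ρ (k + 1) - ρ k) ^ 2 / (ρ k - r) ^ 2 else 0) ≤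
        if i < m then Φ m - Φ (i + 1) else 0 := by
      intro m
      induction m with
      | zero => simp
      | succ m ih =>
        intro hm
        have ih := ih (by omega)
        rw [Finset.sum_range_succ]
        rcases lt_trichotomy m i with h | h | h
        · rw [if_neg (show ¬ i < m by omega)] at ih
          rw [if_neg (show ¬ i < m + 1 by omega), if_neg (show ¬ (ρ 0 ≤ r ∧ r < ρ (m - 1)) by
            rintro ⟨-, h2⟩; have := himin _ h2; omega)]
          linarith
        · rw [if_neg (show ¬ i < m by omega)] at ih
          rw [if_pos (show i < m + 1 by omega), if_neg (show ¬ (ρ 0 ≤ r ∧ r < ρ (m - 1)) by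
            rintro ⟨-, h2⟩; have := himin _ h2; omega), ← h]
          linarith
        · rw [if_pos (show i < m from h)] at ih
          rw [if_pos (show i < m + 1 by omega)]
          have hmn : m < n := by omega
          have fi := F i (by omega)
          have hδ : S.kk t (ρ i) ≤ ρ m - ρ i := by
            have h1 := sm.monotone (show i + 1 ≤ m by omega)
            rw [ρs i] at h1; linarith
          have hk0 := (F m hmn).k0
          have st := tele_step fi.k0 hδ hk0 ht (S.kk_grow ht (pos i) fi hδ) (by
            linarith [hlt m hmn, pos i])
          have e : ρ m - ρ i + S.kk t (ρ m) = ρ (m + 1) - ρ i := by rw [ρs]; ring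
          rw [e] at st
          have hterm : (if ρ 0 ≤ r ∧ r < ρ (m - 1) then (ρ (m + 1) - ρ m) ^ 2 / (ρ m - r) ^ 2 else 0) ≤
              S.kk t (ρ m) ^ 2 / (ρ m - ρ i) ^ 2 := by
            split_ifs
            · have e : ρ (m + 1) - ρ m = S.kk t (ρ m) := by rw [ρs]; ring
              rw [e]
              have : 0 < ρ m - ρ i := by linarith [fi.k0]
              gcongr
            · positivity
          simp only [hΦ] at ih ⊢
          linarith
    refine (hle n le_rfl).trans ?_
    split_ifs with hin
    · have fi := F i hin
      have a1 : ρ (i + 1) - ρ i = S.kk t (ρ i) := by rw [ρs]; ring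
      have a2 : 0 < √(S.kk t (ρ i)) := Real.sqrt_pos.2 fi.k0
      have a3 : 0 < √t := Real.sqrt_pos.2 ht
      simp only [hΦ]
      rw [a1, mul_div_assoc 84 (√(S.kk t (ρ i))) (√(S.kk t (ρ i))), div_self a2.ne']
      have b1 : 0 ≤ 84 * √(S.kk t (ρ i)) / √(ρ n - ρ i) := by positivity
      have b2 : 0 ≤ 28 * √(S.kk t (ρ i)) / √t := by positivity
      have b3 : 28 * √(ρ n - ρ i) / √t ≤ 28 := by
        rw [div_le_iff₀ a3]
        have : ρ n ≤ t := by
          obtain ⟨j, hj⟩ := Nat.exists_eq_succ_of_ne_zero (show n ≠ 0 by omega)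
          rw [hj, Nat.succ_eq_add_one]
          linarith [hk2 j (by omega), hlt j (by omega), pos j]
        have := Real.sqrt_le_sqrt (show ρ n - ρ i ≤ t by linarith [pos i])
        linarith
      have : 0 ≤ 10 ^ 10 * B0 := by positivity
      linarith
    · positivity
end Sec


lemma mm_nn {t r : ℝ} (ht : 0 < t) (hr : 0 < r) : mm t (nn t r) = r := by
  unfold mm nn
  have hJ : 0 < √(1 + r ^ 2) := Real.sqrt_pos.2 (by positivity)
  have s := Real.sq_sqrt (show 0 ≤ 1 + r ^ 2 by positivity)
  have : t ^ 2 - (t * r / √(1 + r ^ 2)) ^ 2 = (t / √(1 + r ^ 2)) ^ 2 := by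
    rw [div_pow, div_pow, s]; field_simp; ring
  rw [this, Real.sqrt_sq (by positivity)]
  field_simp

lemma nn_lt_t {t r : ℝ} (ht : 0 < t) (hr : 0 < r) : nn t r < t := by
  unfold nn
  rw [div_lt_iff₀ (Real.sqrt_pos.2 (by positivity))]
  have : r < √(1 + r ^ 2) := Real.lt_sqrt_of_sq_lt (by linarith)
  gcongr

namespace Sec
variable {B B0 : ℝ} (S : Sec B B0)

def W (t r : ℝ) : ℝ := √((nn t r * r) ^ 2 - max S.mu 0)

lemma corner_all {g : ℝ → ℝ} {a b N t q : ℝ} (hg : Nice g a b N) (ht : 0 < t) (hq : 0 < q) (hbq : b ≤ q)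
    (hqt : 8 * q ≤ t) (hW : S.W t q ^ 3 ≤ (nn t q * q) ^ 2 * (1 + q ^ 2)) :
    IntegrableOn (fun x => Top' S.h t g x ^ 2) (Set.Ioi 0) ∧
      ∫ x in Set.Ioi 0, Top' S.h t g x ^ 2 ≤ (16 * B ^ 2 + 20 * 10 ^ 10 * B0 + B0) * ∫ r, g r ^ 2 := by
  have hG : 0 ≤ ∫ r, g r ^ 2 := integral_nonneg fun _ => sq_nonneg _
  have hB := S.B0_nonneg
  have hX : 0 < nn t q := nn_pos ht hq
  have hXt := nn_lt_t ht hq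
  have em := mm_nn ht hq
  have hs0 : 0 < nn t q * q := by positivity
  have hP : PI (Top' S.h t g) 0 (nn t q) ((16 * B ^ 2 + 20 * 10 ^ 10 * B0) * ∫ r, g r ^ 2) := by
    have small : nn t q * q ≤ 16 → PI (Top' S.h t g) 0 (nn t q) ((16 * B ^ 2 + 20 * 10 ^ 10 * B0) * ∫ r, g r ^ 2) := by
      intro h
      have := S.corner_small hg hX hXt (by rw [em]; exact h)
      refine ⟨this.1, this.2.trans ?_⟩
      gcongr
      linarith [mul_nonneg (show (0:ℝ) ≤ 20 * 10 ^ 10 by norm_num) hB]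
    rcases le_or_gt ((nn t q * q) ^ 2) (4 * max S.mu 0) with h4 | h4
    · rcases le_or_gt 1 S.mu with h1 | h1
      · rw [max_eq_left (by linarith)] at h4
        have := S.corner_B h1 hg hX hXt (by rw [em]; exact h4) (by
          rw [em]; intro _
          have e : S.W t q = S.w (nn t q * q) := by unfold W w; rw [max_eq_left (by linarith)]
          rw [← e]; exact hW)
        refine ⟨this.1, this.2.trans ?_⟩
        gcongr
        have : 0 ≤ 16 * B ^ 2 := by positivity
        linarith
      · apply small
        have : max S.mu 0 ≤ 1 := max_le h1.le zero_le_one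
        nlinarith
    · apply small
      have hm0 : 0 ≤ max S.mu 0 := le_max_right _ _
      have w1 : 4 / 5 * (nn t q * q) ≤ S.W t q := by
        unfold W; apply Real.le_sqrt_of_sq_le; nlinarith
      have w2 : (4 / 5 * (nn t q * q)) ^ 3 ≤ (nn t q * q) ^ 2 * (1 + q ^ 2) := by
        refine le_trans ?_ hW; gcongr
      have w3 : nn t q * q ≤ 2 * (1 + q ^ 2) := by
        have : (nn t q * q) ^ 2 * (64 / 125 * (nn t q * q)) ≤ (nn t q * q) ^ 2 * (1 + q ^ 2) := by
          linarith [show (4 / 5 * (nn t q * q)) ^ 3 = (nn t q * q) ^ 2 * (64 / 125 * (nn t q * q)) by ring]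
        have := le_of_mul_le_mul_left this (by positivity)
        nlinarith
      rcases le_or_gt 1 q with h1 | h1
      · exfalso
        have hJ : 0 < √(1 + q ^ 2) := Real.sqrt_pos.2 (by positivity)
        have hJ2 : √(1 + q ^ 2) ≤ 3 / 2 * q := by
          rw [Real.sqrt_le_left (by positivity)]; nlinarith
        have : 8 * q * q * q ≤ t * q * q := by gcongr
        have e : nn t q * q * √(1 + q ^ 2) = t * q * q := by unfold nn; field_simp
        have : nn t q * q * √(1 + q ^ 2) ≤ 2 * (1 + q ^ 2) * (3 / 2 * q) := by gcongr
        nlinarith [mul_pos hq hq]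
      · nlinarith
  have hH : ∀ x ∈ Set.Ioi (nn t q), Top' S.h t g x ^ 2 = Hop S.h g x ^ 2 := by
    intro x hx
    congr 1
    unfold Top' Hop
    congr 1; ext r
    by_cases hr : a ≤ r ∧ r ≤ b
    · rw [if_pos ((nn_mono' ht (hg.pos.le.trans hr.1) (hr.2.trans hbq)).trans_lt hx)]
    · simp [hg.supp r hr]
  have sub : Set.Ioi (nn t q) ⊆ Set.Ioi 0 := Set.Ioi_subset_Ioi hX.le
  have i2 : IntegrableOn (fun x => Top' S.h t g x ^ 2) (Set.Ioi (nn t q)) :=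
    ((S.isoI _ _ _ _ hg).mono_set sub).congr_fun (fun x hx => (hH x hx).symm) measurableSet_Ioi
  have b2 : ∫ x in Set.Ioi (nn t q), Top' S.h t g x ^ 2 ≤ B0 * ∫ r, g r ^ 2 := by
    rw [setIntegral_congr_fun measurableSet_Ioi hH, ← S.iso _ _ _ _ hg]
    exact setIntegral_mono_set (S.isoI _ _ _ _ hg) (Eventually.of_forall fun _ => sq_nonneg _) (LE.le.eventuallyLE sub)
  rw [← Set.Ioc_union_Ioi_eq_Ioi hX.le]
  refine ⟨hP.1.union i2, ?_⟩
  rw [setIntegral_union (Set.Ioc_disjoint_Ioi le_rfl) measurableSet_Ioi hP.1 i2]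
  linarith [hP.2]

lemma star_of {t r : ℝ} (ht : 0 < t) (hr : 0 < r) (h : (nn t r * r) ^ 2 * (1 + r ^ 2) ≤ S.W t r ^ 3) : S.Star t r := by
  have hs0 : 0 < nn t r * r := mul_pos (nn_pos ht hr) hr
  have e : S.W t r = nn t r * r * S.cc t r := by
    unfold W cc
    rw [← Real.sqrt_sq hs0.le, ← Real.sqrt_mul (by positivity), Real.sqrt_sq hs0.le]
    rw [mul_sub, mul_one, mul_div_cancel₀ _ (pow_pos hs0 2).ne']
  rw [e] at h
  unfold Star
  have : (nn t r * r) ^ 2 * (1 + r ^ 2) ≤ (nn t r * r) ^ 2 * (nn t r * r * S.cc t r ^ 3) := by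
    linarith [show (nn t r * r * S.cc t r) ^ 3 = (nn t r * r) ^ 2 * (nn t r * r * S.cc t r ^ 3) by ring]
  exact le_of_mul_le_mul_left this (by positivity)

def C1 (B B0 M : ℝ) : ℝ := 2 * ((16 * B ^ 2 + 20 * 10 ^ 10 * B0 + B0) +
  2 * (B0 * (4 + 68 * (1 + M ^ 2) * (5000 + 10 ^ 10 * B0) * (5000 + 10 ^ 10 * B0)) + (5000 + 10 ^ 10 * B0)))

theorem main1 {M : ℝ} (hM : ∀ x, |deriv Real.smoothTransition x| ≤ M ∧
    |deriv (deriv Real.smoothTransition) x| ≤ M) {g : ℝ → ℝ} {a b N t : ℝ} (hg : Nice g a b N) (ht : 0 < t)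
    (hbt : 8 * b ≤ t) :
    IntegrableOn (fun x => Top' S.h t g x ^ 2) (Set.Ioi 0) ∧
      ∫ x in Set.Ioi 0, Top' S.h t g x ^ 2 ≤ C1 B B0 M * ∫ r, g r ^ 2 := by
  have hB := S.B0_nonneg
  have hG : 0 ≤ ∫ r, g r ^ 2 := integral_nonneg fun _ => sq_nonneg _
  rcases lt_or_ge b a with hba | hba
  · have : ∀ r, g r = 0 := fun r => hg.supp r fun h => by linarith [h.1, h.2]
    simp [Top', this]
  have hb : 0 < b := hg.pos.trans_le hba
  have cn := nn_continuous t
  have cs : Continuous fun r => nn t r * r := cn.mul continuous_id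
  have cW : Continuous fun r => S.W t r ^ 3 := by unfold W; fun_prop
  have cS : Continuous fun r => (nn t r * r) ^ 2 * (1 + r ^ 2) := by fun_prop
  have cl : IsClosed {r | S.W t r ^ 3 ≤ (nn t r * r) ^ 2 * (1 + r ^ 2)} := isClosed_le cW cS
  have hcomp : IsCompact (Set.Icc 0 b ∩ {r | S.W t r ^ 3 ≤ (nn t r * r) ^ 2 * (1 + r ^ 2)}) := isCompact_Icc.inter_right cl
  obtain ⟨r1, hr1, hr1m⟩ : ∃ r1, 0 < r1 ∧ r1 ∈ Set.Icc 0 b ∩ {r | S.W t r ^ 3 ≤ (nn t r * r) ^ 2 * (1 + r ^ 2)} := by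
    have hp : 0 < min b (1 / (t + 1)) := by positivity
    refine ⟨min b (1 / (t + 1)), hp, ⟨hp.le, min_le_left _ _⟩, ?_⟩
    set r := min b (1 / (t + 1))
    have hr : r * (t + 1) ≤ 1 := by
      rw [← le_div_iff₀ (by positivity)]; exact min_le_right _ _
    have n1 := nn_pos ht hp
    have n2 := nn_lt_t ht hp
    have s0 : 0 < nn t r * r := by positivity
    have s1 : nn t r * r ≤ 1 := by nlinarith
    have w1 : S.W t r ≤ nn t r * r := by
      unfold W; rw [Real.sqrt_le_left s0.le]; linarith [le_max_right S.mu 0]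
    have w0 : 0 ≤ S.W t r := Real.sqrt_nonneg _
    calc S.W t r ^ 3 ≤ (nn t r * r) ^ 3 := by gcongr
      _ = (nn t r * r) ^ 2 * (nn t r * r) := by ring
      _ ≤ _ := by gcongr; nlinarith
  obtain ⟨q, hq, hmax⟩ := hcomp.exists_isGreatest ⟨r1, hr1m⟩
  have hq0 : 0 < q := hr1.trans_le (hmax hr1m)
  have hqb : q ≤ b := hq.1.2
  have hC0 : 0 ≤ B0 * (4 + 68 * (1 + M ^ 2) * (5000 + 10 ^ 10 * B0) * (5000 + 10 ^ 10 * B0)) + (5000 + 10 ^ 10 * B0) := by positivity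
  have hC1 : 0 ≤ 16 * B ^ 2 + 20 * 10 ^ 10 * B0 + B0 := by positivity
  rcases hqb.eq_or_lt with hqe | hqe
  · obtain ⟨h1, h2⟩ := S.corner_all hg ht hq0 hqe.ge (by linarith) hq.2
    refine ⟨h1, h2.trans ?_⟩
    gcongr
    unfold C1
    linarith
  have hIoc : Set.Ioc q b ⊆ {r | (nn t r * r) ^ 2 * (1 + r ^ 2) ≤ S.W t r ^ 3} := by
    intro r hr
    by_contra hh
    have := hmax (a := r) ⟨⟨hq0.le.trans hr.1.le, hr.2⟩, by
      have := not_le.1 (show ¬ (nn t r * r) ^ 2 * (1 + r ^ 2) ≤ S.W t r ^ 3 from hh); exact this.le⟩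
    exact absurd hr.1 (not_lt.2 this)
  have hIcc : ∀ r, q ≤ r → r ≤ b → S.Star t r := by
    intro r h1 h2
    refine S.star_of ht (hq0.trans_le h1) ?_
    have := closure_minimal hIoc (isClosed_le cS cW)
    rw [closure_Ioc hqe.ne] at this
    exact this ⟨h1, h2⟩
  obtain ⟨n, H, Q, c, hn⟩ := S.mkCells ht hbt hq0 hqb hIcc
  have e0 : S.rho t q 0 = q := rfl
  obtain ⟨i2, b2⟩ := c.block hM hg
  rw [e0] at i2 b2
  set ρn := S.rho t q n
  have hg1 : Nice ((Set.Iio q).indicator g) a q N := by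
    have := hg.ind (measurableSet_Iio (a := q))
    refine ⟨this.meas, this.bdd, this.pos, fun r hr => ?_⟩
    by_cases h : r < q
    · rw [Set.indicator_of_mem (show r ∈ Set.Iio q from h)]
      exact hg.supp r fun h' => hr ⟨h'.1, h.le⟩
    · exact Set.indicator_of_notMem (s := Set.Iio q) h g
  obtain ⟨i1, b1⟩ := S.corner_all hg1 ht hq0 le_rfl (by linarith) hq.2
  have b1' : ∫ r, (Set.Iio q).indicator g r ^ 2 ≤ ∫ r, g r ^ 2 := by
    refine integral_mono hg1.sq hg.sq fun r => ?_
    by_cases h : r ∈ Set.Iio q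
    · simp only [Set.indicator_of_mem h]; exact le_rfl
    · simp only [Set.indicator_of_notMem h]; simpa using sq_nonneg (g r)
  have key : ∀ x ∈ Set.Ioi (0:ℝ), Top' S.h t g x = Top' S.h t ((Set.Iio q).indicator g) x +
      Top' S.h t ((Set.Ico q ρn).indicator g) x := by
    intro x hx
    have ti : ∀ D : Set ℝ, MeasurableSet D → Integrable fun r => if nn t r < x then S.h (x * r) * D.indicator g r else 0 := by
      intro D hD
      have := (S.int_Hop (hg.ind hD) hx).indicator (measurableSet_lt (nn_continuous t).measurable (measurable_const (a := x)))
      refine this.congr (Eventually.of_forall fun r => ?_)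
      simp [Set.indicator]
    unfold Top'
    rw [← integral_add (ti _ measurableSet_Iio) (ti _ measurableSet_Ico)]
    congr 1; ext r
    by_cases hx' : nn t r < x
    · simp only [if_pos hx']
      rw [← mul_add]
      congr 1
      by_cases h1 : r < q
      · simp [Set.indicator, h1]
      · by_cases h2 : r < ρn
        · simp [Set.indicator, h1, h2, not_lt.1 h1]
        · have : g r = 0 := hg.supp r fun h => by linarith [h.2]
          simp [Set.indicator, this]
    · simp [if_neg hx']
  have kle : ∀ x ∈ Set.Ioi (0:ℝ), Top' S.h t g x ^ 2 ≤ 2 * Top' S.h t ((Set.Iio q).indicator g) x ^ 2 +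
      2 * Top' S.h t ((Set.Ico q ρn).indicator g) x ^ 2 := by
    intro x hx
    rw [key x hx]
    nlinarith [sq_nonneg (Top' S.h t ((Set.Iio q).indicator g) x - Top' S.h t ((Set.Ico q ρn).indicator g) x)]
  have iS := (i1.const_mul 2).add (i2.const_mul 2)
  have iT : IntegrableOn (fun x => Top' S.h t g x ^ 2) (Set.Ioi 0) := by
    refine Integrable.mono' iS ((S.meas_Top hg t).pow 2) ?_
    filter_upwards [ae_restrict_mem measurableSet_Ioi] with x hx
    rw [Real.norm_of_nonneg (sq_nonneg _)]
    exact kle x hx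
  refine ⟨iT, ?_⟩
  have := setIntegral_mono_on iT iS measurableSet_Ioi kle
  refine this.trans ?_
  rw [integral_add' (i1.const_mul 2) (i2.const_mul 2), integral_const_mul, integral_const_mul]
  have b1'' := b1.trans (mul_le_mul_of_nonneg_left b1' hC1)
  unfold C1
  linarith
end Sec


abbrev Sp (d : ℕ) := Metric.sphere (0 : Euc d) 1
abbrev sg (d : ℕ) : Measure (Sp d) := (volume : Measure (Euc d)).toSphere

lemma polar_mp (d : ℕ) [NeZero d] : MeasurePreserving (fun p : Sp d × ℝ => p.2 • (p.1 : Euc d))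
    ((sg d).prod ((volume.restrict (Set.Ioi (0:ℝ))).withDensity (fun r => ENNReal.ofReal (r^(d-1))))) volume := by
  have h0 : MeasurePreserving (Subtype.val : Set.Ioi (0:ℝ) → ℝ) (Measure.volumeIoiPow (d-1))
      ((volume.restrict (Set.Ioi (0:ℝ))).withDensity (fun r => ENNReal.ofReal (r^(d-1)))) := by
    refine ⟨measurable_subtype_coe, ?_⟩
    ext s hs
    rw [Measure.map_apply measurable_subtype_coe hs, Measure.volumeIoiPow,
      withDensity_apply _ (measurable_subtype_coe hs), withDensity_apply _ hs,
      Measure.restrict_restrict hs,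
      setLIntegral_subtype measurableSet_Ioi _ fun a : ℝ ↦ ENNReal.ofReal (a ^ (d-1)),
      Subtype.image_preimage_coe, Set.inter_comm]
  have h1 := (MeasurePreserving.id (sg d)).prod h0
  have h2 := (volume : Measure (Euc d)).measurePreserving_homeomorphUnitSphereProd
  rw [finrank_euclideanSpace_fin] at h2
  have h3 : MeasurePreserving (Subtype.val : ({0}ᶜ : Set (Euc d)) → Euc d) (volume.comap Subtype.val) volume := by
    refine ⟨measurable_subtype_coe, ?_⟩
    rw [map_comap_subtype_coe (measurableSet_singleton _).compl, restrict_compl_singleton]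
  have hm : Measurable (fun p : Sp d × ℝ => p.2 • (p.1 : Euc d)) := by fun_prop
  refine ⟨hm, ?_⟩
  rw [← h1.map_eq, Measure.map_map hm h1.measurable, ← h2.map_eq,
    Measure.map_map (hm.comp h1.measurable) h2.measurable, ← h3.map_eq]
  congr 1
  · ext x i
    have : (x:Euc d) ≠ 0 := x.2
    simp [homeomorphUnitSphereProd, mul_inv_cancel_left₀ (norm_ne_zero_iff.2 this)]
  · rw [h3.map_eq]

lemma nu_prod (d : ℕ) : (sg d).prod ((volume.restrict (Set.Ioi (0:ℝ))).withDensity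
    (fun r => ENNReal.ofReal (r^(d-1)))) = ((sg d).prod (volume.restrict (Set.Ioi (0:ℝ)))).withDensity
    (fun p => ENNReal.ofReal (p.2^(d-1))) := by
  rw [prod_withDensity_right (by fun_prop)]

lemma polar_iff {𝕜 : Type} [NormedAddCommGroup 𝕜] [NormedSpace ℝ 𝕜] [MeasurableSpace 𝕜] [BorelSpace 𝕜] [SecondCountableTopology 𝕜] {d : ℕ} [NeZero d] {f : Euc d → 𝕜} (hf : Measurable f) : Integrable f ↔
    Integrable (fun p : Sp d × ℝ => p.2^(d-1) • f (p.2 • (p.1 : Euc d)))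
      ((sg d).prod (volume.restrict (Set.Ioi (0:ℝ)))) := by
  rw [← (polar_mp d).integrable_comp hf.aestronglyMeasurable, nu_prod,
    integrable_withDensity_iff_integrable_smul' (by fun_prop) (by simp)]
  refine integrable_congr ?_
  have : ∀ᵐ p ∂(sg d).prod (volume.restrict (Set.Ioi (0:ℝ))), (0:ℝ) < p.2 :=
    Measure.quasiMeasurePreserving_snd.ae (ae_restrict_mem measurableSet_Ioi)
  filter_upwards [this] with p hp
  simp [ENNReal.toReal_ofReal, pow_nonneg hp.le]

lemma polar_int {𝕜 : Type} [NormedAddCommGroup 𝕜] [NormedSpace ℝ 𝕜] [MeasurableSpace 𝕜] [BorelSpace 𝕜] [SecondCountableTopology 𝕜] {d : ℕ} [NeZero d] {f : Euc d → 𝕜} (hf : Measurable f) : ∫ x, f x =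
    ∫ p : Sp d × ℝ, p.2^(d-1) • f (p.2 • (p.1 : Euc d)) ∂((sg d).prod (volume.restrict (Set.Ioi (0:ℝ)))) := by
  rw [← (polar_mp d).map_eq, integral_map (polar_mp d).aemeasurable hf.aestronglyMeasurable, nu_prod,
    integral_withDensity_eq_integral_toReal_smul (by fun_prop) (by simp)]
  refine integral_congr_ae ?_
  have : ∀ᵐ p ∂(sg d).prod (volume.restrict (Set.Ioi (0:ℝ))), (0:ℝ) < p.2 :=
    Measure.quasiMeasurePreserving_snd.ae (ae_restrict_mem measurableSet_Ioi)
  filter_upwards [this] with p hp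
  simp [ENNReal.toReal_ofReal, pow_nonneg hp.le]

lemma polar_lint {d : ℕ} [NeZero d] {f : Euc d → ℝ≥0∞} (hf : Measurable f) : ∫⁻ x, f x =
    ∫⁻ r in Set.Ioi (0:ℝ), ENNReal.ofReal (r^(d-1)) * ∫⁻ ω, f (r • (ω : Euc d)) ∂sg d := by
  rw [← (polar_mp d).map_eq, lintegral_map hf (polar_mp d).measurable, nu_prod,
    lintegral_withDensity_eq_lintegral_mul _ (by fun_prop) (by fun_prop),
    lintegral_prod_symm' _ (by fun_prop)]
  refine lintegral_congr fun r => ?_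
  simp only [Pi.mul_apply]
  rw [lintegral_const_mul _ (by fun_prop)]


section
variable {d : ℕ} [NeZero d]

def gN (d N : ℕ) : ℝ := ∫ r in Set.Ioi (0:ℝ), r^(N+d-1) * Real.exp (-(1/2)*r^2)

lemma gN_eq (N : ℕ) : gN d N = (1/2:ℝ)^(-((N+d:ℕ):ℝ)/2) * (1/2) * Real.Gamma (((N+d:ℕ):ℝ)/2) := by
  have hd := NeZero.pos d
  have := integral_rpow_mul_exp_neg_mul_rpow (p := 2) (q := ((N+d-1:ℕ):ℝ)) (b := 1/2) (by norm_num)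
    (by have : (0:ℝ) ≤ ((N+d-1:ℕ):ℝ) := by positivity
        linarith) (by norm_num)
  have e : ((N+d-1:ℕ):ℝ) + 1 = ((N+d:ℕ):ℝ) := by
    rw [← Nat.cast_add_one]; congr 1; omega
  rw [e] at this
  rw [← this, gN]
  refine setIntegral_congr_fun measurableSet_Ioi fun r hr => ?_
  simp

lemma gN_pos (N : ℕ) : 0 < gN d N := by
  have hd := NeZero.pos d
  have : (0:ℝ) < ((N+d:ℕ):ℝ) := by exact_mod_cast (by omega)
  rw [gN_eq]; have := Real.Gamma_pos_of_pos (half_pos this); positivity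

lemma gN_rec (N : ℕ) : gN d (N+2) = (N+d) * gN d N := by
  have hd := NeZero.pos d
  have h : (0:ℝ) < ((N+d:ℕ):ℝ) := by exact_mod_cast (by omega)
  rw [gN_eq, gN_eq, show ((N+2+d:ℕ):ℝ)/2 = ((N+d:ℕ):ℝ)/2+1 by push_cast; ring,
    Real.Gamma_add_one (by positivity), show -((N+2+d:ℕ):ℝ)/2 = -((N+d:ℕ):ℝ)/2 - 1 by push_cast; ring,
    Real.rpow_sub_one (by norm_num)]
  push_cast; ring

lemma gauss_int (k : ℕ) : Integrable (fun x : Euc d => ‖x‖^k * Real.exp (-(1/2)*‖x‖^2)) := by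
  rw [integrable_fun_norm_addHaar volume (f := fun r => r^k * Real.exp (-(1/2)*r^2)), finrank_euclideanSpace_fin]
  refine (integrableOn_rpow_mul_exp_neg_mul_sq (b := 1/2) (by norm_num) (s := ((d-1+k:ℕ):ℝ))
    (by have : (0:ℝ) ≤ ((d-1+k:ℕ):ℝ) := by positivity
        linarith)).congr_fun (fun r hr => ?_) measurableSet_Ioi
  simp only [Real.rpow_natCast, smul_eq_mul, pow_add]; ring

def MI (n m : ℕ) (ω φ x : Euc d) : ℝ := ⟪ω, x⟫^n * ⟪φ, x⟫^m * Real.exp (-(1/2)*‖x‖^2)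
def MM (n m : ℕ) (ω φ : Euc d) : ℝ := ∫ x, MI n m ω φ x

lemma MI_int (n m : ℕ) (ω φ : Euc d) : Integrable (MI n m ω φ) := by
  refine ((gauss_int (d := d) (n+m)).const_mul (‖ω‖^n*‖φ‖^m)).mono' (by unfold MI; fun_prop) (.of_forall fun x => ?_)
  rw [MI, norm_mul, norm_mul, norm_pow, norm_pow, Real.norm_of_nonneg (Real.exp_pos _).le]
  calc _ ≤ (‖ω‖*‖x‖)^n * (‖φ‖*‖x‖)^m * Real.exp (-(1/2)*‖x‖^2) := by
        gcongr <;> exact norm_inner_le_norm _ _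
    _ = _ := by ring

lemma MM_comm (n m : ℕ) (ω φ : Euc d) : MM n m ω φ = MM m n φ ω := by
  simp only [MM, MI, mul_comm]

lemma MM_swap (n m : ℕ) (ω φ : Sp d) : MM n m (ω:Euc d) φ = MM n m (φ:Euc d) ω := by
  set R := Submodule.reflection (ℝ ∙ ((ω:Euc d) - φ))ᗮ
  have hR : R ω = φ := Submodule.reflection_sub (by simp)
  have hR' : R φ = ω := by rw [← hR]; exact Submodule.reflection_reflection _ _
  rw [MM, ← R.measurePreserving.integral_comp R.toHomeomorph.measurableEmbedding, MM]
  refine integral_congr_ae (.of_forall fun x => ?_)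
  have key : ∀ a b : Euc d, ⟪a, R b⟫ = ⟪R a, b⟫ := fun a b => by
    rw [← R.inner_map_map, Submodule.reflection_reflection]
  simp only [MI]
  change ⟪(ω:Euc d), R x⟫^n * ⟪(φ:Euc d), R x⟫^m * Real.exp (-(1/2)*‖R x‖^2) = _
  rw [key, key, hR, hR', R.norm_map]

lemma MM_odd (n m : ℕ) (h : Odd (n+m)) (ω φ : Euc d) : MM n m ω φ = 0 := by
  have : MM n m ω φ = - MM n m ω φ := by
    conv_lhs => rw [MM, ← integral_neg_eq_self]
    rw [MM, ← integral_neg]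
    refine integral_congr_ae (.of_forall fun x => ?_)
    simp only [MI, inner_neg_right, norm_neg]
    rw [neg_pow ⟪ω,x⟫, neg_pow ⟪φ,x⟫]
    have : ((-1:ℝ)^n*(-1)^m) = -1 := by rw [← pow_add]; exact h.neg_one_pow
    linear_combination (⟪ω,x⟫^n*⟪φ,x⟫^m*Real.exp (-(1/2)*‖x‖^2)) * this
  linarith

lemma MM_ibp (n m : ℕ) (ω φ : Euc d) (hω : ‖ω‖ = 1) :
    MM (n+1) m ω φ = n * MM (n-1) m ω φ + m * ⟪ω,φ⟫ * MM n (m-1) ω φ := by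
  have hg : ∀ x : Euc d, HasFDerivAt (fun x : Euc d => Real.exp (-(1/2)*‖x‖^2))
      (Real.exp (-(1/2)*‖x‖^2) • (-(1/2:ℝ)) • (2 • innerSL ℝ x)) x := fun x =>
    (((hasStrictFDerivAt_norm_sq x).hasFDerivAt.const_mul (-(1/2:ℝ)))).exp
  have hf : ∀ x : Euc d, HasFDerivAt (fun x : Euc d => ⟪ω,x⟫^n*⟪φ,x⟫^m)
      ((⟪ω,x⟫^n) • (m * ⟪φ,x⟫^(m-1)) • innerSL ℝ φ + (⟪φ,x⟫^m) • (n*⟪ω,x⟫^(n-1)) • innerSL ℝ ω) x := fun x => by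
    have := ((innerSL ℝ ω).hasFDerivAt (x := x).pow n).mul ((innerSL ℝ φ).hasFDerivAt (x := x).pow m)
    simp only [innerSL_apply_apply] at this; simp only [nsmul_eq_mul] at this; exact this
  have h1 : ∀ x : Euc d, fderiv ℝ (fun x : Euc d => ⟪ω,x⟫^n*⟪φ,x⟫^m) x ω * Real.exp (-(1/2)*‖x‖^2) =
     n * MI (n-1) m ω φ x + m * ⟪ω,φ⟫ * MI n (m-1) ω φ x := fun x => by
    rw [(hf x).fderiv]; simp [MI, hω, real_inner_comm]; ring
  have h2 : ∀ x : Euc d, ⟪ω,x⟫^n*⟪φ,x⟫^m * fderiv ℝ (fun x : Euc d => Real.exp (-(1/2)*‖x‖^2)) x ω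
      = - MI (n+1) m ω φ x := fun x => by
    rw [(hg x).fderiv]; simp [MI, real_inner_comm ω x]; ring
  have := integral_mul_fderiv_eq_neg_fderiv_mul_of_integrable (μ := (volume : Measure (Euc d)))
    (f := fun x : Euc d => ⟪ω,x⟫^n*⟪φ,x⟫^m) (g := fun x : Euc d => Real.exp (-(1/2)*‖x‖^2)) (v := ω)
    (by simp_rw [h1]; exact ((MI_int _ _ _ _).const_mul _).add ((MI_int _ _ _ _).const_mul _))
    (by simp_rw [h2]; exact (MI_int _ _ _ _).neg) (MI_int n m ω φ)
    (fun x _ => (hf x).differentiableAt) (fun x _ => (hg x).differentiableAt)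
  simp_rw [h1, h2] at this
  rw [integral_neg, integral_add ((MI_int _ _ _ _).const_mul _) ((MI_int _ _ _ _).const_mul _),
    integral_const_mul, integral_const_mul] at this
  simp only [MM]; linarith

def KK (n m : ℕ) (ω φ : Sp d) : ℝ := ∫ η : Sp d, ⟪(ω:Euc d), (η:Euc d)⟫^n * ⟪(φ:Euc d), (η:Euc d)⟫^m ∂sg d

lemma MM_KK (n m : ℕ) (ω φ : Sp d) : MM n m (ω:Euc d) φ = gN d (n+m) * KK n m ω φ := by
  have hd := NeZero.pos d
  have hm : Measurable (MI n m (ω:Euc d) φ) := by unfold MI; fun_prop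
  rw [MM, polar_int hm, gN, KK, mul_comm, ← integral_prod_mul]
  refine integral_congr_ae (.of_forall fun p => ?_)
  have : ‖((p.1:Euc d))‖ = 1 := by simp
  simp only [MI, inner_smul_right, norm_smul, this, smul_eq_mul, mul_one, Real.norm_eq_abs, sq_abs]
  rw [mul_pow, mul_pow, show n+m+d-1 = n+m+(d-1) by omega, pow_add, pow_add]; ring

lemma KK_symm (n m : ℕ) (ω φ : Sp d) : KK n m ω φ = KK m n ω φ := by
  have h := MM_swap n m ω φ
  rw [MM_comm n m (φ:Euc d), MM_KK, MM_KK, add_comm m n] at h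
  exact mul_left_cancel₀ (gN_pos _).ne' h

lemma KK_odd (n m : ℕ) (h : Odd (n+m)) (ω φ : Sp d) : KK n m ω φ = 0 := by
  have h := MM_odd n m h (ω:Euc d) φ
  rw [MM_KK] at h
  exact (mul_eq_zero.1 h).resolve_left (gN_pos _).ne'

lemma KK_rec (n m : ℕ) (ω φ : Sp d) : ((n:ℝ)*(n+d-2) - m*(m+d-2)) * KK n m ω φ =
    n*(n-1)*KK (n-2) m ω φ - m*(m-1)*KK n (m-2) ω φ := by
  have hω : ‖(ω:Euc d)‖ = 1 := by simp
  have hφ : ‖(φ:Euc d)‖ = 1 := by simp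
  -- n * (ibp in φ) and m * (ibp in ω)
  have A : ∀ n m : ℕ, (n+m-2+d) * (n:ℝ) * KK n m ω φ = n*(n-1) * KK (n-2) m ω φ + n*m*⟪(ω:Euc d),φ⟫ * KK (n-1) (m-1) ω φ := by
    intro n m
    rcases n with _ | n
    · simp
    have h := MM_ibp n m (ω:Euc d) φ hω
    rw [MM_KK, MM_KK, MM_KK] at h
    rcases n with _ | n
    · rcases m with _ | m
      · simp [KK_odd 1 0 (by decide)]
      · simp only [Nat.add_sub_cancel, show 0+1+(m+1) = 0+m+2 by ring, gN_rec] at h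
        have := gN_pos (d := d) m
        simp only [zero_add, Nat.cast_zero, zero_mul] at h
        have h' := mul_left_cancel₀ this.ne' (b := (m+d)*KK 1 (m+1) ω φ) (c := (m+1)*⟪(ω:Euc d),φ⟫ * KK 0 m ω φ) (by push_cast at h; linarith)
        push_cast; linear_combination h'
    · rcases m with _ | m
      · rw [show gN d (n+1+1+0) = gN d (n+0+2) from rfl, gN_rec] at h
        simp only [add_zero] at h ⊢
        have := gN_pos (d := d) n
        push_cast at h ⊢
        have h' := mul_left_cancel₀ this.ne' (b := (n+d)*KK (n+2) 0 ω φ) (c := (n+1)*KK n 0 ω φ) (by linarith)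
        simp only [mul_zero, zero_mul, add_zero]
        linear_combination (n+2:ℝ) * h'
      · rw [show n+1+1+(m+1) = n+(m+1)+2 by ring, gN_rec] at h
        have := gN_pos (d := d) (n+(m+1))
        push_cast at h ⊢
        simp only [Nat.add_sub_cancel, show n+1+1-2 = n by omega, show n+1+m = n+(m+1) by ring] at h ⊢
        have h' := mul_left_cancel₀ this.ne' (b := (n+(m+1)+d)*KK (n+2) (m+1) ω φ) (c := (n+1)*KK n (m+1) ω φ + (m+1)*⟪(ω:Euc d),φ⟫ * KK (n+1) m ω φ) (by linarith)
        linear_combination (n+2:ℝ) * h'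
  have a := A n m
  have b := A m n
  rw [KK_symm m n, KK_symm (m-2) n, KK_symm (m-1) (n-1)] at b
  linear_combination a - b
end


section
variable {d : ℕ} [NeZero d]

abbrev HS (d : ℕ) := Lp ℂ 2 (sg d)

lemma inner_pow_expand (n : ℕ) (ω θ : Euc d) : ⟪ω, θ⟫^n = ∑ φ : Fin n → Fin d, (∏ i, ω (φ i)) * ∏ i, θ (φ i) := by
  rw [PiLp.inner_apply, Fintype.sum_pow]
  refine Finset.sum_congr rfl fun φ _ => ?_
  rw [← Finset.prod_mul_distrib]
  exact Finset.prod_congr rfl fun i _ => by simp [mul_comm]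

def mc {n : ℕ} (φ : Fin n → Fin d) : C(Sp d, ℂ) :=
  ⟨fun ω => ((∏ i, (ω : Euc d) (φ i) : ℝ) : ℂ), by fun_prop⟩

def mL {n : ℕ} (φ : Fin n → Fin d) : HS d := ContinuousMap.toLp 2 (sg d) ℂ (mc φ)

def Pn (d n : ℕ) [NeZero d] : HS d →ₗ[ℂ] HS d := ∑ φ : Fin n → Fin d, (innerₛₗ ℂ (mL φ)).smulRight (mL φ)

def cP (n : ℕ) (f : HS d) : C(Sp d, ℂ) := ∑ φ : Fin n → Fin d, (inner ℂ (mL φ) f) • mc φ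

lemma Pn_apply (n : ℕ) (f : HS d) : Pn d n f = ∑ φ : Fin n → Fin d, (inner ℂ (mL φ) f) • mL φ := by
  simp [Pn, LinearMap.sum_apply]

lemma Pn_eq (n : ℕ) (f : HS d) : Pn d n f = ContinuousMap.toLp 2 (sg d) ℂ (cP n f) := by
  rw [Pn_apply, cP, map_sum]; simp [mL]

lemma Pn_ae (n : ℕ) (f : HS d) : (Pn d n f : Sp d → ℂ) =ᵐ[sg d] cP n f := by
  rw [Pn_eq]; exact ContinuousMap.coeFn_toLp (𝕜 := ℂ) _ _

lemma HS_int (f : HS d) : Integrable f (sg d) := (Lp.memLp f).integrable (by norm_num)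

lemma cP_apply (n : ℕ) (f : HS d) (ω : Sp d) : cP n f ω = ∫ θ, ((⟪(ω:Euc d), (θ:Euc d)⟫^n : ℝ) : ℂ) * f θ ∂sg d := by
  have h : ∀ φ : Fin n → Fin d, inner ℂ (mL φ) f = ∫ θ, ((∏ i, (θ : Euc d) (φ i) : ℝ) : ℂ) * f θ ∂sg d := fun φ => by
    rw [L2.inner_def]
    refine integral_congr_ae ?_
    filter_upwards [ContinuousMap.coeFn_toLp (p := 2) (sg d) (𝕜 := ℂ) (mc φ)] with θ hθ
    rw [mL, hθ]; simp [mc, mul_comm]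
  have hi : ∀ φ : Fin n → Fin d, Integrable (fun θ : Sp d => ((∏ i, (θ : Euc d) (φ i) : ℝ) : ℂ) * f θ) (sg d) := fun φ => by
    refine (HS_int f).bdd_mul (c := ‖mc φ‖) (by have : Continuous (mc φ) := by fun_prop
                                                exact this.aestronglyMeasurable)
      (.of_forall fun θ => (mc φ).norm_coe_le_norm θ)
  simp_rw [inner_pow_expand, Complex.ofReal_sum, Finset.sum_mul, Complex.ofReal_mul, mul_assoc]
  rw [integral_finset_sum _ fun φ _ => (hi φ).const_mul _]
  simp only [cP, ContinuousMap.coe_sum, Finset.sum_apply, ContinuousMap.smul_apply, smul_eq_mul, h, integral_const_mul]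
  exact Finset.sum_congr rfl fun φ _ => mul_comm _ _

lemma Pn_symm (n : ℕ) : (Pn d n).IsSymmetric := fun f g => by
  simp only [Pn_apply, sum_inner, inner_sum, inner_smul_left, inner_smul_right]
  refine Finset.sum_congr rfl fun φ _ => ?_
  rw [← inner_conj_symm (mL φ) f]; simp [mul_comm]

lemma abs_sp_le (ω θ : Sp d) : |⟪(ω:Euc d), (θ:Euc d)⟫| ≤ 1 := by
  simpa using abs_real_inner_le_norm (ω:Euc d) θ

lemma Pn_Pm (n m : ℕ) (f : HS d) (ω : Sp d) : cP n (Pn d m f) ω = ∫ θ, (KK n m ω θ : ℂ) * f θ ∂sg d := by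
  rw [cP_apply]
  have h1 : ∫ θ, ((⟪(ω:Euc d), (θ:Euc d)⟫^n : ℝ) : ℂ) * Pn d m f θ ∂sg d =
      ∫ η, ∫ θ, (((⟪(ω:Euc d), (η:Euc d)⟫^n : ℝ) : ℂ) * ((⟪(θ:Euc d), (η:Euc d)⟫^m : ℝ) : ℂ)) * f θ ∂sg d ∂sg d := by
    refine integral_congr_ae ?_
    filter_upwards [Pn_ae m f] with η hη
    rw [hη, cP_apply, ← integral_const_mul]
    refine integral_congr_ae (.of_forall fun θ => ?_)
    simp only [real_inner_comm (θ:Euc d)]; ring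
  rw [h1, integral_integral_swap]
  · refine integral_congr_ae (.of_forall fun θ => ?_)
    simp only
    rw [integral_mul_const, KK, ← integral_complex_ofReal]
    simp
  · have : Integrable (fun z : Sp d × Sp d => f z.2) ((sg d).prod (sg d)) := (HS_int f).comp_snd _
    refine this.bdd_mul (c := 1) (Continuous.aestronglyMeasurable (by fun_prop)) (.of_forall fun z => ?_)
    rw [← Complex.ofReal_mul, Complex.norm_real, Real.norm_eq_abs, abs_mul, abs_pow, abs_pow]
    exact mul_le_one₀ (pow_le_one₀ (abs_nonneg _) (abs_sp_le _ _)) (by positivity) (pow_le_one₀ (abs_nonneg _) (abs_sp_le _ _))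

lemma Pn_comm (n m : ℕ) : Commute (Pn d n) (Pn d m) := by
  refine LinearMap.ext fun f => ?_
  change Pn d n (Pn d m f) = Pn d m (Pn d n f)
  rw [Pn_eq, Pn_eq m (Pn d n f)]
  congr 1
  ext ω
  simp only [Pn_Pm, KK_symm n m]

def WN (d N : ℕ) [NeZero d] : Submodule ℂ (HS d) := ⨆ n : Fin N, LinearMap.range (Pn d n)

instance (n : ℕ) : FiniteDimensional ℂ (LinearMap.range (Pn d n)) := by
  have : LinearMap.range (Pn d n) ≤ Submodule.span ℂ (Set.range (mL : (Fin n → Fin d) → HS d)) := by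
    rintro _ ⟨f, rfl⟩
    rw [Pn_apply]
    exact Submodule.sum_mem _ fun φ _ => Submodule.smul_mem _ _ (Submodule.subset_span ⟨φ, rfl⟩)
  have := FiniteDimensional.span_of_finite ℂ (Set.finite_range (mL : (Fin n → Fin d) → HS d))
  exact Submodule.finiteDimensional_of_le ‹_ ≤ _›

instance (N : ℕ) : FiniteDimensional ℂ (WN d N) := by unfold WN; infer_instance

lemma mL_perp {n : ℕ} {f : HS d} (h : Pn d n f = 0) (φ : Fin n → Fin d) : inner ℂ (mL φ) f = 0 := by
  have h1 : (inner ℂ (Pn d n f) f) = ∑ φ : Fin n → Fin d, ((‖inner ℂ (mL φ) f‖^2 : ℝ) : ℂ) := by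
    rw [Pn_apply, sum_inner]
    refine Finset.sum_congr rfl fun φ _ => ?_
    rw [inner_smul_left, ← Complex.normSq_eq_conj_mul_self, Complex.normSq_eq_norm_sq]
  rw [h, inner_zero_left, ← Complex.ofReal_sum] at h1
  have h2 := (Finset.sum_eq_zero_iff_of_nonneg (fun φ _ => by positivity)).1 (Complex.ofReal_eq_zero.1 h1.symm) φ (Finset.mem_univ _)
  simpa using h2

lemma mL_mem {n : ℕ} (φ : Fin n → Fin d) : mL φ ∈ LinearMap.range (Pn d n) := by
  rw [← (LinearMap.range (Pn d n)).orthogonal_orthogonal]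
  intro f hf
  have h1 : inner ℂ (Pn d n f) (Pn d n f) = 0 := by
    rw [← Pn_symm n]
    exact hf _ ⟨_, rfl⟩
  rw [← inner_conj_symm, mL_perp (inner_self_eq_zero.1 h1), map_zero]

lemma WN_inv (N n : ℕ) : ∀ f ∈ WN d N, Pn d n f ∈ WN d N := by
  intro f hf
  have : WN d N ≤ (WN d N).comap (Pn d n) := by
    refine iSup_le fun k => ?_
    rintro _ ⟨g, rfl⟩
    refine Submodule.mem_iSup_of_mem k ⟨Pn d n g, ?_⟩
    exact (LinearMap.congr_fun (Pn_comm (d := d) k n) g)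
  exact this hf

lemma joint_abs {E : Type} [NormedAddCommGroup E] [InnerProductSpace ℂ E] [FiniteDimensional ℂ E]
    (T : ℕ → E →ₗ[ℂ] E) (hT : ∀ n, (T n).IsSymmetric) (hc : ∀ n m, Commute (T n) (T m)) :
    ∃ (J : Type) (_ : Fintype J) (b : OrthonormalBasis J ℂ E), ∀ j, ∃ p : ℕ → ℂ, ∀ n, T n (b j) = p n • b j := by
  classical
  have htop := LinearMap.IsSymmetric.iSup_iInf_eq_top_of_commute hT (fun n m _ => hc n m)
  have hof := LinearMap.IsSymmetric.orthogonalFamily_iInf_eigenspaces hT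
  let v := fun χ : ℕ → ℂ => stdOrthonormalBasis ℂ (⨅ n, Module.End.eigenspace (T n) (χ n) : Submodule ℂ E)
  have ho := hof.orthonormal_sigma_orthonormal (v_family := fun χ => v χ) (fun χ => (v χ).orthonormal)
  have hfin := ho.linearIndependent.finite
  have hft := Fintype.ofFinite (Σ χ : ℕ → ℂ, Fin (Module.finrank ℂ (⨅ n, Module.End.eigenspace (T n) (χ n) : Submodule ℂ E)))
  have hsp : ⊤ ≤ Submodule.span ℂ (Set.range (fun a : Σ χ : ℕ → ℂ, Fin (Module.finrank ℂ (⨅ n, Module.End.eigenspace (T n) (χ n) : Submodule ℂ E)) => ((v a.1 a.2 : _) : E))) := by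
    rw [← htop]
    refine iSup_le fun χ x hx => ?_
    have : x ∈ (Submodule.span ℂ (Set.range (v χ))).map (Submodule.subtype _) := by
      rw [← (v χ).coe_toBasis, (v χ).toBasis.span_eq]; exact ⟨⟨x, hx⟩, trivial, rfl⟩
    rw [Submodule.map_span] at this
    refine Submodule.span_mono ?_ this
    rintro _ ⟨_, ⟨i, rfl⟩, rfl⟩
    exact ⟨⟨χ, i⟩, rfl⟩
  let b := OrthonormalBasis.mk ho hsp
  have key : ∀ a, ∀ n, T n (b a) = a.1 n • b a := fun a n => by
    have h1 : b a = (v a.1 a.2 : E) := by simp [b]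
    rw [h1]
    exact Module.End.mem_eigenspace_iff.1 ((Submodule.mem_iInf _).1 (v a.1 a.2).2 n)
  exact ⟨Fin _, inferInstance, b.reindex (Fintype.equivFin _), fun j => ⟨((Fintype.equivFin _).symm j).1, fun n => by
    rw [OrthonormalBasis.reindex_apply]; exact key _ n⟩⟩

lemma joint_basis (N : ℕ) : ∃ (J : Type) (_ : Fintype J) (b : OrthonormalBasis J ℂ (WN d N)),
    ∀ j, ∃ p : ℕ → ℂ, ∀ n, Pn d n (b j) = p n • (b j : HS d) := by
  obtain ⟨J, iJ, b, hb⟩ := joint_abs (E := WN d N) (fun n => (Pn d n).restrict (WN_inv N n))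
    (fun n => (Pn_symm n).restrict_invariant _) (fun n m => by
      refine LinearMap.ext fun f => Subtype.ext ?_
      exact LinearMap.congr_fun (Pn_comm (d := d) n m) (f : HS d))
  refine ⟨J, iJ, b, fun j => ?_⟩
  obtain ⟨p, hp⟩ := hb j
  exact ⟨p, fun n => congrArg Subtype.val (hp n)⟩

/-- continuous joint eigenfunction -/
structure EigF (y : C(Sp d, ℂ)) (p : ℕ → ℝ) : Prop where
  ne : y ≠ 0
  ex : ∃ n, p n ≠ 0
  eq : ∀ n (ω : Sp d), ∫ θ, ((⟪(ω:Euc d), (θ:Euc d)⟫^n : ℝ) : ℂ) * y θ ∂sg d = p n * y ω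

lemma cP_toLp (n : ℕ) (y : C(Sp d, ℂ)) (ω : Sp d) : cP n (ContinuousMap.toLp 2 (sg d) ℂ y) ω =
    ∫ θ, ((⟪(ω:Euc d), (θ:Euc d)⟫^n : ℝ) : ℂ) * y θ ∂sg d := by
  rw [cP_apply]
  refine integral_congr_ae ?_
  filter_upwards [ContinuousMap.coeFn_toLp (p := 2) (sg d) (𝕜 := ℂ) y] with θ hθ
  rw [hθ]

lemma eig_cont {N : ℕ} {Y : HS d} (hW : Y ∈ WN d N) (hY : Y ≠ 0) {p : ℕ → ℂ} (h : ∀ n, Pn d n Y = p n • Y) :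
    ∃ (y : C(Sp d, ℂ)) (q : ℕ → ℝ), Y = ContinuousMap.toLp 2 (sg d) ℂ y ∧ EigF y q := by
  have hre : ∀ n, ((p n).re : ℂ) = p n := fun n =>
    Complex.conj_eq_iff_re.1 ((Pn_symm n).conj_eigenvalue_eq_self
      (Module.End.hasEigenvalue_of_hasEigenvector ⟨Module.End.mem_eigenspace_iff.2 (h n), hY⟩))
  have hex : ∃ n, p n ≠ 0 := by
    by_contra! hn
    have : WN d N ≤ (ℂ ∙ Y)ᗮ := by
      refine iSup_le fun k => ?_
      rintro _ ⟨g, rfl⟩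
      rw [Submodule.mem_orthogonal_singleton_iff_inner_right, ← Pn_symm, h, hn]
      simp
    exact hY (inner_self_eq_zero.1 ((Submodule.mem_orthogonal_singleton_iff_inner_right).1 (this hW)))
  obtain ⟨k, hk⟩ := hex
  set y : C(Sp d, ℂ) := (p k)⁻¹ • cP k Y with hy
  have hYy : Y = ContinuousMap.toLp 2 (sg d) ℂ y := by
    rw [hy, map_smul, ← Pn_eq, h, smul_smul, inv_mul_cancel₀ hk, one_smul]
  refine ⟨y, fun n => (p n).re, hYy, ?_, ⟨k, fun h0 => hk (by rw [← hre, h0]; simp)⟩, fun n ω => ?_⟩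
  · intro h0; rw [h0, map_zero] at hYy; exact hY hYy
  · rw [← cP_toLp, ← hYy, hre]
    have : cP n Y = p n • y := by
      apply ContinuousMap.toLp_injective (p := 2) (𝕜 := ℂ) (sg d)
      rw [map_smul, ← Pn_eq, ← hYy, h]
    rw [this]; rfl

namespace EigF
variable {y : C(Sp d, ℂ)} {p : ℕ → ℝ}

lemma pt (h : EigF y p) : ∃ ω, y ω ≠ 0 := by
  by_contra! h0; exact h.ne (ContinuousMap.ext h0)

lemma KKeq (h : EigF y p) (n m : ℕ) (ω : Sp d) : ∫ θ, (KK n m ω θ : ℂ) * y θ ∂sg d = p n * p m * y ω := by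
  have h1 : Pn d m (ContinuousMap.toLp 2 (sg d) ℂ y) = ContinuousMap.toLp 2 (sg d) ℂ ((p m : ℂ) • y) := by
    rw [Pn_eq]; congr 1; ext ω
    rw [cP_toLp, h.eq]; rfl
  have h2 := Pn_Pm n m (ContinuousMap.toLp 2 (sg d) ℂ y) ω
  rw [h1, cP_toLp] at h2
  have h3 : ∫ θ, (KK n m ω θ : ℂ) * y θ ∂sg d = ∫ θ, (KK n m ω θ : ℂ) * ContinuousMap.toLp 2 (sg d) ℂ y θ ∂sg d := by
    refine integral_congr_ae ?_
    filter_upwards [ContinuousMap.coeFn_toLp (p := 2) (sg d) (𝕜 := ℂ) y] with θ hθ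
    rw [hθ]
  rw [h3, ← h2]
  simp only [ContinuousMap.smul_apply, smul_eq_mul]
  have := h.eq n ω
  calc _ = ∫ θ, (p m : ℂ) * (((⟪(ω:Euc d), (θ:Euc d)⟫^n : ℝ) : ℂ) * y θ) ∂sg d := by congr 1; ext θ; ring
    _ = _ := by rw [integral_const_mul, this]; ring

lemma KKint (n m : ℕ) (ω : Sp d) : Integrable (fun θ => (KK n m ω θ : ℂ) * y θ) (sg d) := by
  have hc : Continuous (fun z : Sp d × Sp d => ⟪(ω:Euc d), (z.2:Euc d)⟫^n * ⟪(z.1:Euc d), (z.2:Euc d)⟫^m) := by fun_prop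
  have hm : StronglyMeasurable (fun θ => KK n m ω θ) := hc.stronglyMeasurable.integral_prod_right
  have hy : Integrable y (sg d) := y.continuous.integrable_of_hasCompactSupport (HasCompactSupport.of_compactSpace _)
  refine hy.bdd_mul (c := 1 * (sg d).real Set.univ) (Complex.continuous_ofReal.comp_aestronglyMeasurable hm.aestronglyMeasurable) (.of_forall fun θ => ?_)
  rw [Complex.norm_real, KK]
  refine norm_integral_le_of_norm_le_const (.of_forall fun η => ?_)
  rw [Real.norm_eq_abs, abs_mul, abs_pow, abs_pow]
  exact mul_le_one₀ (pow_le_one₀ (abs_nonneg _) (abs_sp_le _ _)) (by positivity) (pow_le_one₀ (abs_nonneg _) (abs_sp_le _ _))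

lemma odd (h : EigF y p) (n m : ℕ) (ho : Odd (n+m)) : p n * p m = 0 := by
  obtain ⟨ω, hω⟩ := h.pt
  have := h.KKeq n m ω
  simp only [KK_odd n m ho, Complex.ofReal_zero, zero_mul, integral_zero] at this
  have h2 := (mul_eq_zero.1 this.symm).resolve_right hω
  exact_mod_cast h2

lemma recu (h : EigF y p) (n m : ℕ) : ((n:ℝ)*(n+d-2) - m*(m+d-2)) * (p n * p m) =
    n*(n-1)*(p (n-2) * p m) - m*(m-1)*(p n * p (m-2)) := by
  obtain ⟨ω, hω⟩ := h.pt
  have e : ∫ θ, ((((n:ℝ)*(n+d-2) - m*(m+d-2) : ℝ):ℂ)) * ((KK n m ω θ : ℂ) * y θ) ∂sg d =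
      ∫ θ, (((n:ℝ)*(n-1) : ℝ):ℂ) * ((KK (n-2) m ω θ : ℂ) * y θ) - (((m:ℝ)*(m-1) : ℝ):ℂ) * ((KK n (m-2) ω θ : ℂ) * y θ) ∂sg d := by
    refine integral_congr_ae (.of_forall fun θ => ?_)
    simp only
    have := congrArg (fun x : ℝ => (x:ℂ) * y θ) (KK_rec n m ω θ)
    push_cast at this ⊢
    linear_combination this
  rw [integral_sub ((KKint _ _ _).const_mul _) ((KKint _ _ _).const_mul _), integral_const_mul, integral_const_mul,
    integral_const_mul, h.KKeq, h.KKeq, h.KKeq] at e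
  have e2 := mul_right_cancel₀ hω (a := ((((n:ℝ)*(n+d-2) - m*(m+d-2)) * (p n * p m) : ℝ):ℂ))
    (c := ((n*(n-1)*(p (n-2) * p m) - m*(m-1)*(p n * p (m-2)) : ℝ) : ℂ)) (by push_cast at e ⊢; linear_combination e)
  exact_mod_cast e2

lemma bd (h : EigF y p) (n : ℕ) : |p n| ≤ (sg d).real Set.univ := by
  have h1 : ‖(p n : ℂ) • y‖ ≤ (sg d).real Set.univ * ‖y‖ := by
    refine (ContinuousMap.norm_le _ (by positivity)).2 fun ω => ?_
    rw [ContinuousMap.smul_apply, smul_eq_mul, ← h.eq, mul_comm]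
    refine norm_integral_le_of_norm_le_const (.of_forall fun θ => ?_)
    rw [norm_mul, Complex.norm_real, Real.norm_eq_abs, abs_pow]
    exact (mul_le_of_le_one_left (norm_nonneg _) (pow_le_one₀ (abs_nonneg _) (abs_sp_le _ _))).trans (y.norm_coe_le_norm θ)
  rw [norm_smul, Complex.norm_real] at h1
  exact le_of_mul_le_mul_right h1 (norm_pos_iff.2 h.ne)
end EigF
end


lemma hsc {E : Type*} [AddCommMonoid E] [TopologicalSpace E] {f g : ℕ → E} {v : E} (h : ∀ n, f n = g n) (hg : HasSum g v) : HasSum f v := by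
  rwa [funext h]

def ef (q : ℕ → ℝ) (s : ℝ) : ℝ := ∑' n, q n * s^n / n.factorial

lemma ef_hs {q : ℕ → ℝ} {Λ : ℝ} (hq : ∀ n, |q n| ≤ Λ) (s : ℝ) : HasSum (fun n => q n * s^n / n.factorial) (ef q s) := by
  refine Summable.hasSum (((Real.summable_pow_div_factorial |s|).mul_left Λ).of_norm_bounded fun n => ?_)
  rw [mul_div_assoc, norm_mul, norm_div, norm_pow]
  simp only [Real.norm_eq_abs, Nat.abs_cast]
  gcongr; exact hq n

lemma ef_sh {a : ℕ → ℝ} {s v : ℝ} (h : HasSum (fun n => a n * s^n / n.factorial) v) :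
    HasSum (fun n : ℕ => n * a (n-1) * s^n / n.factorial) (s*v) := by
  rw [← hasSum_nat_add_iff' 1]
  simp only [Finset.range_one, Finset.sum_singleton, Nat.cast_zero, zero_mul, zero_div, sub_zero]
  refine hsc (fun n => ?_) (h.mul_left s)
  rw [Nat.factorial_succ, Nat.add_sub_cancel]; push_cast
  have : (n.factorial:ℝ) ≠ 0 := by positivity
  field_simp; ring

lemma ef_deriv {q : ℕ → ℝ} {Λ : ℝ} (hq : ∀ n, |q n| ≤ Λ) (s : ℝ) : HasDerivAt (ef q) (ef (fun n => q (n+1)) s) s := by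
  have e : ef (fun n => q (n+1)) s = ∑' n : ℕ, q n * (n * s^(n-1)) / n.factorial := by
    rw [tsum_eq_zero_add' (f := fun n : ℕ => q n * (n * s^(n-1)) / n.factorial)]
    · simp only [Nat.cast_zero, zero_mul, mul_zero, zero_div, zero_add]
      refine tsum_congr fun n => ?_
      rw [Nat.factorial_succ, Nat.add_sub_cancel]; push_cast
      have : (n.factorial:ℝ) ≠ 0 := by positivity
      field_simp
    · refine (summable_congr fun n => ?_).2 (ef_hs (q := fun n => q (n+1)) (fun n => hq _) s).summable
      rw [Nat.factorial_succ, Nat.add_sub_cancel]; push_cast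
      have : (n.factorial:ℝ) ≠ 0 := by positivity
      field_simp
  rw [e]
  have hΛ : 0 ≤ Λ := (abs_nonneg _).trans (hq 0)
  have hsum : Summable (fun n : ℕ => Λ * (n * (|s|+1)^(n-1) / n.factorial)) := by
    refine Summable.mul_left _ ?_
    rw [← summable_nat_add_iff 1]
    refine (summable_congr fun n => ?_).2 (Real.summable_pow_div_factorial (|s|+1))
    rw [Nat.factorial_succ, Nat.add_sub_cancel]; push_cast
    have : (n.factorial:ℝ) ≠ 0 := by positivity
    field_simp
  refine hasDerivAt_tsum_of_isPreconnected (t := Metric.ball 0 (|s|+1)) (y₀ := 0) hsum Metric.isOpen_ball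
    (convex_ball _ _).isPreconnected (fun n y _ => (((hasDerivAt_pow n y).const_mul (q n)).div_const _)) (fun n y hy => ?_)
    (Metric.mem_ball_self (by positivity)) (ef_hs hq 0).summable (by simp)
  rw [mul_div_assoc, norm_mul, norm_div, norm_mul, norm_pow]
  simp only [Real.norm_eq_abs, Nat.abs_cast]
  have : |y| ≤ |s|+1 := by simpa using (Metric.mem_ball.1 hy).le
  gcongr; exact hq n

lemma ef_bd {q : ℕ → ℝ} {Λ : ℝ} (hq : ∀ n, |q n| ≤ Λ) {s : ℝ} (hs : 0 ≤ s) : |ef q s| ≤ Λ * Real.exp s := by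
  have h1 : HasSum (fun n : ℕ => Λ * (s^n / n.factorial)) (Λ * Real.exp s) := by
    rw [Real.exp_eq_exp_ℝ]; exact (NormedSpace.expSeries_div_hasSum_exp s).mul_left _
  rw [← Real.norm_eq_abs, ← (ef_hs hq s).tsum_eq]
  refine tsum_of_norm_bounded h1 fun n => ?_
  rw [mul_div_assoc, norm_mul, Real.norm_eq_abs, Real.norm_of_nonneg (by positivity)]
  gcongr; exact hq n

lemma ser_bd {a : ℕ → ℝ} {Λ s v : ℝ} (k : ℕ) (hs0 : 0 ≤ s) (hs : s ≤ 1) (ha : ∀ n, |a n| ≤ Λ * (n+1)) (h0 : ∀ n < k, a n = 0)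
    (hv : HasSum (fun n => a n * s^n / n.factorial) v) : |v| ≤ 2 * Λ * Real.exp 1 * s^k := by
  have hΛ : 0 ≤ Λ := by have := (abs_nonneg _).trans (ha 0); simpa using this
  have h1 : HasSum (fun n : ℕ => (1:ℝ) * 1^n / n.factorial) (Real.exp 1) := by
    rw [Real.exp_eq_exp_ℝ]; simpa using (NormedSpace.expSeries_div_hasSum_exp (1:ℝ))
  have h2 := ((ef_sh h1).add h1).mul_left (Λ * s^k)
  rw [← Real.norm_eq_abs, ← hv.tsum_eq]
  refine (tsum_of_norm_bounded h2 fun n => ?_).trans (le_of_eq (by ring))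
  rcases lt_or_ge n k with hn | hn
  · simp only [h0 n hn, zero_mul, zero_div, norm_zero]; positivity
  · rw [mul_div_assoc, norm_mul, Real.norm_eq_abs, Real.norm_of_nonneg (by positivity)]
    calc |a n| * (s^n/n.factorial) ≤ (Λ*(n+1)) * (s^k/n.factorial) := by
          exact mul_le_mul (ha n) (div_le_div_of_nonneg_right (pow_le_pow_of_le_one hs0 hs hn) (by positivity)) (by positivity) (by positivity)
      _ = _ := by simp; ring

namespace EigF
section
variable {d : ℕ} [NeZero d] {y : C(Sp d, ℂ)} {p : ℕ → ℝ}

open Classical in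
def l (h : EigF y p) : ℕ := Nat.find h.ex

lemma l_ne (h : EigF y p) : p h.l ≠ 0 := by classical exact Nat.find_spec h.ex
lemma lt_l (h : EigF y p) {n : ℕ} (hn : n < h.l) : p n = 0 := by
  classical
  have := Nat.find_min h.ex hn
  simpa using this

lemma podd (h : EigF y p) {n : ℕ} (hn : Odd (n + h.l)) : p n = 0 := (mul_eq_zero.1 (h.odd n h.l hn)).resolve_right h.l_ne

lemma prec (h : EigF y p) (n : ℕ) : ((n:ℝ)*(n+d-2) - h.l*(h.l+d-2)) * p n = n*(n-1)*p (n-2) := by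
  have h1 := h.recu n h.l
  have h2 : (h.l:ℝ)*(h.l-1)*p (h.l-2) = 0 := by
    rcases Nat.lt_or_ge h.l 2 with h3 | h3
    · interval_cases h.l <;> simp
    · rw [h.lt_l (by omega), mul_zero]
  refine mul_right_cancel₀ h.l_ne ?_
  linear_combination h1 - p n * h2

def c (h : EigF y p) (n : ℕ) : ℝ := (Complex.I^n * (-Complex.I)^h.l).re
def q (h : EigF y p) (n : ℕ) : ℝ := h.c n * p n

lemma c_two (h : EigF y p) (n : ℕ) : h.c (n+2) = - h.c n := by simp [c, pow_add]

lemma q_eq (h : EigF y p) (n : ℕ) : Complex.I^n * p n = Complex.I^h.l * h.q n := by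
  rcases Nat.even_or_odd (n + h.l) with hn | hn
  · have hc : ((h.c n : ℝ) : ℂ) = Complex.I^n * (-Complex.I)^h.l := by
      refine Complex.conj_eq_iff_re.1 ?_
      simp only [map_mul, map_pow, map_neg, Complex.conj_I, neg_neg]
      rw [neg_pow Complex.I n, neg_pow Complex.I h.l]
      have : (-1:ℂ)^n = (-1)^h.l := by
        rcases Nat.even_or_odd n with h1 | h1
        · rw [h1.neg_one_pow, ((Nat.even_add.1 hn).1 h1).neg_one_pow]
        · rw [h1.neg_one_pow, (Nat.not_even_iff_odd.1 (fun h2 => Nat.not_even_iff_odd.2 h1 ((Nat.even_add.1 hn).2 h2))).neg_one_pow]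
      rw [this]; ring
    rw [q, Complex.ofReal_mul, hc]
    have : Complex.I^h.l * (-Complex.I)^h.l = 1 := by rw [← mul_pow]; simp
    linear_combination (-(Complex.I^n * p n)) * this
  · simp [q, h.podd hn]

lemma q_bd (h : EigF y p) (n : ℕ) : |h.q n| ≤ (sg d).real Set.univ := by
  have : |h.c n| ≤ 1 := (Complex.abs_re_le_norm _).trans (by simp)
  rw [q, abs_mul]
  exact (mul_le_of_le_one_left (abs_nonneg _) this).trans (h.bd n)

lemma qrec (h : EigF y p) (n : ℕ) : ((n:ℝ)*(n+d-2) - h.l*(h.l+d-2)) * h.q n = -(n*(n-1)*h.q (n-2)) := by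
  have h1 := h.prec n
  match n, h1 with
  | 0, h1 => rw [q, mul_left_comm, h1]; simp
  | 1, h1 => rw [q, mul_left_comm, h1]; simp
  | n+2, h1 =>
    rw [q, mul_left_comm, h1, c_two, show n+2-2 = n by omega, q]; ring

def F (h : EigF y p) : ℝ → ℝ := ef h.q
def F1 (h : EigF y p) : ℝ → ℝ := ef (fun n => h.q (n+1))
def F2 (h : EigF y p) : ℝ → ℝ := ef (fun n => h.q (n+2))

lemma ode (h : EigF y p) (s : ℝ) : s^2 * h.F2 s + (d-1)*s*h.F1 s + (s^2 - h.l*(h.l+d-2)) * h.F s = 0 := by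
  have a2 := ef_sh (ef_sh (ef_hs (q := fun n => h.q (n+2)) (fun n => h.q_bd _) s))
  have a1 := ef_sh (ef_hs (q := fun n => h.q (n+1)) (fun n => h.q_bd _) s)
  have a0 := ef_hs h.q_bd s
  have b0 := ef_sh (ef_sh a0)
  have := ((a2.add (a1.mul_left (d-1:ℝ))).add b0).sub (a0.mul_left (h.l*(h.l+d-2):ℝ))
  have h0 := this.unique (f := _) (a₂ := 0) (by
    refine hsc (fun n => ?_) hasSum_zero
    have hr := h.qrec n
    match n, hr with
    | 0, hr => norm_num [Nat.factorial] at hr ⊢; tauto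
    | 1, hr =>
      simp only [Nat.cast_one, Nat.factorial, pow_one, Nat.sub_self, Nat.zero_add, Nat.cast_zero, zero_mul, mul_zero] at hr ⊢
      push_cast
      linear_combination s * hr
    | n+2, hr =>
      simp only [show n+2-1-1 = n by omega, show n+2-2 = n by omega, show n+2-1+1 = n+2 by omega, show n+2-1 = n+1 by omega] at hr ⊢
      push_cast at hr ⊢
      linear_combination (s^(n+2)/(n+2).factorial) * hr)
  simp only [F, F1, F2]
  linear_combination h0

def be (d : ℕ) : ℝ := ((d:ℝ)-1)/2
lemma be_nn : 0 ≤ be d := by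
  have : (1:ℝ) ≤ d := by exact_mod_cast NeZero.pos d
  unfold be; linarith

def hh (h : EigF y p) (s : ℝ) : ℝ := s^(be d) * h.F s
def hh' (h : EigF y p) (s : ℝ) : ℝ := be d * s^(be d - 1) * h.F s + s^(be d) * h.F1 s

lemma dF (h : EigF y p) (s : ℝ) : HasDerivAt h.F (h.F1 s) s := ef_deriv h.q_bd s
lemma dF1 (h : EigF y p) (s : ℝ) : HasDerivAt h.F1 (h.F2 s) s := ef_deriv (fun n => h.q_bd _) s

lemma dh (h : EigF y p) {s : ℝ} (hs : 0 < s) : HasDerivAt h.hh (h.hh' s) s :=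
  (Real.hasDerivAt_rpow_const (p := be d) (Or.inl hs.ne')).mul (h.dF s)

lemma dh' (h : EigF y p) {s : ℝ} (hs : 0 < s) : HasDerivAt h.hh'
    (-(1 - (h.l + be d)*(h.l + be d - 1)/s^2) * h.hh s) s := by
  have := (((Real.hasDerivAt_rpow_const (p := be d - 1) (Or.inl hs.ne')).const_mul (be d)).mul (h.dF s)).add
    ((Real.hasDerivAt_rpow_const (p := be d) (Or.inl hs.ne')).mul (h.dF1 s))
  refine this.congr_deriv ?_
  have o := h.ode s
  rw [hh, Real.rpow_sub_one hs.ne' (be d - 1), Real.rpow_sub_one hs.ne']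
  have e : (d:ℝ) = 2 * be d + 1 := by unfold be; ring
  rw [e] at o
  field_simp
  linear_combination o

lemma hbd (h : EigF y p) {s : ℝ} (hs : 0 < s) (hs1 : s ≤ 16) :
    |h.hh s| ≤ (16:ℝ)^(be d) * ((sg d).real Set.univ * Real.exp 16) := by
  rw [hh, abs_mul, abs_of_nonneg (by positivity)]
  have := ef_bd h.q_bd hs.le
  have h2 : (sg d).real Set.univ * Real.exp s ≤ (sg d).real Set.univ * Real.exp 16 := by gcongr
  exact mul_le_mul (Real.rpow_le_rpow hs.le hs1 be_nn) (this.trans h2) (abs_nonneg _) (by positivity)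

lemma hn0 (h : EigF y p) {s : ℝ} (hs : 0 < s) (hs1 : s ≤ 1) :
    |h.hh s| ≤ (2 * (sg d).real Set.univ * Real.exp 1) * s^((h.l:ℝ) + be d) := by
  have := ser_bd h.l hs.le hs1 (Λ := (sg d).real Set.univ) (fun n => (h.q_bd n).trans
    (le_mul_of_one_le_right (by positivity) (by linarith [Nat.cast_nonneg (α := ℝ) n])))
    (fun n hn => by simp [q, h.lt_l hn]) (ef_hs h.q_bd s)
  rw [hh, abs_mul, abs_of_nonneg (by positivity), Real.rpow_add hs, Real.rpow_natCast]
  calc _ ≤ s^be d * (2 * (sg d).real Set.univ * Real.exp 1 * s^h.l) := by gcongr; exact this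
    _ = _ := by ring

lemma hn1 (h : EigF y p) {s : ℝ} (hs : 0 < s) (hs1 : s ≤ 1) :
    |s * h.hh' s - (h.l + be d) * h.hh s| ≤ (2 * ((h.l+1) * (sg d).real Set.univ) * Real.exp 1) * s^((h.l:ℝ) + be d + 2) := by
  have a1 := ef_sh (ef_hs (q := fun n => h.q (n+1)) (fun n => h.q_bd _) s)
  have a0 := (ef_hs h.q_bd s).mul_left (h.l:ℝ)
  have a : HasSum (fun n : ℕ => (((n:ℝ) - h.l) * h.q n) * s^n / n.factorial) (s * h.F1 s - h.l * h.F s) := by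
    refine hsc (fun n => ?_) (a1.sub a0)
    rcases n with _ | n
    · simp
    · simp only [show n+1-1+1 = n+1 by omega]; push_cast; ring
  have := ser_bd (h.l+2) hs.le hs1 (Λ := (h.l+1) * (sg d).real Set.univ) (fun n => ?_) (fun n hn => ?_) a
  · have e : s * h.hh' s - (h.l + be d) * h.hh s = s^be d * (s * h.F1 s - h.l * h.F s) := by
      rw [hh, hh', Real.rpow_sub_one hs.ne']; field_simp; ring
    rw [e, abs_mul, abs_of_nonneg (by positivity), Real.rpow_add hs, Real.rpow_add hs, Real.rpow_natCast]
    calc _ ≤ s^be d * (2 * ((h.l+1) * (sg d).real Set.univ) * Real.exp 1 * s^(h.l+2)) := by gcongr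
      _ = _ := by rw [pow_add]; norm_cast; ring
  · rw [abs_mul]
    have h1 : |(n:ℝ) - h.l| ≤ (h.l+1)*(n+1) := by
      rw [abs_le]; constructor <;> nlinarith [Nat.cast_nonneg (α := ℝ) n, Nat.cast_nonneg (α := ℝ) h.l, mul_nonneg (Nat.cast_nonneg (α := ℝ) n) (Nat.cast_nonneg (α := ℝ) h.l)]
    calc _ ≤ ((h.l+1)*(n+1)) * (sg d).real Set.univ := by gcongr; exact h.q_bd n
      _ = _ := by ring
  · rcases lt_trichotomy n h.l with h1 | h1 | h1
    · simp [q, h.lt_l h1]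
    · simp [h1]
    · have : n = h.l + 1 := by omega
      rw [q, h.podd (n := n) ⟨h.l, by omega⟩]; simp

lemma fourier (h : EigF y p) (s : ℝ) (ω : Sp d) :
    ∫ θ, Complex.exp (Complex.I * ((s * ⟪(ω:Euc d), (θ:Euc d)⟫ : ℝ) : ℂ)) * y θ ∂sg d = Complex.I^h.l * h.F s * y ω := by
  have hy : Integrable y (sg d) := y.continuous.integrable_of_hasCompactSupport (HasCompactSupport.of_compactSpace _)
  have h1 := hasSum_integral_of_dominated_convergence (μ := sg d)
    (F := fun (n : ℕ) (θ : Sp d) => (Complex.I * ((s * ⟪(ω:Euc d), (θ:Euc d)⟫ : ℝ) : ℂ))^n / n.factorial * y θ)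
    (f := fun θ => Complex.exp (Complex.I * ((s * ⟪(ω:Euc d), (θ:Euc d)⟫ : ℝ) : ℂ)) * y θ)
    (bound := fun n θ => |s|^n / n.factorial * ‖y θ‖) (fun n => Continuous.aestronglyMeasurable (by fun_prop))
    (fun n => .of_forall fun θ => ?_) (.of_forall fun θ => (Real.summable_pow_div_factorial |s|).mul_right _) ?_
    (.of_forall fun θ => ?_)
  · have h2 : HasSum (fun n : ℕ => (Complex.I^h.l * y ω) * ((h.q n * s^n / n.factorial : ℝ) : ℂ)) ((Complex.I^h.l * y ω) * (h.F s : ℂ)) :=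
      (Complex.hasSum_ofReal.2 (ef_hs h.q_bd s)).mul_left _
    have := h1.unique (by
      refine hsc (fun n => ?_) h2
      have e : ∀ θ : Sp d, (Complex.I * ((s * ⟪(ω:Euc d), (θ:Euc d)⟫ : ℝ) : ℂ))^n / n.factorial * y θ =
        (Complex.I^n * s^n/n.factorial) * (((⟪(ω:Euc d), (θ:Euc d)⟫^n : ℝ) : ℂ) * y θ) := fun θ => by
          push_cast; ring
      simp_rw [e]
      rw [integral_const_mul, h.eq]
      have := h.q_eq n
      push_cast
      linear_combination (s^n/n.factorial * y ω) * this)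
    rw [this]; ring
  · rw [norm_mul, norm_div, norm_pow, norm_mul, Complex.norm_I, one_mul, Complex.norm_real, Real.norm_eq_abs, abs_mul]
    simp only [Complex.norm_natCast]
    gcongr
    exact mul_le_of_le_one_right (abs_nonneg _) (abs_sp_le _ _)
  · simp_rw [tsum_mul_right]; exact hy.norm.const_mul _
  · rw [Complex.exp_eq_exp_ℂ]
    exact HasSum.mul_right (y θ) (NormedSpace.expSeries_div_hasSum_exp (Complex.I * ((s * ⟪(ω:Euc d), (θ:Euc d)⟫ : ℝ) : ℂ)))
end
end EigF


def IT {d : ℕ} (f : Euc d → ℂ) (x : Euc d) : ℂ := ∫ ξ : Euc d, Complex.exp (Complex.I * ((⟪x, ξ⟫ : ℝ) : ℂ)) * f ξ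

lemma memsq {α : Type*} [MeasurableSpace α] {μ : Measure α} {f : α → ℂ} (hf : AEStronglyMeasurable f μ) :
    MemLp f 2 μ ↔ Integrable (fun x => ‖f x‖^2) μ := memLp_two_iff_integrable_sq_norm hf

lemma lp_norm_sq {α : Type*} [MeasurableSpace α] {μ : Measure α} (f : Lp ℂ 2 μ) : ‖f‖^2 = ∫ x, ‖f x‖^2 ∂μ := by
  have := inner_self_eq_norm_sq (𝕜 := ℂ) f
  rw [← this, L2.inner_def]
  simp_rw [inner_self_eq_norm_sq_to_K]
  have : ∫ x, ((‖f x‖ : ℝ) : ℂ)^2 ∂μ = ((∫ x, ‖f x‖^2 ∂μ : ℝ) : ℂ) := by rw [← integral_complex_ofReal]; push_cast; rfl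
  exact (congrArg Complex.re this).trans (Complex.ofReal_re _)

section
variable {d : ℕ}
open FourierTransform in
lemma FT_eq (g : SchwartzMap (Euc d) ℂ) (x : Euc d) : FT (⇑g) x = 𝓕 g ((2*Real.pi)⁻¹ • x) := by
  rw [SchwartzMap.fourier_coe, Real.fourier_eq', FT]
  refine integral_congr_ae (.of_forall fun v => ?_)
  simp only [smul_eq_mul, inner_smul_right]
  congr 2
  push_cast
  have : (Real.pi:ℂ) ≠ 0 := by simp [Real.pi_ne_zero]
  field_simp

open FourierTransform in
lemma pl_core {u v : Euc d → ℂ} (hu : MemLp u 2 volume) (hv : LocallyIntegrable v volume)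
    (h : ∀ g : SchwartzMap (Euc d) ℂ, ∫ ξ, v ξ * g ξ = ∫ x, u x * (𝓕 g) x) : MemLp v 2 volume ∧ ∫ x, ‖v x‖^2 = ∫ x, ‖u x‖^2 := by
  set U : Lp ℂ 2 (volume : Measure (Euc d)) := hu.toLp u
  set W : Lp ℂ 2 (volume : Measure (Euc d)) := 𝓕 U
  have hW : MemLp W 2 volume := Lp.memLp W
  have key : v =ᵐ[volume] W := by
    refine ae_eq_of_integral_contDiff_smul_eq hv (hW.locallyIntegrable (by norm_num)) fun g hg hc => ?_
    have hc' : HasCompactSupport (fun x => (g x : ℂ)) := hc.comp_left (g := Complex.ofReal) rfl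
    have hg' : ContDiff ℝ (⊤ : ℕ∞) (fun x => (g x : ℂ)) := Complex.ofRealCLM.contDiff.comp hg
    let G : SchwartzMap (Euc d) ℂ := hc'.toSchwartzMap hg'
    have h1 := h G
    have h2 := congrArg (fun T => T G) (Lp.fourier_toTemperedDistribution_eq U)
    simp only [Lp.toTemperedDistribution_apply, TemperedDistribution.fourier_apply, smul_eq_mul] at h2
    have e1 : ∫ x, g x • v x = ∫ x, v x * G x := integral_congr_ae (.of_forall fun x => by
      show g x • v x = v x * (g x : ℂ); rw [Complex.real_smul, mul_comm])
    have e2 : ∫ x, g x • W x = ∫ x, G x * W x := integral_congr_ae (.of_forall fun x => by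
      show g x • W x = (g x : ℂ) * W x; rw [Complex.real_smul])
    rw [e1, e2, h1, ← h2]
    refine integral_congr_ae ?_
    filter_upwards [hu.coeFn_toLp] with x hx
    rw [hx, mul_comm]
  refine ⟨(memLp_congr_ae key).2 hW, ?_⟩
  have e1 : ∫ x, ‖v x‖^2 = ∫ x, ‖W x‖^2 := integral_congr_ae (by filter_upwards [key] with x hx; simp only [hx])
  have e2 : ∫ x, ‖u x‖^2 = ∫ x, ‖U x‖^2 := integral_congr_ae (by filter_upwards [hu.coeFn_toLp] with x hx; simp only [U, hx])
  rw [e1, e2, ← lp_norm_sq, ← lp_norm_sq, Lp.norm_fourier_eq]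

open FourierTransform in
lemma pl_is {u v : Euc d → ℂ} (hu : MemLp u 2 volume) (hv : LocallyIntegrable v volume)
    (h : IsFourierTransformOf u v) : MemLp v 2 volume ∧ ∫ x, ‖v x‖^2 = (2*Real.pi)^d * ∫ x, ‖u x‖^2 := by
  have hpi : (0:ℝ) < 2*Real.pi := by positivity
  set c : ℝ := (2*Real.pi)^d
  have hc : 0 < c := by positivity
  set u2 : Euc d → ℂ := fun x => (c:ℂ) * u ((2*Real.pi) • x)
  have hs : ∀ f : Euc d → ℝ, ∫ x, f ((2*Real.pi) • x) = c⁻¹ * ∫ x, f x := fun f => by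
    rw [Measure.integral_comp_smul volume f, smul_eq_mul, finrank_euclideanSpace, Fintype.card_fin, abs_of_pos (by positivity)]
  have hsC : ∀ f : Euc d → ℂ, ∫ x, f ((2*Real.pi) • x) = (c:ℂ)⁻¹ * ∫ x, f x := fun f => by
    rw [Measure.integral_comp_smul volume f, finrank_euclideanSpace, Fintype.card_fin, abs_of_pos (by positivity), Complex.real_smul]
    push_cast [c]; rfl
  have hq : Measure.QuasiMeasurePreserving (fun x : Euc d => (2*Real.pi) • x) := by
    exact ⟨measurable_const_smul _, by rw [Measure.map_addHaar_smul _ hpi.ne']; exact Measure.smul_absolutelyContinuous⟩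
  have hm : AEStronglyMeasurable u2 volume := (hu.1.comp_quasiMeasurePreserving hq).const_mul _
  have hu2 : MemLp u2 2 volume := by
    rw [memsq hm]
    have := (integrable_comp_smul_iff volume (fun x => ‖u x‖^2) hpi.ne').2 ((memsq hu.1).1 hu)
    simpa [u2, mul_pow] using this.const_mul (c^2)
  have := pl_core hu2 hv fun g => by
    rw [h g]
    have := hsC (fun x => u x * (𝓕 g) ((2*Real.pi)⁻¹ • x))
    simp only [inv_smul_smul₀ hpi.ne'] at this
    simp_rw [FT_eq, u2, mul_assoc, integral_const_mul, this]
    rw [mul_inv_cancel_left₀ (by exact_mod_cast hc.ne')]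
  refine ⟨this.1, this.2.trans ?_⟩
  have e := hs (fun x => ‖u x‖^2)
  simp_rw [u2, norm_mul, mul_pow, integral_const_mul, e]
  rw [Complex.norm_real, Real.norm_of_nonneg hc.le]; field_simp

lemma cexp_n (r : ℝ) : ‖Complex.exp (Complex.I * (r:ℂ))‖ = 1 := by rw [mul_comm]; exact Complex.norm_exp_ofReal_mul_I r

lemma IT_bd {f : Euc d → ℂ} (x : Euc d) : ‖IT f x‖ ≤ ∫ ξ, ‖f ξ‖ :=
  (norm_integral_le_integral_norm _).trans (le_of_eq (by simp_rw [norm_mul, cexp_n, one_mul]))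

lemma IT_int {f : Euc d → ℂ} (hf : Integrable f) (x : Euc d) :
    Integrable (fun ξ : Euc d => Complex.exp (Complex.I * ((⟪x, ξ⟫ : ℝ) : ℂ)) * f ξ) :=
  hf.bdd_mul (c := 1) (Continuous.aestronglyMeasurable (by fun_prop)) (.of_forall fun ξ => (cexp_n _).le)

lemma IT_cont {f : Euc d → ℂ} (hf : Integrable f) : Continuous (IT f) :=
  continuous_of_dominated (bound := fun ξ => ‖f ξ‖) (fun x => (IT_int hf x).1)
    (fun x => .of_forall fun ξ => by rw [norm_mul, cexp_n, one_mul]) hf.norm (.of_forall fun ξ => by fun_prop)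

lemma plan {f : Euc d → ℂ} (hf : Integrable f) (hf2 : MemLp f 2 volume) :
    MemLp (IT f) 2 volume ∧ ∫ x, ‖IT f x‖^2 = (2*Real.pi)^d * ∫ x, ‖f x‖^2 := by
  have hmp : MeasurePreserving (fun x : Euc d => -x) := Measure.measurePreserving_neg volume
  have h1 := pl_is (u := fun x => f (-x)) (v := IT f) (hf2.comp_measurePreserving hmp) (IT_cont hf).locallyIntegrable (fun g => by
    have e : ∫ x, f (-x) * FT (⇑g) x = ∫ x, f x * FT (⇑g) (-x) := by
      rw [← integral_neg_eq_self (fun x => f x * FT (⇑g) (-x))]; simp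
    rw [e]
    have hg : Integrable g := g.integrable
    have hF : Integrable (fun p : Euc d × Euc d => Complex.exp (Complex.I * ((⟪p.1, p.2⟫ : ℝ) : ℂ)) * (g p.1 * f p.2)) (volume.prod volume) :=
      (hg.mul_prod hf).bdd_mul (c := 1) (Continuous.aestronglyMeasurable (by fun_prop)) (.of_forall fun ξ => (cexp_n _).le)
    have := integral_integral_swap (f := fun x ξ => Complex.exp (Complex.I * ((⟪x, ξ⟫ : ℝ) : ℂ)) * (g x * f ξ)) hF
    convert this using 1
    · refine integral_congr_ae (.of_forall fun x => ?_)
      simp only [IT]; rw [← integral_mul_const]; congr 1; ext; ring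
    · refine integral_congr_ae (.of_forall fun x => ?_)
      simp only [FT]; rw [← integral_const_mul]; congr 1; ext
      rw [inner_neg_right]; push_cast; ring_nf)
  rw [integral_neg_eq_self (fun x => ‖f x‖^2)] at h1
  exact h1
end


structure NiceC (k : ℝ → ℂ) (a b M : ℝ) : Prop where
  meas : Measurable k
  bdd : ∀ r, ‖k r‖ ≤ M
  pos : 0 < a
  supp : ∀ r, ¬ (a ≤ r ∧ r ≤ b) → k r = 0

lemma NiceC.re {k : ℝ → ℂ} {a b M : ℝ} (h : NiceC k a b M) : Nice (fun r => (k r).re) a b M :=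
  ⟨Complex.measurable_re.comp h.meas, fun r => (Complex.abs_re_le_norm _).trans (h.bdd r), h.pos, fun r hr => by simp [h.supp r hr]⟩
lemma NiceC.im {k : ℝ → ℂ} {a b M : ℝ} (h : NiceC k a b M) : Nice (fun r => (k r).im) a b M :=
  ⟨Complex.measurable_im.comp h.meas, fun r => (Complex.abs_im_le_norm _).trans (h.bdd r), h.pos, fun r hr => by simp [h.supp r hr]⟩
lemma Nice.toC {k : ℝ → ℝ} {a b M : ℝ} (h : Nice k a b M) : NiceC (fun r => (k r : ℂ)) a b M :=
  ⟨Complex.measurable_ofReal.comp h.meas, fun r => by simpa using h.bdd r, h.pos, fun r hr => by simp [h.supp r hr]⟩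

def HopC (h : ℝ → ℝ) (k : ℝ → ℂ) (x : ℝ) : ℂ := ∫ r, (h (x*r) : ℂ) * k r

lemma bdd_int {d : ℕ} {F : Type} [NormedAddCommGroup F] {f : Euc d → F} (hf : AEStronglyMeasurable f volume) {C b : ℝ} (h : ∀ x, ‖f x‖ ≤ C)
    (h0 : ∀ x, b < ‖x‖ → f x = 0) : Integrable f := by
  refine IntegrableOn.integrable_of_forall_notMem_eq_zero (s := Metric.closedBall 0 b) ?_ (fun x hx => h0 x (by simpa using hx))
  exact Measure.integrableOn_of_bounded (M := C) measure_closedBall_lt_top.ne hf (.of_forall fun x => h x)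

lemma bdd_l2 {d : ℕ} {f : Euc d → ℂ} (hf : AEStronglyMeasurable f volume) {C b : ℝ} (h : ∀ x, ‖f x‖ ≤ C)
    (h0 : ∀ x, b < ‖x‖ → f x = 0) : MemLp f 2 volume := by
  rw [memsq hf]
  refine bdd_int (C := C^2) (b := b) (hf.norm.pow 2) (fun x => ?_) (fun x hx => by simp [h0 x hx])
  rw [norm_pow, norm_norm]; exact pow_le_pow_left₀ (norm_nonneg _) (h x) 2

section
variable {d : ℕ} [NeZero d]

def dir (ξ : Euc d) : Sp d := ⟨if ξ = 0 then EuclideanSpace.single 0 1 else ‖ξ‖⁻¹ • ξ, by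
  split_ifs with h
  · simp
  · simp [norm_smul, inv_mul_cancel₀ (norm_ne_zero_iff.2 h)]⟩

lemma dir_meas : Measurable (dir : Euc d → Sp d) :=
  Measurable.subtype_mk (Measurable.ite (measurableSet_singleton _) measurable_const (by fun_prop))

lemma dir_smul {r : ℝ} (hr : 0 < r) (ω : Sp d) : dir (r • (ω : Euc d)) = ω := by
  ext1
  have h1 : ‖(ω:Euc d)‖ = 1 := by simp
  have : r • (ω:Euc d) ≠ 0 := smul_ne_zero hr.ne' (by rw [← norm_ne_zero_iff, h1]; norm_num)
  simp only [dir, if_neg this, norm_smul, h1, mul_one, Real.norm_of_nonneg hr.le, inv_smul_smul₀ hr.ne']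

lemma smul_dir (x : Euc d) : ‖x‖ • (dir x : Euc d) = x := by
  by_cases h : x = 0
  · simp [h]
  · simp only [dir, if_neg h]; rw [smul_inv_smul₀ (norm_ne_zero_iff.2 h)]

lemma norm_sp {r : ℝ} (hr : 0 < r) (ω : Sp d) : ‖r • (ω : Euc d)‖ = r := by
  rw [norm_smul, Real.norm_of_nonneg hr.le]; simp

def blk (k : ℝ → ℂ) (y : C(Sp d, ℂ)) (ξ : Euc d) : ℂ := ((‖ξ‖^(-EigF.be d) : ℝ) : ℂ) * k ‖ξ‖ * y (dir ξ)

variable {k : ℝ → ℂ} {a b M : ℝ} {y : C(Sp d, ℂ)} {p : ℕ → ℝ}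

lemma blk_meas (hk : Measurable k) : Measurable (blk k y) := by
  have h1 : Measurable fun ξ : Euc d => y (dir ξ) := y.continuous.measurable.comp dir_meas
  have h2 : Measurable fun ξ : Euc d => k ‖ξ‖ := hk.comp measurable_norm
  have h3 : Measurable fun ξ : Euc d => ((‖ξ‖^(-EigF.be d) : ℝ) : ℂ) := by fun_prop
  exact (h3.mul h2).mul h1

lemma blk_bd (hk : NiceC k a b M) (ξ : Euc d) : ‖blk k y ξ‖ ≤ a^(-EigF.be d) * M * ‖y‖ := by
  have hM : 0 ≤ M := (norm_nonneg _).trans (hk.bdd 0)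
  have ha := hk.pos
  by_cases h : a ≤ ‖ξ‖ ∧ ‖ξ‖ ≤ b
  · rw [blk, norm_mul, norm_mul, Complex.norm_real, Real.norm_of_nonneg (by positivity)]
    have := Real.rpow_le_rpow_of_nonpos hk.pos h.1 (neg_nonpos.2 (EigF.be_nn (d := d)))
    gcongr
    · exact hk.bdd _
    · exact y.norm_coe_le_norm _
  · rw [blk, hk.supp _ h]; simp; positivity

lemma blk_zero (hk : NiceC k a b M) (ξ : Euc d) (h : b < ‖ξ‖) : blk k y ξ = 0 := by
  rw [blk, hk.supp _ (fun h1 => by linarith [h1.2])]; simp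

lemma blk_int (hk : NiceC k a b M) : Integrable (blk k y) := bdd_int (blk_meas hk.meas).aestronglyMeasurable (blk_bd hk) (blk_zero hk)
lemma blk_l2 (hk : NiceC k a b M) : MemLp (blk k y) 2 volume := bdd_l2 (blk_meas hk.meas).aestronglyMeasurable (blk_bd hk) (blk_zero hk)

lemma be_pow {r : ℝ} (hr : 0 < r) : r^(d-1) = r^(EigF.be d) * r^(EigF.be d) := by
  rw [← Real.rpow_natCast, ← Real.rpow_add hr, Nat.cast_sub NeZero.one_le]; unfold EigF.be; push_cast; ring_nf

lemma blk_IT (h : EigF y p) (hk : NiceC k a b M) {ρ : ℝ} (hρ : 0 < ρ) (ω : Sp d) :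
    IT (blk k y) (ρ • (ω : Euc d)) = blk (fun x => Complex.I^h.l * HopC h.hh k x) y (ρ • (ω : Euc d)) := by
  have hm : Measurable fun ξ : Euc d => Complex.exp (Complex.I * ((⟪ρ • (ω : Euc d), ξ⟫ : ℝ) : ℂ)) * blk k y ξ :=
    Measurable.mul (Continuous.measurable (by fun_prop)) (blk_meas hk.meas)
  have hi := (polar_iff hm).1 (IT_int (blk_int hk) _)
  rw [IT, polar_int hm, integral_prod_symm _ hi, blk, norm_sp hρ, dir_smul hρ]
  have e : ∀ r ∈ Set.Ioi (0:ℝ), ∫ θ : Sp d, r^(d-1) • (Complex.exp (Complex.I * ((⟪ρ • (ω : Euc d), r • (θ : Euc d)⟫ : ℝ) : ℂ)) * blk k y (r • (θ:Euc d))) ∂sg d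
      = (((ρ^(-EigF.be d) : ℝ) : ℂ) * Complex.I^h.l * y ω) * ((h.hh (ρ*r) : ℂ) * k r) := fun r hr => by
    have hr : 0 < r := hr
    have e1 : ∀ θ : Sp d, r^(d-1) • (Complex.exp (Complex.I * ((⟪ρ • (ω : Euc d), r • (θ : Euc d)⟫ : ℝ) : ℂ)) * blk k y (r • (θ:Euc d))) =
      ((r^(EigF.be d) : ℝ) * k r) * (Complex.exp (Complex.I * (((ρ*r) * ⟪(ω : Euc d), (θ : Euc d)⟫ : ℝ) : ℂ)) * y θ) := fun θ => by
        rw [blk, norm_sp hr, dir_smul hr, real_inner_smul_left, real_inner_smul_right, ← mul_assoc ρ, Complex.real_smul, be_pow hr, Real.rpow_neg hr.le]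
        have : ((r^EigF.be d : ℝ) : ℂ) ≠ 0 := by exact_mod_cast (by positivity : r^EigF.be d ≠ 0)
        push_cast; field_simp
    simp_rw [e1]
    rw [integral_const_mul, h.fourier, EigF.hh, Real.mul_rpow hρ.le hr.le, Real.rpow_neg hρ.le]
    have : ((ρ^EigF.be d : ℝ) : ℂ) ≠ 0 := by exact_mod_cast (by positivity : ρ^EigF.be d ≠ 0)
    push_cast; field_simp
  rw [setIntegral_congr_fun measurableSet_Ioi e, integral_const_mul, setIntegral_eq_integral_of_forall_compl_eq_zero, HopC]
  · ring
  · intro r hr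
    rw [hk.supp r (fun h1 => hr (hk.pos.trans_le h1.1)), mul_zero]

lemma ae_dir {f g : Euc d → ℂ} (h : ∀ ρ : ℝ, 0 < ρ → ∀ ω : Sp d, f (ρ • (ω:Euc d)) = g (ρ • (ω:Euc d))) : f =ᵐ[volume] g := by
  have : ∀ᵐ x : Euc d, x ≠ 0 := by simp [ae_iff]
  filter_upwards [this] with x hx
  have := h ‖x‖ (norm_pos_iff.2 hx) (dir x)
  rwa [smul_dir] at this

lemma nrm {J : Type} [Fintype J] {y : J → C(Sp d, ℂ)} {N : J → ℝ≥0∞}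
    (hY : ∀ c : J → ℂ, ∫⁻ ω, ‖∑ j, c j * y j ω‖ₑ^2 ∂sg d = ∑ j, N j * ‖c j‖ₑ^2) {c : J → ℝ → ℂ} (hc : ∀ j, Measurable (c j)) :
    ∫⁻ x : Euc d, ‖∑ j, blk (c j) (y j) x‖ₑ^2 = ∑ j, N j * ∫⁻ r in Set.Ioi (0:ℝ), ‖c j r‖ₑ^2 := by
  have hm : Measurable fun x : Euc d => ∑ j, blk (c j) (y j) x := Finset.measurable_sum _ fun j _ => blk_meas (hc j)
  rw [polar_lint (hm.enorm.pow_const 2)]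
  simp_rw [← lintegral_const_mul _ ((hc _).enorm.pow_const 2)]
  rw [← lintegral_finsetSum _ (fun j _ => ((hc j).enorm.pow_const 2).const_mul _)]
  refine setLIntegral_congr_fun measurableSet_Ioi fun r hr => ?_
  have hr : 0 < r := hr
  have e : ∀ ω : Sp d, ‖∑ j, blk (c j) (y j) (r • (ω:Euc d))‖ₑ^2 = ‖((r^(-EigF.be d) : ℝ) : ℂ)‖ₑ^2 * ‖∑ j, c j r * y j ω‖ₑ^2 := fun ω => by
    rw [← mul_pow, ← enorm_mul, Finset.mul_sum]
    simp only [blk, norm_sp hr, dir_smul hr, mul_assoc]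
  simp only [e]
  rw [lintegral_const_mul _ (by fun_prop), hY, ← mul_assoc]
  have : ENNReal.ofReal (r^(d-1)) * ‖((r^(-EigF.be d) : ℝ) : ℂ)‖ₑ^2 = 1 := by
    rw [← ofReal_norm_eq_enorm, Complex.norm_real, Real.norm_of_nonneg (by positivity), ← ENNReal.ofReal_pow (by positivity),
      ← ENNReal.ofReal_mul (by positivity), be_pow hr, Real.rpow_neg hr.le]
    have : r^EigF.be d ≠ 0 := by positivity
    field_simp; simp
  rw [this, one_mul]
end


lemma en_sq {α : Type*} [MeasurableSpace α] {μ : Measure α} {f : α → ℂ} (h : MemLp f 2 μ) :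
    ∫⁻ x, ‖f x‖ₑ^2 ∂μ = ENNReal.ofReal (∫ x, ‖f x‖^2 ∂μ) := by
  rw [ofReal_integral_eq_lintegral_ofReal ((memsq h.1).1 h) (.of_forall fun _ => by positivity)]
  simp_rw [ENNReal.ofReal_pow (norm_nonneg _), ofReal_norm_eq_enorm]

lemma planl {d : ℕ} {f : Euc d → ℂ} (hf : Integrable f) (hf2 : MemLp f 2 volume) :
    ∫⁻ x, ‖IT f x‖ₑ^2 = ENNReal.ofReal ((2*Real.pi)^d) * ∫⁻ x, ‖f x‖ₑ^2 := by
  have := plan hf hf2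
  rw [en_sq this.1, en_sq hf2, this.2, ENNReal.ofReal_mul (by positivity)]

lemma niceC_l {k : ℝ → ℂ} {a b M : ℝ} (hk : NiceC k a b M) :
    ∫⁻ r in Set.Ioi (0:ℝ), ‖k r‖ₑ^2 = ENNReal.ofReal (∫ r, ((k r).re^2 + (k r).im^2)) := by
  rw [ofReal_integral_eq_lintegral_ofReal (f := fun r => (k r).re^2 + (k r).im^2) (hk.re.sq.add hk.im.sq) (.of_forall fun _ => by positivity),
    ← lintegral_indicator measurableSet_Ioi]
  refine lintegral_congr fun r => ?_
  by_cases hr : r ∈ Set.Ioi (0:ℝ)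
  · rw [Set.indicator_of_mem hr, ← ofReal_norm_eq_enorm, ← ENNReal.ofReal_pow (norm_nonneg _), Complex.sq_norm, Complex.normSq_apply]
    ring_nf
  · rw [Set.indicator_of_notMem hr, hk.supp r (fun h => hr (hk.pos.trans_le h.1))]; simp

def TopC (h : ℝ → ℝ) (t : ℝ) (k : ℝ → ℂ) (x : ℝ) : ℂ := HopC h (fun r => if nn t r < x then k r else 0) x

lemma NiceC.cut {k : ℝ → ℂ} {a b M : ℝ} (hk : NiceC k a b M) (t x : ℝ) : NiceC (fun r => if nn t r < x then k r else 0) a b M := by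
  have hM : 0 ≤ M := (norm_nonneg _).trans (hk.bdd 0)
  refine ⟨Measurable.ite (measurableSet_lt (by unfold nn; fun_prop) measurable_const) hk.meas measurable_const, fun r => ?_, hk.pos, fun r hr => ?_⟩
  · split_ifs; exacts [hk.bdd r, by simpa]
  · simp [hk.supp r hr]

namespace EigF
section
variable {d : ℕ} [NeZero d] {y : C(Sp d, ℂ)} {p : ℕ → ℝ} {k : ℝ → ℂ} {a b M : ℝ}

lemma Fcont (h : EigF y p) : Continuous h.F := continuous_iff_continuousAt.2 fun s => (h.dF s).continuousAt
lemma hh_cont (h : EigF y p) : Continuous h.hh := (Real.continuous_rpow_const be_nn).mul h.Fcont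

lemma TopC_meas (h : EigF y p) (hk : NiceC k a b M) (t : ℝ) : Measurable (TopC h.hh t k) := by
  have : Measurable fun q : ℝ × ℝ => (h.hh (q.1*q.2) : ℂ) * (if nn t q.2 < q.1 then k q.2 else 0) :=
    Measurable.mul (Complex.measurable_ofReal.comp (h.hh_cont.measurable.comp (by fun_prop)))
      (Measurable.ite (measurableSet_lt (by unfold nn; fun_prop) measurable_fst) (hk.meas.comp measurable_snd) measurable_const)
  exact this.stronglyMeasurable.integral_prod_right.measurable

lemma HopC_meas (h : EigF y p) (hk : NiceC k a b M) : Measurable (HopC h.hh k) := by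
  have : Measurable fun q : ℝ × ℝ => (h.hh (q.1*q.2) : ℂ) * k q.2 :=
    Measurable.mul (Complex.measurable_ofReal.comp (h.hh_cont.measurable.comp (by fun_prop))) (hk.meas.comp measurable_snd)
  exact this.stronglyMeasurable.integral_prod_right.measurable

lemma hop_l (h : EigF y p) (hk : NiceC k a b M) : ∫⁻ r in Set.Ioi (0:ℝ), ‖HopC h.hh k r‖ₑ^2 =
    ENNReal.ofReal ((2*Real.pi)^d) * ∫⁻ r in Set.Ioi (0:ℝ), ‖k r‖ₑ^2 := by
  set N : ℝ≥0∞ := ∫⁻ ω, ‖y ω‖ₑ^2 ∂sg d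
  have hY : ∀ c : Unit → ℂ, ∫⁻ ω, ‖∑ j, c j * y ω‖ₑ^2 ∂sg d = ∑ j, N * ‖c j‖ₑ^2 := fun c => by
    simp only [Finset.univ_unique, Finset.sum_singleton, enorm_mul, mul_pow]
    rw [lintegral_const_mul _ (by fun_prop), mul_comm]
  have hy : MemLp y 2 (sg d) := (memsq y.continuous.aestronglyMeasurable).2
    (Continuous.integrable_of_hasCompactSupport (by fun_prop) (HasCompactSupport.of_compactSpace _))
  have hN : N ≠ ⊤ := by simp only [N, en_sq hy]; exact ENNReal.ofReal_ne_top
  have hN0 : N ≠ 0 := by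
    simp only [N]
    rw [Ne, lintegral_eq_zero_iff (by fun_prop)]
    intro h0
    refine h.ne (ContinuousMap.ext fun ω => ?_)
    have h1 : (y : Sp d → ℂ) =ᵐ[sg d] 0 := by filter_upwards [h0] with ω hω; simpa using hω
    exact congrFun ((Continuous.ae_eq_iff_eq (sg d) y.continuous continuous_zero).1 h1) ω
  have h1 := planl (blk_int (y := y) hk) (blk_l2 hk)
  have h2 : ∫⁻ x, ‖IT (blk k y) x‖ₑ^2 = ∫⁻ x, ‖∑ j : Unit, blk (fun x => Complex.I^h.l * HopC h.hh k x) y x‖ₑ^2 := by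
    refine lintegral_congr_ae ?_
    filter_upwards [ae_dir (f := IT (blk k y)) (fun ρ hρ ω => blk_IT h hk hρ ω)] with x hx
    simp [hx]
  have h3 := nrm (y := fun _ : Unit => y) hY (c := fun _ => k) (fun _ => hk.meas)
  rw [h2, nrm (y := fun _ : Unit => y) hY (fun _ => (h.HopC_meas hk).const_mul _)] at h1
  simp only [Finset.univ_unique, Finset.sum_singleton, enorm_mul, enorm_pow] at h1 h3
  rw [h3, mul_left_comm] at h1
  have h4 := (ENNReal.mul_right_inj hN0 hN).1 h1
  simpa [enorm_eq_nnnorm] using h4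

lemma HopC_re (h : EigF y p) (hk : NiceC k a b M) (x : ℝ) : HopC h.hh k x =
    (Hop h.hh (fun r => (k r).re) x : ℂ) + (Hop h.hh (fun r => (k r).im) x : ℂ) * Complex.I := by
  have hi : ∀ {g : ℝ → ℝ}, Nice g a b M → Integrable (fun r => h.hh (x*r) * g r) := fun {g} hg => by
    have := (hg.integrable).norm
    obtain ⟨C, hC⟩ := (isCompact_Icc (a := a) (b := b)).exists_bound_of_continuousOn (f := fun r => h.hh (x*r)) (h.hh_cont.comp (by fun_prop)).continuousOn
    refine (this.const_mul C).mono' ((h.hh_cont.comp (by fun_prop)).aestronglyMeasurable.mul hg.meas.aestronglyMeasurable) (.of_forall fun r => ?_)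
    by_cases hr : a ≤ r ∧ r ≤ b
    · rw [norm_mul]; exact mul_le_mul_of_nonneg_right (hC r hr) (norm_nonneg _)
    · simp [hg.supp r hr]
  simp only [HopC, Hop]
  rw [← integral_complex_ofReal, ← integral_complex_ofReal, ← integral_mul_const, ← integral_add (hi hk.re).ofReal ((hi hk.im).ofReal.mul_const _)]
  refine integral_congr_ae (.of_forall fun r => ?_)
  simp only []
  conv_lhs => rw [← Complex.re_add_im (k r)]
  push_cast; ring

lemma TopC_re (h : EigF y p) (hk : NiceC k a b M) (t x : ℝ) : TopC h.hh t k x =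
    (Top' h.hh t (fun r => (k r).re) x : ℂ) + (Top' h.hh t (fun r => (k r).im) x : ℂ) * Complex.I := by
  rw [TopC, h.HopC_re (hk.cut t x)]
  congr 2
  · simp only [Hop, Top']; congr 2; ext r; split_ifs <;> simp
  · simp only [Hop, Top']; congr 3; ext r; split_ifs <;> simp

lemma iso_l (h : EigF y p) {g : ℝ → ℝ} (hg : Nice g a b M) :
    ∫⁻ x in Set.Ioi (0:ℝ), ENNReal.ofReal (Hop h.hh g x^2) = ENNReal.ofReal ((2*Real.pi)^d * ∫ r, g r^2) := by
  have := h.hop_l hg.toC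
  rw [niceC_l hg.toC, ← ENNReal.ofReal_mul (by positivity)] at this
  simp only [Complex.ofReal_re, Complex.ofReal_im, ne_eq, OfNat.ofNat_ne_zero, not_false_eq_true, zero_pow, add_zero] at this
  rw [← this]
  refine lintegral_congr fun x => ?_
  rw [h.HopC_re hg.toC, ← ofReal_norm_eq_enorm, ← ENNReal.ofReal_pow (norm_nonneg _)]
  simp [Hop]

def sec (h : EigF y p) : Sec ((16:ℝ)^(be d) * ((sg d).real Set.univ * Real.exp 16)) ((2*Real.pi)^d) where
  h := h.hh
  h' := h.hh'
  p := h.l + be d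
  B' := 2 * ((h.l+1) * (sg d).real Set.univ) * Real.exp 1
  hp := by have := be_nn (d := d); positivity
  hd _ hs := h.dh hs
  hd' _ hs := h.dh' hs
  bd _ hs hs1 := h.hbd hs hs1
  n0 s hs hs1 := (h.hn0 hs hs1).trans (by
    gcongr; exact le_mul_of_one_le_left (by positivity) (by linarith [Nat.cast_nonneg (α := ℝ) h.l]))
  n1 _ hs hs1 := h.hn1 hs hs1
  isoI g a b M hg := by
    have hm : AEStronglyMeasurable (fun x => Hop h.hh g x^2) (volume.restrict (Set.Ioi 0)) := by
      have := ((h.HopC_meas hg.toC)).re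
      simp only [h.HopC_re hg.toC] at this
      simp [Hop] at this
      exact (this.pow_const 2).aestronglyMeasurable
    refine ⟨hm, ?_⟩
    rw [hasFiniteIntegral_iff_ofReal (.of_forall fun _ => by positivity), h.iso_l hg]
    exact ENNReal.ofReal_lt_top
  iso g a b M hg := by
    have hm : AEStronglyMeasurable (fun x => Hop h.hh g x^2) (volume.restrict (Set.Ioi 0)) := by
      have := ((h.HopC_meas hg.toC)).re
      simp only [h.HopC_re hg.toC] at this
      simp [Hop] at this
      exact (this.pow_const 2).aestronglyMeasurable
    rw [integral_eq_lintegral_of_nonneg_ae (.of_forall fun _ => by positivity) hm, h.iso_l hg, ENNReal.toReal_ofReal (by positivity)]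

lemma top_l (h : EigF y p) (hk : NiceC k a b M) {M' t : ℝ} (hM : ∀ x, |deriv Real.smoothTransition x| ≤ M' ∧
    |deriv (deriv Real.smoothTransition) x| ≤ M') (ht : 0 < t) (hbt : 8 * b ≤ t) :
    ∫⁻ r in Set.Ioi (0:ℝ), ‖TopC h.hh t k r‖ₑ^2 ≤
    ENNReal.ofReal (Sec.C1 ((16:ℝ)^(be d) * ((sg d).real Set.univ * Real.exp 16)) ((2*Real.pi)^d) M') * ∫⁻ r in Set.Ioi (0:ℝ), ‖k r‖ₑ^2 := by
  have h1 := h.sec.main1 hM hk.re ht hbt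
  have h2 := h.sec.main1 hM hk.im ht hbt
  have e : ∀ r, ‖TopC h.hh t k r‖ₑ^2 = ENNReal.ofReal (Top' h.sec.h t (fun r => (k r).re) r^2 + Top' h.sec.h t (fun r => (k r).im) r^2) := fun r => by
    rw [h.TopC_re hk, ← ofReal_norm_eq_enorm, ← ENNReal.ofReal_pow (norm_nonneg _), Complex.sq_norm, Complex.normSq_apply]
    simp [sec]; ring_nf
  simp_rw [e]
  rw [← ofReal_integral_eq_lintegral_ofReal (f := fun r => Top' h.sec.h t (fun r => (k r).re) r^2 + Top' h.sec.h t (fun r => (k r).im) r^2) (Integrable.add h1.1 h2.1) (.of_forall fun _ => by positivity), niceC_l hk,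
    ← ENNReal.ofReal_mul' (integral_nonneg fun _ => by positivity)]
  refine ENNReal.ofReal_le_ofReal ?_
  rw [integral_add h1.1 h2.1, integral_add hk.re.sq hk.im.sq, mul_add]
  exact add_le_add h1.2 h2.2
end
end EigF

section
variable {d : ℕ} [NeZero d]

def AF (t : ℝ) (f : Euc d → ℂ) (x : Euc d) : ℂ := IT (fun ξ => if nn t ‖ξ‖ < ‖x‖ then f ξ else 0) x

lemma blk_bound : ∃ C : ℝ≥0∞, C ≠ ⊤ ∧ ∀ (J : Type) (_ : Fintype J) (y : J → C(Sp d, ℂ)) (p : J → ℕ → ℝ) (_ : ∀ j, EigF (y j) (p j))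
    (_ : ∀ c : J → ℂ, ∫⁻ ω, ‖∑ j, c j * y j ω‖ₑ^2 ∂sg d = ∑ j, 1 * ‖c j‖ₑ^2) (k : J → ℝ → ℂ) (a b M : J → ℝ) (t : ℝ)
    (_ : ∀ j, NiceC (k j) (a j) (b j) (M j)) (_ : 0 < t) (_ : ∀ j, 8 * b j ≤ t),
    ∫⁻ x : Euc d, ‖AF t (fun ξ => ∑ j, blk (k j) (y j) ξ) x‖ₑ^2 ≤ C * ∫⁻ ξ : Euc d, ‖∑ j, blk (k j) (y j) ξ‖ₑ^2 := by
  obtain ⟨M', -, hM⟩ := eta_bound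
  refine ⟨_, ENNReal.ofReal_ne_top (r := Sec.C1 ((16:ℝ)^(EigF.be d) * ((sg d).real Set.univ * Real.exp 16)) ((2*Real.pi)^d) M'), ?_⟩
  intro J _ y p h hY k a b M t hk ht hb
  rw [nrm hY (fun j => (hk j).meas)]
  have e : AF t (fun ξ => ∑ j, blk (k j) (y j) ξ) =ᵐ[volume] fun x => ∑ j, blk (fun x => Complex.I^(h j).l * TopC (h j).hh t (k j) x) (y j) x := by
    refine ae_dir fun ρ hρ ω => ?_
    have e1 : (fun ξ : Euc d => if nn t ‖ξ‖ < ‖ρ • (ω:Euc d)‖ then ∑ j, blk (k j) (y j) ξ else 0) = fun ξ => ∑ j, blk (fun r => if nn t r < ρ then k j r else 0) (y j) ξ := by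
      ext ξ
      rw [norm_sp hρ]
      split_ifs with hc <;> simp [blk, hc]
    rw [AF, e1, IT]
    simp_rw [Finset.mul_sum]
    rw [integral_finsetSum _ fun j _ => IT_int (blk_int ((hk j).cut t ρ)) _]
    refine Finset.sum_congr rfl fun j _ => ?_
    have := blk_IT (h j) ((hk j).cut t ρ) hρ ω
    rw [IT] at this
    rw [this]
    simp only [blk, norm_sp hρ, TopC]
  rw [lintegral_congr_ae (g := fun x => ‖∑ j, blk (fun x => Complex.I^(h j).l * TopC (h j).hh t (k j) x) (y j) x‖ₑ^2)
    (by filter_upwards [e] with x hx; simp only [hx]), nrm hY (fun j => ((h j).TopC_meas (hk j) t).const_mul _), Finset.mul_sum]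
  refine Finset.sum_le_sum fun j _ => ?_
  have := (h j).top_l (hk j) hM ht (hb j)
  simpa [enorm_mul, enorm_eq_nnnorm] using this
end


def gg (R : ℝ) (n : ℕ) (r : ℝ) : ℝ := Real.smoothTransition ((n+1)*r-1) * Real.smoothTransition ((n+1)*(R-r)-1)

lemma gg_smooth (R : ℝ) (n : ℕ) : ContDiff ℝ (⊤ : ℕ∞) (gg R n) := by
  unfold gg
  exact (Real.smoothTransition.contDiff.comp (by fun_prop)).mul (Real.smoothTransition.contDiff.comp (by fun_prop))

lemma gg_nice (R : ℝ) (n : ℕ) : Nice (gg R n) (1/(n+1)) R 1 := by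
  refine ⟨(gg_smooth R n).continuous.measurable, fun r => ?_, by positivity, fun r hr => ?_⟩
  · unfold gg
    rw [abs_of_nonneg (mul_nonneg (Real.smoothTransition.nonneg _) (Real.smoothTransition.nonneg _))]
    exact mul_le_one₀ (Real.smoothTransition.le_one _) (Real.smoothTransition.nonneg _) (Real.smoothTransition.le_one _)
  · have hn : (0:ℝ) < n+1 := by positivity
    unfold gg
    rcases not_and_or.1 hr with h | h
    · rw [Real.smoothTransition.zero_of_nonpos, zero_mul]
      rw [not_le, lt_div_iff₀ hn] at h; linarith
    · rw [Real.smoothTransition.zero_of_nonpos (x := (n+1)*(R-r)-1), mul_zero]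
      nlinarith

lemma gg_pos {R r : ℝ} (h0 : 0 < r) (h1 : r < R) : ∃ n, gg R n r ≠ 0 := by
  obtain ⟨n, hn⟩ := exists_nat_gt (1/r + 1/(R-r))
  have hR : 0 < R - r := by linarith
  have a1 : 1/r < n+1 := by have : 0 < 1/(R-r) := by positivity
                            linarith
  have a2 : 1/(R-r) < n+1 := by have : 0 < 1/r := by positivity
                                linarith
  rw [div_lt_iff₀ (by assumption)] at a1 a2
  exact ⟨n, (mul_pos (Real.smoothTransition.pos_of_pos (by linarith)) (Real.smoothTransition.pos_of_pos (by linarith))).ne'⟩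

section
variable {d : ℕ}

lemma l2_int {f : Euc d → ℂ} {R : ℝ} (hf : MemLp f 2 volume) (h0 : ∀ ξ, R < ‖ξ‖ → f ξ = 0) : Integrable f := by
  refine IntegrableOn.integrable_of_forall_notMem_eq_zero (s := Metric.closedBall 0 R) ?_ (fun x hx => h0 x (by simpa using hx))
  have : IsFiniteMeasure (volume.restrict (Metric.closedBall (0:Euc d) R)) := ⟨by simpa using measure_closedBall_lt_top⟩
  exact (hf.restrict _).integrable (by norm_num)

lemma dens_all [NeZero d] {f : Euc d → ℂ} {R : ℝ} (hf : MemLp f 2 volume) (h0 : ∀ ξ, R < ‖ξ‖ → f ξ = 0)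
    (h : ∀ n b, IT (fun ξ => (gg R n ‖ξ‖ : ℂ) * f ξ) b = 0) : f =ᵐ[volume] 0 := by
  have h1 : ∀ n : ℕ, ∀ᵐ ξ : Euc d, (gg R n ‖ξ‖ : ℂ) * f ξ = 0 := fun n => by
    have hm : AEStronglyMeasurable (fun ξ : Euc d => (gg R n ‖ξ‖ : ℂ)) volume :=
      (Complex.continuous_ofReal.comp ((gg_smooth R n).continuous.comp continuous_norm)).aestronglyMeasurable
    have hb : ∀ ξ : Euc d, ‖(gg R n ‖ξ‖ : ℂ)‖ ≤ 1 := fun ξ => by simpa using (gg_nice R n).bdd ‖ξ‖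
    have h2 : MemLp (fun ξ => (gg R n ‖ξ‖ : ℂ) * f ξ) 2 volume := hf.of_le (hm.mul hf.1) (.of_forall fun ξ => by
      rw [norm_mul]; exact mul_le_of_le_one_left (norm_nonneg _) (hb ξ))
    have h3 := (plan (l2_int (R := R) h2 (fun ξ hξ => by rw [h0 ξ hξ, mul_zero])) h2).2
    simp only [h n, norm_zero, ne_eq, OfNat.ofNat_ne_zero, not_false_eq_true, zero_pow, integral_zero] at h3
    have h4 := (mul_eq_zero.1 h3.symm).resolve_left (by positivity)
    rw [integral_eq_zero_iff_of_nonneg (fun _ => by positivity) ((memsq h2.1).1 h2)] at h4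
    filter_upwards [h4] with ξ hξ; simpa using hξ
  have h5 : ∀ᵐ ξ : Euc d, ξ ≠ 0 := by simp [ae_iff]
  have h6 : ∀ᵐ ξ : Euc d, ‖ξ‖ ≠ R := by
    have : volume (Metric.sphere (0:Euc d) R) = 0 := Measure.addHaar_sphere _ _ _
    rw [ae_iff]; convert this using 2; ext; simp
  filter_upwards [ae_all_iff.2 h1, h5, h6] with ξ a1 a2 a3
  rcases lt_or_gt_of_ne a3 with h7 | h7
  · obtain ⟨n, hn⟩ := gg_pos (norm_pos_iff.2 a2) h7
    exact (mul_eq_zero.1 (a1 n)).resolve_left (by exact_mod_cast hn)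
  · exact h0 ξ h7

abbrev mR (d : ℕ) (R : ℝ) : Measure (Euc d) := volume.restrict (Metric.closedBall 0 R)
instance (R : ℝ) : IsFiniteMeasure (mR d R) := ⟨by simpa using measure_closedBall_lt_top⟩

lemma bL {R C : ℝ} {f : Euc d → ℂ} (hf : AEStronglyMeasurable f volume) (h : ∀ x, ‖f x‖ ≤ C) : MemLp f 2 (mR d R) :=
  MemLp.of_bound hf.restrict C (.of_forall h)

lemma memLp_ind {R : ℝ} {f : Euc d → ℂ} (hf : MemLp f 2 (mR d R)) : MemLp ((Metric.closedBall 0 R).indicator f) 2 volume :=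
  (memLp_indicator_iff_restrict measurableSet_closedBall).2 hf

variable [NeZero d]
/-- generators -/
def genS (d : ℕ) [NeZero d] (R : ℝ) : Set (Lp ℂ 2 (mR d R)) := {F | ∃ (n : ℕ) (φ : Fin n → Fin d) (G : ℝ → ℂ) (a M : ℝ),
  NiceC G a R M ∧ F =ᵐ[mR d R] fun ξ => G ‖ξ‖ * mc φ (dir ξ)}

lemma mc_bd {n : ℕ} (φ : Fin n → Fin d) (ω : Sp d) : ‖mc φ ω‖ ≤ ‖mc φ‖ := (mc φ).norm_coe_le_norm ω

lemma gen_mem {R a M : ℝ} {G : ℝ → ℂ} (hG : NiceC G a R M) {n : ℕ} (φ : Fin n → Fin d) : MemLp (fun ξ => G ‖ξ‖ * mc φ (dir ξ)) 2 (mR d R) :=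
  bL (C := M * ‖mc φ‖) ((hG.meas.comp measurable_norm).mul ((mc φ).continuous.measurable.comp dir_meas)).aestronglyMeasurable fun ξ => by
    rw [norm_mul]; exact mul_le_mul (hG.bdd _) (mc_bd φ _) (norm_nonneg _) ((norm_nonneg _).trans (hG.bdd 0))

lemma gen_dense (R : ℝ) : (Submodule.span ℂ (genS d R)).topologicalClosure = ⊤ := by
  rw [Submodule.topologicalClosure_eq_top_iff, Submodule.eq_bot_iff]
  intro F hF
  have hF1 : ∀ s ∈ genS d R, inner ℂ s F = 0 := fun s hs => (Submodule.mem_orthogonal _ _).1 hF s (Submodule.subset_span hs)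
  set K := Metric.closedBall (0:Euc d) R
  set f : Euc d → ℂ := K.indicator F
  have hFm := Lp.memLp F
  have hf : MemLp f 2 volume := memLp_ind hFm
  have h0 : ∀ ξ, R < ‖ξ‖ → f ξ = 0 := fun ξ hξ => Set.indicator_of_notMem (by simpa [K] using hξ) _
  have hfi := l2_int hf h0
  have horth : ∀ {a M : ℝ} {G : ℝ → ℝ}, Nice G a R M → ∀ {n : ℕ} (φ : Fin n → Fin d), ∫ ξ, (G ‖ξ‖ : ℂ) * mc φ (dir ξ) * f ξ = 0 := by
    intro a M G hG n φ
    have h1 := hF1 _ ⟨n, φ, _, a, M, hG.toC, (gen_mem hG.toC φ).coeFn_toLp⟩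
    rw [L2.inner_def] at h1
    rw [← h1, ← integral_indicator measurableSet_closedBall]
    have h2 : (gen_mem hG.toC φ).toLp _ =ᵐ[mR d R] _ := (gen_mem hG.toC φ).coeFn_toLp
    have h3 := (ae_restrict_iff' measurableSet_closedBall).1 h2
    refine integral_congr_ae ?_
    filter_upwards [h3] with ξ hξ
    by_cases hk : ξ ∈ Metric.closedBall (0:Euc d) R
    · rw [Set.indicator_of_mem hk, hξ hk, show f ξ = F ξ from Set.indicator_of_mem hk _]
      have : starRingEnd ℂ (mc φ (dir ξ)) = mc φ (dir ξ) := by simp [mc]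
      simp [this]; ring
    · rw [Set.indicator_of_notMem hk, show f ξ = 0 from Set.indicator_of_notMem hk _, mul_zero]
  have key := dens_all hf h0 fun n b => by
    set g := gg R n
    have hg := gg_nice R n
    have hm : ∀ m : ℕ, Nice (fun r => r^m * g r) (1/(n+1)) R (|R|^m * 1) := fun m => ⟨by have := hg.meas; fun_prop, fun r => by
      by_cases hr : 1/((n:ℝ)+1) ≤ r ∧ r ≤ R
      · have : 0 ≤ r := hg.pos.le.trans hr.1
        rw [abs_mul, abs_pow, abs_of_nonneg this]
        exact mul_le_mul (pow_le_pow_left₀ this (hr.2.trans (le_abs_self R)) m) (hg.bdd r) (abs_nonneg _) (by positivity)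
      · rw [show g r = 0 from hg.supp r hr, mul_zero, abs_zero]
        positivity, hg.pos, fun r hr => by rw [show g r = 0 from hg.supp r hr, mul_zero]⟩
    have hgm : AEStronglyMeasurable (fun ξ : Euc d => (g ‖ξ‖ : ℂ)) volume :=
      (Complex.continuous_ofReal.comp ((gg_smooth R n).continuous.comp continuous_norm)).aestronglyMeasurable
    have hgf : Integrable (fun ξ => (g ‖ξ‖ : ℂ) * f ξ) := hfi.bdd_mul (c := 1) hgm (.of_forall fun ξ => by simpa using hg.bdd ‖ξ‖)
    have h1 := hasSum_integral_of_dominated_convergence (μ := volume)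
      (F := fun (m : ℕ) (ξ : Euc d) => (Complex.I * ((⟪b, ξ⟫ : ℝ) : ℂ))^m / m.factorial * ((g ‖ξ‖ : ℂ) * f ξ))
      (f := fun ξ => Complex.exp (Complex.I * ((⟪b, ξ⟫ : ℝ) : ℂ)) * ((g ‖ξ‖ : ℂ) * f ξ))
      (bound := fun m ξ => (‖b‖*R)^m / m.factorial * ‖(g ‖ξ‖ : ℂ) * f ξ‖)
      (fun m => (Continuous.aestronglyMeasurable (by fun_prop)).mul hgf.1)
      (fun m => .of_forall fun ξ => ?_) (.of_forall fun ξ => (Real.summable_pow_div_factorial _).mul_right _) ?_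
      (.of_forall fun ξ => ?_)
    · refine h1.unique (hsc (fun m => ?_) hasSum_zero)
      have e : ∀ ξ : Euc d, (Complex.I * ((⟪b, ξ⟫ : ℝ) : ℂ))^m / m.factorial * ((g ‖ξ‖ : ℂ) * f ξ) =
        ∑ φ : Fin m → Fin d, (Complex.I^m/m.factorial * ∏ i, (b (φ i) : ℂ)) * (((‖ξ‖^m * g ‖ξ‖ : ℝ) : ℂ) * mc φ (dir ξ) * f ξ) := fun ξ => by
          have h2 : ⟪b, ξ⟫^m = ‖ξ‖^m * ∑ φ : Fin m → Fin d, (∏ i, b (φ i)) * ∏ i, (dir ξ : Euc d) (φ i) := by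
            rw [← inner_pow_expand, ← mul_pow, ← real_inner_smul_right, smul_dir]
          rw [mul_pow, ← Complex.ofReal_pow, h2, Finset.mul_sum]
          push_cast
          rw [Finset.mul_sum, Finset.sum_div, Finset.sum_mul]
          refine Finset.sum_congr rfl fun φ _ => ?_
          simp [mc]; ring
      simp_rw [e]
      rw [integral_finsetSum _ fun φ _ => ?_]
      · exact Finset.sum_eq_zero fun φ _ => by rw [integral_const_mul, horth (hm m), mul_zero]
      · refine Integrable.const_mul (hfi.bdd_mul (c := |R|^m * 1 * ‖mc φ‖) ?_ (.of_forall fun ξ => ?_)) _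
        · exact (((Complex.measurable_ofReal.comp (hm m).meas).comp measurable_norm).mul ((mc φ).continuous.measurable.comp dir_meas)).aestronglyMeasurable
        · rw [norm_mul, Complex.norm_real]
          exact mul_le_mul ((hm m).bdd _) (mc_bd φ _) (norm_nonneg _) ((abs_nonneg _).trans ((hm m).bdd 0))
    · rw [norm_mul, norm_div, norm_pow, norm_mul, Complex.norm_I, one_mul, Complex.norm_real, Complex.norm_natCast]
      by_cases hξ : R < ‖ξ‖
      · simp [h0 ξ hξ]
      · gcongr
        exact (norm_inner_le_norm b ξ).trans (by gcongr; exact not_lt.1 hξ)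
    · simp_rw [tsum_mul_right]; exact hgf.norm.const_mul _
    · rw [Complex.exp_eq_exp_ℂ]
      exact HasSum.mul_right _ (NormedSpace.expSeries_div_hasSum_exp (Complex.I * ((⟪b, ξ⟫ : ℝ) : ℂ)))
  rw [← Lp.norm_eq_zero_iff (by norm_num : (0:ℝ≥0∞) < 2)]
  rw [norm_eq_zero, Lp.eq_zero_iff_ae_eq_zero]
  rw [Filter.EventuallyEq, ae_restrict_iff' measurableSet_closedBall]
  filter_upwards [key] with ξ hξ hk
  rw [← hξ]; exact (Set.indicator_of_mem hk _).symm
end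


section
variable {d : ℕ} [NeZero d]

lemma AF_congr {t : ℝ} {f g : Euc d → ℂ} (h : f =ᵐ[volume] g) : AF t f = AF t g := by
  ext x; refine integral_congr_ae ?_
  filter_upwards [h] with ξ hξ; simp only [hξ]

lemma lcong {α : Type*} [MeasurableSpace α] {μ : Measure α} {f g : α → ℂ} (h : f =ᵐ[μ] g) : ∫⁻ x, ‖f x‖ₑ^2 ∂μ = ∫⁻ x, ‖g x‖ₑ^2 ∂μ :=
  lintegral_congr_ae (by filter_upwards [h] with x h; rw [h])

lemma AF_meas (t : ℝ) {f : Euc d → ℂ} (hf : Measurable f) : StronglyMeasurable (AF t f) := by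
  refine StronglyMeasurable.integral_prod_right (f := fun p q : Euc d => Complex.exp (Complex.I*((⟪p,q⟫:ℝ):ℂ)) * if nn t ‖q‖ < ‖p‖ then f q else 0) ?_
  refine Measurable.stronglyMeasurable (Measurable.mul (Continuous.measurable (by fun_prop)) (Measurable.ite ?_ (hf.comp measurable_snd) measurable_const))
  refine measurableSet_lt ?_ (by fun_prop)
  unfold nn; fun_prop

set_option maxHeartbeats 1000000 in
lemma span_bound : ∃ C : ℝ≥0∞, C ≠ ⊤ ∧ ∀ (R t : ℝ) (u : Lp ℂ 2 (mR d R)), u ∈ Submodule.span ℂ (genS d R) → 0 < t → 8 * R ≤ t →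
    ∫⁻ x : Euc d, ‖AF t ((Metric.closedBall 0 R).indicator u) x‖ₑ^2 ≤ C * ∫⁻ ξ, ‖(Metric.closedBall (0:Euc d) R).indicator u ξ‖ₑ^2 := by
  obtain ⟨C, hC, H⟩ := blk_bound (d := d)
  refine ⟨C, hC, fun R t u hu ht hR => ?_⟩
  obtain ⟨m, c, g, rfl⟩ := Submodule.mem_span_set'.1 hu
  choose n φ G a M hG hs using fun i => (g i).2
  set N := Finset.univ.sup n + 1
  have hW : ∀ i, mL (φ i) ∈ WN d N := fun i =>
    (le_iSup (fun n : Fin N => LinearMap.range (Pn d n)) ⟨n i, Nat.lt_succ_of_le (Finset.le_sup (Finset.mem_univ i))⟩) (mL_mem (φ i))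
  obtain ⟨J, _, b, hb⟩ := joint_basis (d := d) N
  choose p hp using hb
  choose y q hy hE using fun j => eig_cont (b j).2 (fun h => b.orthonormal.ne_zero j (Subtype.ext h)) (hp j)
  set T := ContinuousMap.toLp (E := ℂ) 2 (sg d) ℂ
  have hs' : ∀ c : J → ℂ, ((∑ j, c j • b j : WN d N) : HS d) = T (∑ j, c j • y j) := fun c => by
    simp [map_sum, hy, T]
  set e : Fin m → J → ℂ := fun i j => b.repr ⟨mL (φ i), hW i⟩ j
  have hmc : ∀ i, mc (φ i) = ∑ j, e i j • y j := fun i => by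
    refine ContinuousMap.toLp_injective (E := ℂ) (p := 2) (𝕜 := ℂ) (sg d) ?_
    have := hs' (e i)
    rw [b.sum_repr] at this
    exact this
  obtain ⟨a0, ha0, ha⟩ : ∃ a0 : ℝ, 0 < a0 ∧ ∀ i, a0 ≤ a i := by
    rcases isEmpty_or_nonempty (Fin m) with h | h
    · exact ⟨1, one_pos, fun i => h.elim i⟩
    · obtain ⟨i, hi⟩ := Finite.exists_min a
      exact ⟨a i, (hG i).pos, hi⟩
  set k : J → ℝ → ℂ := fun j r => ((r^(EigF.be d) : ℝ) : ℂ) * ∑ i, c i * e i j * G i r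
  have hz : ∀ r, ¬ (a0 ≤ r ∧ r ≤ R) → ∀ i, G i r = 0 := fun r hr i => (hG i).supp r (fun h => hr ⟨(ha i).trans h.1, h.2⟩)
  have hk : ∀ j, NiceC (k j) a0 R (|R|^(EigF.be d) * ∑ i, ‖c i * e i j‖ * M i) := fun j => by
    have hM : ∀ i, 0 ≤ M i := fun i => (norm_nonneg _).trans ((hG i).bdd 0)
    refine ⟨?_, fun r => ?_, ha0, fun r hr => ?_⟩
    · have := fun i => (hG i).meas
      fun_prop
    · by_cases hr : a0 ≤ r ∧ r ≤ R
      · have h0 : 0 ≤ r := ha0.le.trans hr.1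
        rw [norm_mul, Complex.norm_real, Real.norm_eq_abs, abs_of_nonneg (by positivity)]
        refine mul_le_mul (Real.rpow_le_rpow h0 (hr.2.trans (le_abs_self R)) EigF.be_nn) ((norm_sum_le _ _).trans (Finset.sum_le_sum fun i _ => ?_)) (norm_nonneg _) (by positivity)
        rw [norm_mul]; exact mul_le_mul_of_nonneg_left ((hG i).bdd r) (norm_nonneg _)
      · simp only [k, hz r hr, mul_zero, Finset.sum_const_zero, norm_zero]
        exact mul_nonneg (by positivity) (Finset.sum_nonneg fun i _ => mul_nonneg (norm_nonneg _) (hM i))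
    · simp only [k, hz r hr, mul_zero, Finset.sum_const_zero]
  have hae : (Metric.closedBall (0:Euc d) R).indicator (∑ i, c i • (g i : Lp ℂ 2 (mR d R)) : Lp ℂ 2 (mR d R)) =ᵐ[volume] fun ξ => ∑ j, blk (k j) (y j) ξ := by
    have h1 : (∑ i, c i • (g i : Lp ℂ 2 (mR d R)) : Lp ℂ 2 (mR d R)) =ᵐ[mR d R] fun ξ => ∑ i, c i * (G i ‖ξ‖ * mc (φ i) (dir ξ)) := by
      refine (Lp.coeFn_finsetSum _ _).trans ?_
      have h2 := ae_all_iff.2 fun i => Lp.coeFn_smul (c i) (g i : Lp ℂ 2 (mR d R))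
      filter_upwards [h2, ae_all_iff.2 hs] with ξ a1 a2
      simp [a1, a2]
    filter_upwards [(ae_restrict_iff' measurableSet_closedBall).1 h1] with ξ hξ
    have h3 : ∑ j, blk (k j) (y j) ξ = ∑ i, c i * (G i ‖ξ‖ * mc (φ i) (dir ξ)) := by
      by_cases h0 : a0 ≤ ‖ξ‖ ∧ ‖ξ‖ ≤ R
      · have hp : 0 < ‖ξ‖ := ha0.trans_le h0.1
        have e1 : (((‖ξ‖^(-EigF.be d) : ℝ)) : ℂ) * ((‖ξ‖^(EigF.be d) : ℝ) : ℂ) = 1 := by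
          rw [← Complex.ofReal_mul, ← Real.rpow_add hp]; simp
        simp only [blk, k, ← mul_assoc, e1, one_mul, hmc, ContinuousMap.coe_sum, Finset.sum_apply, ContinuousMap.coe_smul, Pi.smul_apply, smul_eq_mul, Finset.sum_mul, Finset.mul_sum]
        rw [Finset.sum_comm]
        exact Finset.sum_congr rfl fun i _ => Finset.sum_congr rfl fun j _ => by ring
      · simp only [blk, k, hz _ h0, mul_zero, zero_mul, Finset.sum_const_zero]
    by_cases hk : ξ ∈ Metric.closedBall (0:Euc d) R
    · rw [Set.indicator_of_mem hk, hξ hk, h3]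
    · rw [Set.indicator_of_notMem hk, h3]
      simp [hz ‖ξ‖ (fun h => hk (by simpa using h.2))]
  rw [AF_congr hae, lcong hae]
  refine H J _ y q hE (fun c => ?_) k _ _ _ t hk ht fun _ => hR
  have h1 := en_sq (Lp.memLp (∑ j, c j • b j : WN d N).1)
  rw [← lp_norm_sq, hs'] at h1
  rw [← lcong (f := T (∑ j, c j • y j)), h1, ← hs']
  · have : ‖((∑ j, c j • b j : WN d N) : HS d)‖^2 = ∑ j, ‖c j‖^2 := by
      change ‖(∑ j, c j • b j : WN d N)‖^2 = _
      rw [← b.sum_sq_norm_inner_right]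
      simp only [b.orthonormal.inner_right_fintype]
    rw [this, ENNReal.ofReal_sum_of_nonneg fun _ _ => by positivity]
    simp [ENNReal.ofReal_pow, ofReal_norm_eq_enorm]
  · filter_upwards [ContinuousMap.coeFn_toLp (p:=2) (sg d) (𝕜:=ℂ) (∑ j, c j • y j)] with ω hω
    rw [hω]; simp

theorem unif : ∃ C : ℝ≥0∞, C ≠ ⊤ ∧ ∀ (R t : ℝ) (f : Euc d → ℂ), MemLp f 2 volume → (∀ ξ, R < ‖ξ‖ → f ξ = 0) → 0 < t → 8 * R ≤ t →
    ∫⁻ x : Euc d, ‖AF t f x‖ₑ^2 ≤ C * ∫⁻ ξ, ‖f ξ‖ₑ^2 := by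
  obtain ⟨C, hC, H⟩ := span_bound (d := d)
  refine ⟨C, hC, fun R t f hf h0 ht hR => ?_⟩
  set B := Metric.closedBall (0:Euc d) R
  have hfr : MemLp f 2 (mR d R) := hf.restrict _
  set F := hfr.toLp f
  have hF : B.indicator F =ᵐ[volume] f := by
    filter_upwards [(ae_restrict_iff' measurableSet_closedBall).1 hfr.coeFn_toLp] with ξ hξ
    by_cases hk : ξ ∈ B
    · rw [Set.indicator_of_mem hk, hξ hk]
    · rw [Set.indicator_of_notMem hk, h0 ξ (by simpa [B] using hk)]
  have hcl : F ∈ closure (Submodule.span ℂ (genS d R) : Set (Lp ℂ 2 (mR d R))) := by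
    rw [← Submodule.topologicalClosure_coe, gen_dense]; trivial
  obtain ⟨u, hu, hl⟩ := mem_closure_iff_seq_limit.1 hcl
  have e1 : ∀ v : Lp ℂ 2 (mR d R), ∫⁻ ξ, ‖B.indicator v ξ‖ₑ^2 = ENNReal.ofReal (‖v‖^2) := fun v => by
    rw [lp_norm_sq, ← en_sq (Lp.memLp v), ← lintegral_indicator measurableSet_closedBall]
    refine lintegral_congr fun ξ => ?_
    by_cases hk : ξ ∈ B
    · rw [Set.indicator_of_mem hk, Set.indicator_of_mem hk]
    · rw [Set.indicator_of_notMem hk, Set.indicator_of_notMem hk]; simp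
  have hlim : ∀ x, Tendsto (fun k => AF t (B.indicator (u k)) x) atTop (𝓝 (AF t (B.indicator F) x)) := fun x => by
    set K : Euc d → ℂ := fun ξ => Complex.exp (-(Complex.I*((⟪x,ξ⟫:ℝ):ℂ))) * if nn t ‖ξ‖ < ‖x‖ then 1 else 0
    have hK : MemLp K 2 (mR d R) := bL (C := 1) (Measurable.aestronglyMeasurable (Measurable.mul (Continuous.measurable (by fun_prop))
      (Measurable.ite (measurableSet_lt (by unfold nn; fun_prop) (by fun_prop)) measurable_const measurable_const))) fun ξ => by
        rw [norm_mul, ← mul_neg, ← Complex.ofReal_neg, cexp_n, one_mul]; split_ifs <;> simp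
    have e2 : ∀ v : Lp ℂ 2 (mR d R), AF t (B.indicator v) x = inner ℂ (hK.toLp K) v := fun v => by
      rw [L2.inner_def, ← integral_indicator measurableSet_closedBall]
      refine integral_congr_ae ?_
      filter_upwards [(ae_restrict_iff' measurableSet_closedBall).1 hK.coeFn_toLp] with ξ hξ
      by_cases hk : ξ ∈ B
      · rw [Set.indicator_of_mem hk, Set.indicator_of_mem hk, hξ hk]
        simp only [K, RCLike.inner_apply, map_mul, ← Complex.exp_conj, map_neg, Complex.conj_I, Complex.conj_ofReal, neg_mul, neg_neg]
        split_ifs <;> simp [mul_comm]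
      · rw [Set.indicator_of_notMem hk, Set.indicator_of_notMem hk]; simp
    simp_rw [e2]
    exact tendsto_const_nhds.inner hl
  have hm : ∀ v : Lp ℂ 2 (mR d R), Measurable (B.indicator v) := fun v => (Lp.stronglyMeasurable v).measurable.indicator measurableSet_closedBall
  rw [← AF_congr hF, ← lcong hF]
  calc _ = ∫⁻ x, liminf (fun k => ‖AF t (B.indicator (u k)) x‖ₑ^2) atTop :=
        lintegral_congr fun x => (((ENNReal.continuous_pow 2).tendsto _).comp ((continuous_enorm.tendsto _).comp (hlim x))).liminf_eq.symm
    _ ≤ liminf (fun k => ∫⁻ x, ‖AF t (B.indicator (u k)) x‖ₑ^2) atTop := lintegral_liminf_le fun k => (AF_meas t (hm _)).measurable.enorm.pow_const 2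
    _ ≤ liminf (fun k => C * ENNReal.ofReal (‖u k‖^2)) atTop := liminf_le_liminf (.of_forall fun k => by rw [← e1]; exact H R t _ (hu k) ht hR)
    _ = _ := by
      rw [e1]
      refine Tendsto.liminf_eq (ENNReal.Tendsto.const_mul (ENNReal.tendsto_ofReal (hl.norm.pow 2)) (.inr hC))
end


def ei (x : ℝ) : ℂ := Complex.exp (Complex.I * (x:ℂ))
lemma ei_n (x : ℝ) : ‖ei x‖ = 1 := cexp_n x
lemma ei_c : Continuous ei := by unfold ei; fun_prop
lemma ei_d {φ : ℝ → ℝ} {p x : ℝ} (h : HasDerivAt φ p x) : HasDerivAt (fun x => ei (φ x)) (Complex.I * p * ei (φ x)) x :=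
  ((h.ofReal_comp.const_mul Complex.I).cexp).congr_deriv (by rw [ei]; ring)
lemma ei_add (x y : ℝ) : ei (x+y) = ei x * ei y := by simp [ei, mul_add, Complex.exp_add]
lemma ei_lip (x y : ℝ) : ‖ei x - ei y‖ ≤ |x - y| := by
  have := Convex.norm_image_sub_le_of_norm_hasDerivWithin_le (f := ei) (s := Set.univ) (C := 1) (fun z _ => (ei_d (hasDerivAt_id z)).hasDerivWithinAt)
    (fun z _ => by simp [ei_n]) convex_univ (Set.mem_univ y) (Set.mem_univ x)
  simpa using this

lemma FL {φ φ1 φ2 γ γ1 : ℝ → ℝ} {p q m U l C L : ℝ} (hpq : p ≤ q) (hU : 0 < U) (hl : 0 < l) (hL : 0 ≤ L) (hC : 0 ≤ C) (dφ : ∀ ρ, HasDerivAt φ (φ1 ρ) ρ)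
    (dφ1 : ∀ ρ, HasDerivAt φ1 (φ2 ρ) ρ) (dγ : ∀ ρ, HasDerivAt γ (γ1 ρ) ρ) (bγ : ∀ ρ, |γ ρ| ≤ L) (bγ1 : ∀ ρ, |γ1 ρ| ≤ L)
    (hm : ∀ ρ, p ≤ ρ → ρ ≤ q → U ≤ |ρ - m| ∧ l * |ρ - m| ≤ |φ1 ρ| ∧ |φ2 ρ| ≤ C * l) :
    ‖∫ ρ in p..q, ei (φ ρ) * γ ρ‖ ≤ L / (l*U) * (2 + (q-p) + 2*C) := by
  have cφ : Continuous φ := continuous_iff_continuousAt.2 fun x => (dφ x).continuousAt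
  have cγ : Continuous γ := continuous_iff_continuousAt.2 fun x => (dγ x).continuousAt
  have cf : Continuous fun ρ => ei (φ ρ) * (γ ρ : ℂ) := (ei_c.comp cφ).mul (Complex.continuous_ofReal.comp cγ)
  have h1 : ∀ ρ, p ≤ ρ → ρ ≤ q → 0 < l*U ∧ l*U ≤ |φ1 ρ| := fun ρ a b => ⟨by positivity, (mul_le_mul_of_nonneg_left (hm ρ a b).1 hl.le).trans (hm ρ a b).2.1⟩
  have hne : ∀ ρ, p ≤ ρ → ρ ≤ q → (φ1 ρ : ℂ) ≠ 0 ∧ ρ - m ≠ 0 := fun ρ a b => ⟨by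
    have := h1 ρ a b; exact_mod_cast abs_pos.1 (this.1.trans_le this.2), abs_pos.1 (hU.trans_le (hm ρ a b).1)⟩
  set F : ℝ → ℂ := fun ρ => ei (φ ρ) * γ ρ / (Complex.I * φ1 ρ)
  have bF : ∀ ρ, p ≤ ρ → ρ ≤ q → ‖F ρ‖ ≤ L / (l*U) := fun ρ a b => by
    simp only [F, norm_div, norm_mul, ei_n, Complex.norm_I, one_mul, Complex.norm_real, Real.norm_eq_abs]
    exact div_le_div₀ hL (bγ ρ) (h1 ρ a b).1 (h1 ρ a b).2
  have key := image_norm_le_of_norm_deriv_right_le_deriv_boundary' (a := p) (b := q) (f := fun ρ => (∫ x in p..ρ, ei (φ x) * γ x) - (F ρ - F p))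
    (f' := fun ρ => ei (φ ρ) * (γ ρ * φ2 ρ / (Complex.I * φ1 ρ^2) - γ1 ρ / (Complex.I * φ1 ρ))) (B := fun ρ => L/(l*U) * (ρ - p) + L*C/l * ((p-m)⁻¹ - (ρ-m)⁻¹))
    (B' := fun ρ => L/(l*U) + L*C/l*((ρ-m)^2)⁻¹) ?_ ?_ (by simp) ?_ ?_ ?_ (Set.right_mem_Icc.2 hpq)
  · have e : ∫ ρ in p..q, ei (φ ρ) * γ ρ = ((∫ ρ in p..q, ei (φ ρ) * γ ρ) - (F q - F p)) + F q - F p := by ring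
    rw [e]
    refine (norm_sub_le _ _).trans ((add_le_add ((norm_add_le _ _).trans (add_le_add key (bF q hpq le_rfl))) (bF p le_rfl hpq)).trans ?_)
    have a1 : ∀ ρ, p ≤ ρ → ρ ≤ q → |(ρ-m)⁻¹| ≤ U⁻¹ := fun ρ a b => by rw [abs_inv]; exact inv_anti₀ hU (hm ρ a b).1
    have a2 : (p-m)⁻¹ - (q-m)⁻¹ ≤ 2*U⁻¹ := by linarith [(abs_le.1 (a1 p le_rfl hpq)).2, (abs_le.1 (a1 q hpq le_rfl)).1]
    have : L*C/l * ((p-m)⁻¹ - (q-m)⁻¹) ≤ L*C/l*(2*U⁻¹) := by gcongr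
    have e2 : L*C/l*(2*U⁻¹) = L / (l*U) * (2*C) := by field_simp
    linarith
  · refine ContinuousOn.sub (intervalIntegral.continuous_primitive (fun a b => cf.intervalIntegrable a b) p).continuousOn ((ContinuousOn.div cf.continuousOn ?_ fun ρ hρ => ?_).sub continuousOn_const)
    · exact (continuous_const.mul (Complex.continuous_ofReal.comp (continuous_iff_continuousAt.2 fun x => (dφ1 x).continuousAt))).continuousOn
    · exact mul_ne_zero Complex.I_ne_zero (hne ρ hρ.1 hρ.2).1
  · intro ρ hρ
    have hn := (hne ρ hρ.1 hρ.2.le).1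
    refine HasDerivAt.hasDerivWithinAt (((intervalIntegral.integral_hasDerivAt_right (cf.intervalIntegrable _ _) (cf.stronglyMeasurableAtFilter _ _) cf.continuousAt).sub
      ((((ei_d (dφ ρ)).mul (dγ ρ).ofReal_comp).div ((dφ1 ρ).ofReal_comp.const_mul Complex.I) (mul_ne_zero Complex.I_ne_zero hn)).sub_const _)).congr_deriv ?_)
    have := Complex.I_ne_zero
    simp only [Pi.mul_apply]
    field_simp
    ring
  · refine ContinuousOn.add (by fun_prop) (ContinuousOn.mul continuousOn_const (continuousOn_const.sub (ContinuousOn.inv₀ (by fun_prop) fun ρ hρ => (hne ρ hρ.1 hρ.2).2)))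
  · intro ρ hρ
    have hn := (hne ρ hρ.1 hρ.2.le).2
    refine HasDerivAt.hasDerivWithinAt (((((hasDerivAt_id ρ).sub_const p).const_mul _).add
      (((((hasDerivAt_id ρ).sub_const m).inv hn).const_sub ((p-m)⁻¹)).const_mul (L*C/l))).congr_deriv ?_)
    simp only [id]; field_simp
  · intro ρ hρ
    obtain ⟨b1, b2, b3⟩ := hm ρ hρ.1 hρ.2.le
    have b4 := h1 ρ hρ.1 hρ.2.le
    rw [norm_mul, ei_n, one_mul, add_comm]
    refine (norm_sub_le _ _).trans (add_le_add ?_ ?_)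
    · simp only [norm_div, norm_mul, norm_pow, Complex.norm_I, one_mul, Complex.norm_real, Real.norm_eq_abs]
      have : L*C/l*((ρ-m)^2)⁻¹ = L*(C*l)/(l*|ρ-m|)^2 := by rw [mul_pow, sq_abs]; have := (hne ρ hρ.1 hρ.2.le).2; field_simp
      rw [this]
      have : 0 < |ρ-m| := hU.trans_le b1
      exact div_le_div₀ (by positivity) (mul_le_mul (bγ ρ) b3 (abs_nonneg _) hL) (by positivity) (by gcongr)
    · simp only [norm_div, norm_mul, Complex.norm_I, one_mul, Complex.norm_real, Real.norm_eq_abs]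
      exact div_le_div₀ hL (bγ1 ρ) b4.1 b4.2

lemma NL {φ γ : ℝ → ℝ} {m U D L : ℝ} (hU : 0 ≤ U) (cφ : Continuous φ) (cγ : Continuous γ) (bγ : ∀ ρ, |γ ρ| ≤ L)
    (hγ : ∀ u, 0 ≤ u → u ≤ U → |γ (m+u) - γ (m-u)| ≤ 2*L*U) (hφ : ∀ u, 0 ≤ u → u ≤ U → |φ (m+u) - φ (m-u)| ≤ D) :
    ‖(∫ ρ in (m-U)..m, ei (φ ρ) * γ ρ) - ∫ ρ in m..(m+U), ei (φ ρ) * γ ρ‖ ≤ U * (L*D + 2*L*U) := by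
  have cf : Continuous fun ρ => ei (φ ρ) * (γ ρ : ℂ) := (ei_c.comp cφ).mul (Complex.continuous_ofReal.comp cγ)
  have e1 := intervalIntegral.integral_comp_sub_left (a := 0) (b := U) (fun ρ => ei (φ ρ) * (γ ρ : ℂ)) m
  have e2 := intervalIntegral.integral_comp_add_left (a := 0) (b := U) (fun ρ => ei (φ ρ) * (γ ρ : ℂ)) m
  rw [sub_zero] at e1; rw [add_zero] at e2
  have hc1 : Continuous (fun u => ei (φ (m-u))*(γ (m-u):ℂ)) := cf.comp (by fun_prop : Continuous fun u:ℝ => m-u)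
  have hc2 : Continuous (fun u => ei (φ (m+u))*(γ (m+u):ℂ)) := cf.comp (by fun_prop : Continuous fun u:ℝ => m+u)
  rw [← e1, ← e2, ← intervalIntegral.integral_sub (hc1.intervalIntegrable _ _) (hc2.intervalIntegrable _ _)]
  refine (intervalIntegral.norm_integral_le_of_norm_le_const (C := L*D + 2*L*U) fun u hu => ?_).trans (by rw [sub_zero, abs_of_nonneg hU, mul_comm])
  rw [Set.uIoc_of_le hU] at hu
  have e : ei (φ (m-u)) * (γ (m-u) : ℂ) - ei (φ (m+u)) * γ (m+u) = (ei (φ (m-u)) - ei (φ (m+u))) * γ (m-u) + ei (φ (m+u)) * ((γ (m-u) - γ (m+u) : ℝ) : ℂ) := by push_cast; ring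
  rw [e]
  refine (norm_add_le _ _).trans (add_le_add ?_ ?_)
  · rw [norm_mul, Complex.norm_real, mul_comm]
    refine mul_le_mul (bγ _) ((ei_lip _ _).trans ?_) (norm_nonneg _) ((abs_nonneg _).trans (bγ 0))
    rw [abs_sub_comm]; exact hφ u hu.1.le hu.2
  · rw [norm_mul, ei_n, one_mul, Complex.norm_real, Real.norm_eq_abs, abs_sub_comm]; exact hγ u hu.1.le hu.2


lemma ode_as {h h' : ℝ → ℝ} {μ : ℝ} (dh : ∀ s : ℝ, 0 < s → HasDerivAt h (h' s) s) (dh' : ∀ s : ℝ, 0 < s → HasDerivAt h' (-(1 - μ/s^2) * h s) s) :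
    ∃ (c : ℂ) (K : ℝ), 0 ≤ K ∧ ∀ s : ℝ, 1 ≤ s → |h s - (c * ei s).im| ≤ K / s := by
  set α : ℝ → ℂ := fun s => (h' s + Complex.I * h s) * ei (-s)
  set α' : ℝ → ℂ := fun s => ((μ / s^2 * h s : ℝ) : ℂ) * ei (-s)
  have dα : ∀ s : ℝ, 0 < s → HasDerivAt α (α' s) s := fun s hs => by
    refine (((dh' s hs).ofReal_comp.add ((dh s hs).ofReal_comp.const_mul Complex.I)).mul (ei_d (hasDerivAt_neg s))).congr_deriv ?_
    simp only [α', Pi.add_apply]; push_cast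
    linear_combination (-(h s:ℂ) * ei (-s)) * Complex.I_sq
  have bα : ∀ s : ℝ, 0 < s → ‖α' s‖ ≤ |μ| / s^2 * ‖α s‖ := fun s hs => by
    simp only [α, α', norm_mul, ei_n, mul_one, Complex.norm_real, Real.norm_eq_abs, abs_mul, abs_div, abs_of_pos (pow_pos hs 2)]
    gcongr
    have := Complex.abs_im_le_norm ((h' s:ℂ) + Complex.I * h s)
    simpa using this
  have dinv : ∀ s : ℝ, 0 < s → HasDerivAt (fun s : ℝ => -s⁻¹) (1/s^2) s := fun s hs => by
    refine ((hasDerivAt_inv hs.ne').neg).congr_deriv ?_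
    field_simp
  have bd : ∀ s : ℝ, 1 ≤ s → ‖α s‖ ≤ (‖α 1‖+1) * Real.exp (|μ|+1) := fun s hs => by
    set B : ℝ → ℝ := fun s => (‖α 1‖+1) * Real.exp ((|μ|+1) * (1 + -s⁻¹))
    have := image_norm_le_of_norm_deriv_right_lt_deriv_boundary' (a := 1) (b := s) (f := α) (f' := α') (B := B) (B' := fun s => (|μ|+1)*(1/s^2) * B s)
      (fun x hx => (dα x (by linarith [hx.1])).continuousAt.continuousWithinAt) (fun x hx => (dα x (by linarith [hx.1])).hasDerivWithinAt)
      (by simp [B]) (fun x hx => ?_) (fun x hx => ?_) (fun x hx he => ?_) (Set.right_mem_Icc.2 hs)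
    · refine this.trans ?_
      simp only [B]
      have : 0 ≤ s⁻¹ := by positivity
      gcongr
      nlinarith [abs_nonneg μ]
    · exact (((((dinv x (by linarith [hx.1])).const_add 1).const_mul _).exp.const_mul _).continuousAt).continuousWithinAt
    · refine HasDerivAt.hasDerivWithinAt (((((dinv x (by linarith [hx.1])).const_add 1).const_mul (|μ|+1)).exp.const_mul (‖α 1‖+1)).congr_deriv ?_)
      simp only [B]; ring
    · have hx0 : 0 < x := by linarith [hx.1]
      refine (bα x hx0).trans_lt ?_
      rw [he]
      have : 0 < B x := by positivity
      refine mul_lt_mul_of_pos_right ?_ this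
      rw [div_eq_mul_one_div]
      have : (0:ℝ) < 1/x^2 := by positivity
      nlinarith
  set K := |μ| * ((‖α 1‖+1) * Real.exp (|μ|+1))
  have hK : 0 ≤ K := by positivity
  have ca : ∀ s r : ℝ, 1 ≤ s → s ≤ r → ‖α r - α s‖ ≤ K / s := fun s r hs hr => by
    have h0 : 0 < s := by linarith
    have := image_norm_le_of_norm_deriv_right_le_deriv_boundary' (a := s) (b := r) (f := fun x => α x - α s) (f' := α') (B := fun x => K * (s⁻¹ + -x⁻¹)) (B' := fun x => K * (1/x^2))
      (fun x hx => ((dα x (by linarith [hx.1])).sub_const _).continuousAt.continuousWithinAt) (fun x hx => ((dα x (by linarith [hx.1])).sub_const _).hasDerivWithinAt)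
      (by simp) (fun x hx => (((dinv x (by linarith [hx.1])).const_add _).const_mul K).continuousAt.continuousWithinAt)
      (fun x hx => (((dinv x (by linarith [hx.1])).const_add _).const_mul K).hasDerivWithinAt) (fun x hx => ?_) (Set.right_mem_Icc.2 hr)
    · refine this.trans ?_
      have : 0 ≤ r⁻¹ := inv_nonneg.2 (by linarith)
      simp only [div_eq_mul_inv]
      gcongr; linarith
    · have hx0 : 0 < x := by linarith [hx.1]
      refine (bα x hx0).trans ?_
      have := bd x (by linarith [hx.1])
      simp only [K, div_eq_mul_inv, one_mul]
      rw [mul_assoc, mul_assoc |μ|, mul_comm (x^2)⁻¹]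
      gcongr
  have tb : Tendsto (fun N : ℕ => 2*K*(1 / ((N:ℝ)+1))) atTop (𝓝 0) := by
    have := tendsto_one_div_add_atTop_nhds_zero_nat (𝕜 := ℝ).const_mul (2*K)
    simpa using this
  have cs : CauchySeq (fun n : ℕ => α (n+1)) := by
    refine cauchySeq_of_le_tendsto_0 _ (fun n m N hn hm => ?_) tb
    have hn' : (N:ℝ) ≤ n := by exact_mod_cast hn
    have hm' : (N:ℝ) ≤ m := by exact_mod_cast hm
    have hN : (0:ℝ) ≤ N := by positivity
    have a1 := ca (N+1) (n+1) (by linarith) (by linarith)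
    have a2 := ca (N+1) (m+1) (by linarith) (by linarith)
    rw [dist_eq_norm]
    have e : α (n+1) - α (m+1) = (α (n+1) - α (N+1)) - (α (m+1) - α (N+1)) := by ring
    rw [e]
    refine (norm_sub_le _ _).trans ((add_le_add a1 a2).trans (le_of_eq ?_))
    ring
  obtain ⟨c, hc⟩ := cauchySeq_tendsto_of_complete cs
  refine ⟨c, K, hK, fun s hs => ?_⟩
  have h1 : ‖c - α s‖ ≤ K / s := by
    refine le_of_tendsto (hc.sub_const (α s)).norm ?_
    filter_upwards [eventually_ge_atTop ⌈s⌉₊] with n hn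
    exact ca s _ hs (by have := Nat.le_of_ceil_le hn; linarith)
  have e : h s = (α s * ei s).im := by
    have : α s * ei s = h' s + Complex.I * h s := by
      simp only [α]
      rw [mul_assoc, ← ei_add]; simp [ei]
    rw [this]; simp
  rw [e, ← Complex.sub_im, ← sub_mul]
  refine (Complex.abs_im_le_norm _).trans ?_
  rwa [norm_mul, ei_n, mul_one, norm_sub_rev]

variable {d : ℕ} [NeZero d]

def Zs (y : Euc d) : ℂ := ∫ θ : Sp d, ei ⟪y, (θ:Euc d)⟫ ∂sg d

lemma Zs_as : ∃ (c₁ c₂ : ℂ) (C : ℝ), 0 ≤ C ∧ ∀ y : Euc d, 1 ≤ ‖y‖ →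
    ‖Zs y - ((‖y‖^(-EigF.be d) : ℝ) : ℂ) * (c₁ * ei ‖y‖ + c₂ * ei (-‖y‖))‖ ≤ C * ‖y‖^(-EigF.be d - 1) := by
  set ω₀ : Sp d := dir 0
  have hE : EigF (1 : C(Sp d, ℂ)) (fun n => KK n 0 ω₀ ω₀) := by
    refine ⟨fun h => one_ne_zero (α := ℂ) (by simpa using congrArg (fun f : C(Sp d, ℂ) => f ω₀) h), ⟨0, ?_⟩, fun n ω => ?_⟩
    · simp [KK, Measure.real, ENNReal.toReal_eq_zero_iff, NeZero.ne d, (Metric.measure_ball_pos volume (0:Euc d) one_pos).ne', measure_ball_lt_top.ne]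
    · have e : KK n 0 ω₀ ω₀ = KK n 0 ω ω := by
        have a : ∀ ψ φ φ' : Sp d, KK n 0 ψ φ = KK n 0 ψ φ' := fun ψ φ φ' => by simp [KK]
        have b : KK 0 n ω₀ ω = KK n 0 ω ω₀ := by simp [KK]
        rw [a ω₀ ω₀ ω, KK_symm, b, a ω ω₀ ω]
      rw [e, KK, ← integral_complex_ofReal]
      simp
  obtain ⟨c, K, hK, h⟩ := ode_as (fun s hs => hE.dh hs) (fun s hs => hE.dh' hs)
  refine ⟨Complex.I^hE.l * (c / (2*Complex.I)), Complex.I^hE.l * (-(starRingEnd ℂ c) / (2*Complex.I)), K, hK, fun y hy => ?_⟩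
  have h0 : 0 < ‖y‖ := by linarith
  have e1 : Zs y = Complex.I^hE.l * (((‖y‖^(-EigF.be d) : ℝ) : ℂ) * hE.hh ‖y‖) := by
    have := hE.fourier ‖y‖ (dir y)
    simp only [ContinuousMap.one_apply, mul_one] at this
    rw [EigF.hh]; push_cast
    rw [← mul_assoc (((‖y‖^(-EigF.be d) : ℝ) : ℂ)), ← Complex.ofReal_mul, ← Real.rpow_add h0, neg_add_cancel, Real.rpow_zero, Complex.ofReal_one, one_mul, ← this, Zs]
    congr 1; ext θ
    rw [ei, ← real_inner_smul_left, smul_dir]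
  have e2 : Complex.I^hE.l * (c / (2*Complex.I)) * ei ‖y‖ + Complex.I^hE.l * (-(starRingEnd ℂ c) / (2*Complex.I)) * ei (-‖y‖) = Complex.I^hE.l * (((c * ei ‖y‖).im : ℝ) : ℂ) := by
    have : ei (-‖y‖) = starRingEnd ℂ (ei ‖y‖) := by simp [ei, ← Complex.exp_conj]
    rw [Complex.im_eq_sub_conj, this, map_mul]
    have := Complex.I_ne_zero
    field_simp
    ring
  have e3 : Zs y - ((‖y‖^(-EigF.be d) : ℝ) : ℂ) * (Complex.I^hE.l * (c / (2*Complex.I)) * ei ‖y‖ + Complex.I^hE.l * (-(starRingEnd ℂ c) / (2*Complex.I)) * ei (-‖y‖))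
      = Complex.I^hE.l * ((‖y‖^(-EigF.be d) : ℝ) : ℂ) * ((hE.hh ‖y‖ - (c * ei ‖y‖).im : ℝ) : ℂ) := by
    rw [e1, e2]; push_cast; ring
  rw [e3, norm_mul, norm_mul, norm_pow, Complex.norm_I, one_pow, one_mul, Complex.norm_real, Complex.norm_real, Real.norm_of_nonneg (by positivity), Real.norm_eq_abs]
  refine (mul_le_mul_of_nonneg_left (h _ hy) (by positivity)).trans (le_of_eq ?_)
  rw [Real.rpow_sub h0, Real.rpow_one]; ring


def js (ρ : ℝ) : ℝ := Real.sqrt (1+ρ^2)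
def vv (ρ : ℝ) : ℝ := ρ / js ρ
lemma js_sq (ρ : ℝ) : js ρ^2 = 1+ρ^2 := Real.sq_sqrt (by positivity)
lemma js_ge (ρ : ℝ) : 1 ≤ js ρ := Real.one_le_sqrt.2 (by nlinarith [sq_nonneg ρ])
lemma js_pos (ρ : ℝ) : 0 < js ρ := by linarith [js_ge ρ]
lemma js_abs (ρ : ℝ) : |ρ| ≤ js ρ := Real.abs_le_sqrt (by linarith)
lemma js_d (ρ : ℝ) : HasDerivAt js (vv ρ) ρ := by
  have := (((hasDerivAt_id ρ).pow 2).const_add 1).sqrt (by simp only [Pi.pow_apply, id]; positivity)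
  refine this.congr_deriv ?_
  simp only [Pi.pow_apply, id, vv, js]; field_simp; norm_num
lemma vv_d (ρ : ℝ) : HasDerivAt vv ((js ρ)⁻¹^3) ρ := by
  refine ((hasDerivAt_id ρ).div (js_d ρ) (js_pos ρ).ne').congr_deriv ?_
  have h := js_sq ρ
  have := (js_pos ρ).ne'
  simp only [vv, id]; field_simp
  linarith
lemma ji_d (ρ : ℝ) : HasDerivAt (fun x => (js x)⁻¹) (-ρ * (js ρ)⁻¹^3) ρ := by
  refine ((js_d ρ).inv (js_pos ρ).ne').congr_deriv ?_
  have := (js_pos ρ).ne'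
  simp only [vv]; field_simp
lemma js_mono {a b : ℝ} (ha : 0 ≤ a) (h : a ≤ b) : js a ≤ js b := Real.sqrt_le_sqrt (by gcongr)
lemma vv_abs (ρ : ℝ) : |vv ρ| ≤ 1 := by rw [vv, abs_div, abs_of_pos (js_pos ρ)]; exact (div_le_one (js_pos ρ)).2 (js_abs ρ)
lemma ji_le (ρ : ℝ) : (js ρ)⁻¹ ≤ 1 := inv_le_one_of_one_le₀ (js_ge ρ)
lemma ji_pos (ρ : ℝ) : 0 < (js ρ)⁻¹ := inv_pos.2 (js_pos ρ)
lemma vv_nn {ρ : ℝ} (h : 0 ≤ ρ) : 0 ≤ vv ρ := div_nonneg h (js_pos ρ).le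
lemma nn_vv (t ρ : ℝ) : nn t ρ = t * vv ρ := by rw [nn, vv, js]; ring
lemma vv_sm : StrictMono vv := strictMono_of_hasDerivAt_pos vv_d fun x => pow_pos (ji_pos x) 3
lemma vv_low {B ρ m : ℝ} (h0 : 0 ≤ m) (hρ : 0 ≤ ρ) (h1 : m ≤ B) (h2 : ρ ≤ B) : (js B)⁻¹^3 * |ρ - m| ≤ |vv ρ - vv m| := by
  wlog h : m ≤ ρ generalizing m ρ
  · rw [abs_sub_comm, abs_sub_comm (vv ρ)]; exact this hρ h0 h2 h1 (le_of_not_ge h)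
  rw [abs_of_nonneg (sub_nonneg.2 h), abs_of_nonneg (sub_nonneg.2 (vv_sm.monotone h))]
  refine Convex.mul_sub_le_image_sub_of_le_deriv (convex_Icc 0 B) (f := vv) (fun x _ => (vv_d x).continuousAt.continuousWithinAt) (fun x _ => (vv_d x).differentiableAt.differentiableWithinAt)
    (fun x hx => ?_) m ⟨h0, h1⟩ ρ ⟨hρ, h2⟩ h
  rw [interior_Icc] at hx
  rw [(vv_d x).deriv]
  have := js_mono hx.1.le hx.2.le
  have := js_pos x
  have := (ji_pos B).le
  gcongr

lemma cub (m u : ℝ) (hm : 0 ≤ m) (hu : 0 ≤ u) : |js (m+u) - js (m-u) - 2*u*vv m| ≤ u^3 := by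
  obtain ⟨a1, a2, a3⟩ := And.intro (js_sq (m+u)) (And.intro (js_sq (m-u)) (js_sq m))
  obtain ⟨b1, b2, b3⟩ := And.intro (js_ge (m+u)) (And.intro (js_ge (m-u)) (js_ge m))
  have hmc := (le_abs_self m).trans (js_abs m)
  set a := js (m+u); set b := js (m-u); set c := js m
  have e : a - b - 2*u*vv m = (m / c) * (2*u*(2*c-a-b)/(a+b)) := by
    rw [show vv m = m / c from rfl]; field_simp
    linear_combination c*(a1-a2)
  have hab : c^2 - u^2 ≤ a*b := by
    refine (le_abs_self _).trans (abs_le_of_sq_le_sq ?_ (by positivity))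
    rw [mul_pow, a1, a2, a3]; linarith [sq_nonneg u]
  have h1 : 2*c ≤ a+b := by nlinarith
  have h2 : a+b-2*c ≤ u^2 := by nlinarith [sq_nonneg (a-b)]
  have h3 : 0 ≤ m / c := by positivity
  have h4 : m/c ≤ 1 := (div_le_one (by linarith)).2 hmc
  rw [e, abs_mul, abs_of_nonneg h3]
  have h5 : |2*u*(2*c-a-b)/(a+b)| ≤ u^3 := by
    rw [abs_div, abs_of_pos (by linarith : 0 < a+b), div_le_iff₀ (by linarith), abs_mul, abs_of_nonneg (by positivity : 0 ≤ 2*u), abs_of_nonpos (by linarith)]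
    linarith [pow_nonneg hu 3, mul_le_mul_of_nonneg_left h2 hu, mul_le_mul_of_nonneg_left (by linarith : 2 ≤ a+b) (pow_nonneg hu 3)]
  nlinarith [abs_nonneg (2*u*(2*c-a-b)/(a+b))]

set_option maxHeartbeats 1600000 in
lemma P1 {s σ B m0 L ε : ℝ} (hs : s = 1 ∨ s = -1) (hσ : σ = 1 ∨ σ = -1) (hB : 0 < B) (hm0 : 0 < m0) (hL : 0 ≤ L) (hε : 0 < ε) :
    ∃ η T : ℝ, 0 < η ∧ ∀ t E : ℝ, T ≤ t → 0 ≤ E → E ≤ η * √t → ∀ (m : ℝ) (N N1 N2 γ γ1 : ℝ → ℝ), m0 ≤ m → m ≤ B - 1 →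
      (∀ ρ, HasDerivAt N (N1 ρ) ρ) → (∀ ρ, HasDerivAt N1 (N2 ρ) ρ) → (∀ ρ, |N ρ - t * vv m| ≤ E) → (∀ ρ, |N1 ρ| ≤ E) → (∀ ρ, |N2 ρ| ≤ t) →
      (∀ ρ, HasDerivAt γ (γ1 ρ) ρ) → (∀ ρ, |γ ρ| ≤ L) → (∀ ρ, |γ1 ρ| ≤ L) →
      ‖(∫ ρ in (0:ℝ)..m, ei (s*(t * js ρ - σ * (ρ * N ρ))) * γ ρ) - ∫ ρ in m..B, ei (s*(t * js ρ - σ * (ρ * N ρ))) * γ ρ‖ ≤ ε / √t := by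
  have c0p : 0 < (js B)⁻¹^3 := pow_pos (ji_pos B) 3
  set c0 := (js B)⁻¹^3
  have sa : ∀ x : ℝ, |s*x| = |x| := fun x => by rcases hs with rfl | rfl <;> simp
  have gen : ∀ {t E m : ℝ} {N N1 N2 : ℝ → ℝ}, 1 ≤ t → 0 ≤ E → E ≤ t →
      (∀ ρ, HasDerivAt N (N1 ρ) ρ) → (∀ ρ, HasDerivAt N1 (N2 ρ) ρ) → (∀ ρ, |N1 ρ| ≤ E) → (∀ ρ, |N2 ρ| ≤ t) →
      (∀ ρ, HasDerivAt (fun ρ => s*(t * js ρ - σ * (ρ * N ρ))) (s*(t*vv ρ - σ*(N ρ + ρ * N1 ρ))) ρ) ∧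
      (∀ ρ, HasDerivAt (fun ρ => s*(t*vv ρ - σ*(N ρ + ρ * N1 ρ))) (s*(t*(js ρ)⁻¹^3 - σ*(2*N1 ρ + ρ * N2 ρ))) ρ) ∧
      (∀ ρ, 0 ≤ ρ → ρ ≤ B → |s*(t*(js ρ)⁻¹^3 - σ*(2*N1 ρ + ρ * N2 ρ))| ≤ (3+B)*t) := by
    intro t E m N N1 N2 ht hE hEt dN dN1 bN1 bN2
    refine ⟨fun ρ => ?_, fun ρ => ?_, fun ρ h0 h1 => ?_⟩
    · exact ((((js_d ρ).const_mul t).sub (((hasDerivAt_id ρ).mul (dN ρ)).const_mul σ)).const_mul s).congr_deriv (by simp only [id]; ring)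
    · exact ((((vv_d ρ).const_mul t).sub (((dN ρ).add ((hasDerivAt_id ρ).mul (dN1 ρ))).const_mul σ)).const_mul s).congr_deriv (by simp only [id]; ring)
    · rw [sa]
      have h3 : |t*(js ρ)⁻¹^3| ≤ t := by
        have := pow_le_one₀ (ji_pos ρ).le (ji_le ρ) (n := 3)
        have := pow_pos (ji_pos ρ) 3
        rw [abs_of_pos (by positivity)]; nlinarith
      have h4 : |σ*(2*N1 ρ + ρ * N2 ρ)| ≤ 2*t + B*t := by
        have : |σ*(2*N1 ρ + ρ * N2 ρ)| = |2*N1 ρ + ρ * N2 ρ| := by rw [abs_mul]; rcases hσ with rfl | rfl <;> simp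
        rw [this]
        refine (abs_add_le _ _).trans (add_le_add ?_ ?_)
        · rw [abs_mul, abs_two]; linarith [bN1 ρ]
        · rw [abs_mul, abs_of_nonneg h0]; exact mul_le_mul h1 (bN2 ρ) (abs_nonneg _) hB.le
      refine (abs_sub _ _).trans ?_
      linarith
  rcases hσ with rfl | rfl
  · set C := 2*(3+B)/c0
    set K := 8*L*(2+B+2*C)/(c0*ε)+1
    have hC : 0 ≤ C := by positivity
    have hK : 1 ≤ K := by have : 0 ≤ 8*L*(2+B+2*C)/(c0*ε) := by positivity
                          linarith
    have hK0 : 0 < K := by linarith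
    set η := min 1 (min (c0/(2*(1+B))) (ε / (8*(L+1)*K^2*(1+B))))
    have hη : 0 < η := by positivity
    set T := max 1 (max (K^2) (max ((K/m0)^2) ((4*(L+1)*(K^4+2*K^2)/ε)^2)))
    refine ⟨η, T, hη, fun t E ht hE hEη m N N1 N2 γ γ1 hm hmB dN dN1 bN bN1 bN2 dγ bγ bγ1 => ?_⟩
    have t1 : 1 ≤ t := (le_max_left _ _).trans ht
    have t2 : K^2 ≤ t := ((le_max_left _ _).trans (le_max_right _ _)).trans ht
    have t3 : (K/m0)^2 ≤ t := ((le_max_left _ _).trans ((le_max_right _ _).trans (le_max_right _ _))).trans ht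
    have t4 : (4*(L+1)*(K^4+2*K^2)/ε)^2 ≤ t := ((le_max_right _ _).trans ((le_max_right _ _).trans (le_max_right _ _))).trans ht
    have w2 := Real.le_sqrt_of_sq_le t2
    have w3 := Real.le_sqrt_of_sq_le t3
    have w4 := Real.le_sqrt_of_sq_le t4
    have w1 : 1 ≤ √t := Real.one_le_sqrt.2 t1
    have wt : √t * √t = t := Real.mul_self_sqrt (by linarith)
    have n1 : η ≤ 1 := min_le_left _ _
    have n2 : η * (1+B) ≤ c0/2 := by
      have : η ≤ c0/(2*(1+B)) := (min_le_right _ _).trans (min_le_left _ _)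
      rw [le_div_iff₀ (by positivity)] at this; linarith
    have n3 : 8*(L+1)*K^2*(1+B)*η ≤ ε := by
      have : η ≤ ε / (8*(L+1)*K^2*(1+B)) := (min_le_right _ _).trans (min_le_right _ _)
      rw [le_div_iff₀ (by positivity)] at this; linarith
    set w := √t
    have w0 : 0 < w := by linarith
    have hEt : E ≤ t := by linarith [mul_le_mul_of_nonneg_right n1 w0.le, mul_le_mul_of_nonneg_right w1 w0.le]
    obtain ⟨d1, d2, d3⟩ := gen (m := m) t1 hE hEt dN dN1 bN1 bN2
    set U := K / w
    have hU : 0 < U := by positivity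
    have hUw : U * w = K := by simp only [U]; field_simp
    have hU1 : U ≤ 1 := (div_le_one w0).2 w2
    have hUm : U ≤ m := by
      rw [div_le_iff₀ hm0] at w3
      refine le_trans ?_ hm
      rw [div_le_iff₀ w0]; linarith
    set f : ℝ → ℂ := fun ρ => ei (s*(t * js ρ - 1 * (ρ * N ρ))) * γ ρ
    have cφ : Continuous fun ρ => s*(t * js ρ - 1 * (ρ * N ρ)) := continuous_iff_continuousAt.2 fun x => (d1 x).continuousAt
    have cγ : Continuous γ := continuous_iff_continuousAt.2 fun x => (dγ x).continuousAt
    have cf : Continuous f := (ei_c.comp cφ).mul (Complex.continuous_ofReal.comp cγ)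
    have ii : ∀ a b, IntervalIntegrable f volume a b := fun a b => cf.intervalIntegrable a b
    have hm0' : 0 < m := by linarith
    have vis : ∀ ρ, 0 ≤ ρ → ρ ≤ B → U ≤ |ρ-m| → U ≤ |ρ - m| ∧ (c0*t/2) * |ρ - m| ≤ |s*(t*vv ρ - 1*(N ρ + ρ * N1 ρ))| ∧ |s*(t*(js ρ)⁻¹^3 - 1*(2*N1 ρ + ρ * N2 ρ))| ≤ C * (c0*t/2) := by
      intro ρ h0 h1 h2
      refine ⟨h2, ?_, (d3 ρ h0 h1).trans (le_of_eq ?_)⟩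
      · rw [sa]
        have a1 := vv_low hm0'.le h0 (by linarith) h1
        have a2 : |(N ρ - t*vv m) + ρ * N1 ρ| ≤ (1+B)*E := by
          refine (abs_add_le _ _).trans ?_
          rw [abs_mul, abs_of_nonneg h0]
          linarith [bN ρ, mul_le_mul h1 (bN1 ρ) (abs_nonneg _) hB.le]
        have a3 : t * |vv ρ - vv m| ≤ |t*vv ρ - 1*(N ρ + ρ * N1 ρ)| + |(N ρ - t*vv m) + ρ * N1 ρ| := by
          have e : t * |vv ρ - vv m| = |(t*vv ρ - 1*(N ρ + ρ * N1 ρ)) + ((N ρ - t*vv m) + ρ * N1 ρ)| := by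
            rw [← abs_of_pos (show 0 < t by linarith), ← abs_mul, abs_of_pos (show 0 < t by linarith)]; congr 1; ring
          rw [e]; exact abs_add_le _ _
        have a4 : t * (c0 * |ρ-m|) ≤ t * |vv ρ - vv m| := mul_le_mul_of_nonneg_left a1 (by linarith)
        have a5 : (1+B)*E ≤ c0/2 * w := by linarith [mul_le_mul_of_nonneg_left hEη (by linarith : 0 ≤ 1+B), mul_le_mul_of_nonneg_right n2 w0.le]
        have a6 : w ≤ t * |ρ-m| := by
          rw [← wt]
          have : 1 ≤ w * |ρ-m| := by linarith [mul_le_mul_of_nonneg_right h2 w0.le]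
          linarith [mul_le_mul_of_nonneg_left this w0.le]
        linarith [mul_le_mul_of_nonneg_left a6 (by positivity : 0 ≤ c0/2)]
      · simp only [C]; field_simp
    have F1 := FL (γ := γ) (p := 0) (q := m-U) (m := m) (U := U) (l := c0*t/2) (C := C) (L := L) (by linarith) hU (by positivity) hL hC d1 d2 dγ bγ bγ1
      (fun ρ h0 h1 => vis ρ h0 (by linarith) (by rw [abs_sub_comm, abs_of_nonneg (by linarith)]; linarith))
    have F2 := FL (γ := γ) (p := m+U) (q := B) (m := m) (U := U) (l := c0*t/2) (C := C) (L := L) (by linarith) hU (by positivity) hL hC d1 d2 dγ bγ bγ1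
      (fun ρ h0 h1 => vis ρ (by linarith) h1 (by rw [abs_of_nonneg (by linarith)]; linarith))
    have lg : ∀ u, 0 ≤ u → u ≤ U → |γ (m+u) - γ (m-u)| ≤ 2*L*U := fun u h0 h1 => by
      have := Convex.norm_image_sub_le_of_norm_hasDerivWithin_le (f := γ) (s := Set.univ) (C := L) (fun z _ => (dγ z).hasDerivWithinAt) (fun z _ => bγ1 z) convex_univ (Set.mem_univ (m-u)) (Set.mem_univ (m+u))
      rw [Real.norm_eq_abs, Real.norm_eq_abs, abs_of_nonneg (by linarith : 0 ≤ m+u-(m-u))] at this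
      linarith [mul_le_mul_of_nonneg_left h1 hL]
    have lp : ∀ u, 0 ≤ u → u ≤ U → |s*(t * js (m+u) - 1*((m+u)*N (m+u))) - s*(t * js (m-u) - 1*((m-u)*N (m-u)))| ≤ t*U^3 + 2*U*((1+B)*E) := fun u h0 h1 => by
      rw [← mul_sub, sa]
      have a1 := cub m u hm0'.le h0
      have a2 := Convex.norm_image_sub_le_of_norm_hasDerivWithin_le (f := fun ρ => ρ * (N ρ - t*vv m)) (s := Set.Icc 0 B) (C := (1+B)*E) (f' := fun ρ => 1*(N ρ - t*vv m) + ρ*N1 ρ)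
        (fun z _ => ((hasDerivAt_id z).mul ((dN z).sub_const _)).hasDerivWithinAt) (fun z hz => ?_) (convex_Icc 0 B)
        (show m-u ∈ Set.Icc 0 B from ⟨by linarith, by linarith⟩) (show m+u ∈ Set.Icc 0 B from ⟨by linarith, by linarith⟩)
      · rw [Real.norm_eq_abs, Real.norm_eq_abs, abs_of_nonneg (by linarith : 0 ≤ m+u-(m-u))] at a2
        have e : t * js (m+u) - 1*((m+u)*N (m+u)) - (t * js (m-u) - 1*((m-u)*N (m-u))) = t * (js (m+u) - js (m-u) - 2*u*vv m) - ((m+u)*(N (m+u) - t*vv m) - (m-u)*(N (m-u) - t*vv m)) := by ring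
        rw [e]
        refine (abs_sub _ _).trans (add_le_add ?_ ?_)
        · rw [abs_mul, abs_of_pos (by linarith : 0 < t)]
          exact mul_le_mul_of_nonneg_left (a1.trans (pow_le_pow_left₀ h0 h1 3)) (by linarith)
        · refine a2.trans ?_
          linarith [mul_le_mul_of_nonneg_right h1 (by positivity : 0 ≤ (1+B)*E)]
      · refine (abs_add_le _ _).trans ?_
        rw [one_mul, abs_mul, abs_of_nonneg hz.1]
        linarith [bN z, mul_le_mul hz.2 (bN1 z) (abs_nonneg _) hB.le]
    have NN := NL hU.le cφ cγ bγ lg lp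
    have e : (∫ ρ in (0:ℝ)..m, f ρ) - ∫ ρ in m..B, f ρ = (∫ ρ in (0:ℝ)..(m-U), f ρ) + ((∫ ρ in (m-U)..m, f ρ) - ∫ ρ in m..(m+U), f ρ) - ∫ ρ in (m+U)..B, f ρ := by
      rw [← intervalIntegral.integral_add_adjacent_intervals (ii 0 (m-U)) (ii _ m), ← intervalIntegral.integral_add_adjacent_intervals (ii m (m+U)) (ii _ B)]; ring
    rw [e]
    refine (norm_sub_le _ _).trans ((add_le_add ((norm_add_le _ _).trans (add_le_add F1 NN)) F2).trans ?_)
    have G : ∀ z, z ≤ B → L / (c0*t/2*U) * (2 + z + 2*C) ≤ ε/4/w := fun z hz => by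
      have e1 : c0*t/2*U = c0*K/2*w := by rw [← wt, ← hUw]; ring
      have e2 : 8*L*(2+B+2*C) ≤ K*(c0*ε) := by
        have : 8*L*(2+B+2*C)/(c0*ε) ≤ K := by simp only [K]; linarith
        rwa [div_le_iff₀ (by positivity)] at this
      rw [e1, div_mul_eq_mul_div, div_le_div_iff₀ (by positivity) w0]
      have : L*(2+z+2*C) ≤ L*(2+B+2*C) := by gcongr
      have : L*(2+z+2*C) ≤ ε/4*(c0*K/2) := by linarith
      linarith [mul_le_mul_of_nonneg_right this w0.le]
    have H : U * (L*(t*U^3 + 2*U*((1+B)*E)) + 2*L*U) ≤ ε/2/w := by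
      have e1 : U * (L*(t*U^3 + 2*U*((1+B)*E)) + 2*L*U) * w = L*(K^4+2*K^2)/w + 2*L*K^2*(1+B)*(E/w) := by
        simp only [U]; rw [← wt]; field_simp; ring
      have e2 : E/w ≤ η := (div_le_iff₀ w0).2 hEη
      have e3 : L*(K^4+2*K^2)/w ≤ ε/4 := by
        rw [div_le_iff₀ hε] at w4
        rw [div_le_iff₀ w0]
        linarith [show 0 ≤ K^4+2*K^2 by positivity]
      have e4 : 2*L*K^2*(1+B)*(E/w) ≤ ε/4 := by
        have : 2*L*K^2*(1+B)*(E/w) ≤ 2*(L+1)*K^2*(1+B)*η := by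
          have : 0 ≤ E/w := by positivity
          gcongr; linarith
        linarith
      rw [le_div_iff₀ w0, e1]; linarith
    have := G (m-U-0) (by linarith)
    have := G (B-(m+U)) (by linarith)
    have e5 : ε/w = ε/4/w + ε/2/w + ε/4/w := by ring
    linarith
  · have hv : 0 < vv m0 := div_pos hm0 (js_pos _)
    set c := vv m0/(2*(B+1))
    have hc : 0 < c := by positivity
    set M := L/c*(2+B+2*((3+B)/c))
    have hM : 0 ≤ M := by positivity
    refine ⟨min 1 (vv m0/(2*(1+B))), max 1 ((2*M/ε)^2), by positivity, fun t E ht hE hEη m N N1 N2 γ γ1 hm hmB dN dN1 bN bN1 bN2 dγ bγ bγ1 => ?_⟩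
    have t1 : 1 ≤ t := (le_max_left _ _).trans ht
    have w1 : 1 ≤ √t := Real.one_le_sqrt.2 t1
    have wt : √t * √t = t := Real.mul_self_sqrt (by linarith)
    have w4 := Real.le_sqrt_of_sq_le ((le_max_right _ _).trans ht)
    set w := √t
    have hw0 : 0 < w := by linarith
    have hwt : w ≤ t := by linarith [mul_le_mul_of_nonneg_right w1 hw0.le]
    have hEt : E ≤ t := by linarith [mul_le_mul_of_nonneg_right (min_le_left 1 (vv m0/(2*(1+B)))) hw0.le]
    have hE2 : (1+B)*E ≤ vv m0/2*t := by
      have : min 1 (vv m0/(2*(1+B))) ≤ vv m0/(2*(1+B)) := min_le_right _ _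
      rw [le_div_iff₀ (by positivity)] at this
      have h1 := mul_le_mul_of_nonneg_left hEη (by linarith : 0 ≤ 1+B)
      linarith [mul_le_mul_of_nonneg_right this hw0.le, mul_le_mul_of_nonneg_left hwt hv.le]
    obtain ⟨d1, d2, d3⟩ := gen (m := m) t1 hE hEt dN dN1 bN1 bN2
    have vis : ∀ ρ, 0 ≤ ρ → ρ ≤ B → 1 ≤ |ρ - -1| ∧ (c*t) * |ρ - -1| ≤ |s*(t*vv ρ - -1*(N ρ + ρ * N1 ρ))| ∧ |s*(t*(js ρ)⁻¹^3 - -1*(2*N1 ρ + ρ * N2 ρ))| ≤ (3+B)/c * (c*t) := by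
      intro ρ h0 h1
      rw [abs_of_nonneg (by linarith : 0 ≤ ρ - -1)]
      refine ⟨by linarith, ?_, (d3 ρ h0 h1).trans (le_of_eq (by field_simp))⟩
      rw [sa]
      refine le_trans ?_ (le_abs_self _)
      have a1 := (abs_le.1 (bN ρ)).1
      have a2 := (abs_le.1 (bN1 ρ)).1
      have a3 : ρ * (-E) ≤ ρ * N1 ρ := mul_le_mul_of_nonneg_left a2 h0
      have a4 : ρ*E ≤ B*E := mul_le_mul_of_nonneg_right h1 hE
      have a5 : vv m0 ≤ vv m := vv_sm.monotone hm
      have a6 : c*t*(ρ - -1) ≤ c*t*(B+1) := mul_le_mul_of_nonneg_left (by linarith) (by positivity)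
      have a7 : c*t*(B+1) = vv m0/2*t := by simp only [c]; field_simp
      have a8 : 0 ≤ t * vv ρ := mul_nonneg (by linarith) (vv_nn h0)
      linarith [mul_le_mul_of_nonneg_left a5 (by linarith : 0 ≤ t)]
    have hm' : 0 < m := by linarith
    have F1 := FL (γ := γ) (p := 0) (q := m) (m := -1) (U := 1) (l := c*t) (C := (3+B)/c) (L := L) hm'.le one_pos (by positivity) hL (by positivity) d1 d2 dγ bγ bγ1
      (fun ρ h0 h1 => vis ρ h0 (by linarith))
    have F2 := FL (γ := γ) (p := m) (q := B) (m := -1) (U := 1) (l := c*t) (C := (3+B)/c) (L := L) (by linarith) one_pos (by positivity) hL (by positivity) d1 d2 dγ bγ bγ1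
      (fun ρ h0 h1 => vis ρ (by linarith) h1)
    refine (norm_sub_le _ _).trans ((add_le_add F1 F2).trans ?_)
    have G : ∀ z, z ≤ B → L / (c*t*1) * (2 + z + 2*((3+B)/c)) ≤ ε/2/w := fun z hz => by
      have e1 : L / (c*t*1) * (2 + z + 2*((3+B)/c)) ≤ M / t := by
        have : M / t = L / (c*t*1) * (2 + B + 2*((3+B)/c)) := by simp only [M]; field_simp
        rw [this]; gcongr
      refine e1.trans ?_
      rw [div_le_iff₀ hε] at w4
      rw [div_le_div_iff₀ (by linarith) hw0, ← wt]
      linarith [mul_le_mul_of_nonneg_right w4 hw0.le]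
    have e5 : ε/w = ε/2/w + ε/2/w := by ring
    linarith [G (m-0) (by linarith), G (B-m) (by linarith)]


lemma js_c : Continuous js := continuous_iff_continuousAt.2 fun x => (js_d x).continuousAt
lemma ji_c : Continuous fun ρ => (js ρ)⁻¹ := continuous_iff_continuousAt.2 fun x => (ji_d x).continuousAt

lemma NNl {d : ℕ} {y z : Euc d} (h : 2*‖z‖ ≤ ‖y‖) (hy : 0 < ‖y‖) : ∃ N1 N2 : ℝ → ℝ, (∀ ρ, HasDerivAt (fun ρ => ‖y + (js ρ)⁻¹ • z‖) (N1 ρ) ρ) ∧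
    (∀ ρ, HasDerivAt N1 (N2 ρ) ρ) ∧ (∀ ρ, |N1 ρ| ≤ ‖z‖) ∧ ∀ ρ, |N2 ρ| ≤ 6*‖z‖ := by
  set w : ℝ → Euc d := fun ρ => y + (js ρ)⁻¹ • z
  set N : ℝ → ℝ := fun ρ => ‖w ρ‖
  set k1 : ℝ → ℝ := fun ρ => -ρ * (js ρ)⁻¹^3
  set k2 : ℝ → ℝ := fun ρ => -(js ρ)⁻¹^3 + 3*ρ^2*(js ρ)⁻¹^5
  have hN : ∀ ρ, ‖z‖ ≤ N ρ ∧ 0 < N ρ := fun ρ => by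
    have h1 : ‖(js ρ)⁻¹ • z‖ ≤ ‖z‖ := by
      rw [norm_smul, Real.norm_of_nonneg (ji_pos ρ).le]
      exact mul_le_of_le_one_left (norm_nonneg _) (ji_le ρ)
    have h2 := norm_sub_le (w ρ) ((js ρ)⁻¹ • z)
    simp only [w, add_sub_cancel_right] at h2
    have h3 : N ρ = ‖y + (js ρ)⁻¹ • z‖ := rfl
    have := norm_nonneg z
    constructor <;> linarith
  have dw : ∀ ρ, HasDerivAt w (k1 ρ • z) ρ := fun ρ => ((ji_d ρ).smul_const z).const_add y
  have dk : ∀ ρ, HasDerivAt k1 (k2 ρ) ρ := fun ρ => by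
    refine ((hasDerivAt_neg ρ).mul ((ji_d ρ).pow 3)).congr_deriv ?_
    simp only [k2, Pi.pow_apply]; norm_num; ring
  have dN : ∀ ρ, HasDerivAt N (k1 ρ * ⟪w ρ, z⟫ / N ρ) ρ := fun ρ => by
    have h1 := ((dw ρ).norm_sq).sqrt (pow_pos (hN ρ).2 2).ne'
    have e : (fun ρ => √(‖w ρ‖^2)) = N := by ext x; exact Real.sqrt_sq (norm_nonneg _)
    rw [e] at h1
    refine h1.congr_deriv ?_
    rw [Real.sqrt_sq (norm_nonneg _), inner_smul_right]
    have := (hN ρ).2.ne'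
    simp only [N]; field_simp
  have cs : ∀ ρ, |⟪w ρ, z⟫| ≤ N ρ * ‖z‖ := fun ρ => abs_real_inner_le_norm _ _
  have jb : ∀ ρ, |ρ * (js ρ)⁻¹| ≤ 1 := fun ρ => by have := vv_abs ρ; rwa [vv, div_eq_mul_inv] at this
  have bk1 : ∀ ρ, |k1 ρ| ≤ 1 := fun ρ => by
    have e : k1 ρ = -(ρ * (js ρ)⁻¹) * (js ρ)⁻¹^2 := by simp only [k1]; ring
    rw [e, abs_mul, abs_neg, abs_of_nonneg (by positivity : 0 ≤ (js ρ)⁻¹^2)]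
    exact mul_le_one₀ (jb ρ) (by positivity) (pow_le_one₀ (ji_pos ρ).le (ji_le ρ))
  have bk2 : ∀ ρ, |k2 ρ| ≤ 4 := fun ρ => by
    have e : k2 ρ = -(js ρ)⁻¹^3 + 3*((ρ*(js ρ)⁻¹)^2*(js ρ)⁻¹^3) := by simp only [k2]; ring
    have h1 : 0 ≤ (js ρ)⁻¹^3 := pow_nonneg (ji_pos ρ).le 3
    have h2 : (js ρ)⁻¹^3 ≤ 1 := pow_le_one₀ (ji_pos ρ).le (ji_le ρ)
    have h3 : (ρ*(js ρ)⁻¹)^2 ≤ 1 := (sq_le_one_iff_abs_le_one _).2 (jb ρ)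
    have h4 := mul_le_one₀ h3 h1 h2
    have h5 := mul_nonneg (sq_nonneg (ρ*(js ρ)⁻¹)) h1
    rw [e, abs_le]; constructor <;> linarith
  have bN1 : ∀ ρ, |k1 ρ * ⟪w ρ, z⟫ / N ρ| ≤ ‖z‖ := fun ρ => by
    rw [abs_div, abs_of_pos (hN ρ).2, div_le_iff₀ (hN ρ).2, abs_mul, mul_comm ‖z‖]
    exact (mul_le_of_le_one_left (abs_nonneg _) (bk1 ρ)).trans (cs ρ)
  refine ⟨_, fun ρ => ((k2 ρ * ⟪w ρ, z⟫ + k1 ρ * (k1 ρ * ‖z‖^2)) - (k1 ρ * ⟪w ρ, z⟫ / N ρ) * (k1 ρ * ⟪w ρ, z⟫ / N ρ)) / N ρ, dN, fun ρ => ?_, bN1, fun ρ => ?_⟩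
  · have h1 : HasDerivAt (fun ρ => ⟪w ρ, z⟫) (k1 ρ * ‖z‖^2) ρ := by
      refine ((dw ρ).inner ℝ (hasDerivAt_const ρ z)).congr_deriv ?_
      rw [inner_zero_right, zero_add, real_inner_smul_left, real_inner_self_eq_norm_sq]
    refine ((dk ρ).mul h1 |>.div (dN ρ) (hN ρ).2.ne').congr_deriv ?_
    have := (hN ρ).2.ne'
    simp only [Pi.mul_apply]
    field_simp
  · have hn := (hN ρ).2
    have z0 := norm_nonneg z
    rw [abs_div, abs_of_pos hn, div_le_iff₀ hn]
    have a1 : |k2 ρ * ⟪w ρ, z⟫| ≤ 4*(N ρ * ‖z‖) := by rw [abs_mul]; exact mul_le_mul (bk2 ρ) (cs ρ) (abs_nonneg _) (by norm_num)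
    have a2 : |k1 ρ * (k1 ρ * ‖z‖^2)| ≤ N ρ * ‖z‖ := by
      rw [abs_mul (k1 ρ), abs_mul (k1 ρ), abs_of_nonneg (sq_nonneg ‖z‖)]
      have : |k1 ρ| * (|k1 ρ| * ‖z‖^2) ≤ ‖z‖^2 := (mul_le_of_le_one_left (by positivity) (bk1 ρ)).trans (mul_le_of_le_one_left (by positivity) (bk1 ρ))
      nlinarith [(hN ρ).1]
    have a3 : |(k1 ρ * ⟪w ρ, z⟫ / N ρ) * (k1 ρ * ⟪w ρ, z⟫ / N ρ)| ≤ N ρ * ‖z‖ := by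
      rw [abs_mul]
      exact (mul_le_mul (bN1 ρ) (bN1 ρ) (abs_nonneg _) z0).trans (mul_le_mul_of_nonneg_right (hN ρ).1 z0)
    refine (abs_sub _ _).trans ?_
    have := abs_add_le (k2 ρ * ⟪w ρ, z⟫) (k1 ρ * (k1 ρ * ‖z‖^2))
    linarith

lemma gaml (R : ℝ) (n : ℕ) (β : ℝ) : ∃ (γ1 : ℝ → ℝ) (L : ℝ), 0 ≤ L ∧ (∀ ρ, HasDerivAt (fun ρ => gg R n ρ * ρ^β) (γ1 ρ) ρ) ∧ (∀ ρ, |gg R n ρ * ρ^β| ≤ L) ∧ ∀ ρ, |γ1 ρ| ≤ L := by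
  set γ : ℝ → ℝ := fun ρ => gg R n ρ * ρ^β
  have h0 : ∀ ρ : ℝ, (ρ < 1/((n:ℝ)+1) ∨ R < ρ) → γ ρ = 0 := fun ρ h => by
    simp only [γ]
    rw [(gg_nice R n).supp ρ (fun hh => by rcases h with h | h <;> linarith [hh.1, hh.2]), zero_mul]
  have hp : (0:ℝ) < 1/(n+1) := by positivity
  have hc : ContDiff ℝ 1 γ := contDiff_iff_contDiffAt.2 fun ρ => by
    rcases lt_or_ge ρ (1/((n:ℝ)+1)) with h | h
    · refine (contDiffAt_const (c := (0:ℝ))).congr_of_eventuallyEq ?_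
      filter_upwards [eventually_lt_nhds h] with x hx using h0 x (.inl hx)
    · exact ((gg_smooth R n).contDiffAt.of_le (by exact_mod_cast le_top)).mul (contDiffAt_id.rpow_const_of_ne (hp.trans_le h).ne')
  have hs : HasCompactSupport γ := HasCompactSupport.intro (isCompact_Icc (a := 0) (b := R)) fun x hx => h0 x (by
    by_contra hh; push Not at hh; exact hx ⟨hp.le.trans hh.1, hh.2⟩)
  obtain ⟨L1, h1⟩ := hs.exists_bound_of_continuous hc.continuous
  obtain ⟨L2, h2⟩ := hs.deriv.exists_bound_of_continuous (hc.continuous_deriv le_rfl)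
  exact ⟨deriv γ, max 0 (max L1 L2), le_max_left _ _, fun ρ => (hc.differentiable one_ne_zero ρ).hasDerivAt,
    fun ρ => (h1 ρ).trans ((le_max_left _ _).trans (le_max_right _ _)), fun ρ => (h2 ρ).trans ((le_max_right _ _).trans (le_max_right _ _))⟩

lemma rpl (β : ℝ) : ∃ C : ℝ, 0 ≤ C ∧ ∀ z : ℝ, 1/2 ≤ z → z ≤ 2 → |z^β - 1| ≤ C * |z - 1| := by
  have hc : ContinuousOn (fun z : ℝ => β * z^(β-1)) (Set.Icc (1/2) 2) := continuousOn_const.mul (ContinuousOn.rpow_const continuousOn_id fun x hx => .inl (by have := hx.1; exact (show (0:ℝ) < x by linarith).ne'))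
  obtain ⟨C, hC⟩ := isCompact_Icc.exists_bound_of_continuousOn hc
  refine ⟨max C 0, le_max_right _ _, fun z h1 h2 => ?_⟩
  have := Convex.norm_image_sub_le_of_norm_hasDerivWithin_le (f := fun z : ℝ => z^β) (s := Set.Icc (1/2) 2) (C := max C 0)
    (fun z hz => (Real.hasDerivAt_rpow_const (p := β) (.inl (show (0:ℝ) < z by linarith [hz.1]).ne')).hasDerivWithinAt) (fun z hz => (hC z hz).trans (le_max_left _ _)) (convex_Icc _ _)
    (show (1:ℝ) ∈ Set.Icc (1/2) 2 by constructor <;> norm_num) (show z ∈ Set.Icc (1/2) 2 from ⟨h1, h2⟩)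
  simpa using this


section
variable {d : ℕ} [NeZero d]

def Ff (R : ℝ) (n : ℕ) (s t : ℝ) (b z : Euc d) (ξ : Euc d) : ℂ := ei (s*t*js ‖ξ‖ + ⟪b + (js ‖ξ‖)⁻¹ • z, ξ⟫) * (gg R n ‖ξ‖ : ℂ)

lemma gg_c (R : ℝ) (n : ℕ) : Continuous fun x => ((gg R n x : ℝ) : ℂ) := Complex.continuous_ofReal.comp (gg_smooth R n).continuous

lemma Ff_c (R : ℝ) (n : ℕ) (s t : ℝ) (b z : Euc d) : Continuous (Ff R n s t b z) := by
  have h1 := js_c.comp (continuous_norm (E := Euc d))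
  have h2 := ji_c.comp (continuous_norm (E := Euc d))
  have h3 := (gg_c R n).comp (continuous_norm (E := Euc d))
  exact (ei_c.comp ((continuous_const.mul h1).add ((continuous_const.add (h2.smul continuous_const)).inner continuous_id))).mul h3

lemma Ff_b (R : ℝ) (n : ℕ) (s t : ℝ) (b z ξ : Euc d) : ‖Ff R n s t b z ξ‖ ≤ 1 := by
  rw [Ff, norm_mul, ei_n, one_mul]; simpa using (gg_nice R n).bdd ‖ξ‖
lemma Ff_0 {R : ℝ} (n : ℕ) (s t : ℝ) (b z : Euc d) (ξ : Euc d) (h : R < ‖ξ‖) : Ff R n s t b z ξ = 0 := by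
  rw [Ff, (gg_nice R n).supp _ (fun h1 => by linarith [h1.2])]; simp
lemma Ff_i (R : ℝ) (n : ℕ) (s t : ℝ) (b z : Euc d) : Integrable (Ff R n s t b z) := bdd_int (Ff_c R n s t b z).aestronglyMeasurable (Ff_b R n s t b z) (Ff_0 n s t b z)

lemma Zs_c : Continuous (Zs (d := d)) := continuous_of_dominated (bound := fun _ => 1)
    (fun x => (ei_c.comp (by fun_prop)).aestronglyMeasurable) (fun x => .of_forall fun θ => (ei_n _).le) (integrable_const _)
    (.of_forall fun θ => ei_c.comp (by fun_prop))

def Hf (R : ℝ) (n : ℕ) (s t : ℝ) (y z : Euc d) (ρ : ℝ) : ℂ := ((ρ^(d-1) * gg R n ρ : ℝ) : ℂ) * (ei (s*t*js ρ) * Zs (ρ • (y + (js ρ)⁻¹ • z)))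

lemma Hf_c (R : ℝ) (n : ℕ) (s t : ℝ) (y z : Euc d) : Continuous (Hf R n s t y z) :=
  (Complex.continuous_ofReal.comp ((continuous_pow _).mul (gg_smooth R n).continuous)).mul ((ei_c.comp (continuous_const.mul js_c)).mul
    (Zs_c.comp (continuous_id.smul (continuous_const.add (ji_c.smul continuous_const)))))

lemma PA {R : ℝ} {n : ℕ} {s t : ℝ} {b z x : Euc d} {m B : ℝ} (hm : 0 ≤ m) (hB : m ≤ B) (hR : R ≤ B) (h : ∀ ρ : ℝ, 0 < ρ → (nn t ρ < ‖x‖ ↔ ρ < m)) :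
    2 * AF t (Ff R n s t b z) x - IT (Ff R n s t b z) x = (∫ ρ in (0:ℝ)..m, Hf R n s t (x+b) z ρ) - ∫ ρ in m..B, Hf R n s t (x+b) z ρ := by
  set G : Euc d → ℂ := fun ξ => (if nn t ‖ξ‖ < ‖x‖ then 1 else -1) * (Complex.exp (Complex.I * ((⟪x, ξ⟫ : ℝ) : ℂ)) * Ff R n s t b z ξ)
  have ms : MeasurableSet {ξ : Euc d | nn t ‖ξ‖ < ‖x‖} := measurableSet_lt (by unfold nn; fun_prop) measurable_const
  have mG : Measurable G := (Measurable.ite ms measurable_const measurable_const).mul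
    ((Continuous.measurable (by fun_prop)).mul (Ff_c R n s t b z).measurable)
  have e1 : 2 * AF t (Ff R n s t b z) x - IT (Ff R n s t b z) x = ∫ ξ, G ξ := by
    rw [AF, IT, IT, ← integral_const_mul, ← integral_sub]
    · refine integral_congr_ae (.of_forall fun ξ => ?_)
      simp only [G]; split_ifs <;> ring
    · refine (IT_int ?_ x).const_mul 2
      exact (Ff_i R n s t b z).indicator ms
    · exact IT_int (Ff_i R n s t b z) x
  have iG : Integrable G := (IT_int (Ff_i R n s t b z) x).bdd_mul (c := 1) (Measurable.ite ms measurable_const measurable_const).aestronglyMeasurable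
    (.of_forall fun ξ => by split_ifs <;> simp)
  have iP := (polar_iff mG).1 iG
  rw [e1, polar_int mG, integral_prod_symm _ iP]
  set H := Hf R n s t (x+b) z
  have cH := Hf_c R n s t (x+b) z
  have e2 : ∀ ρ : ℝ, 0 < ρ → ∫ θ : Sp d, ρ^(d-1) • G (ρ • (θ:Euc d)) ∂sg d = (if ρ < m then 1 else -1) * H ρ := fun ρ hρ => by
    simp only [H, Hf, Zs]
    rw [← integral_const_mul, ← integral_const_mul, ← integral_const_mul]
    refine integral_congr_ae (.of_forall fun θ => ?_)
    simp only [G, Ff, norm_sp hρ, h ρ hρ]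
    change _ • (_ * (ei _ * _)) = _
    rw [Complex.real_smul, ei_add]
    have : ei ⟪ρ • (x + b + (js ρ)⁻¹ • z), (θ:Euc d)⟫ = ei ⟪x, ρ • (θ:Euc d)⟫ * ei ⟪b + (js ρ)⁻¹ • z, ρ • (θ:Euc d)⟫ := by
      rw [← ei_add, ← inner_add_left, real_inner_smul_left, real_inner_smul_right, add_assoc]
    rw [this]; push_cast; ring
  rw [setIntegral_congr_fun measurableSet_Ioi (fun ρ hρ => e2 ρ hρ)]
  have hH : ∀ ρ, B < ρ → H ρ = 0 := fun ρ hρ => by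
    simp only [H, Hf]; rw [(gg_nice R n).supp ρ (fun hh => by linarith [hh.2])]; simp
  rw [setIntegral_eq_of_subset_of_forall_diff_eq_zero (s := Set.Ioc 0 B) measurableSet_Ioi Set.Ioc_subset_Ioi_self (fun ρ hρ => by
    rw [hH ρ (not_le.1 fun hh => hρ.2 ⟨hρ.1, hh⟩), mul_zero]), ← intervalIntegral.integral_of_le (hm.trans hB)]
  have ii : ∀ a b : ℝ, IntervalIntegrable (fun ρ => (if ρ < m then (1:ℂ) else -1) * H ρ) volume a b := fun a b => by
    have := (cH.intervalIntegrable (μ := volume) a b)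
    rw [intervalIntegrable_iff] at this ⊢
    exact this.bdd_mul (c := 1) (Measurable.ite measurableSet_Iio measurable_const measurable_const).aestronglyMeasurable
      (.of_forall fun ξ => by split_ifs <;> simp)
  rw [← intervalIntegral.integral_add_adjacent_intervals (ii 0 m) (ii m B), sub_eq_add_neg, ← intervalIntegral.integral_neg]
  have hne : ∀ᵐ ρ : ℝ, ρ ≠ m := by simp [ae_iff]
  congr 1
  · refine intervalIntegral.integral_congr_ae ?_
    filter_upwards [hne] with ρ h1 h2
    rw [Set.uIoc_of_le hm] at h2
    rw [if_pos (lt_of_le_of_ne h2.2 h1), one_mul]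
  · refine intervalIntegral.integral_congr fun ρ h2 => ?_
    rw [Set.uIcc_of_le hB] at h2
    simp only [if_neg (not_lt.2 h2.1), neg_mul, one_mul]

lemma PB (R : ℝ) (n : ℕ) : ∃ (c₁ c₂ : ℂ) (K : ℝ), 0 ≤ K ∧ ∀ (s t r E : ℝ) (y z : Euc d), 0 ≤ E → 2*E ≤ r → 2*(n+1) ≤ r → 
    (∀ ρ, |‖y + (js ρ)⁻¹ • z‖ - r| ≤ E) → ∀ ρ, 
    ‖Hf R n s t y z ρ - ((r^(-EigF.be d) : ℝ):ℂ) * (((gg R n ρ * ρ^(EigF.be d) : ℝ) : ℂ) * (ei (s*t*js ρ) * (c₁ * ei (ρ * ‖y + (js ρ)⁻¹ • z‖) + c₂ * ei (-(ρ * ‖y + (js ρ)⁻¹ • z‖)))))‖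
      ≤ K * (1+E) * r^(-EigF.be d) / r := by
  obtain ⟨c₁, c₂, C, hC, H⟩ := Zs_as (d := d)
  obtain ⟨γ1, L, hL, -, bγ, -⟩ := gaml R n (EigF.be d)
  obtain ⟨C2, hC2, H2⟩ := rpl (-EigF.be d)
  set β := EigF.be d
  refine ⟨c₁, c₂, L*((n+1)*(C*(1+C2)*2)) + L*((‖c₁‖+‖c₂‖)*C2), by positivity, fun s t r E y z hE h2E hr hN ρ => ?_⟩
  have hr0 : 0 < r := by have : (0:ℝ) ≤ n := by positivity
                         linarith
  set N := ‖y + (js ρ)⁻¹ • z‖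
  by_cases hρ : 1/((n:ℝ)+1) ≤ ρ ∧ ρ ≤ R
  swap
  · rw [Hf, (gg_nice R n).supp ρ hρ]; simp; positivity
  have ρ0 : 0 < ρ := lt_of_lt_of_le (by positivity) hρ.1
  have hNr := abs_le.1 (hN ρ)
  have hN0 : r/2 ≤ N := by linarith [hNr.1]
  have N0 : 0 < N := by linarith
  have ry : ‖ρ • (y + (js ρ)⁻¹ • z)‖ = ρ * N := by rw [norm_smul, Real.norm_of_nonneg ρ0.le]
  have iρ : 1/ρ ≤ n+1 := by rw [div_le_iff₀ ρ0]; have := hρ.1; rw [div_le_iff₀ (by positivity)] at this; linarith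
  have hZ := H (ρ • (y + (js ρ)⁻¹ • z)) (by
    rw [ry]; have := mul_le_mul hρ.1 (show (n:ℝ)+1 ≤ N by linarith) (by positivity) ρ0.le
    rwa [one_div_mul_cancel (by positivity)] at this)
  rw [ry] at hZ
  have hq := H2 (N/r) (by rw [le_div_iff₀ hr0]; linarith) (by rw [div_le_iff₀ hr0]; linarith [hNr.2])
  have e1 : |N/r - 1| ≤ E/r := by
    rw [show N/r - 1 = (N-r)/r by field_simp, abs_div, abs_of_pos hr0]; exact div_le_div_of_nonneg_right (hN ρ) hr0.le
  have e2 : |N^(-β) - r^(-β)| ≤ r^(-β) * (C2 * (E/r)) := by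
    have : N^(-β) - r^(-β) = r^(-β) * ((N/r)^(-β) - 1) := by
      rw [Real.div_rpow N0.le hr0.le]; have : r^(-β) ≠ 0 := (Real.rpow_pos_of_pos hr0 _).ne'
      field_simp
    rw [this, abs_mul, abs_of_nonneg (by positivity)]
    exact mul_le_mul_of_nonneg_left (hq.trans (mul_le_mul_of_nonneg_left e1 hC2)) (by positivity)
  have e3 : N^(-β) ≤ r^(-β) * (1+C2) := by
    have h1 := (abs_le.1 e2).2
    have h3 : E/r ≤ 1 := by rw [div_le_one hr0]; linarith
    have h4 : r^(-β) * (C2*(E/r)) ≤ r^(-β)*C2 := mul_le_mul_of_nonneg_left (mul_le_of_le_one_right hC2 h3) (by positivity)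
    linarith
  set Q := c₁ * ei (ρ * N) + c₂ * ei (-(ρ * N))
  have hQ : ‖Q‖ ≤ ‖c₁‖+‖c₂‖ := (norm_add_le _ _).trans (by simp [ei_n])
  set W := Zs (ρ • (y + (js ρ)⁻¹ • z))
  set g := gg R n ρ
  have ep : ρ^(d-1) = ρ^β * ρ^β := be_pow ρ0
  have em : ρ^β * ρ^(-β) = 1 := by rw [← Real.rpow_add ρ0]; simp
  have key : Hf R n s t y z ρ - ((r^(-β) : ℝ):ℂ) * (((g * ρ^β : ℝ) : ℂ) * (ei (s*t*js ρ) * Q)) =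
      ((g * ρ^β : ℝ) : ℂ) * (ei (s*t*js ρ) * (((ρ^β:ℝ):ℂ) * (W - (((ρ*N)^(-β) : ℝ):ℂ) * Q) + ((N^(-β) - r^(-β) : ℝ):ℂ) * Q)) := by
    have : ((ρ^β:ℝ):ℂ) * (((ρ*N)^(-β) : ℝ):ℂ) = ((N^(-β):ℝ):ℂ) := by
      rw [← Complex.ofReal_mul, Real.mul_rpow ρ0.le N0.le, ← mul_assoc, em, one_mul]
    rw [Hf, mul_sub, ← mul_assoc ((ρ^β:ℝ):ℂ) _ Q, this, ep]; push_cast; ring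
  rw [key, norm_mul, norm_mul, ei_n, one_mul, Complex.norm_real, Real.norm_eq_abs]
  have b1 : ‖((ρ^β:ℝ):ℂ) * (W - (((ρ*N)^(-β) : ℝ):ℂ) * Q)‖ ≤ (n+1)*(C*(1+C2)*2) * (r^(-β)/r) := by
    rw [norm_mul, Complex.norm_real, Real.norm_of_nonneg (by positivity)]
    have h1 : ρ^β * (C * (ρ*N)^(-β-1)) = 1/ρ * (C * N^(-β) * (1/N)) := by
      rw [Real.rpow_sub_one (by positivity), Real.mul_rpow ρ0.le N0.le]
      field_simp; linear_combination C * em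
    have h2 : 1/N ≤ 2/r := by rw [div_le_div_iff₀ N0 hr0]; linarith
    calc _ ≤ ρ^β * (C * (ρ*N)^(-β-1)) := mul_le_mul_of_nonneg_left hZ (by positivity)
      _ = 1/ρ * (C * N^(-β) * (1/N)) := h1
      _ ≤ (n+1) * (C * (r^(-β)*(1+C2)) * (2/r)) := by gcongr
      _ = _ := by ring
  have b2 : ‖((N^(-β) - r^(-β) : ℝ):ℂ) * Q‖ ≤ ((‖c₁‖+‖c₂‖)*C2) * (r^(-β)/r) * E := by
    rw [norm_mul, Complex.norm_real, Real.norm_eq_abs]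
    calc _ ≤ (r^(-β) * (C2 * (E/r))) * (‖c₁‖+‖c₂‖) := mul_le_mul e2 hQ (norm_nonneg _) (by positivity)
      _ = _ := by ring
  calc _ ≤ L * ((n+1)*(C*(1+C2)*2) * (r^(-β)/r) + ((‖c₁‖+‖c₂‖)*C2) * (r^(-β)/r) * E) :=
        mul_le_mul (bγ ρ) ((norm_add_le _ _).trans (add_le_add b1 b2)) (norm_nonneg _) hL
    _ ≤ _ := by
        have p1 : 0 ≤ (n+1)*(C*(1+C2)*2) * (r^(-β)/r) := by positivity
        have p2 : 0 ≤ ((‖c₁‖+‖c₂‖)*C2) * (r^(-β)/r) := by positivity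
        have := mul_nonneg hL (add_nonneg (mul_nonneg p1 hE) p2)
        exact le_of_sub_nonneg (this.trans_eq (by ring))

end


lemma vv_inv {v : ℝ} (h1 : v^2 < 1) : vv (v/√(1-v^2)) = v := by
  have h0 : 0 < √(1-v^2) := Real.sqrt_pos.2 (by linarith)
  have : js (v/√(1-v^2)) = 1/√(1-v^2) := by
    rw [js, Real.sqrt_eq_iff_mul_self_eq (by positivity) (by positivity)]
    field_simp; rw [Real.sq_sqrt (by linarith)]; ring
  rw [vv, this]; field_simp

section
variable {d : ℕ} [NeZero d]
set_option maxHeartbeats 1000000 in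
lemma P2 (R : ℝ) (n : ℕ) {s c1 c2 q : ℝ} (hs : s = 1 ∨ s = -1) (h1 : 0 < c1) (h2 : c2 < 1) (hq : 0 < q) :
    ∃ η T : ℝ, 0 < η ∧ 1 ≤ T ∧ ∀ (t : ℝ) (b z x : Euc d), T ≤ t → ‖b‖ + ‖z‖ ≤ η * √t → c1*t ≤ ‖x‖ → ‖x‖ ≤ c2*t →
      ‖2 * AF t (Ff R n s t b z) x - IT (Ff R n s t b z) x‖ ≤ q * (‖x‖^(-EigF.be d) / √t) := by
  obtain ⟨a₁, a₂, K, hK, HB⟩ := PB (d := d) R n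
  obtain ⟨γ1, L, hL, dγ, bγ, bγ1⟩ := gaml R n (EigF.be d)
  set β := EigF.be d
  set γ : ℝ → ℝ := fun ρ => gg R n ρ * ρ^β
  set B := max (max R (c2/√(1-c2^2))) 0 + 1
  have hB : 0 < B := by have := le_max_right (max R (c2/√(1-c2^2))) 0; simp only [B]; linarith
  set q1 := q/(4*(‖a₁‖+‖a₂‖+1))
  have hq1 : 0 < q1 := by positivity
  have hms : -s = 1 ∨ -s = -1 := by rcases hs with rfl | rfl <;> simp
  obtain ⟨η1, T1, hη1, H1⟩ := P1 hs hms hB h1 hL hq1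
  obtain ⟨η2, T2, hη2, H2⟩ := P1 hs hs hB h1 hL hq1
  set D := B*K/c1 + 1
  have hD : 0 < D := by positivity
  set η := min (min η1 η2) (q/(4*D))
  have hη : 0 < η := lt_min (lt_min hη1 hη2) (by positivity)
  have hn : (0:ℝ) ≤ n := by positivity
  set M := 1 + 2*η/c1 + 6*η + 4*D/q + 2*(n+1)/c1
  have hM : 1 ≤ M := by have : 0 ≤ 2*η/c1 + 6*η + 4*D/q + 2*(n+1)/c1 := by positivity
                        simp only [M]; linarith
  refine ⟨η, max (max T1 T2) (M^2), hη, (one_le_pow₀ hM).trans (le_max_right _ _), fun t b z x ht hE hx1 hx2 => ?_⟩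
  have hMt : M ≤ √t := Real.le_sqrt_of_sq_le ((le_max_right _ _).trans ht)
  have hT1 : T1 ≤ t := ((le_max_left _ _).trans (le_max_left _ _)).trans ht
  have hT2 : T2 ≤ t := ((le_max_right _ _).trans (le_max_left _ _)).trans ht
  have st : 1 ≤ √t := hM.trans hMt
  have t0 : 0 < t := Real.sqrt_pos.1 (by linarith)
  have tt : √t * √t = t := Real.mul_self_sqrt t0.le
  set r := ‖x‖
  set E := ‖b‖ + ‖z‖
  have E0 : 0 ≤ E := by positivity
  have p1 : 0 ≤ 2*η/c1 := by positivity
  have p2 : 0 ≤ 4*D/q := by positivity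
  have p3 : 0 ≤ 2*(n+1)/c1 := by positivity
  have k1 : 2*η ≤ c1*√t := by
    have : 2*η/c1 ≤ √t := by simp only [M] at hMt; linarith
    rw [div_le_iff₀ h1] at this; linarith
  have k2 : 2*(n+1) ≤ c1*√t := by
    have : 2*(n+1)/c1 ≤ √t := by simp only [M] at hMt; linarith
    rw [div_le_iff₀ h1] at this; linarith
  have k3 : 6*η ≤ √t := by simp only [M] at hMt; linarith
  have k4 : 4*D ≤ q*√t := by
    have : 4*D/q ≤ √t := by simp only [M] at hMt; linarith
    rw [div_le_iff₀ hq] at this; linarith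
  have r0 : 0 < r := lt_of_lt_of_le (by positivity) hx1
  have tr : √t ≤ t := (le_mul_of_one_le_left (Real.sqrt_nonneg t) st).trans_eq tt
  have u1 : 2*E ≤ r := by
    have := mul_le_mul_of_nonneg_right k1 (Real.sqrt_nonneg t)
    rw [mul_assoc c1, tt] at this; linarith
  have u2 : 2*(n+1) ≤ r := by linarith [mul_le_mul_of_nonneg_left tr h1.le]
  have u3 : 6*E ≤ t := by
    have := mul_le_mul_of_nonneg_right k3 (Real.sqrt_nonneg t)
    rw [tt] at this; linarith
  have hyr : |‖x+b‖ - r| ≤ ‖b‖ := by have := abs_norm_sub_norm_le (x+b) x; rwa [add_sub_cancel_left] at this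
  have hz0 := norm_nonneg z
  have hb0 := norm_nonneg b
  have hy : 2*‖z‖ ≤ ‖x+b‖ ∧ 0 < ‖x+b‖ := by
    have := (abs_le.1 hyr).1
    simp only [E] at u1
    exact ⟨by linarith, by linarith⟩
  obtain ⟨N1, N2, dN, dN1, bN1, bN2⟩ := NNl hy.1 hy.2
  set N : ℝ → ℝ := fun ρ => ‖x + b + (js ρ)⁻¹ • z‖
  have hN : ∀ ρ, |N ρ - r| ≤ E := fun ρ => by
    have h3 := abs_norm_sub_norm_le (x+b+(js ρ)⁻¹•z) x
    refine h3.trans ?_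
    rw [add_assoc, add_sub_cancel_left]
    refine (norm_add_le _ _).trans (add_le_add_right ?_ _)
    rw [norm_smul, Real.norm_of_nonneg (ji_pos ρ).le]
    exact mul_le_of_le_one_left hz0 (ji_le ρ)
  have v0 : 0 < r/t := by positivity
  have vc1 : c1 ≤ r/t := by rwa [le_div_iff₀ t0]
  have vc2 : r/t ≤ c2 := by rwa [div_le_iff₀ t0]
  have vv1 : (r/t)^2 < 1 := (sq_lt_one_iff_abs_lt_one _).2 (by rw [abs_of_pos v0]; linarith)
  set m := (r/t)/√(1-(r/t)^2)
  have hm : vv m = r/t := vv_inv vv1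
  have m0 : 0 ≤ m := by positivity
  have hm1 : c1 ≤ m := by
    have : vv m ≤ m := div_le_self m0 (js_ge m)
    linarith
  have hm2 : m ≤ B - 1 := by
    have h3 : m ≤ c2/√(1-c2^2) := by
      rw [← vv_sm.le_iff_le, hm, vv_inv ((sq_lt_one_iff_abs_lt_one _).2 (by rw [abs_of_pos (v0.trans_le vc2)]; exact h2))]; exact vc2
    have h4 := le_max_right R (c2/√(1-c2^2))
    have h5 := le_max_left (max R (c2/√(1-c2^2))) 0
    simp only [B]; linarith
  have hRB : R ≤ B := by
    have h4 := le_max_left R (c2/√(1-c2^2))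
    have h5 := le_max_left (max R (c2/√(1-c2^2))) 0
    simp only [B]; linarith
  have hmB : m ≤ B := by linarith
  have tvm : t * vv m = r := by rw [hm]; field_simp
  rw [PA m0 hmB hRB (fun ρ hρ => by rw [nn_vv, show ‖x‖ = t * vv m from tvm.symm, mul_lt_mul_iff_right₀ t0, vv_sm.lt_iff_lt])]
  have hH := HB s t r E (x+b) z E0 u1 u2 hN
  have g1 := H1 t E hT1 E0 (hE.trans (mul_le_mul_of_nonneg_right ((min_le_left _ _).trans (min_le_left _ _)) (Real.sqrt_nonneg t))) m N N1 N2 γ γ1 hm1 hm2 dN dN1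
    (by rwa [tvm]) (fun ρ => (bN1 ρ).trans (by simp only [E]; linarith)) (fun ρ => (bN2 ρ).trans (by simp only [E] at u3; linarith)) dγ bγ bγ1
  have g2 := H2 t E hT2 E0 (hE.trans (mul_le_mul_of_nonneg_right ((min_le_left _ _).trans (min_le_right _ _)) (Real.sqrt_nonneg t))) m N N1 N2 γ γ1 hm1 hm2 dN dN1
    (by rwa [tvm]) (fun ρ => (bN1 ρ).trans (by simp only [E]; linarith)) (fun ρ => (bN2 ρ).trans (by simp only [E] at u3; linarith)) dγ bγ bγ1
  have cN : Continuous N := continuous_iff_continuousAt.2 fun x => (dN x).continuousAt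
  have cγ : Continuous γ := continuous_iff_continuousAt.2 fun x => (dγ x).continuousAt
  set f : ℝ → ℝ → ℂ := fun σ ρ => ei (s*(t * js ρ - σ * (ρ * N ρ))) * γ ρ
  have cf : ∀ σ, Continuous (f σ) := fun σ => (ei_c.comp (continuous_const.mul ((continuous_const.mul js_c).sub
    (continuous_const.mul (continuous_id.mul cN))))).mul (Complex.continuous_ofReal.comp cγ)
  set ρb : ℂ := ((r^(-β) : ℝ) : ℂ)
  set Hm : ℝ → ℂ := fun ρ => ρb * a₁ * f (-s) ρ + ρb * a₂ * f s ρ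
  have cm : Continuous Hm := (continuous_const.mul (cf _)).add (continuous_const.mul (cf _))
  set H := Hf R n s t (x+b) z
  have cH : Continuous H := Hf_c R n s t (x+b) z
  set k := K * (1+E) * r^(-β) / r
  have hd : ∀ ρ, ‖H ρ - Hm ρ‖ ≤ k := fun ρ => by
    refine le_trans (le_of_eq ?_) (hH ρ)
    congr 2
    have ss : s*s = 1 := by rcases hs with rfl | rfl <;> norm_num
    have q1 : s*(t*js ρ - -s*(ρ*N ρ)) = s*t*js ρ + ρ*N ρ := by linear_combination (ρ*N ρ) * ss
    have q2 : s*(t*js ρ - s*(ρ*N ρ)) = s*t*js ρ + -(ρ*N ρ) := by linear_combination -(ρ*N ρ) * ss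
    simp only [Hm, f, q1, q2, ei_add, γ, N]; ring
  have eI : ∀ a b : ℝ, ∫ ρ in a..b, Hm ρ = ρb * a₁ * (∫ ρ in a..b, f (-s) ρ) + ρb * a₂ * ∫ ρ in a..b, f s ρ := fun a b => by
    rw [← intervalIntegral.integral_const_mul, ← intervalIntegral.integral_const_mul]
    exact intervalIntegral.integral_add ((continuous_const.mul (cf _)).intervalIntegrable _ _) ((continuous_const.mul (cf _)).intervalIntegrable _ _)
  have eD : ∀ a b : ℝ, a ≤ b → ‖(∫ ρ in a..b, H ρ) - ∫ ρ in a..b, Hm ρ‖ ≤ k * (b-a) := fun a b hab => by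
    rw [← intervalIntegral.integral_sub (cH.intervalIntegrable _ _) (cm.intervalIntegrable _ _)]
    have := intervalIntegral.norm_integral_le_of_norm_le_const (a := a) (b := b) (f := fun ρ => H ρ - Hm ρ) fun ρ _ => hd ρ
    rwa [abs_of_nonneg (by linarith)] at this
  have d1 := eD 0 m m0
  have d2 := eD m B hmB
  have rp : 0 < r^(-β) := Real.rpow_pos_of_pos r0 _
  have nb : ‖ρb‖ = r^(-β) := by simp only [ρb]; rw [Complex.norm_real, Real.norm_of_nonneg rp.le]
  have key : (∫ ρ in (0:ℝ)..m, H ρ) - ∫ ρ in m..B, H ρ = ((∫ ρ in (0:ℝ)..m, H ρ) - ∫ ρ in (0:ℝ)..m, Hm ρ) - ((∫ ρ in m..B, H ρ) - ∫ ρ in m..B, Hm ρ)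
      + (ρb * a₁ * ((∫ ρ in (0:ℝ)..m, f (-s) ρ) - ∫ ρ in m..B, f (-s) ρ) + ρb * a₂ * ((∫ ρ in (0:ℝ)..m, f s ρ) - ∫ ρ in m..B, f s ρ)) := by
    rw [eI, eI]; ring
  have A1 : ‖ρb * a₁ * ((∫ ρ in (0:ℝ)..m, f (-s) ρ) - ∫ ρ in m..B, f (-s) ρ)‖ ≤ r^(-β) * ‖a₁‖ * (q1/√t) := by
    rw [norm_mul, norm_mul, nb]; exact mul_le_mul_of_nonneg_left g1 (by positivity)
  have A2 : ‖ρb * a₂ * ((∫ ρ in (0:ℝ)..m, f s ρ) - ∫ ρ in m..B, f s ρ)‖ ≤ r^(-β) * ‖a₂‖ * (q1/√t) := by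
    rw [norm_mul, norm_mul, nb]; exact mul_le_mul_of_nonneg_left g2 (by positivity)
  have A3 : k * B ≤ r^(-β) * (q/2/√t) := by
    have w1 : 1 + E ≤ 1 + q/(4*D)*√t := by
      have := hE.trans (mul_le_mul_of_nonneg_right (min_le_right (min η1 η2) (q/(4*D))) (Real.sqrt_nonneg t))
      linarith
    have w2 : D * (1 + q/(4*D)*√t) ≤ q/2*√t := by
      rw [mul_add, show D*(q/(4*D)*√t) = q/4*√t by field_simp]; linarith
    have w3 : B*K/c1 ≤ D := by simp only [D]; linarith
    have w4 : B*K/c1*(1+E) ≤ q/2*√t := (mul_le_mul w3 w1 (by positivity) hD.le).trans w2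
    have w5 : B*K*(1+E)/r ≤ q/2/√t := by
      calc B*K*(1+E)/r ≤ B*K*(1+E)/(c1*t) := div_le_div_of_nonneg_left (by positivity) (by positivity) hx1
        _ = B*K/c1*(1+E)/t := by field_simp
        _ ≤ q/2*√t/t := div_le_div_of_nonneg_right w4 t0.le
        _ = _ := by rw [div_eq_div_iff t0.ne' (by positivity), mul_assoc, tt]
    calc k*B = r^(-β) * (B*K*(1+E)/r) := by simp only [k]; ring
      _ ≤ _ := mul_le_mul_of_nonneg_left w5 rp.le
  have A4 : (‖a₁‖+‖a₂‖)*q1 ≤ q/2 := by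
    simp only [q1]; rw [mul_div_assoc', div_le_iff₀ (by positivity)]
    linarith [mul_nonneg hq.le (norm_nonneg a₁), mul_nonneg hq.le (norm_nonneg a₂)]
  have A5 := mul_le_mul_of_nonneg_left (div_le_div_of_nonneg_right A4 (Real.sqrt_nonneg t)) rp.le
  rw [key]
  have n1 := norm_sub_le ((∫ ρ in (0:ℝ)..m, H ρ) - ∫ ρ in (0:ℝ)..m, Hm ρ) ((∫ ρ in m..B, H ρ) - ∫ ρ in m..B, Hm ρ)
  have n2 := (norm_add_le _ _).trans (add_le_add A1 A2)
  refine (norm_add_le _ _).trans ((add_le_add (n1.trans (add_le_add d1 d2)) n2).trans ?_)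
  have e9 : k*(m-0) + k*(B-m) + (r^(-β) * ‖a₁‖ * (q1/√t) + r^(-β) * ‖a₂‖ * (q1/√t)) = k*B + r^(-β)*((‖a₁‖+‖a₂‖)*q1/√t) := by ring
  rw [e9]
  refine (add_le_add A3 A5).trans (le_of_eq (by ring))

end


section
variable {d : ℕ}

def SQ (f : Euc d → ℂ) : ℝ≥0∞ := ∫⁻ x, ‖f x‖ₑ^2
def Z0 (w : ℝ → Euc d → ℂ) : Prop := Tendsto (fun t => SQ (w t)) atTop (𝓝 0)

lemma e2 (a b : ℂ) : ‖a+b‖ₑ^2 ≤ 2*(‖a‖ₑ^2+‖b‖ₑ^2) := by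
  have h : ‖a+b‖^2 ≤ 2*(‖a‖^2+‖b‖^2) := by
    have := pow_le_pow_left₀ (norm_nonneg _) (norm_add_le a b) 2
    nlinarith [sq_nonneg (‖a‖-‖b‖)]
  have := ENNReal.ofReal_le_ofReal h
  rwa [ENNReal.ofReal_mul (by norm_num), ENNReal.ofReal_add (by positivity) (by positivity), ENNReal.ofReal_pow (norm_nonneg _), ENNReal.ofReal_pow (norm_nonneg _),
    ENNReal.ofReal_pow (norm_nonneg _), ofReal_norm_eq_enorm, ofReal_norm_eq_enorm, ofReal_norm_eq_enorm, ENNReal.ofReal_ofNat] at this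

lemma SQ_add {f g : Euc d → ℂ} (hf : Measurable f) : SQ (fun x => f x + g x) ≤ 2*(SQ f + SQ g) := by
  unfold SQ
  rw [← lintegral_add_left (by fun_prop), ← lintegral_const_mul' _ _ (by norm_num)]
  exact lintegral_mono fun x => e2 _ _

lemma SQ_mul (c : ℂ) (f : Euc d → ℂ) : SQ (fun x => c * f x) = ‖c‖ₑ^2 * SQ f := by
  unfold SQ; simp_rw [enorm_mul, mul_pow]; rw [lintegral_const_mul' _ _ (by simp)]

lemma SQ_le {f g : Euc d → ℂ} (h : ∀ x, ‖f x‖ ≤ ‖g x‖) : SQ f ≤ SQ g :=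
  lintegral_mono fun x => by have := (enorm_le_iff_norm_le).2 (h x); gcongr

lemma Z0.of_le {w u : ℝ → Euc d → ℂ} (h : Z0 w) {C : ℝ≥0∞} (hC : C ≠ ⊤) (hl : ∀ᶠ t in atTop, SQ (u t) ≤ C * SQ (w t)) : Z0 u := by
  have := ENNReal.Tendsto.const_mul (a := C) h (.inr hC)
  rw [mul_zero] at this
  exact tendsto_of_tendsto_of_tendsto_of_le_of_le' tendsto_const_nhds this (.of_forall fun _ => zero_le) hl

lemma Z0.add {w u v : ℝ → Euc d → ℂ} (h : Z0 w) (h' : Z0 u) (hm : ∀ᶠ t in atTop, Measurable (w t)) (e : ∀ᶠ t in atTop, ∀ x, v t x = w t x + u t x) : Z0 v := by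
  have := ENNReal.Tendsto.const_mul (a := 2) (Filter.Tendsto.add h h') (.inr (by norm_num))
  rw [add_zero, mul_zero] at this
  refine tendsto_of_tendsto_of_tendsto_of_le_of_le' tendsto_const_nhds this (.of_forall fun _ => zero_le) ?_
  filter_upwards [hm, e] with t h1 h2
  rw [funext h2]; exact SQ_add h1

lemma Z0.mul {w v : ℝ → Euc d → ℂ} (h : Z0 w) (c : ℂ) (e : ∀ᶠ t in atTop, ∀ x, v t x = c * w t x) : Z0 v :=
  h.of_le (C := ‖c‖ₑ^2) (by simp) (by filter_upwards [e] with t h; rw [funext h, SQ_mul])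

lemma super {k : Euc d → ℂ} (hk : Measurable k) (hki : Integrable k) {w : ℝ → Euc d → Euc d → ℂ} (hm : ∀ t, Measurable (fun p : Euc d × Euc d => w t p.1 p.2))
    {M : ℝ≥0∞} (hM : M ≠ ⊤) (hb : ∀ᶠ t in atTop, ∀ ζ, SQ (w t ζ) ≤ M) (h : ∀ ζ, Z0 fun t => w t ζ) : Z0 fun t x => ∫ ζ, k ζ * w t ζ x := by
  set K := ∫⁻ ζ, ‖k ζ‖ₑ
  have hK : K ≠ ⊤ := hki.2.ne
  have hp : ∀ t x, ‖∫ ζ, k ζ * w t ζ x‖ₑ^2 ≤ K * ∫⁻ ζ, ‖k ζ‖ₑ * ‖w t ζ x‖ₑ^2 := fun t x => by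
    have hw : Measurable (fun ζ => w t ζ x) := (hm t).comp (measurable_id.prodMk measurable_const)
    have h1 : ‖∫ ζ, k ζ * w t ζ x‖ₑ ≤ ∫⁻ ζ, ‖k ζ‖ₑ^(1/2:ℝ) * (‖k ζ‖ₑ^(1/2:ℝ) * ‖w t ζ x‖ₑ) := (enorm_integral_le_lintegral_enorm _).trans (lintegral_mono fun ζ => by
      rw [enorm_mul, ← mul_assoc, ← ENNReal.rpow_add_of_nonneg _ _ (by norm_num) (by norm_num)]; norm_num)
    have h2 := ENNReal.lintegral_mul_le_Lp_mul_Lq volume Real.HolderConjugate.two_two (f := fun ζ => ‖k ζ‖ₑ^(1/2:ℝ)) (g := fun ζ => ‖k ζ‖ₑ^(1/2:ℝ) * ‖w t ζ x‖ₑ)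
      (by fun_prop) (by fun_prop)
    refine (pow_le_pow_left₀ zero_le (h1.trans h2) 2).trans (le_of_eq ?_)
    have ee : ∀ a : ℝ≥0∞, (a^(1/2:ℝ))^2 = a := fun a => by rw [← ENNReal.rpow_natCast, ← ENNReal.rpow_mul]; norm_num
    rw [mul_pow, ee, ee]
    have e3 : ∀ a : ℝ≥0∞, (a^(1/2:ℝ))^(2:ℝ) = a := fun a => by rw [← ENNReal.rpow_mul]; norm_num
    simp_rw [ENNReal.mul_rpow_of_nonneg _ _ (show (0:ℝ) ≤ 2 by norm_num), e3]
    simp [K]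
  have hF : ∀ t, SQ (fun x => ∫ ζ, k ζ * w t ζ x) ≤ K * ∫⁻ ζ, ‖k ζ‖ₑ * SQ (w t ζ) := fun t => by
    refine (lintegral_mono (hp t)).trans (le_of_eq ?_)
    rw [lintegral_const_mul' _ _ hK, lintegral_lintegral_swap (f := fun x ζ => ‖k ζ‖ₑ * ‖w t ζ x‖ₑ^2)]
    · simp_rw [lintegral_const_mul' _ _ enorm_ne_top]; rfl
    · exact ((hk.comp measurable_snd).enorm.mul (((hm t).comp measurable_swap).enorm.pow_const 2)).aemeasurable
  have hT : Tendsto (fun t => ∫⁻ ζ, ‖k ζ‖ₑ * SQ (w t ζ)) atTop (𝓝 (∫⁻ _ : Euc d, 0)) := by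
    refine tendsto_lintegral_filter_of_dominated_convergence (fun ζ => ‖k ζ‖ₑ * M) (.of_forall fun t => ?_) ?_ ?_ (.of_forall fun ζ => ?_)
    · exact (hk.enorm.mul (Measurable.lintegral_prod_right' ((hm t).enorm.pow_const 2)))
    · filter_upwards [hb] with t ht using .of_forall fun ζ => by gcongr; exact ht ζ
    · rw [lintegral_mul_const' _ _ hM]; exact ENNReal.mul_ne_top hK hM
    · have := ENNReal.Tendsto.const_mul (a := ‖k ζ‖ₑ) (h ζ) (.inr enorm_ne_top)
      rwa [mul_zero] at this
  rw [lintegral_zero] at hT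
  have := ENNReal.Tendsto.const_mul (a := K) hT (.inr hK)
  rw [mul_zero] at this
  exact tendsto_of_tendsto_of_tendsto_of_le_of_le tendsto_const_nhds this (fun _ => zero_le) hF

open FourierTransform in
lemma FI {F : Euc d → ℝ} (h : ContDiff ℝ (⊤ : ℕ∞) F) (hc : HasCompactSupport F) : ∃ k : Euc d → ℂ, Measurable k ∧ Integrable k ∧ ∀ y, (F y : ℂ) = ∫ ζ, k ζ * ei ⟪ζ, y⟫ := by
  have hc' : HasCompactSupport (fun x => (F x : ℂ)) := hc.comp_left (g := Complex.ofReal) rfl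
  let G : SchwartzMap (Euc d) ℂ := hc'.toSchwartzMap (Complex.ofRealCLM.contDiff.comp h)
  set H : SchwartzMap (Euc d) ℂ := 𝓕 G with hH
  have hp : (0:ℝ) < 2*Real.pi := by positivity
  set c : ℝ := (2*Real.pi)^d
  have hc0 : (c:ℂ) ≠ 0 := by norm_cast; positivity
  refine ⟨fun ζ => (c:ℂ)⁻¹ * H ((2*Real.pi)⁻¹ • ζ), ?_, ?_, fun y => ?_⟩
  · have := H.continuous.measurable; fun_prop
  · exact ((integrable_comp_smul_iff volume H (inv_ne_zero hp.ne')).2 H.integrable).const_mul _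
  · have e1 : (F y : ℂ) = (𝓕⁻ H : SchwartzMap (Euc d) ℂ) y := by rw [hH, FourierTransform.fourierInv_fourier_eq]; rfl
    rw [e1, SchwartzMap.fourierInv_coe, Real.fourierInv_eq']
    have := Measure.integral_comp_smul volume (fun v : Euc d => Complex.exp (((2*Real.pi*⟪v, y⟫ : ℝ) : ℂ) * Complex.I) • H v) ((2*Real.pi)⁻¹)
    rw [finrank_euclideanSpace, Fintype.card_fin, inv_pow, inv_inv, abs_of_pos (by positivity), Complex.real_smul] at this
    refine (mul_left_cancel₀ hc0 (this.symm.trans ?_))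
    rw [← integral_const_mul]
    refine integral_congr_ae (.of_forall fun v => ?_)
    simp only [smul_eq_mul, ei, real_inner_smul_left]
    rw [mul_inv_cancel_left₀ hp.ne', ← mul_assoc, mul_inv_cancel_left₀ hc0, mul_comm Complex.I, mul_comm]
end


section
variable {d : ℕ} [NeZero d]

lemma js_tay (p η : Euc d) : |js ‖p‖ + (js ‖p‖)⁻¹ * ⟪η, p⟫ - js ‖p+η‖| ≤ ‖η‖^2 := by
  set J := js ‖p‖ with hJ
  set J' := js ‖p+η‖ with hJ'
  have h1 := js_ge ‖p‖; have h2 := js_ge ‖p+η‖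
  have e1 := js_sq ‖p‖; have e2 := js_sq ‖p+η‖
  rw [← hJ] at h1 e1; rw [← hJ'] at h2 e2
  have en : ‖p+η‖^2 = ‖p‖^2 + 2*⟪p,η⟫ + ‖η‖^2 := norm_add_sq_real p η
  set u := J⁻¹ * ⟪η, p⟫ with hu
  have hJu : J*u = ⟪p, η⟫ := by rw [hu, mul_inv_cancel_left₀ (by linarith), real_inner_comm]
  have hpJ : ‖p‖ ≤ J := by simpa using js_abs ‖p‖
  have hpJ' : ‖p+η‖ ≤ J' := by simpa using js_abs ‖p+η‖
  have bu : |u| ≤ ‖η‖ := by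
    have : J*|u| ≤ J*‖η‖ := by
      rw [← abs_of_pos (show 0 < J by linarith), ← abs_mul, abs_of_pos (show 0 < J by linarith), hJu]
      exact (abs_real_inner_le_norm p η).trans (by gcongr)
    exact le_of_mul_le_mul_left this (by linarith)
  have bd : |J - J'| ≤ ‖η‖ := by
    have h3 : (J+J')*|J-J'| ≤ (J+J')*‖η‖ := by
      rw [← abs_of_pos (show 0 < J+J' by linarith), ← abs_mul, abs_of_pos (show 0 < J+J' by linarith)]
      have : (J+J')*(J-J') = - (⟪p+(p+η), η⟫) := by
        rw [inner_add_left, inner_add_left, real_inner_self_eq_norm_sq]; linarith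
      rw [this, abs_neg]
      refine (abs_real_inner_le_norm _ _).trans ?_
      have := norm_add_le p (p+η)
      gcongr; linarith
    exact le_of_mul_le_mul_left h3 (by linarith)
  have e : (J+J')*(J+u-J') = u*(J'-J) - ‖η‖^2 := by linear_combination e1 - e2 - en + (2:ℝ)*hJu
  have b : (J+J')*|J+u-J'| ≤ (J+J')*‖η‖^2 := by
    rw [← abs_of_pos (show 0 < J+J' by linarith), ← abs_mul, abs_of_pos (show 0 < J+J' by linarith), e]
    have h4 : |u*(J'-J)| ≤ ‖η‖*‖η‖ := by rw [abs_mul, abs_sub_comm]; gcongr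
    have h5 := abs_sub (u*(J'-J)) (‖η‖^2)
    rw [abs_of_nonneg (sq_nonneg ‖η‖)] at h5
    nlinarith [sq_nonneg ‖η‖]
  exact le_of_mul_le_mul_left b (by linarith)

lemma IT_shift (f : Euc d → ℂ) (η x : Euc d) : ei ⟪η, x⟫ * IT f x = IT (fun ξ => f (ξ-η)) x := by
  unfold IT
  rw [← integral_add_right_eq_self (fun ξ => Complex.exp (Complex.I * ((⟪x, ξ⟫:ℝ):ℂ)) * f (ξ-η)) η, ← integral_const_mul]
  refine integral_congr_ae (.of_forall fun ξ => ?_)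
  simp only [add_sub_cancel_right, ei]
  rw [← mul_assoc, ← Complex.exp_add, inner_add_right, real_inner_comm]; congr 2; push_cast; ring

lemma IT_sub {f g : Euc d → ℂ} (hf : Integrable f) (hg : Integrable g) (x : Euc d) : IT (fun ξ => f ξ - g ξ) x = IT f x - IT g x := by
  unfold IT; rw [← integral_sub (IT_int hf x) (IT_int hg x)]; simp_rw [mul_sub]

lemma gg_l (R : ℝ) (n : ℕ) (r : ℝ) : ‖(gg R n r : ℂ)‖ ≤ 1 := by simpa using (gg_nice R n).bdd r

lemma Ff_l2 (R : ℝ) (n : ℕ) (s t : ℝ) (b z : Euc d) : MemLp (Ff R n s t b z) 2 volume :=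
  bdd_l2 (Ff_c R n s t b z).aestronglyMeasurable (Ff_b R n s t b z) (Ff_0 n s t b z)

lemma shift (R : ℝ) (n : ℕ) {s : ℝ} (hs : s = 1 ∨ s = -1) (b : Euc d) {η : ℝ → Euc d} (h0 : Tendsto η atTop (𝓝 0)) (h2 : Tendsto (fun t => t*‖η t‖^2) atTop (𝓝 0)) :
    Z0 fun t x => ei ⟪η t, x⟫ * IT (Ff R n s t b ((s*t)•η t)) x - IT (Ff R n s t b 0) x := by
  have hsa : |s| = 1 := by rcases hs with rfl | rfl <;> simp
  set D : ℝ → Euc d → ℂ := fun t ξ => Ff R n s t b ((s*t)•η t) (ξ-η t) - Ff R n s t b 0 ξ with hD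
  have hc : ∀ t, Continuous (D t) := fun t => ((Ff_c R n s t b _).comp (continuous_id.sub continuous_const)).sub (Ff_c R n s t b 0)
  have i1 : ∀ t, Integrable (fun ξ => Ff R n s t b ((s*t)•η t) (ξ-η t)) := fun t => (Ff_i R n s t b _).comp_sub_right (η t)
  have l1 : ∀ t, MemLp (fun ξ => Ff R n s t b ((s*t)•η t) (ξ-η t)) 2 volume := fun t =>
    (Ff_l2 R n s t b _).comp_measurePreserving (measurePreserving_sub_right volume (η t))
  have e : ∀ t, SQ (fun x => ei ⟪η t, x⟫ * IT (Ff R n s t b ((s*t)•η t)) x - IT (Ff R n s t b 0) x) = ENNReal.ofReal ((2*Real.pi)^d) * ∫⁻ ξ, ‖D t ξ‖ₑ^2 := fun t => by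
    refine Eq.trans ?_ (planl ((i1 t).sub (Ff_i R n s t b 0)) ((l1 t).sub (Ff_l2 R n s t b 0)))
    simp_rw [IT_shift, SQ]
    refine lintegral_congr fun x => ?_
    rw [← IT_sub (i1 t) (Ff_i R n s t b 0)]
  have key : Tendsto (fun t => ∫⁻ ξ, ‖D t ξ‖ₑ^2) atTop (𝓝 (∫⁻ _ : Euc d, 0)) := by
    refine tendsto_lintegral_filter_of_dominated_convergence ((Metric.closedBall (0:Euc d) (R+1)).indicator fun _ => 4) (.of_forall fun t => ?_) ?_ ?_ (.of_forall fun ξ => ?_)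
    · exact ((hc t).measurable.enorm.pow_const 2)
    · filter_upwards [h0.eventually (Metric.ball_mem_nhds 0 one_pos)] with t ht
      refine .of_forall fun ξ => ?_
      have ht' : ‖η t‖ < 1 := by simpa using ht
      by_cases hξ : ξ ∈ Metric.closedBall (0:Euc d) (R+1)
      · rw [Set.indicator_of_mem hξ]
        have := norm_sub_le (Ff R n s t b ((s*t)•η t) (ξ-η t)) (Ff R n s t b 0 ξ)
        have h3 : ‖D t ξ‖ ≤ 2 := this.trans (by linarith [Ff_b R n s t b ((s*t)•η t) (ξ-η t), Ff_b R n s t b 0 ξ])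
        have h4 : ‖D t ξ‖ₑ ≤ 2 := by rw [← ofReal_norm_eq_enorm, ← ENNReal.ofReal_ofNat]; exact ENNReal.ofReal_le_ofReal h3
        calc ‖D t ξ‖ₑ^2 ≤ 2^2 := by gcongr
          _ = 4 := by norm_num
      · have hξ' : R+1 < ‖ξ‖ := by simpa using hξ
        have : R < ‖ξ-η t‖ := by linarith [norm_sub_norm_le ξ (η t)]
        have : D t ξ = 0 := by simp only [hD]; rw [Ff_0 n s t b _ _ this, Ff_0 n s t b 0 ξ (by linarith), sub_zero]
        simp [this]
    · rw [lintegral_indicator Metric.isClosed_closedBall.measurableSet, setLIntegral_const]; exact ENNReal.mul_ne_top (by norm_num) measure_closedBall_lt_top.ne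
    · have bd : ∀ᶠ t in atTop, ‖D t ξ‖ ≤ t*‖η t‖^2 + |⟪b, η t⟫| + ‖(gg R n ‖ξ-η t‖ : ℂ) - (gg R n ‖ξ‖ : ℂ)‖ := by
        filter_upwards [eventually_ge_atTop 0] with t ht
        simp only [hD, Ff]
        set A := s*t*js ‖ξ-η t‖ + ⟪b + (js ‖ξ-η t‖)⁻¹ • (s*t) • η t, ξ-η t⟫ with hA
        set B := s*t*js ‖ξ‖ + ⟪b + (js ‖ξ‖)⁻¹ • (0:Euc d), ξ⟫ with hB
        have e1 : ei A * (gg R n ‖ξ-η t‖ : ℂ) - ei B * (gg R n ‖ξ‖ : ℂ) = (ei A - ei B) * (gg R n ‖ξ-η t‖ : ℂ) + ei B * ((gg R n ‖ξ-η t‖ : ℂ) - (gg R n ‖ξ‖ : ℂ)) := by ring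
        have hAB : |A - B| ≤ t*‖η t‖^2 + |⟪b, η t⟫| := by
          have h5 := js_tay (ξ-η t) (η t)
          rw [sub_add_cancel] at h5
          have e2 : A - B = s*t*(js ‖ξ-η t‖ + (js ‖ξ-η t‖)⁻¹ * ⟪η t, ξ-η t⟫ - js ‖ξ‖) - ⟪b, η t⟫ := by
            rw [hA, hB, smul_zero, add_zero, inner_add_left, real_inner_smul_left, real_inner_smul_left, inner_sub_right b]; ring
          rw [e2]
          refine (abs_sub _ _).trans (add_le_add ?_ le_rfl)
          rw [abs_mul, abs_mul, hsa, one_mul, abs_of_nonneg ht]; gcongr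
        rw [e1]
        refine (norm_add_le _ _).trans (add_le_add ?_ ?_)
        · rw [norm_mul]
          exact (mul_le_of_le_one_right (norm_nonneg _) (gg_l _ _ _)).trans ((ei_lip A B).trans hAB)
        · rw [norm_mul, ei_n, one_mul]
      have lim : Tendsto (fun t => t*‖η t‖^2 + |⟪b, η t⟫| + ‖(gg R n ‖ξ-η t‖ : ℂ) - (gg R n ‖ξ‖ : ℂ)‖) atTop (𝓝 0) := by
        have a1 : Tendsto (fun t => |⟪b, η t⟫|) atTop (𝓝 0) := by
          have h : Continuous fun η : Euc d => |⟪b, η⟫| := by fun_prop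
          have := h.tendsto 0
          simp only [inner_zero_right, abs_zero] at this
          exact this.comp h0
        have a2 : Tendsto (fun t => ‖(gg R n ‖ξ-η t‖ : ℂ) - (gg R n ‖ξ‖ : ℂ)‖) atTop (𝓝 0) := by
          have h : Continuous fun η : Euc d => ‖(gg R n ‖ξ-η‖ : ℂ) - (gg R n ‖ξ‖ : ℂ)‖ := by have := (gg_smooth R n).continuous; fun_prop
          have := h.tendsto 0
          simp only [sub_zero, sub_self, norm_zero] at this
          exact this.comp h0
        simpa using (h2.add a1).add a2
      have h6 := squeeze_zero' (.of_forall fun t => norm_nonneg (D t ξ)) bd lim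
      have h7 := ENNReal.Tendsto.pow (n := 2) (ENNReal.tendsto_ofReal h6)
      simpa [ofReal_norm_eq_enorm] using h7
  rw [lintegral_zero] at key
  have := ENNReal.Tendsto.const_mul (a := ENNReal.ofReal ((2*Real.pi)^d)) key (.inr (by simp))
  rw [mul_zero] at this
  exact (tendsto_congr e).2 this
end


section
variable {d : ℕ} [NeZero d]

lemma gg_one {R r : ℝ} {n : ℕ} (h1 : 2 ≤ (n+1)*r) (h2 : 2 ≤ (n+1)*(R-r)) : gg R n r = 1 := by
  rw [gg, Real.smoothTransition.one_of_one_le (by linarith), Real.smoothTransition.one_of_one_le (by linarith), one_mul]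

lemma Ff_SQ (R : ℝ) (n : ℕ) : ∃ M : ℝ≥0∞, M ≠ ⊤ ∧ ∀ (s t : ℝ) (b z : Euc d), SQ (IT (Ff R n s t b z)) ≤ M := by
  refine ⟨ENNReal.ofReal ((2*Real.pi)^d) * volume (Metric.closedBall (0:Euc d) R), ENNReal.mul_ne_top (by simp) measure_closedBall_lt_top.ne, fun s t b z => ?_⟩
  rw [SQ, planl (Ff_i R n s t b z) (Ff_l2 R n s t b z)]
  gcongr
  rw [← setLIntegral_one, ← lintegral_indicator Metric.isClosed_closedBall.measurableSet]
  refine lintegral_mono fun ξ => ?_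
  by_cases hξ : ξ ∈ Metric.closedBall (0:Euc d) R
  · rw [Set.indicator_of_mem hξ]
    refine pow_le_one₀ zero_le ?_
    rw [← ofReal_norm_eq_enorm]; exact ENNReal.ofReal_le_one.2 (Ff_b R n s t b z ξ)
  · rw [Ff_0 n s t b z ξ (by simpa using hξ)]; simp

lemma Ff_z (R : ℝ) (n : ℕ) (s t : ℝ) (b z ξ : Euc d) : Ff R n s t b z ξ = ei ⟪z, (js ‖ξ‖)⁻¹ • ξ⟫ * Ff R n s t b 0 ξ := by
  rw [Ff, Ff, ← mul_assoc, ← ei_add]; congr 2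
  rw [inner_add_left, inner_add_left, real_inner_smul_left, smul_zero, inner_zero_left, inner_smul_right]; ring

lemma jsn_c : Continuous fun ξ : Euc d => (js ‖ξ‖)⁻¹ • ξ := (ji_c.comp continuous_norm).smul continuous_id

lemma Ff_3 (R : ℝ) (n : ℕ) (s t σ : ℝ) (b : Euc d) : Measurable fun q : (Euc d × Euc d) × Euc d => Complex.exp (Complex.I * ((⟪q.1.2, q.2⟫:ℝ):ℂ)) * Ff R n s t b (σ • q.1.1) q.2 := by
  simp_rw [Ff_z R n s t b (σ • _)]
  have h1 := (Ff_c R n s t b 0)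
  have h2 : Continuous fun q : (Euc d × Euc d) × Euc d => ei ⟪σ • q.1.1, (js ‖q.2‖)⁻¹ • q.2⟫ :=
    ei_c.comp (Continuous.inner (𝕜 := ℝ) (by fun_prop) (jsn_c.comp continuous_snd))
  exact Continuous.measurable (Continuous.mul (by fun_prop) (h2.mul (by fun_prop)))

lemma mass0 (R : ℝ) (n : ℕ) {s : ℝ} (hs : s = 1 ∨ s = -1) (b : Euc d) : ∃ c1 c2 : ℝ, 0 < c1 ∧ c1 ≤ vv (1/(n+1)) ∧ vv R ≤ c2 ∧ 0 ≤ c2 ∧ c2 < 1 ∧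
    Z0 fun t x => if c1*t ≤ ‖x‖ ∧ ‖x‖ ≤ c2*t then 0 else IT (Ff R n s t b 0) x := by
  set a : ℝ := 1/(n+1)
  have ha : 0 < vv a := div_pos (by positivity) (js_pos _)
  have hv : vv R^2 < 1 := by rw [vv, div_pow, js_sq, div_lt_one (by positivity)]; linarith
  set c := (1+vv R^2)/2 with hc
  obtain ⟨N, hN⟩ := exists_nat_gt (2/(vv a^2) + 2/(c - vv R^2))
  have hcv : 0 < c - vv R^2 := by linarith
  have p1 : 0 < 2/(vv a^2) := by positivity
  have p2 : 0 < 2/(c - vv R^2) := by positivity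
  have n1 : 2 ≤ ((N:ℝ)+1)*vv a^2 := (div_le_iff₀ (by positivity)).1 (by linarith)
  have n2 : 2 ≤ ((N:ℝ)+1)*(c - vv R^2) := (div_le_iff₀ hcv).1 (by linarith)
  set F : Euc d → ℝ := fun y => gg c N (‖y‖^2) with hF
  have hFs : ContDiff ℝ (⊤ : ℕ∞) F := (gg_smooth c N).comp (contDiff_norm_sq ℝ)
  have hF0 : ∀ y, ¬ (Real.sqrt (1/(N+1)) ≤ ‖y‖ ∧ ‖y‖ ≤ Real.sqrt c) → F y = 0 := fun y hy => (gg_nice c N).supp _ fun h => hy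
    ⟨(Real.sqrt_le_left (norm_nonneg _)).2 h.1, Real.le_sqrt_of_sq_le h.2⟩
  have hFc : HasCompactSupport F := HasCompactSupport.intro (isCompact_closedBall 0 (Real.sqrt c)) fun y hy => hF0 y fun h => hy (by simpa using h.2)
  obtain ⟨k, km, ki, hk⟩ := FI hFs hFc
  have hs2 : s*s = 1 := by rcases hs with rfl | rfl <;> norm_num
  have hF1 : ∀ t ξ, (F (-s • (js ‖ξ‖)⁻¹ • ξ) : ℂ) * Ff R n s t b 0 ξ = Ff R n s t b 0 ξ := fun t ξ => by
    by_cases h : 1/((n:ℝ)+1) ≤ ‖ξ‖ ∧ ‖ξ‖ ≤ R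
    · have e : ‖-s • (js ‖ξ‖)⁻¹ • ξ‖^2 = vv ‖ξ‖^2 := by
        rw [norm_smul, norm_smul, mul_pow, norm_neg, Real.norm_eq_abs, sq_abs, pow_two s, hs2, one_mul, norm_inv, Real.norm_of_nonneg (js_pos _).le, vv]; ring
      have m1 : vv a ≤ vv ‖ξ‖ := vv_sm.monotone h.1
      have m2 : vv ‖ξ‖ ≤ vv R := vv_sm.monotone h.2
      have m3 := pow_le_pow_left₀ ha.le m1 2
      have m4 := pow_le_pow_left₀ (ha.le.trans m1) m2 2
      rw [hF]; simp only [e]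
      rw [gg_one (n1.trans (by gcongr)) (n2.trans (by gcongr))]; simp
    · simp only [Ff]; rw [(gg_nice R n).supp _ h]; simp
  obtain ⟨M, hM, hMb⟩ := Ff_SQ (d := d) R n
  have hi := fun t (z : Euc d) => (IT_cont (Ff_i R n s t b z)).measurable
  have hw := super km ki (w := fun t ζ x => IT (Ff R n s t b (-s • ζ)) x - ei ⟪t⁻¹ • ζ, x⟫ * IT (Ff R n s t b 0) x) (fun t => by
      have h1 : Measurable fun p : Euc d × Euc d => IT (Ff R n s t b (-s • p.1)) p.2 := (Ff_3 R n s t (-s) b).stronglyMeasurable.integral_prod_right'.measurable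
      have h2 := hi t 0; have h3 := ei_c.measurable
      fun_prop) (M := 2*(M+M)) (by simp [ENNReal.mul_eq_top, hM]) (.of_forall fun t ζ => by
      simp_rw [sub_eq_add_neg]
      refine (SQ_add (hi t _)).trans ?_
      gcongr
      · exact hMb _ _ _ _
      · exact (SQ_le fun x => by rw [norm_neg, norm_mul, ei_n, one_mul]).trans (hMb s t b 0)) (fun ζ => by
      have h0 : Tendsto (fun t : ℝ => -(t⁻¹ • ζ)) atTop (𝓝 0) := by simpa using ((tendsto_inv_atTop_zero (𝕜 := ℝ)).smul_const ζ).neg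
      refine (shift R n hs b h0 ?_).of_le (C := 1) (by simp) ?_
      · have : Tendsto (fun t : ℝ => t⁻¹ * ‖ζ‖^2) atTop (𝓝 0) := by simpa using tendsto_inv_atTop_zero.mul_const (‖ζ‖^2)
        refine this.congr' ?_
        filter_upwards [eventually_gt_atTop 0] with t ht
        rw [norm_neg, norm_smul, mul_pow, norm_inv, Real.norm_of_nonneg ht.le]; field_simp
      · filter_upwards [eventually_gt_atTop 0] with t ht
        rw [one_mul]
        refine SQ_le fun x => le_of_eq ?_
        have e : (s*t) • -(t⁻¹ • ζ) = -s • ζ := by rw [smul_neg, smul_smul, mul_assoc, mul_inv_cancel₀ ht.ne', mul_one, neg_smul]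
        rw [e]
        have : ei ⟪t⁻¹ • ζ, x⟫ * ei ⟪-(t⁻¹ • ζ), x⟫ = 1 := by rw [← ei_add, inner_neg_left, add_neg_cancel]; simp [ei]
        have e2 : IT (Ff R n s t b (-s • ζ)) x - ei ⟪t⁻¹ • ζ, x⟫ * IT (Ff R n s t b 0) x = ei ⟪t⁻¹ • ζ, x⟫ * (ei ⟪-(t⁻¹ • ζ), x⟫ * IT (Ff R n s t b (-s • ζ)) x - IT (Ff R n s t b 0) x) := by
          linear_combination -(IT (Ff R n s t b (-s • ζ)) x) * this
        rw [e2, norm_mul, ei_n, one_mul])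
  refine ⟨Real.sqrt (1/(N+1)), Real.sqrt c, Real.sqrt_pos.2 (by positivity), ?_, ?_, Real.sqrt_nonneg _, ?_, ?_⟩
  · rw [Real.sqrt_le_left ha.le, div_le_iff₀ (by positivity)]; linarith
  · exact Real.le_sqrt_of_sq_le (by linarith)
  · rw [Real.sqrt_lt' one_pos]; linarith
  refine hw.of_le (C := 1) (by simp) ?_
  filter_upwards [eventually_gt_atTop 0] with t ht
  rw [one_mul]
  refine SQ_le fun x => ?_
  split_ifs with h
  · simp
  · have e0 : F (t⁻¹ • x) = 0 := hF0 _ fun h' => h (by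
      rw [norm_smul, norm_inv, Real.norm_of_nonneg ht.le, inv_mul_eq_div, le_div_iff₀ ht, div_le_iff₀ ht] at h'; exact h')
    have i1 : Integrable (fun ζ => k ζ * (ei ⟪t⁻¹ • ζ, x⟫ * IT (Ff R n s t b 0) x)) :=
      ki.mul_bdd (c := ‖IT (Ff R n s t b 0) x‖) (Continuous.aestronglyMeasurable (by have := ei_c; fun_prop)) (.of_forall fun ζ => by rw [norm_mul, ei_n, one_mul])
    have i2 : Integrable (fun p : Euc d × Euc d => k p.1 * (Complex.exp (Complex.I * ((⟪x, p.2⟫:ℝ):ℂ)) * Ff R n s t b (-s • p.1) p.2)) (volume.prod volume) := by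
      refine (ki.norm.mul_prod (Ff_i R n s t b 0).norm).mono' ?_ (.of_forall fun p => ?_)
      · exact ((km.comp measurable_fst).mul ((Ff_3 R n s t (-s) b).comp (((measurable_fst).prodMk measurable_const).prodMk measurable_snd))).aestronglyMeasurable
      · rw [norm_mul, norm_mul, cexp_n, one_mul, Ff_z, norm_mul, ei_n, one_mul]
    have e1 : ∫ ζ, k ζ * IT (Ff R n s t b (-s • ζ)) x = IT (Ff R n s t b 0) x := by
      unfold IT
      simp_rw [← integral_const_mul]
      rw [integral_integral_swap i2]
      refine integral_congr_ae (.of_forall fun ξ => ?_)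
      simp only
      rw [← hF1 t ξ, hk, ← integral_mul_const, ← integral_const_mul]
      refine integral_congr_ae (.of_forall fun ζ => ?_)
      simp only [Ff_z R n s t b (-s • ζ)]
      rw [real_inner_smul_left, inner_smul_right ζ _ (-s)]; ring
    have i3 : Integrable (fun ζ => k ζ * IT (Ff R n s t b (-s • ζ)) x) := by
      have := i2.integral_prod_left
      simp only [integral_const_mul] at this; exact this
    simp_rw [mul_sub]
    rw [integral_sub i3 i1, e1]
    simp_rw [← mul_assoc, integral_mul_const]
    have e3 := hk (t⁻¹ • x)
    rw [e0] at e3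
    simp_rw [inner_smul_right] at e3
    simp_rw [real_inner_smul_left, ← e3]
    simp
end


section
variable {d : ℕ} [NeZero d]

lemma half (R : ℝ) (n : ℕ) {s : ℝ} (hs : s = 1 ∨ s = -1) (b : Euc d) {η : ℝ → Euc d} (h0 : Tendsto η atTop (𝓝 0)) (h2 : Tendsto (fun t => t*‖η t‖^2) atTop (𝓝 0)) :
    Z0 fun t x => 2 * AF t (Ff R n s t b ((s*t)•η t)) x - IT (Ff R n s t b ((s*t)•η t)) x := by
  have hsa : |s| = 1 := by rcases hs with rfl | rfl <;> simp
  obtain ⟨c1, c2, hc1, hca, hcR, hc0, hc2, hm⟩ := mass0 R n hs b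
  have hi := fun t (z : Euc d) => (IT_cont (Ff_i R n s t b z)).measurable
  have hA := fun t (z : Euc d) => (AF_meas t (Ff_c R n s t b z).measurable).measurable
  have hS : ∀ t, MeasurableSet {x : Euc d | c1*t ≤ ‖x‖ ∧ ‖x‖ ≤ c2*t} := fun t =>
    (measurableSet_le measurable_const measurable_norm).inter (measurableSet_le measurable_norm measurable_const)
  have hm2 : Z0 fun t x => if c1*t ≤ ‖x‖ ∧ ‖x‖ ≤ c2*t then 0 else IT (Ff R n s t b ((s*t)•η t)) x := by
    refine Z0.of_le (C := 1) (Z0.add (v := fun t x => (if c1*t ≤ ‖x‖ ∧ ‖x‖ ≤ c2*t then 0 else IT (Ff R n s t b 0) x) +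
      (ei ⟪η t, x⟫ * IT (Ff R n s t b ((s*t)•η t)) x - IT (Ff R n s t b 0) x)) hm (shift R n hs b h0 h2)
      (.of_forall fun t => Measurable.ite (hS t) measurable_const (hi t 0)) (.of_forall fun t x => rfl)) (by simp) (.of_forall fun t => ?_)
    rw [one_mul]
    refine SQ_le fun x => ?_
    split_ifs with h
    · simp
    · rw [add_sub_cancel, norm_mul, ei_n, one_mul]
  have hU : Z0 fun t x => if c1*t ≤ ‖x‖ ∧ ‖x‖ ≤ c2*t then 2 * AF t (Ff R n s t b ((s*t)•η t)) x - IT (Ff R n s t b ((s*t)•η t)) x else 0 := by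
    refine ENNReal.tendsto_nhds_zero.2 fun e he => ?_
    set K : ℝ≥0∞ := ENNReal.ofReal ((c1^(d-1))⁻¹ * c2^d) * volume (Metric.ball (0:Euc d) 1)
    have hK : K ≠ ⊤ := ENNReal.mul_ne_top (by simp) measure_ball_lt_top.ne
    obtain ⟨q, hq, hqe⟩ := ENNReal.exists_nnreal_pos_mul_lt hK he.ne'
    obtain ⟨u, T, hu, hT, hP⟩ := P2 (d := d) R n hs hc1 hc2 (Real.sqrt_pos.2 (NNReal.coe_pos.2 hq))
    have ev1 : ∀ᶠ t : ℝ in atTop, ‖b‖/(u/2) ≤ Real.sqrt t := Real.tendsto_sqrt_atTop.eventually_ge_atTop _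
    filter_upwards [eventually_ge_atTop T, ev1, h2.eventually_lt_const (show (0:ℝ) < (u/2)^2 by positivity)] with t ht h3 h4
    have ht0 : 0 < t := by linarith
    have hz : ‖b‖ + ‖(s*t)•η t‖ ≤ u*Real.sqrt t := by
      rw [div_le_iff₀ (by positivity)] at h3
      have : ‖(s*t)•η t‖ ≤ Real.sqrt t * (u/2) := by
        rw [norm_smul, norm_mul, Real.norm_eq_abs, hsa, one_mul, Real.norm_of_nonneg ht0.le]
        refine abs_le_of_sq_le_sq' ?_ (by positivity) |>.2
        rw [mul_pow, mul_pow, Real.sq_sqrt ht0.le]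
        nlinarith
      linarith
    refine le_trans ?_ hqe.le
    have hb : ∀ x : Euc d, ‖(if c1*t ≤ ‖x‖ ∧ ‖x‖ ≤ c2*t then 2 * AF t (Ff R n s t b ((s*t)•η t)) x - IT (Ff R n s t b ((s*t)•η t)) x else 0 : ℂ)‖ₑ^2 ≤
        (Metric.closedBall (0:Euc d) (c2*t)).indicator (fun _ => ENNReal.ofReal (q*((c1^(d-1))⁻¹*(t^d)⁻¹))) x := fun x => by
      split_ifs with h
      · rw [Set.indicator_of_mem (by simpa using h.2), ← ofReal_norm_eq_enorm, ← ENNReal.ofReal_pow (norm_nonneg _)]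
        refine ENNReal.ofReal_le_ofReal ((pow_le_pow_left₀ (norm_nonneg _) (hP t b _ x ht hz h.1 h.2) 2).trans ?_)
        have hx : 0 < ‖x‖ := (mul_pos hc1 ht0).trans_le h.1
        rw [mul_pow, div_pow, Real.sq_sqrt ht0.le, Real.sq_sqrt (NNReal.coe_nonneg q), Real.rpow_neg hx.le, inv_pow, pow_two (‖x‖^_), ← be_pow hx, div_eq_mul_inv]
        have h5 : ‖x‖^(d-1) * t ≥ c1^(d-1) * t^d := by
          have : t^d = t^(d-1)*t := by rw [← pow_succ, Nat.sub_add_cancel (NeZero.one_le)]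
          rw [this, ← mul_assoc, ← mul_pow]; gcongr; exact h.1
        rw [← mul_inv, ← mul_inv]
        gcongr
      · simp
    refine (lintegral_mono hb).trans (le_of_eq ?_)
    rw [lintegral_indicator Metric.isClosed_closedBall.measurableSet, setLIntegral_const, Measure.addHaar_closedBall _ _ (by positivity), finrank_euclideanSpace, Fintype.card_fin,
      ← mul_assoc, ← ENNReal.ofReal_mul (by positivity)]
    rw [← ENNReal.ofReal_coe_nnreal (p := q), ← mul_assoc (ENNReal.ofReal q), ← ENNReal.ofReal_mul (by positivity)]
    congr 2
    rw [mul_pow]; field_simp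
  refine (hU.add hm2 (.of_forall fun t => Measurable.ite (hS t) (((hA t _).const_mul 2).sub (hi t _)) measurable_const) (.of_forall fun t x => rfl)).of_le (C := 1) (by simp) ?_
  filter_upwards [eventually_gt_atTop 0] with t ht
  rw [one_mul]
  refine SQ_le fun x => ?_
  set f := Ff R n s t b ((s*t)•η t) with hf
  by_cases h : c1*t ≤ ‖x‖ ∧ ‖x‖ ≤ c2*t
  · rw [if_pos h, if_pos h, add_zero]
  rw [if_neg h, if_neg h, zero_add]
  have hs0 : ∀ ξ : Euc d, ¬ (1/((n:ℝ)+1) ≤ ‖ξ‖ ∧ ‖ξ‖ ≤ R) → f ξ = 0 := fun ξ h => by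
    rw [hf, Ff, (gg_nice R n).supp _ h]; simp
  by_cases h1 : c1*t ≤ ‖x‖
  · have h1' : c2*t < ‖x‖ := by by_contra h3; exact h ⟨h1, not_lt.1 h3⟩
    have : (fun ξ => if nn t ‖ξ‖ < ‖x‖ then f ξ else 0) = f := funext fun ξ => by
      split_ifs with h3
      · rfl
      · refine (hs0 ξ fun h4 => h3 ?_).symm
        rw [nn_vv]; have := (vv_sm.monotone h4.2).trans hcR; nlinarith
    rw [AF, this, two_mul, add_sub_cancel_right]
  · have : (fun ξ => if nn t ‖ξ‖ < ‖x‖ then f ξ else 0) = fun _ => 0 := funext fun ξ => by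
      split_ifs with h3
      · refine hs0 ξ fun h4 => h1 ?_
        rw [nn_vv] at h3; have := hca.trans (vv_sm.monotone h4.1); nlinarith
      · rfl
    have h6 : AF t f x = 0 := by rw [AF, this, IT]; simp
    rw [h6, mul_zero, zero_sub, norm_neg]
end


section
variable {d : ℕ} [NeZero d]

abbrev LL (d : ℕ) := Lp ℂ 2 (volume : Measure (Euc d))

def gn (R : ℝ) (n : ℕ) (b ξ : Euc d) : ℂ := ei ⟪b, ξ⟫ * (gg R n ‖ξ‖ : ℂ)

lemma gn_l2 (R : ℝ) (n : ℕ) (b : Euc d) : MemLp (gn R n b) 2 volume := by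
  refine (Ff_l2 R n 0 0 b 0).ae_eq (.of_forall fun ξ => ?_)
  simp [Ff, gn]

lemma SQ_Lp (F : LL d) : SQ F = ‖F‖ₑ^2 := by
  rw [SQ, en_sq (Lp.memLp F), ← lp_norm_sq, ENNReal.ofReal_pow (norm_nonneg _), ofReal_norm_eq_enorm]

lemma density {T : ℝ → (Euc d → ℂ) → Euc d → ℂ} (hc : ∀ t f g, f =ᵐ[volume] g → T t f = T t g) (hm : ∀ t f, Measurable f → Measurable (T t f))
    (ha : ∀ t, 0 < t → ∀ f g, MemLp f 2 volume → MemLp g 2 volume → T t (f+g) = T t f + T t g) (hsm : ∀ t (c : ℂ) f, T t (c•f) = c•T t f) {C : ℝ≥0∞} (hC : C ≠ ⊤)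
    (hb : ∀ᶠ t in atTop, ∀ f, MemLp f 2 volume → SQ (T t f) ≤ C * SQ f) (hg : ∀ R n b, Z0 fun t => T t (gn R n b)) {f : Euc d → ℂ} (hf : MemLp f 2 volume) : Z0 fun t => T t f := by
  let S : Submodule ℂ (LL d) :=
    { carrier := {F | Z0 fun t => T t F}
      add_mem' := fun {F G} hF hG => hF.add hG (.of_forall fun t => hm t _ (Lp.stronglyMeasurable F).measurable) (by
        filter_upwards [eventually_gt_atTop 0] with t ht x
        rw [hc t _ _ (Lp.coeFn_add F G), ha t ht _ _ (Lp.memLp F) (Lp.memLp G)]; rfl)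
      zero_mem' := by
        have : ∀ t, T t (0 : LL d) = fun _ => 0 := fun t => by
          have := hsm t 0 (0 : Euc d → ℂ)
          rw [zero_smul, zero_smul] at this
          rw [hc t _ _ (Lp.coeFn_zero ..), this]; rfl
        simp only [Set.mem_setOf_eq, this, Z0, SQ]; simp
      smul_mem' := fun c F hF => Z0.mul hF c (.of_forall fun t x => by rw [hc t _ _ (Lp.coeFn_smul c F), hsm]; rfl) }
  have hS : IsClosed (S : Set (LL d)) := by
    refine isClosed_of_closure_subset fun F hF => ENNReal.tendsto_nhds_zero.2 fun e he => ?_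
    have he4 : 0 < e/4 := ENNReal.div_pos he.ne' (by norm_num)
    obtain ⟨q, hq, hqe⟩ := ENNReal.exists_nnreal_pos_mul_lt hC he4.ne'
    obtain ⟨G, hG, hFG⟩ := Metric.mem_closure_iff.1 hF (Real.sqrt q) (Real.sqrt_pos.2 hq)
    filter_upwards [hb, ENNReal.tendsto_nhds_zero.1 hG _ he4, eventually_gt_atTop 0] with t h1 h2 ht
    have e1 : T t F = fun x => T t (F-G : LL d) x + T t G x := by
      rw [show T t F = T t ((F-G)+G : LL d) by rw [sub_add_cancel], hc t _ _ (Lp.coeFn_add (F-G) G), ha t ht _ _ (Lp.memLp _) (Lp.memLp G)]; rfl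
    rw [e1]
    refine (SQ_add (hm t _ (Lp.stronglyMeasurable _).measurable)).trans ?_
    have h3 := h1 _ (Lp.memLp (F-G))
    rw [SQ_Lp] at h3
    have h4 : ‖F-G‖ₑ^2 ≤ q := by
      rw [← ofReal_norm_eq_enorm, ← ENNReal.ofReal_pow (norm_nonneg _), ← ENNReal.ofReal_coe_nnreal]
      refine ENNReal.ofReal_le_ofReal ?_
      rw [← Real.sq_sqrt q.coe_nonneg, ← dist_eq_norm]; exact pow_le_pow_left₀ dist_nonneg hFG.le 2
    calc _ ≤ 2*(e/4+e/4) := by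
          gcongr
          exact h3.trans ((by rw [mul_comm]; gcongr : C * ‖F-G‖ₑ^2 ≤ q * C).trans hqe.le)
      _ = e := by
        rw [← two_mul, ← mul_assoc, show (2*2:ℝ≥0∞) = 4 by norm_num]; exact ENNReal.mul_div_cancel (by norm_num) (by norm_num)
  set gs : Set (LL d) := {F | ∃ R n b, F =ᵐ[volume] gn R n b}
  have hd : (Submodule.span ℂ gs).topologicalClosure = ⊤ := by
    rw [Submodule.topologicalClosure_eq_top_iff, Submodule.eq_bot_iff]
    intro F hF
    have hF1 : ∀ s ∈ gs, inner ℂ s F = 0 := fun s hs => (Submodule.mem_orthogonal _ _).1 hF s (Submodule.subset_span hs)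
    have h1 : ∀ N : ℕ, ∀ᵐ ξ : Euc d, ‖ξ‖ ≤ N → F ξ = 0 := fun N => by
      have := dens_all (f := (Metric.closedBall 0 (N:ℝ)).indicator F) (R := N) ((Lp.memLp F).indicator measurableSet_closedBall)
        (fun ξ hξ => Set.indicator_of_notMem (by simpa using hξ) _) fun n b => by
          have h2 := hF1 _ ⟨N, n, -b, (gn_l2 N n (-b)).coeFn_toLp⟩
          rw [L2.inner_def] at h2
          rw [← h2, IT]
          refine integral_congr_ae ?_
          filter_upwards [(gn_l2 N n (-b)).coeFn_toLp] with ξ hξ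
          rw [hξ, RCLike.inner_apply, gn]
          have e1 : (gg N n ‖ξ‖ : ℂ) * (Metric.closedBall 0 (N:ℝ)).indicator F ξ = (gg N n ‖ξ‖ : ℂ) * F ξ := by
            by_cases hk : ‖ξ‖ ≤ N
            · rw [Set.indicator_of_mem (by simpa using hk)]
            · rw [(gg_nice N n).supp _ (fun h => hk h.2)]; simp
          have e2 : starRingEnd ℂ (ei ⟪-b, ξ⟫) = Complex.exp (Complex.I * ((⟪b, ξ⟫:ℝ):ℂ)) := by
            rw [ei, ← Complex.exp_conj, inner_neg_left]; simp
          rw [e1, map_mul, e2, Complex.conj_ofReal]; ring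
      filter_upwards [this] with ξ hξ hn
      rwa [Set.indicator_of_mem (by simpa using hn)] at hξ
    rw [Lp.eq_zero_iff_ae_eq_zero]
    filter_upwards [ae_all_iff.2 h1] with ξ hξ
    obtain ⟨N, hN⟩ := exists_nat_ge ‖ξ‖
    exact hξ N hN
  have hle : (⊤ : Submodule ℂ (LL d)) ≤ S := hd ▸ Submodule.topologicalClosure_minimal _ (Submodule.span_le.2 fun F ⟨R, n, b, h⟩ => by
    show Z0 fun t => T t F
    simp_rw [hc _ _ _ h]; exact hg R n b) hS
  have := hle (Submodule.mem_top (x := hf.toLp f))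
  have h9 : Z0 fun t => T t (hf.toLp f) := this
  simp_rw [hc _ _ _ hf.coeFn_toLp] at h9
  exact h9
end


section
variable {d : ℕ} [NeZero d]

def Gt (χ : Euc d → ℝ) (ε s t : ℝ) (f : Euc d → ℂ) (ξ : Euc d) : ℂ := ((χ ((|t|^ε)⁻¹ • ξ) : ℝ) : ℂ) * propagate s t f ξ
def hh (δ t : ℝ) : ℝ := (|t|^((1:ℝ)/2+δ))⁻¹
def Ph (s t : ℝ) (η ξ : Euc d) : ℂ := ei ⟪(s*t)•η, (js ‖ξ‖)⁻¹ • ξ⟫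
def TT (χ : Euc d → ℝ) (δ ε s : ℝ) (ζ : Euc d) (t : ℝ) (f : Euc d → ℂ) (x : Euc d) : ℂ :=
  -IT (Gt χ ε s t f) x + 2*(ei ⟪hh δ t • ζ, x⟫ * AF t (fun ξ => Ph s t (hh δ t • ζ) ξ * Gt χ ε s t f ξ) x)

lemma Ph_n (s t : ℝ) (η ξ : Euc d) : ‖Ph s t η ξ‖ = 1 := ei_n _
lemma Ph_c (s t : ℝ) : Continuous fun p : Euc d × Euc d => Ph s t p.1 p.2 :=
  ei_c.comp (Continuous.inner (𝕜 := ℝ) (by fun_prop) (jsn_c.comp continuous_snd))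
lemma Ph_c2 (s t : ℝ) (η : Euc d) : Continuous (Ph s t η) := by
  have : Continuous fun ξ : Euc d => ei ⟪(s*t)•η, (js ‖ξ‖)⁻¹ • ξ⟫ := ei_c.comp (Continuous.inner (𝕜 := ℝ) continuous_const jsn_c)
  exact this

lemma IT_congr {f g : Euc d → ℂ} (h : f =ᵐ[volume] g) : IT f = IT g := funext fun x => integral_congr_ae (h.mono fun ξ hξ => by simp only [hξ])
lemma IT_add {f g : Euc d → ℂ} (hf : Integrable f) (hg : Integrable g) : IT (f+g) = IT f + IT g := funext fun x => by
  simp only [Pi.add_apply, IT]; rw [← integral_add (IT_int hf x) (IT_int hg x)]; simp_rw [mul_add]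
lemma IT_smul (c : ℂ) (f : Euc d → ℂ) : IT (c•f) = c • IT f := funext fun x => by
  simp only [Pi.smul_apply, IT, smul_eq_mul]; rw [← integral_const_mul]; simp_rw [mul_left_comm]

lemma cut_i {f : Euc d → ℂ} (hf : Integrable f) (t : ℝ) (x : Euc d) : Integrable fun ξ => if nn t ‖ξ‖ < ‖x‖ then f ξ else 0 := by
  have : (fun ξ => if nn t ‖ξ‖ < ‖x‖ then f ξ else 0) = {ξ : Euc d | nn t ‖ξ‖ < ‖x‖}.indicator f := rfl
  rw [this]; exact hf.indicator (measurableSet_lt (by unfold nn; fun_prop) measurable_const)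

lemma AF_add {f g : Euc d → ℂ} (hf : Integrable f) (hg : Integrable g) (t : ℝ) : AF t (f+g) = AF t f + AF t g := funext fun x => by
  have := congrFun (IT_add (cut_i hf t x) (cut_i hg t x)) x
  simp only [AF, Pi.add_apply] at this ⊢
  rw [← this]; congr 1; ext ξ; simp only [Pi.add_apply]; split_ifs <;> simp
lemma AF_smul (c : ℂ) (f : Euc d → ℂ) (t : ℝ) : AF t (c•f) = c • AF t f := funext fun x => by
  have := congrFun (IT_smul c (fun ξ => if nn t ‖ξ‖ < ‖x‖ then f ξ else 0)) x
  simp only [AF, Pi.smul_apply] at this ⊢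
  rw [← this]; congr 1; ext ξ; simp only [Pi.smul_apply]; split_ifs <;> simp

variable {χ : Euc d → ℝ} {δ ε s t : ℝ} {f : Euc d → ℂ}

lemma jap_c : Continuous (jap (d := d)) := by unfold jap; fun_prop

lemma Gt_m (hχ : Continuous χ) {γ : Type} [MeasurableSpace γ] {u : γ → Euc d} (hu : Measurable u) (hf : Measurable f) : Measurable fun p => Gt χ ε s t f (u p) := by
  unfold Gt propagate; have := hχ.measurable; have := (jap_c (d := d)).measurable; fun_prop

lemma Gt_add (g : Euc d → ℂ) : Gt χ ε s t (f+g) = Gt χ ε s t f + Gt χ ε s t g := by ext; simp only [Gt, propagate, Pi.add_apply]; ring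
lemma Gt_smul (c : ℂ) : Gt χ ε s t (c•f) = c • Gt χ ε s t f := by ext; simp only [Gt, propagate, Pi.smul_apply, smul_eq_mul]; ring
lemma Gt_ae {g : Euc d → ℂ} (h : f =ᵐ[volume] g) : Gt χ ε s t f =ᵐ[volume] Gt χ ε s t g := h.mono fun ξ hξ => by simp only [Gt, propagate, hξ]
lemma Gt_n (ξ : Euc d) : ‖Gt χ ε s t f ξ‖ = |χ ((|t|^ε)⁻¹ • ξ)| * ‖f ξ‖ := by rw [Gt, propagate, norm_mul, norm_mul, cexp_n, one_mul, Complex.norm_real, Real.norm_eq_abs]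

lemma χb (hχ : Continuous χ) (hc : HasCompactSupport χ) : ∃ K, 0 < K ∧ (∀ y, |χ y| ≤ K) ∧ ∀ y, K < ‖y‖ → χ y = 0 := by
  obtain ⟨K, hK⟩ := hχ.bounded_above_of_compact_support hc
  obtain ⟨r, hr⟩ := hc.isCompact.isBounded.subset_closedBall 0
  refine ⟨|K| + |r| + 1, by positivity, fun y => (hK y).trans (by linarith [le_abs_self K, abs_nonneg r]), fun y hy => by_contra fun h => ?_⟩
  have := hr (subset_tsupport χ h)
  rw [mem_closedBall_zero_iff] at this; linarith [le_abs_self r, abs_nonneg K]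

lemma Gt_0 {K : ℝ} (h0 : ∀ y, K < ‖y‖ → χ y = 0) (ht : 0 < t) (ξ : Euc d) (h : K*t^ε < ‖ξ‖) : Gt χ ε s t f ξ = 0 := by
  have hp := Real.rpow_pos_of_pos ht ε
  rw [Gt, h0]
  · simp
  · rw [norm_smul, norm_inv, abs_of_pos ht, Real.norm_of_nonneg hp.le, inv_mul_eq_div, lt_div_iff₀ hp]; exact h

lemma Gt_l2 (hχ : Continuous χ) {K : ℝ} (hK : ∀ y, |χ y| ≤ K) (hf : MemLp f 2 volume) : MemLp (Gt χ ε s t f) 2 volume := by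
  refine hf.of_le_mul (c := K) ?_ (.of_forall fun ξ => by rw [Gt_n]; gcongr; exact hK _)
  unfold Gt propagate; have := jap_c (d := d); have := hf.1
  exact (Continuous.aestronglyMeasurable (by fun_prop)).mul ((Continuous.aestronglyMeasurable (by fun_prop)).mul this)

lemma TT_b (hχ : Continuous χ) (hc : HasCompactSupport χ) (hε1 : ε < 1) : ∃ C : ℝ≥0∞, C ≠ ⊤ ∧ ∀ᶠ t in atTop, ∀ ζ f, MemLp f 2 volume → SQ (TT χ δ ε s ζ t f) ≤ C * SQ f := by
  obtain ⟨K, hK, hb, h0⟩ := χb hχ hc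
  obtain ⟨C, hC, hu⟩ := unif (d := d)
  refine ⟨2*(ENNReal.ofReal ((2*Real.pi)^d) + 4*C)*ENNReal.ofReal K^2, by simp [ENNReal.mul_eq_top, hC], ?_⟩
  have ev : ∀ᶠ t : ℝ in atTop, 8*K ≤ t^(1-ε) := (tendsto_rpow_atTop (by linarith)).eventually_ge_atTop _
  filter_upwards [ev, eventually_gt_atTop 0] with t h1 ht ζ f hf
  have hl := Gt_l2 (ε := ε) (s := s) (t := t) hχ hb hf
  have hi := l2_int hl (Gt_0 h0 ht)
  have hS : SQ (Gt χ ε s t f) ≤ ENNReal.ofReal K^2 * SQ f := by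
    have e : ENNReal.ofReal K = ‖(K:ℂ)‖ₑ := by rw [← ofReal_norm_eq_enorm, Complex.norm_real, Real.norm_of_nonneg hK.le]
    rw [e, ← SQ_mul]
    refine SQ_le fun ξ => ?_
    rw [Gt_n, norm_mul, Complex.norm_real, Real.norm_of_nonneg hK.le]; gcongr; exact hb _
  have h8 : 8*(K*t^ε) ≤ t := by
    have : t = t^(1-ε)*t^ε := by rw [← Real.rpow_add ht, sub_add_cancel, Real.rpow_one]
    rw [← mul_assoc]; conv_rhs => rw [this]
    gcongr
  set g : Euc d → ℂ := fun ξ => Ph s t (hh δ t • ζ) ξ * Gt χ ε s t f ξ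
  have hgn : ∀ ξ, ‖g ξ‖ = ‖Gt χ ε s t f ξ‖ := fun ξ => by rw [norm_mul, Ph_n, one_mul]
  have h9 := hu (K*t^ε) t g (hl.of_le ((Ph_c2 s t _).aestronglyMeasurable.mul hl.1) (.of_forall fun ξ => (hgn ξ).le))
    (fun ξ hξ => by simp only [g]; rw [Gt_0 h0 ht ξ hξ, mul_zero]) ht h8
  refine (SQ_add (f := fun x => -IT (Gt χ ε s t f) x) (IT_cont hi).neg.measurable).trans ?_
  rw [SQ_mul, mul_assoc 2, mul_assoc 2, add_mul, add_mul]
  refine mul_le_mul_right (add_le_add ?_ ?_) 2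
  · refine (SQ_le (g := IT (Gt χ ε s t f)) fun x => (norm_neg _).le).trans ?_
    rw [SQ, planl hi hl, mul_assoc]; gcongr; exact hS
  · rw [mul_assoc, mul_assoc]
    refine mul_le_mul' (le_of_eq ?_) ((SQ_le fun x => by rw [norm_mul, ei_n, one_mul]).trans (h9.trans ?_))
    · rw [← ofReal_norm_eq_enorm]; norm_num
    · gcongr; exact (SQ_le fun ξ => (hgn ξ).le).trans hS

lemma TT_m (hχ : Continuous χ) (hf : Measurable f) : Measurable fun p : Euc d × Euc d => TT χ δ ε s p.1 t f p.2 := by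
  have h1 : Measurable fun p : Euc d × Euc d => IT (Gt χ ε s t f) p.2 := StronglyMeasurable.measurable (StronglyMeasurable.integral_prod_right'
    (f := fun q : (Euc d × Euc d) × Euc d => Complex.exp (Complex.I * ((⟪q.1.2, q.2⟫:ℝ):ℂ)) * Gt χ ε s t f q.2) (Measurable.stronglyMeasurable (by
      have := Gt_m (ε := ε) (s := s) (t := t) hχ (γ := (Euc d × Euc d) × Euc d) measurable_snd hf; fun_prop)))
  have h2 : Measurable fun p : Euc d × Euc d => AF t (fun ξ => Ph s t (hh δ t • p.1) ξ * Gt χ ε s t f ξ) p.2 := StronglyMeasurable.measurable (StronglyMeasurable.integral_prod_right'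
    (f := fun q : (Euc d × Euc d) × Euc d => Complex.exp (Complex.I * ((⟪q.1.2, q.2⟫:ℝ):ℂ)) * if nn t ‖q.2‖ < ‖q.1.2‖ then Ph s t (hh δ t • q.1.1) q.2 * Gt χ ε s t f q.2 else 0)
    (Measurable.stronglyMeasurable (by
      have a1 := Gt_m (ε := ε) (s := s) (t := t) hχ (γ := (Euc d × Euc d) × Euc d) measurable_snd hf
      have a2 : Measurable fun q : (Euc d × Euc d) × Euc d => Ph s t (hh δ t • q.1.1) q.2 := ((Ph_c s t).comp (by fun_prop : Continuous fun q : (Euc d × Euc d) × Euc d => (hh δ t • q.1.1, q.2))).measurable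
      exact Measurable.mul (by fun_prop) (Measurable.ite (measurableSet_lt (by unfold nn; fun_prop) (by fun_prop)) (a2.mul a1) measurable_const))))
  have h3 := ei_c.measurable
  unfold TT; fun_prop

set_option maxHeartbeats 1000000 in
lemma TT_Z (hχ : Continuous χ) (hc : HasCompactSupport χ) (h1 : EqOneNearZero χ) (hδ : 0 < δ) (hε : 0 < ε) (hε1 : ε < 1) (hs : s = 1 ∨ s = -1) (ζ : Euc d)
    (hf : MemLp f 2 volume) : Z0 fun t => TT χ δ ε s ζ t f := by
  obtain ⟨K, hK, hb, h0⟩ := χb hχ hc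
  obtain ⟨C, hC, hu⟩ := TT_b (δ := δ) (s := s) hχ hc hε1
  have hPi : ∀ t, 0 < t → ∀ f, MemLp f 2 volume → Integrable (Gt χ ε s t f) ∧ Integrable (fun ξ => Ph s t (hh δ t • ζ) ξ * Gt χ ε s t f ξ) := fun t ht f hf => by
    have hi := l2_int (Gt_l2 (ε := ε) (s := s) (t := t) hχ hb hf) (Gt_0 h0 ht)
    exact ⟨hi, hi.bdd_mul (c := 1) (Ph_c2 s t _).aestronglyMeasurable (.of_forall fun ξ => (Ph_n _ _ _ _).le)⟩
  refine density (T := TT χ δ ε s ζ) (fun t f g h => ?_) (fun t f hf => ?_) (fun t ht f g hf hg => ?_) (fun t c f => ?_) hC (hu.mono fun t h => h ζ) (fun R n b => ?_) hf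
  · unfold TT
    have e : (fun ξ => Ph s t (hh δ t • ζ) ξ * Gt χ ε s t f ξ) =ᵐ[volume] fun ξ => Ph s t (hh δ t • ζ) ξ * Gt χ ε s t g ξ := (Gt_ae h).mono fun ξ hξ => by
      beta_reduce; rw [hξ]
    rw [IT_congr (Gt_ae h), AF_congr e]
  · exact Measurable.comp (g := fun p : Euc d × Euc d => TT χ δ ε s p.1 t f p.2) (f := fun x : Euc d => (ζ, x)) (TT_m hχ hf) measurable_prodMk_left
  · have e : (fun ξ => Ph s t (hh δ t • ζ) ξ * Gt χ ε s t (f+g) ξ) = (fun ξ => Ph s t (hh δ t • ζ) ξ * Gt χ ε s t f ξ) + (fun ξ => Ph s t (hh δ t • ζ) ξ * Gt χ ε s t g ξ) := by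
      rw [Gt_add]; ext; simp only [Pi.add_apply]; ring
    ext x; simp only [TT, Pi.add_apply]
    rw [e, AF_add (hPi t ht f hf).2 (hPi t ht g hg).2, Gt_add, IT_add (hPi t ht f hf).1 (hPi t ht g hg).1]; simp only [Pi.add_apply]; ring
  · have e : (fun ξ => Ph s t (hh δ t • ζ) ξ * Gt χ ε s t (c•f) ξ) = c • (fun ξ => Ph s t (hh δ t • ζ) ξ * Gt χ ε s t f ξ) := by
      rw [Gt_smul]; ext; simp only [Pi.smul_apply, smul_eq_mul]; ring
    ext x; simp only [TT, Pi.smul_apply]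
    rw [e, AF_smul, Gt_smul, IT_smul]; simp only [Pi.smul_apply, smul_eq_mul]; ring
  · have hη : ∀ᶠ t in atTop, hh δ t = t^(-(1/2+δ)) := by
      filter_upwards [eventually_gt_atTop 0] with t ht; rw [hh, abs_of_pos ht, Real.rpow_neg ht.le]
    have l0 : Tendsto (fun t => hh δ t • ζ) atTop (𝓝 0) := by
      have := (tendsto_rpow_neg_atTop (show 0 < 1/2+δ by linarith)).smul_const ζ
      rw [zero_smul] at this
      exact this.congr' (hη.mono fun t h => by beta_reduce; rw [h])
    have l2 : Tendsto (fun t => t*‖hh δ t • ζ‖^2) atTop (𝓝 0) := by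
      have := (tendsto_rpow_neg_atTop (show 0 < 2*δ by linarith)).mul_const (‖ζ‖^2)
      rw [zero_mul] at this
      refine this.congr' ?_
      filter_upwards [hη, eventually_gt_atTop 0] with t h ht
      rw [norm_smul, mul_pow, ← mul_assoc, h, Real.norm_of_nonneg (by positivity)]
      have : t^(-(2*δ)) = t^(1:ℝ)*(t^(-(1/2+δ))*t^(-(1/2+δ))) := by rw [← Real.rpow_add ht, ← Real.rpow_add ht]; congr 1; ring
      rw [this, Real.rpow_one, pow_two (t^_)]
    obtain ⟨r, hr, hr1⟩ := h1
    have ev : ∀ᶠ t : ℝ in atTop, |R|/r < t^ε := (tendsto_rpow_atTop hε).eventually_gt_atTop _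
    have a1 := half R n hs b l0 l2
    have hA := fun t (z : Euc d) => (AF_meas t (Ff_c R n s t b z).measurable).measurable
    have hI := fun t (z : Euc d) => (IT_cont (Ff_i R n s t b z)).measurable
    have a2 : Z0 fun t x => ei ⟪hh δ t • ζ, x⟫ * (2 * AF t (Ff R n s t b ((s*t)•hh δ t • ζ)) x - IT (Ff R n s t b ((s*t)•hh δ t • ζ)) x) :=
      a1.of_le (C := 1) (by simp) (.of_forall fun t => by rw [one_mul]; exact SQ_le fun x => by rw [norm_mul, ei_n, one_mul])
    refine a2.add (shift R n hs b l0 l2) (.of_forall fun t => ?_) ?_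
    · have h3 := ei_c.measurable; have := hA t ((s*t)•hh δ t • ζ); have := hI t ((s*t)•hh δ t • ζ)
      fun_prop
    · filter_upwards [ev, eventually_gt_atTop 0] with t h3 ht x
      have e1 : Gt χ ε s t (gn R n b) = Ff R n s t b 0 := by
        ext ξ
        by_cases h : ‖ξ‖ ≤ R
        · have : χ ((|t|^ε)⁻¹ • ξ) = 1 := hr1 _ (by
            rw [norm_smul, norm_inv, abs_of_pos ht, Real.norm_of_nonneg (by positivity), inv_mul_eq_div, div_lt_iff₀ (by positivity)]
            rw [div_lt_iff₀ hr] at h3; linarith [le_abs_self R])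
          rw [Gt, this, propagate, gn, Ff, ei_add, smul_zero, add_zero]; simp only [Complex.ofReal_one, one_mul, ei, jap, js]; ring
        · rw [Ff_0 n s t b 0 ξ (not_le.1 h), Gt, propagate, gn, (gg_nice R n).supp _ (fun h' => h h'.2)]; simp
      have e2 : (fun ξ => Ph s t (hh δ t • ζ) ξ * Gt χ ε s t (gn R n b) ξ) = Ff R n s t b ((s*t)•hh δ t • ζ) := by
        ext ξ; rw [e1, Ff_z R n s t b ((s*t)•hh δ t • ζ)]; rfl
      rw [TT, e2, e1]; ring
end


section
variable {d : ℕ} [NeZero d] {χ : Euc d → ℝ} {δ ε s t : ℝ} {f : Euc d → ℂ}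

lemma cutn (ht : 0 < t) (ξ : Euc d) : |t| * (‖ξ‖ / jap ξ) = nn t ‖ξ‖ := by rw [abs_of_pos ht, nn, jap, mul_div_assoc]

lemma fub {k : Euc d → ℂ} (hki : Integrable k) (hk : ∀ y, (χ y : ℂ) = ∫ ζ, k ζ * ei ⟪ζ, y⟫) (ht : 0 < t) (hi : Integrable (Gt χ ε s t f)) (x : Euc d) :
    Integrable (fun ζ => k ζ * (ei ⟪hh δ t • ζ, x⟫ * AF t (fun ξ => Ph s t (hh δ t • ζ) ξ * Gt χ ε s t f ξ) x)) ∧ ∫ ζ, k ζ * (ei ⟪hh δ t • ζ, x⟫ * AF t (fun ξ => Ph s t (hh δ t • ζ) ξ * Gt χ ε s t f ξ) x) =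
    ∫ ξ, Complex.exp (Complex.I * ((⟪x, ξ⟫ : ℝ) : ℂ)) * aKGpm χ δ ε s t x ξ * propagate s t f ξ := by
  have e1 : ∀ ζ, k ζ * (ei ⟪hh δ t • ζ, x⟫ * AF t (fun ξ => Ph s t (hh δ t • ζ) ξ * Gt χ ε s t f ξ) x) =
      ∫ ξ, (ei ⟪hh δ t • ζ, x⟫ * Ph s t (hh δ t • ζ) ξ * (ei ⟪x, ξ⟫ * if nn t ‖ξ‖ < ‖x‖ then 1 else 0)) * (k ζ * Gt χ ε s t f ξ) := fun ζ => by
    rw [AF, IT, ← mul_assoc, ← integral_const_mul]; congr 1; ext ξ; rw [ei, ei]; split_ifs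
    · ring
    · simp
  have e2 : ∀ ξ, Complex.exp (Complex.I * ((⟪x, ξ⟫ : ℝ) : ℂ)) * aKGpm χ δ ε s t x ξ * propagate s t f ξ =
      ∫ ζ, (ei ⟪hh δ t • ζ, x⟫ * Ph s t (hh δ t • ζ) ξ * (ei ⟪x, ξ⟫ * if nn t ‖ξ‖ < ‖x‖ then 1 else 0)) * (k ζ * Gt χ ε s t f ξ) := fun ξ => by
    have : ∀ ζ, (ei ⟪hh δ t • ζ, x⟫ * Ph s t (hh δ t • ζ) ξ * (ei ⟪x, ξ⟫ * if nn t ‖ξ‖ < ‖x‖ then 1 else 0)) * (k ζ * Gt χ ε s t f ξ) =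
        k ζ * ei ⟪ζ, hh δ t • (x + (s*t/jap ξ) • ξ)⟫ * ((ei ⟪x, ξ⟫ * if nn t ‖ξ‖ < ‖x‖ then 1 else 0) * Gt χ ε s t f ξ) := fun ζ => by
      have : ⟪ζ, hh δ t • (x + (s*t/jap ξ) • ξ)⟫ = ⟪hh δ t • ζ, x⟫ + ⟪(s*t)•hh δ t • ζ, (js ‖ξ‖)⁻¹ • ξ⟫ := by
        simp only [real_inner_smul_left, real_inner_smul_right, inner_add_right, jap, js]; ring
      rw [this, ei_add, Ph]; ring
    simp_rw [this]; rw [integral_mul_const, ← hk, aKGpm, Gt, cutn ht, ei, hh]; ring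
  simp_rw [e1, e2]
  suffices h : Integrable (Function.uncurry fun ζ ξ => (ei ⟪hh δ t • ζ, x⟫ * Ph s t (hh δ t • ζ) ξ * (ei ⟪x, ξ⟫ * if nn t ‖ξ‖ < ‖x‖ then 1 else 0)) * (k ζ * Gt χ ε s t f ξ)) (volume.prod volume) from
    ⟨h.integral_prod_left, integral_integral_swap h⟩
  refine (hki.mul_prod hi).bdd_mul (c := 1) (Measurable.aestronglyMeasurable ?_) (.of_forall fun p => ?_)
  · have a2 : Measurable fun q : Euc d × Euc d => Ph s t (hh δ t • q.1) q.2 := ((Ph_c s t).comp (by fun_prop : Continuous fun q : Euc d × Euc d => (hh δ t • q.1, q.2))).measurable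
    have h3 := ei_c.measurable
    exact Measurable.mul (by fun_prop) (Measurable.mul (by fun_prop) (Measurable.ite (measurableSet_lt (by unfold nn; fun_prop) (by fun_prop)) measurable_const measurable_const))
  · simp only [norm_mul, ei_n, Ph_n, one_mul]; split_ifs <;> simp

variable (hχ : ContDiff ℝ (⊤ : ℕ∞) χ) (hc : HasCompactSupport χ) (h1 : EqOneNearZero χ) (hδ : 0 < δ) (hε : 0 < ε) (hε1 : ε < 1) (hs : s = 1 ∨ s = -1) (hm : Measurable f) (hf : MemLp f 2 volume)

def cc (d : ℕ) : ℂ := (((2 * Real.pi) ^ d : ℝ) : ℂ)⁻¹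

lemma Gt_i (hχ : Continuous χ) (hc : HasCompactSupport χ) (hf : MemLp f 2 volume) (ht : 0 < t) : Integrable (Gt χ ε s t f) := by
  obtain ⟨K, hK, hb, h0⟩ := χb hχ hc
  exact l2_int (Gt_l2 hχ hb hf) (Gt_0 h0 ht)

include hχ hc h1 hδ hε hε1 hs hm hf in
lemma main_pm : Z0 fun t x => OpF (aKGpm χ δ ε s t) (propagate s t f) x - cc d/2 * IT (Gt χ ε s t f) x := by
  obtain ⟨k, hk, hki, he⟩ := FI hχ hc
  obtain ⟨C, hC, hu⟩ := TT_b (δ := δ) (s := s) hχ.continuous hc hε1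
  have k1 : ∫ ζ, k ζ = 1 := by
    obtain ⟨r, hr, h⟩ := h1
    have := he 0
    rw [h 0 (by simpa using hr)] at this; simpa [ei] using this.symm
  have hM : SQ f ≠ ⊤ := by rw [SQ, en_sq hf]; simp
  have hZ := fun ζ => TT_Z (d := d) hχ.continuous hc h1 hδ hε hε1 hs ζ hf
  refine (super hk hki (fun t => TT_m (ε := ε) (s := s) (t := t) hχ.continuous hm) (ENNReal.mul_ne_top hC hM) (hu.mono fun t h ζ => h ζ f hf) hZ).mul (cc d/2) ?_
  filter_upwards [eventually_gt_atTop 0] with t ht x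
  have hi := Gt_i (ε := ε) (s := s) hχ.continuous hc hf ht
  obtain ⟨a, b⟩ := fub (δ := δ) hki he ht hi x
  have e : ∫ ζ, k ζ * TT χ δ ε s ζ t f x = ∫ ζ, (k ζ * (-IT (Gt χ ε s t f) x) + 2*(k ζ * (ei ⟪hh δ t • ζ, x⟫ * AF t (fun ξ => Ph s t (hh δ t • ζ) ξ * Gt χ ε s t f ξ) x))) := by
    congr 1; ext ζ; rw [TT]; ring
  rw [e, integral_add (hki.mul_const _) (a.const_mul 2), integral_mul_const, integral_const_mul, b, k1, OpF, cc]; ring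

lemma AT (hi : Integrable (Gt χ ε s t f)) (ht : 0 < t) (x : Euc d) : OpF (aKG χ ε t) (propagate s t f) x = cc d * AF t (Gt χ ε s t f) x := by
  rw [OpF, cc, AF, IT]; congr 2; ext ξ; rw [aKG, cutn ht, Gt]; split_ifs
  · ring
  · simp

include hχ hc h1 hδ hε hε1 hs hf in
lemma main_A : Z0 fun t x => OpF (aKG χ ε t) (propagate s t f) x - cc d/2 * IT (Gt χ ε s t f) x := by
  refine (TT_Z (d := d) hχ.continuous hc h1 hδ hε hε1 hs 0 hf).mul (cc d/2) ?_
  filter_upwards [eventually_gt_atTop 0] with t ht x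
  have e : (fun ξ : Euc d => Ph s t (hh δ t • (0:Euc d)) ξ * Gt χ ε s t f ξ) = Gt χ ε s t f := by ext ξ; simp [Ph, ei]
  rw [TT, e, AT (Gt_i hχ.continuous hc hf ht) ht]; simp [ei]; ring

include hχ hc hm hf in
lemma Op_m (ht : 0 < t) : Measurable (OpF (aKGpm χ δ ε s t) (propagate s t f)) ∧ Measurable (OpF (aKG χ ε t) (propagate s t f)) ∧
    ∀ x, OpF (fun x' ξ => aKG χ ε t x' ξ - aKGpm χ δ ε s t x' ξ) (propagate s t f) x = OpF (aKG χ ε t) (propagate s t f) x - OpF (aKGpm χ δ ε s t) (propagate s t f) x := by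
  have hi := Gt_i (ε := ε) (s := s) hχ.continuous hc hf ht
  have hj := (jap_c (d := d)).measurable
  have hc' := hχ.continuous.measurable
  have hsy : Measurable fun q : Euc d × Euc d => ((χ ((|t| ^ ((1:ℝ)/2 + δ))⁻¹ • (q.1 + (s * t / jap q.2) • q.2)) : ℝ) : ℂ) := by fun_prop
  refine ⟨?_, ?_, fun x => ?_⟩
  · have := (StronglyMeasurable.integral_prod_right' (ν := volume)
      (f := fun q : Euc d × Euc d => Complex.exp (Complex.I * ((⟪q.1, q.2⟫:ℝ):ℂ)) * aKGpm χ δ ε s t q.1 q.2 * propagate s t f q.2) (Measurable.stronglyMeasurable (by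
      unfold aKGpm propagate
      exact Measurable.mul (Measurable.mul (by fun_prop) (Measurable.mul (Measurable.mul hsy (Measurable.ite (measurableSet_lt (by fun_prop) (by fun_prop)) measurable_const measurable_const)) (by fun_prop))) (by fun_prop)))).measurable
    exact this.const_mul _
  · rw [funext (AT hi ht)]
    have : Measurable (Gt χ ε s t f) := Gt_m hχ.continuous measurable_id hm
    exact (AF_meas t this).measurable.const_mul _
  · obtain ⟨K, hK, hb, h0⟩ := χb hχ.continuous hc
    rw [OpF, OpF, OpF, ← mul_sub, ← integral_sub]
    · congr 2; ext ξ; ring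
    · have : Integrable fun ξ => Complex.exp (Complex.I * ((⟪x, ξ⟫ : ℝ) : ℂ)) * if nn t ‖ξ‖ < ‖x‖ then Gt χ ε s t f ξ else 0 := IT_int (cut_i hi t x) x
      refine this.congr (.of_forall fun ξ => ?_)
      simp only [aKG, cutn ht, Gt]; split_ifs
      · ring
      · simp
    · have : Integrable fun ξ => Complex.exp (Complex.I * ((⟪x, ξ⟫ : ℝ) : ℂ)) * if nn t ‖ξ‖ < ‖x‖ then Gt χ ε s t f ξ else 0 := IT_int (cut_i hi t x) x
      refine (this.bdd_mul (f := fun ξ => ((χ ((|t| ^ ((1:ℝ)/2 + δ))⁻¹ • (x + (s * t / jap ξ) • ξ)) : ℝ) : ℂ)) (c := K) (by fun_prop) (.of_forall fun ξ => ?_)).congr (.of_forall fun ξ => ?_)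
      · rw [Complex.norm_real]; exact hb _
      simp only [aKGpm, cutn ht, Gt]; split_ifs
      · ring
      · simp

include hχ hc h1 hδ hε hε1 hs hm hf in
lemma main_3 : Z0 fun t => OpF (fun x' ξ => aKG χ ε t x' ξ - aKGpm χ δ ε s t x' ξ) (propagate s t f) := by
  refine (main_A hχ hc h1 hδ hε hε1 hs hf).add ((main_pm hχ hc h1 hδ hε hε1 hs hm hf).mul (-1) (.of_forall fun t x => rfl)) ?_ ?_
  · filter_upwards [eventually_gt_atTop 0] with t ht
    exact (Op_m (δ := δ) (ε := ε) (s := s) hχ hc hm hf ht).2.1.sub ((IT_cont (Gt_i hχ.continuous hc hf ht)).measurable.const_mul _)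
  · filter_upwards [eventually_gt_atTop 0] with t ht x
    rw [(Op_m hχ hc hm hf ht).2.2]; ring
end


section
lemma RL1 (H : ℝ → ℂ) : Tendsto (fun τ => ∫ ρ in Set.Ioi (0:ℝ), ei (τ * js ρ) * H ρ) (cocompact ℝ) (𝓝 0) := by
  have sq : ∀ ρ ∈ Set.Ioi (0:ℝ), √(js ρ^2-1) = ρ := fun ρ h => by rw [js_sq, add_sub_cancel_left]; exact Real.sqrt_sq (le_of_lt h)
  have inj : Set.InjOn js (Set.Ioi 0) := fun a ha b hb e => by rw [← sq a ha, e, sq b hb]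
  have hS : MeasurableSet (js '' Set.Ioi 0) := measurableSet_Ioi.image_of_continuousOn_injOn js_c.continuousOn inj
  set G : ℝ → ℂ := (js '' Set.Ioi 0).indicator fun u => H (√(u^2-1)) / |vv (√(u^2-1))|
  have hv : Tendsto (fun τ : ℝ => (-(2*Real.pi)⁻¹) * τ) (cocompact ℝ) (cocompact ℝ) :=
    (Homeomorph.mulLeft₀ (-(2*Real.pi)⁻¹) (by simp [Real.pi_ne_zero])).isClosedEmbedding.tendsto_cocompact
  refine ((Real.tendsto_integral_exp_smul_cocompact G).comp hv).congr fun τ => ?_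
  have e1 : ∀ v, (Real.fourierChar (-(v * (-(2*Real.pi)⁻¹ * τ)))) • G v = (js '' Set.Ioi 0).indicator (fun u => ei (τ*u) * (H (√(u^2-1)) / |vv (√(u^2-1))|)) v := fun v => by
    have : ((Real.fourierChar (-(v * (-(2*Real.pi)⁻¹ * τ))) : Circle) : ℂ) = ei (τ*v) := by
      rw [Real.fourierChar_apply, ei]; congr 1
      have : 2 * Real.pi * (-(v * (-(2*Real.pi)⁻¹ * τ))) = τ*v := by field_simp
      rw [this, mul_comm]
    rw [Circle.smul_def, this]
    by_cases h : v ∈ js '' Set.Ioi 0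
    · simp [G, h]
    · simp [G, h]
  rw [Function.comp_apply, integral_congr_ae (.of_forall e1), integral_indicator hS,
    integral_image_eq_integral_abs_deriv_smul measurableSet_Ioi (fun x _ => (js_d x).hasDerivWithinAt) inj]
  refine setIntegral_congr_fun measurableSet_Ioi fun ρ hρ => ?_
  have : ((|vv ρ| : ℝ) : ℂ) ≠ 0 := by
    have : 0 < vv ρ := by unfold vv; have := js_pos ρ; have : 0 < ρ := hρ; positivity
    exact_mod_cast (abs_pos.2 this.ne').ne'
  simp only [sq ρ hρ, Complex.real_smul]; field_simp

variable {d : ℕ} [NeZero d]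
lemma RL {q : Euc d → ℂ} (hm : Measurable q) (hi : Integrable q) {σ : ℝ} (hσ : σ ≠ 0) : Tendsto (fun t => ∫ ξ, ei (σ*t*jap ξ) * q ξ) atTop (𝓝 0) := by
  have hv : Tendsto (fun τ : ℝ => σ * τ) atTop (cocompact ℝ) :=
    ((Homeomorph.mulLeft₀ σ hσ).isClosedEmbedding.tendsto_cocompact).comp (by rw [cocompact_eq_atBot_atTop]; exact tendsto_id.mono_right le_sup_right)
  refine ((RL1 fun ρ => ∫ θ, ρ^(d-1) • q (ρ • (θ : Euc d)) ∂sg d).comp hv).congr fun t => ?_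
  have hc : Continuous fun ξ : Euc d => ei (σ*t*jap ξ) := ei_c.comp (jap_c.const_mul _)
  have hM : Measurable fun ξ : Euc d => ei (σ*t*jap ξ) * q ξ := hc.measurable.mul hm
  have hI : Integrable fun ξ : Euc d => ei (σ*t*jap ξ) * q ξ := hi.bdd_mul (c := 1) hc.aestronglyMeasurable (.of_forall fun _ => (ei_n _).le)
  rw [polar_int hM, integral_prod_symm _ ((polar_iff hM).1 hI)]
  refine setIntegral_congr_fun measurableSet_Ioi fun ρ hρ => ?_
  simp only [← integral_const_mul]
  congr 1; ext θ
  rw [jap, norm_sp hρ, ← js, mul_smul_comm]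
end


section
variable {d : ℕ} [NeZero d]

def B (F G : Euc d → ℂ) : ℂ := ∫ x, F x * (starRingEnd ℂ) (G x)
def Nr (F : Euc d → ℂ) : ℝ := √(SQ F).toReal

lemma B_i {F G : Euc d → ℂ} (hF : MemLp F 2 volume) (hG : MemLp G 2 volume) : Integrable fun x => F x * (starRingEnd ℂ) (G x) := hF.integrable_mul hG.star

lemma B_re {F G : Euc d → ℂ} (hF : MemLp F 2 volume) (hG : MemLp G 2 volume) : ∫ x, ‖F x + G x‖^2 = (∫ x, ‖F x‖^2) + (∫ x, ‖G x‖^2) + 2*(B F G).re := by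
  have e : ∀ x, ‖F x + G x‖^2 = ‖F x‖^2 + ‖G x‖^2 + 2*(F x * (starRingEnd ℂ) (G x)).re := fun x => by simp only [← Complex.normSq_eq_norm_sq, Complex.normSq_add]
  have i := B_i hF hG
  have : (B F G).re = ∫ x, (F x * (starRingEnd ℂ) (G x)).re := (integral_re i).symm
  have a := (memsq hF.1).1 hF; have b := (memsq hG.1).1 hG
  rw [integral_congr_ae (.of_forall e), this, ← integral_const_mul, ← integral_add a b]
  exact integral_add (a.add b) (i.re.const_mul 2)

lemma B_a {F G H : Euc d → ℂ} (hF : MemLp F 2 volume) (hG : MemLp G 2 volume) (hH : MemLp H 2 volume) : B (F+G) H = B F H + B G H ∧ B H (F+G) = B H F + B H G := by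
  constructor
  · rw [B, B, B, ← integral_add (B_i hF hH) (B_i hG hH)]; simp only [Pi.add_apply, add_mul]
  · rw [B, B, B, ← integral_add (B_i hH hF) (B_i hH hG)]; simp only [Pi.add_apply, map_add, mul_add]

lemma plB {F G : Euc d → ℂ} (hF : MemLp F 2 volume) (hG : MemLp G 2 volume) (iF : Integrable F) (iG : Integrable G) : B (IT F) (IT G) = ((2*Real.pi)^d : ℝ) * B F G := by
  have re : ∀ G : Euc d → ℂ, MemLp G 2 volume → Integrable G → (B (IT F) (IT G)).re = (2*Real.pi)^d * (B F G).re := fun G hG iG => by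
    have a := plan iF hF; have b := plan iG hG; have c := plan (iF.add iG) (hF.add hG)
    have e := B_re a.1 b.1
    have e' := B_re hF hG
    rw [IT_add iF iG] at c
    have c := c.2; simp only [Pi.add_apply] at c
    rw [c, e', a.2, b.2] at e; linarith
  have im : ∀ F G : Euc d → ℂ, (B F (Complex.I•G)).re = (B F G).im := fun F G => by
    have : B F (Complex.I•G) = -Complex.I * B F G := by
      rw [B, B, ← integral_const_mul]; congr 1; ext x; simp; ring
    rw [this]; simp
  apply Complex.ext
  · rw [re G hG iG, Complex.re_ofReal_mul]
  · rw [← im, ← IT_smul, re _ (hG.const_smul _) (iG.smul _), im, Complex.im_ofReal_mul]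

lemma CS {F G : Euc d → ℂ} (hF : MemLp F 2 volume) (hG : MemLp G 2 volume) : ‖B F G‖ ≤ Nr F * Nr G := by
  have e : ∀ F : Euc d → ℂ, ∀ hF : MemLp F 2 volume, Nr F = ‖hF.toLp F‖ := fun F hF => by
    have : SQ F = SQ (hF.toLp F) := lcong hF.coeFn_toLp.symm
    rw [Nr, this, SQ_Lp, ENNReal.toReal_pow, Real.sqrt_sq ENNReal.toReal_nonneg]; simp
  have : B F G = inner ℂ (hG.toLp G) (hF.toLp F) := by
    rw [L2.inner_def, B]; refine integral_congr_ae ?_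
    filter_upwards [hF.coeFn_toLp, hG.coeFn_toLp] with x h h'
    rw [h, h', RCLike.inner_apply]
  rw [this, e F hF, e G hG, mul_comm]; exact norm_inner_le_norm _ _

lemma Z0.n {w : ℝ → Euc d → ℂ} (h : Z0 w) : Tendsto (fun t => Nr (w t)) atTop (𝓝 0) := by
  have := (Real.continuous_sqrt.tendsto _).comp ((ENNReal.tendsto_toReal ENNReal.zero_ne_top).comp h)
  simp only [ENNReal.toReal_zero, Real.sqrt_zero] at this; exact this

lemma SQm {F : Euc d → ℂ} (hF : Measurable F) (h : SQ F ≠ ⊤) : MemLp F 2 volume := by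
  rw [memsq hF.aestronglyMeasurable]
  refine ⟨(hF.norm.pow_const 2).aestronglyMeasurable, ?_⟩
  rw [HasFiniteIntegral]; convert h.lt_top using 1; rw [SQ]; congr 1; ext x; simp

lemma lim {U W U' W' : ℝ → Euc d → ℂ} (hU : Z0 fun t x => U t x - W t x) (hU' : Z0 fun t x => U' t x - W' t x) {M : ℝ}
    (hm : ∀ᶠ t in atTop, Measurable (U t) ∧ Measurable (U' t) ∧ Measurable (W t) ∧ Measurable (W' t) ∧ MemLp (W t) 2 volume ∧ MemLp (W' t) 2 volume ∧ Nr (W t) ≤ M ∧ Nr (W' t) ≤ M)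
    {l : ℂ} (hl : Tendsto (fun t => B (W t) (W' t)) atTop (𝓝 l)) : Tendsto (fun t => B (U t) (U' t)) atTop (𝓝 l) := by
  have z : Tendsto (fun t => B (U t) (U' t) - B (W t) (W' t)) atTop (𝓝 0) := by
    have b := ((hU.n.mul hU'.n).add (hU.n.mul_const M)).add (hU'.n.const_mul M)
    simp only [mul_zero, zero_mul, add_zero] at b
    refine squeeze_zero_norm' ?_ b
    filter_upwards [hm, hU.eventually_lt_const ENNReal.zero_lt_top, hU'.eventually_lt_const ENNReal.zero_lt_top] with t ⟨h1, h2, h3, h4, h5, h6, h7, h8⟩ h9 h10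
    have a1 := SQm (h1.sub h3) h9.ne
    have a2 := SQm (h2.sub h4) h10.ne
    have e : B (U t) (U' t) - B (W t) (W' t) = B (U t - W t) (U' t - W' t) + B (U t - W t) (W' t) + B (W t) (U' t - W' t) := by
      have e1 : B (U t) (U' t) = B ((U t - W t) + W t) ((U' t - W' t) + W' t) := by simp
      rw [e1, (B_a a1 h5 (a2.add h6)).1, (B_a a2 h6 a1).2, (B_a a2 h6 h5).2]; ring
    rw [e]
    refine (norm_add₃_le).trans (add_le_add (add_le_add (CS a1 a2) ((CS a1 h6).trans ?_)) ((CS h5 a2).trans ?_))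
    · exact mul_le_mul_of_nonneg_left h8 (Real.sqrt_nonneg _)
    · exact mul_le_mul_of_nonneg_right h7 (Real.sqrt_nonneg _)
  have := z.add hl
  simpa using this

variable {χ : Euc d → ℝ} {δ ε s s' : ℝ} {f f' : Euc d → ℂ}
lemma limG (hχ : Continuous χ) (hc : HasCompactSupport χ) (h1 : EqOneNearZero χ) (hε : 0 < ε) (hf : MemLp f 2 volume) (hf' : MemLp f' 2 volume) {l : ℂ}
    (hl : Tendsto (fun t => ∫ ξ, ei ((s-s')*t*jap ξ) * (f ξ * (starRingEnd ℂ) (f' ξ))) atTop (𝓝 l)) :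
    Tendsto (fun t => B (Gt χ ε s t f) (Gt χ ε s' t f')) atTop (𝓝 l) := by
  obtain ⟨K, hK, hb, h0⟩ := χb hχ hc
  have hi := B_i hf hf'
  have hcc : ∀ t, Continuous fun ξ : Euc d => ei ((s-s')*t*jap ξ) := fun t => ei_c.comp (jap_c.const_mul _)
  have hI : ∀ t, Integrable fun ξ : Euc d => ei ((s-s')*t*jap ξ) * (f ξ * (starRingEnd ℂ) (f' ξ)) := fun t =>
    hi.bdd_mul (c := 1) (hcc t).aestronglyMeasurable (.of_forall fun _ => (ei_n _).le)
  have e : ∀ t ξ, Gt χ ε s t f ξ * (starRingEnd ℂ) (Gt χ ε s' t f' ξ) - ei ((s-s')*t*jap ξ) * (f ξ * (starRingEnd ℂ) (f' ξ)) =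
      ((χ ((|t|^ε)⁻¹ • ξ)^2 - 1 : ℝ):ℂ) * (ei ((s-s')*t*jap ξ) * (f ξ * (starRingEnd ℂ) (f' ξ))) := fun t ξ => by
    have : ei ((s-s')*t*jap ξ) = ei (s*t*jap ξ) * (starRingEnd ℂ) (ei (s'*t*jap ξ)) := by
      rw [ei, ei, ei, ← Complex.exp_conj, ← Complex.exp_add]; congr 1; simp; ring
    rw [this, Gt, Gt, propagate, propagate, ← ei, ← ei]; simp; ring
  have z : Tendsto (fun t => B (Gt χ ε s t f) (Gt χ ε s' t f') - ∫ ξ, ei ((s-s')*t*jap ξ) * (f ξ * (starRingEnd ℂ) (f' ξ))) atTop (𝓝 0) := by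
    have : ∀ t, B (Gt χ ε s t f) (Gt χ ε s' t f') - ∫ ξ, ei ((s-s')*t*jap ξ) * (f ξ * (starRingEnd ℂ) (f' ξ)) =
        ∫ ξ, ((χ ((|t|^ε)⁻¹ • ξ)^2 - 1 : ℝ):ℂ) * (ei ((s-s')*t*jap ξ) * (f ξ * (starRingEnd ℂ) (f' ξ))) := fun t => by
      rw [B, ← integral_sub (B_i (Gt_l2 hχ hb hf) (Gt_l2 hχ hb hf')) (hI t)]; simp_rw [e]
    simp_rw [this]
    rw [← integral_zero (Euc d) ℂ]
    refine tendsto_integral_filter_of_dominated_convergence (fun ξ => (K^2+1) * ‖f ξ * (starRingEnd ℂ) (f' ξ)‖) (.of_forall fun t => ?_) (.of_forall fun t => .of_forall fun ξ => ?_) (hi.norm.const_mul _) (.of_forall fun ξ => ?_)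
    · exact (Continuous.aestronglyMeasurable (by fun_prop)).mul (hI t).1
    · rw [norm_mul, norm_mul, ei_n, one_mul, Complex.norm_real]; gcongr
      refine (norm_sub_le _ _).trans ?_
      rw [norm_pow, norm_one]; gcongr; exact hb _
    · obtain ⟨r, hr, h⟩ := h1
      have ev : ∀ᶠ t : ℝ in atTop, ‖ξ‖/r < t^ε := (tendsto_rpow_atTop hε).eventually_gt_atTop _
      refine tendsto_const_nhds.congr' ?_
      filter_upwards [ev, eventually_gt_atTop 0] with t ht h0
      rw [h]
      · simp
      · rw [norm_smul, norm_inv, abs_of_pos h0, Real.norm_of_nonneg (by positivity), inv_mul_eq_div, div_lt_iff₀ (by positivity)]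
        rw [div_lt_iff₀ hr] at ht; linarith
  simpa using z.add hl
end


section
variable {d : ℕ} [NeZero d] {χ : Euc d → ℝ} {δ ε s s' : ℝ} {f f' : Euc d → ℂ}

lemma Wb (hχ : Continuous χ) (hc : HasCompactSupport χ) (hf : MemLp f 2 volume) (ε s : ℝ) : ∃ M, ∀ t, 0 < t → MemLp (fun x => cc d/2 * IT (Gt χ ε s t f) x) 2 volume ∧ Nr (fun x => cc d/2 * IT (Gt χ ε s t f) x) ≤ M := by
  obtain ⟨K, hK, hb, h0⟩ := χb hχ hc
  have hM : SQ f ≠ ⊤ := by rw [SQ, en_sq hf]; simp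
  refine ⟨√(‖cc d/2‖ₑ^2 * (ENNReal.ofReal ((2*Real.pi)^d) * (‖(K:ℂ)‖ₑ^2 * SQ f))).toReal, fun t ht => ?_⟩
  have hi := Gt_i (ε := ε) (s := s) hχ hc hf ht
  have hl := Gt_l2 (ε := ε) (s := s) (t := t) hχ hb hf
  refine ⟨(plan hi hl).1.const_mul _, Real.sqrt_le_sqrt (ENNReal.toReal_mono (by finiteness) ?_)⟩
  rw [SQ_mul, SQ, planl hi hl, ← SQ_mul]; gcongr
  exact SQ_le fun ξ => by
    rw [Gt_n, norm_mul, Complex.norm_real, Real.norm_of_nonneg hK.le]; gcongr; exact hb _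

lemma fin (hχ : ContDiff ℝ (⊤ : ℕ∞) χ) (hc : HasCompactSupport χ) (h1 : EqOneNearZero χ) (hδ : 0 < δ) (hε : 0 < ε) (hε1 : ε < 1) (hs : s = 1 ∨ s = -1) (hs' : s' = 1 ∨ s' = -1)
    (hm : Measurable f) (hf : MemLp f 2 volume) (hm' : Measurable f') (hf' : MemLp f' 2 volume) {l : ℂ}
    (hl : Tendsto (fun t => ∫ ξ, ei ((s-s')*t*jap ξ) * (f ξ * (starRingEnd ℂ) (f' ξ))) atTop (𝓝 l)) :
    Tendsto (fun t => B (OpF (aKGpm χ δ ε s t) (propagate s t f)) (OpF (aKGpm χ δ ε s' t) (propagate s' t f'))) atTop (𝓝 (cc d/4 * l)) := by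
  obtain ⟨M, hM⟩ := Wb hχ.continuous hc hf ε s
  obtain ⟨M', hM'⟩ := Wb hχ.continuous hc hf' ε s'
  refine lim (main_pm hχ hc h1 hδ hε hε1 hs hm hf) (main_pm hχ hc h1 hδ hε hε1 hs' hm' hf') (M := max M M') ?_ ?_
  · filter_upwards [eventually_gt_atTop 0] with t ht
    exact ⟨(Op_m hχ hc hm hf ht).1, (Op_m hχ hc hm' hf' ht).1, (IT_cont (Gt_i hχ.continuous hc hf ht)).measurable.const_mul _,
      (IT_cont (Gt_i hχ.continuous hc hf' ht)).measurable.const_mul _, (hM t ht).1, (hM' t ht).1, (hM t ht).2.trans (le_max_left _ _), (hM' t ht).2.trans (le_max_right _ _)⟩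
  · obtain ⟨K, hK, hb, h0⟩ := χb hχ.continuous hc
    refine ((limG hχ.continuous hc h1 hε hf hf' hl).const_mul (cc d/4)).congr' ?_
    filter_upwards [eventually_gt_atTop 0] with t ht
    have := plB (Gt_l2 (ε := ε) (s := s) (t := t) hχ.continuous hb hf) (Gt_l2 (ε := ε) (s := s') (t := t) hχ.continuous hb hf') (Gt_i hχ.continuous hc hf ht) (Gt_i hχ.continuous hc hf' ht)
    have e : B (fun x => cc d/2 * IT (Gt χ ε s t f) x) (fun x => cc d/2 * IT (Gt χ ε s' t f') x) = cc d/2 * (cc d/2) * B (IT (Gt χ ε s t f)) (IT (Gt χ ε s' t f')) := by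
      have : (starRingEnd ℂ) (cc d) = cc d := by rw [cc, map_inv₀, Complex.conj_ofReal]
      rw [B, B, ← integral_const_mul]; congr 1; ext x; simp only [map_mul, map_div₀, this, map_ofNat]; ring
    have hp : (((2 * Real.pi) ^ d : ℝ) : ℂ) ≠ 0 := by exact_mod_cast (by positivity : (2 * Real.pi) ^ d ≠ 0)
    rw [e, this, cc]; field_simp; ring

lemma Bself (F : Euc d → ℂ) : B F F = ((∫ x, ‖F x‖^2 : ℝ) : ℂ) := by
  rw [B, ← integral_complex_ofReal]; congr 1; ext x; rw [Complex.mul_conj, Complex.normSq_eq_norm_sq]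
lemma pae {f g : Euc d → ℂ} (h : f =ᵐ[volume] g) (a : Euc d → Euc d → ℂ) (s t : ℝ) : OpF a (propagate s t f) = OpF a (propagate s t g) := funext fun x => by
  rw [OpF, OpF]; congr 1; exact integral_congr_ae (h.mono fun ξ h => by simp only [propagate, h])
end

/-- Proposition 5.2: for `v₀, v_{0,1} ∈ L²` with Fourier transforms
`Fv₀, Fv₀₁` and each sign `s = ±1`:
(i) `‖A_±(t)e^{±itP(D)}v₀‖² → (1/4)‖v₀‖²`;
(ii) `⟨A_±(t)e^{±itP(D)}v₀, A_∓(t)e^{∓itP(D)}v_{0,1}⟩ → 0`;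
(iii) `‖(A(t)−A_±(t))e^{±itP(D)}v₀‖² → 0`, as `t → +∞`. -/
theorem statement15
    (d : ℕ) (hd : 1 ≤ d)
    (δ : ℝ) (hδ0 : 0 < δ) (hδ1 : δ < 1/2) (ε : ℝ) (hε0 : 0 < ε) (hε1 : ε < 1)
    (χ : Euc d → ℝ) (hχsm : ContDiff ℝ (⊤ : ℕ∞) χ) (hχc : HasCompactSupport χ)
    (hχrad : IsRadial χ) (hχ1 : EqOneNearZero χ)
    (v₀ v₀₁ Fv₀ Fv₀₁ : Euc d → ℂ)
    (hv₀ : MemLp v₀ 2 (volume : Measure (Euc d)))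
    (hv₀₁ : MemLp v₀₁ 2 (volume : Measure (Euc d)))
    (hFv₀mem : MemLp Fv₀ 2 (volume : Measure (Euc d)))
    (hFv₀₁mem : MemLp Fv₀₁ 2 (volume : Measure (Euc d)))
    (hFv₀ : IsFourierTransformOf v₀ Fv₀) (hFv₀₁ : IsFourierTransformOf v₀₁ Fv₀₁)
    (s : ℝ) (hs : s = 1 ∨ s = -1) :
    Tendsto (fun t : ℝ =>
        ∫ x : Euc d, ‖OpF (aKGpm χ δ ε s t) (propagate s t Fv₀) x‖ ^ 2) atTop
      (𝓝 ((1/4) * ∫ x : Euc d, ‖v₀ x‖ ^ 2)) ∧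
    Tendsto (fun t : ℝ =>
        ∫ x : Euc d, OpF (aKGpm χ δ ε s t) (propagate s t Fv₀) x *
          (starRingEnd ℂ) (OpF (aKGpm χ δ ε (-s) t) (propagate (-s) t Fv₀₁) x)) atTop
      (𝓝 (0 : ℂ)) ∧
    Tendsto (fun t : ℝ =>
        ∫ x : Euc d,
          ‖OpF (fun x' ξ => aKG χ ε t x' ξ - aKGpm χ δ ε s t x' ξ)
              (propagate s t Fv₀) x‖ ^ 2) atTop
      (𝓝 (0 : ℝ)) := by
  haveI : NeZero d := ⟨by omega⟩
  have e1 := pae hFv₀mem.1.ae_eq_mk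
  have e2 := pae hFv₀₁mem.1.ae_eq_mk
  have hm := hFv₀mem.1.stronglyMeasurable_mk.measurable
  have hm' := hFv₀₁mem.1.stronglyMeasurable_mk.measurable
  have hf := hFv₀mem.ae_eq hFv₀mem.1.ae_eq_mk
  have hf' := hFv₀₁mem.ae_eq hFv₀₁mem.1.ae_eq_mk
  have hl := (pl_is hv₀ (hFv₀mem.locallyIntegrable (by norm_num)) hFv₀).2
  set g := hFv₀mem.1.mk Fv₀ with hg
  have hl' : ∫ x, ‖Fv₀ x‖^2 = ∫ x, ‖g x‖^2 := integral_congr_ae (hFv₀mem.1.ae_eq_mk.mono fun x h => by beta_reduce; rw [h])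
  have hs0 : s ≠ 0 := by rcases hs with rfl | rfl <;> norm_num
  have hs' : -s = 1 ∨ -s = -1 := by rcases hs with rfl | rfl <;> norm_num
  simp_rw [e1, e2]
  refine ⟨?_, ?_, ?_⟩
  · have := fin hχsm hχc hχ1 hδ0 hε0 hε1 hs hs hm hf hm hf (l := ((∫ x, ‖g x‖^2 : ℝ) : ℂ)) (tendsto_const_nhds.congr fun t => by
      rw [← Bself, B]; simp [ei])
    rw [← hl', hl] at this
    have := (Complex.continuous_re.tendsto _).comp this
    have e : (cc d / 4 * (((2*Real.pi)^d * ∫ x, ‖v₀ x‖^2 : ℝ) : ℂ)).re = 1/4 * ∫ x, ‖v₀ x‖^2 := by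
      rw [cc, ← Complex.ofReal_inv, mul_comm, Complex.re_ofReal_mul]
      have : ((((2*Real.pi)^d)⁻¹ : ℝ) / 4 : ℂ).re = ((2*Real.pi)^d)⁻¹ / 4 := by norm_cast
      rw [this]; field_simp
    rw [e] at this
    exact this.congr fun t => by rw [Function.comp_apply, Bself, Complex.ofReal_re]
  · have := RL (hm.mul (Complex.continuous_conj.measurable.comp hm')) (B_i hf hf') (σ := s - -s) (by intro h; apply hs0; linarith)
    have := fin hχsm hχc hχ1 hδ0 hε0 hε1 hs hs' hm hf hm' hf' this
    rw [mul_zero] at this; exact this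
  · have := (ENNReal.tendsto_toReal ENNReal.zero_ne_top).comp (main_3 hχsm hχc hχ1 hδ0 hε0 hε1 hs hm hf)
    refine this.congr' ?_
    filter_upwards [eventually_gt_atTop 0] with t ht
    have o := Op_m (δ := δ) (ε := ε) (s := s) hχsm hχc hm hf ht
    have o2 := o.2.1.sub o.1
    rw [Function.comp_apply, SQ, integral_eq_lintegral_of_nonneg_ae (.of_forall fun x => by positivity)]
    · congr 1; exact lintegral_congr fun x => by rw [ENNReal.ofReal_pow (norm_nonneg _), ofReal_norm_eq_enorm]
    · simp_rw [o.2.2]; exact (o2.norm.pow_const 2).aestronglyMeasurable
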